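/- Let f be a smooth positive function on the closed unit disc and j a smooth positive function on the unit circle, extended to the harmonic function on the disc with boundary values j, and set J = j + sqrt(j^2 + f). If the outward normal derivative satisfies ∂J/∂ν₀(z) < 0 for every z on the unit circle, then there exists a function u ∈ C²(closure B) solving −Δu = f e^{2u} in B and ∂u/∂ν₀ + 1 = j e^{u} on ∂B. -/

import Mathlib

open MeasureTheory Metric Set Filter
open scoped Real Topology ENNReal

noncomputable section

/-- The closed unit disc in `ℂ ≅ ℝ²`. -/
def cdisc : Set ℂ := Metric.closedBall 0 1

/-- The open unit disc `B`. -/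
def odisc : Set ℂ := Metric.ball 0 1

/-- The unit circle `∂B`. -/
def bdry : Set ℂ := Metric.sphere 0 1

/-- The boundary point with angle `θ`. -/
def bpt (θ : ℝ) : ℂ := Complex.exp ((θ : ℂ) * Complex.I)

/-- Boundary integral with respect to arclength `ds₀`. -/
def circInt (φ : ℂ → ℝ) : ℝ := ∫ θ in (0:ℝ)..(2 * Real.pi), φ (bpt θ)

/-- Integral over the open unit disc with respect to Lebesgue measure. -/
def ballInt (φ : ℂ → ℝ) : ℝ := ∫ z in odisc, φ z

/-- Outward normal derivative `∂w/∂ν₀(z) = z·∇w(z)` for `z ∈ ∂B`. -/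
def nder (w : ℂ → ℝ) (z : ℂ) : ℝ := fderivWithin ℝ w cdisc z z

/-- The Euclidean Laplacian, computed with derivatives within the closed disc. -/
def lapW (w : ℂ → ℝ) (z : ℂ) : ℝ :=
  fderivWithin ℝ (fun x => fderivWithin ℝ w cdisc x 1) cdisc z 1 +
  fderivWithin ℝ (fun x => fderivWithin ℝ w cdisc x Complex.I) cdisc z Complex.I

/-! ### The reference measure on the closed disc -/

/-- Arclength measure on the unit circle. -/
def arcm : Measure ℂ := (volume.restrict (Ioc 0 (2 * π))).map bpt

/-- Area on the open disc. -/
def aream : Measure ℂ := volume.restrict (ball (0 : ℂ) 1)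

/-- Area on the open disc plus arclength on the unit circle. -/
def Lam : Measure ℂ := aream + arcm

/-- The conformal weight: `2` inside the disc and `1` on the boundary. -/
def kap (x : ℂ) : ℝ := if ‖x‖ < 1 then 2 else 1

lemma continuous_bpt : Continuous bpt := by unfold bpt; fun_prop

lemma norm_bpt (θ : ℝ) : ‖bpt θ‖ = 1 := Complex.norm_exp_ofReal_mul_I θ

lemma bpt_add (a b : ℝ) : bpt (a + b) = bpt a * bpt b := by
  simp [bpt, add_mul, Complex.exp_add]

lemma bpt_periodic : Function.Periodic bpt (2 * π) := by
  intro x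
  rw [bpt_add]
  simp [bpt]

lemma exists_bpt {x : ℂ} (hx : ‖x‖ = 1) : ∃ t, x = bpt t := by
  refine ⟨Complex.arg x, ?_⟩
  have := Complex.norm_mul_exp_arg_mul_I x
  rw [hx] at this
  simpa [bpt] using this.symm

instance : IsFiniteMeasure aream :=
  ⟨by simp only [aream, Measure.restrict_apply_univ]; exact measure_ball_lt_top⟩
instance : IsFiniteMeasure arcm := by unfold arcm; infer_instance
instance : IsFiniteMeasure Lam := by unfold Lam; infer_instance

lemma arcm_ae {p : ℂ → Prop} (h : ∀ x, ‖x‖ = 1 → p x) : ∀ᵐ x ∂arcm, p x := by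
  have h1 : ∀ᵐ x ∂arcm, ‖x‖ = 1 := by
    unfold arcm
    rw [ae_map_iff continuous_bpt.measurable.aemeasurable
      (measurableSet_eq_fun measurable_norm measurable_const)]
    exact Eventually.of_forall norm_bpt
  exact h1.mono h

lemma aream_ae {p : ℂ → Prop} (h : ∀ x, ‖x‖ < 1 → p x) : ∀ᵐ x ∂aream, p x := by
  unfold aream
  filter_upwards [ae_restrict_mem measurableSet_ball] with x hx
  exact h x (by simpa using hx)

lemma Lam_ae_iff {p : ℂ → Prop} : (∀ᵐ x ∂Lam, p x) ↔ (∀ᵐ x ∂aream, p x) ∧ ∀ᵐ x ∂arcm, p x := by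
  unfold Lam; exact ae_add_measure_iff

lemma Lam_ae {p : ℂ → Prop} (h : ∀ x, ‖x‖ ≤ 1 → p x) : ∀ᵐ x ∂Lam, p x :=
  Lam_ae_iff.2 ⟨aream_ae fun x hx => h x hx.le, arcm_ae fun x hx => h x hx.le⟩

lemma integral_arcm {E : Type*} [NormedAddCommGroup E] [NormedSpace ℝ E] {g : ℂ → E}
    (hg : AEStronglyMeasurable g arcm) :
    ∫ x, g x ∂arcm = ∫ θ in (0:ℝ)..(2 * π), g (bpt θ) := by
  rw [intervalIntegral.integral_of_le (by positivity)]
  unfold arcm at *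
  rw [integral_map continuous_bpt.measurable.aemeasurable hg]

lemma integral_Lam {E : Type*} [NormedAddCommGroup E] [NormedSpace ℝ E] {g : ℂ → E}
    (hg : Integrable g Lam) :
    ∫ x, g x ∂Lam = ∫ x, g x ∂aream + ∫ x, g x ∂arcm := by
  unfold Lam at *
  exact integral_add_measure (integrable_add_measure.1 hg).1 (integrable_add_measure.1 hg).2

/-- Rotation invariance of arclength. -/
lemma arcm_map_mul {c : ℂ} (hc : ‖c‖ = 1) : arcm.map (fun x => c * x) = arcm := by
  obtain ⟨t, rfl⟩ := exists_bpt hc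
  have hm : Measurable (fun x => bpt t * x) := by fun_prop
  ext s hs
  unfold arcm
  rw [Measure.map_map hm continuous_bpt.measurable,
    Measure.map_apply (hm.comp continuous_bpt.measurable) hs,
    Measure.map_apply continuous_bpt.measurable hs]
  have h1 : ∀ a : ℝ, volume.restrict (Ioc a (a + 2 * π)) (bpt ⁻¹' s)
      = ∫⁻ θ in Ioc a (a + 2 * π), s.indicator 1 (bpt θ) := by
    intro a
    rw [← lintegral_indicator_one (hs.preimage continuous_bpt.measurable)]
    rfl
  have h2 : volume.restrict (Ioc 0 (2 * π)) ((fun x => bpt t * x) ∘ bpt ⁻¹' s)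
      = ∫⁻ θ in Ioc 0 (2 * π), s.indicator 1 (bpt (t + θ)) := by
    rw [← lintegral_indicator_one (hs.preimage (hm.comp continuous_bpt.measurable))]
    refine lintegral_congr fun θ => ?_
    rw [bpt_add]; rfl
  rw [h2]
  have h3 := h1 0
  simp only [zero_add] at h3
  rw [h3]
  have h4 : ∫⁻ θ in Ioc 0 (2 * π), s.indicator (1 : ℂ → ℝ≥0∞) (bpt (t + θ))
      = ∫⁻ θ in Ioc t (t + 2 * π), s.indicator (1 : ℂ → ℝ≥0∞) (bpt θ) := by
    have := (measurePreserving_add_left volume t).setLIntegral_comp_preimage_emb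
      (measurableEmbedding_addLeft t) (fun θ => s.indicator (1 : ℂ → ℝ≥0∞) (bpt θ))
      (Ioc t (t + 2 * π))
    simpa using this
  rw [h4]
  have hp : Function.Periodic (fun θ => s.indicator (1 : ℂ → ℝ≥0∞) (bpt θ)) (2 * π) :=
    fun x => by simp only [bpt_periodic x]
  have := (isAddFundamentalDomain_Ioc (by positivity : 0 < 2 * π) t).setLIntegral_eq
    (isAddFundamentalDomain_Ioc (by positivity : 0 < 2 * π) 0)
    (fun θ => s.indicator (1 : ℂ → ℝ≥0∞) (bpt θ)) hp.map_vadd_zmultiples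
  simpa using this

/-- Rotation invariance of area. -/
lemma aream_map_mul {c : ℂ} (hc : ‖c‖ = 1) : aream.map (fun x => c * x) = aream := by
  have h0 : c ≠ 0 := by intro h; simp [h] at hc
  have hmp : MeasurePreserving (fun x : ℂ => c * x) volume volume :=
    (rotation ⟨c, by simpa [Submonoid.unitSphere, mem_sphere_zero_iff_norm] using hc⟩).measurePreserving
  have hpre : (fun x : ℂ => c * x) ⁻¹' ball (0 : ℂ) 1 = ball 0 1 := by
    ext x; simp [hc]
  have := (hmp.restrict_preimage (measurableSet_ball (x := (0 : ℂ)) (ε := 1))).map_eq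
  rw [hpre] at this
  exact this

lemma Lam_map_mul {c : ℂ} (hc : ‖c‖ = 1) : Lam.map (fun x => c * x) = Lam := by
  unfold Lam
  rw [Measure.map_add _ _ (by fun_prop), aream_map_mul hc, arcm_map_mul hc]

lemma integral_Lam_mul {E : Type*} [NormedAddCommGroup E] [NormedSpace ℝ E] {c : ℂ}
    (hc : ‖c‖ = 1) (g : ℂ → E) :
    ∫ x, g (c * x) ∂Lam = ∫ x, g x ∂Lam := by
  have h0 : c ≠ 0 := by intro h; simp [h] at hc
  have hmp : MeasurePreserving (fun x : ℂ => c * x) Lam Lam := ⟨by fun_prop, Lam_map_mul hc⟩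
  exact hmp.integral_comp (Homeomorph.mulLeft₀ c h0).measurableEmbedding g

/-! ### Singular integrals -/

lemma two_div_pi_mul_abs_le_norm_one_sub_bpt {θ : ℝ} (h : |θ| ≤ π) :
    2 / π * |θ| ≤ ‖1 - bpt θ‖ := by
  have h1 : ‖1 - bpt θ‖ = 2 * |Real.sin (θ / 2)| := by
    have := Complex.norm_exp_I_mul_ofReal_sub_one θ
    rw [norm_sub_rev, bpt, mul_comm, this]
    simp
  have h2 := Real.mul_abs_le_abs_sin (x := θ / 2) (by rw [abs_div]; norm_num; linarith)
  rw [abs_div, abs_two] at h2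
  rw [h1]; linarith

lemma integrable_norm_rpow_arc {α : ℝ} (h0 : 0 ≤ α) (hα : α < 1) :
    Integrable (fun y : ℂ => ‖1 - y‖ ^ (-α)) arcm := by
  have hm : Measurable (fun y : ℂ => ‖1 - y‖ ^ (-α)) := by fun_prop
  unfold arcm
  rw [integrable_map_measure hm.aestronglyMeasurable continuous_bpt.measurable.aemeasurable]
  have hper : Function.Periodic ((fun y : ℂ => ‖1 - y‖ ^ (-α)) ∘ bpt) (2 * π) :=
    bpt_periodic.comp _
  have key : IntegrableOn ((fun y : ℂ => ‖1 - y‖ ^ (-α)) ∘ bpt) (Ioc (-π) (-π + 2 * π)) := by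
    have hb : IntegrableOn (fun θ : ℝ => (2 / π) ^ (-α) * ‖θ‖ ^ (-α)) (ball 0 4) := by
      refine integrableOn_ball_of_norm_le_rpow (C := (2 / π) ^ (-α)) (α := α) (by simp)
        (by simpa using hα) ?_ (by fun_prop : Measurable _).aestronglyMeasurable
      refine Eventually.of_forall fun x => ?_
      rw [Real.norm_of_nonneg (by positivity)]
    refine Integrable.mono' (hb.mono_set fun x hx => ?_)
      (hm.comp continuous_bpt.measurable).aestronglyMeasurable ?_
    · have := Real.pi_lt_four
      rw [mem_ball_zero_iff, Real.norm_eq_abs, abs_lt]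
      constructor <;> linarith [hx.1, hx.2]
    · have hne : ∀ᵐ x ∂volume.restrict (Ioc (-π) (-π + 2 * π)), x ≠ (0 : ℝ) :=
        ae_restrict_of_ae (by simp [ae_iff])
      filter_upwards [ae_restrict_mem measurableSet_Ioc, hne] with x hx hx0
      have hxp : |x| ≤ π := abs_le.2 ⟨hx.1.le, by linarith [hx.2]⟩
      have hx1 := abs_pos.2 hx0
      simp only [Function.comp]
      rw [Real.norm_of_nonneg (by positivity), ← Real.mul_rpow (by positivity) (by positivity)]
      exact Real.rpow_le_rpow_of_nonpos (by positivity)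
        (two_div_pi_mul_abs_le_norm_one_sub_bpt hxp) (by linarith)
  have h2 := hper.intervalIntegrable (t := -π) (by positivity)
    ((intervalIntegrable_iff_integrableOn_Ioc_of_le (by linarith [Real.pi_pos])).2 key) 0 (2 * π)
  exact (intervalIntegrable_iff_integrableOn_Ioc_of_le (by positivity)).1 h2

instance : NullSingletonClass arcm := by
  refine ⟨fun x => ?_⟩
  have : IsFiniteMeasure arcm := inferInstance
  by_cases hx : ‖x‖ = 1
  · have h1 : arcm {x} = arcm {1} := by
      have h0 : x ≠ 0 := by intro h; simp [h] at hx
      rw [← arcm_map_mul hx, Measure.map_apply (by fun_prop) (by simp), arcm_map_mul hx]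
      congr 1
      ext y
      simp [h0]
    rw [h1]
    unfold arcm
    rw [Measure.map_apply continuous_bpt.measurable (by simp)]
    refine measure_mono_null (t := range fun n : ℤ => (n : ℝ) * (2 * π)) ?_
      ((countable_range _).measure_zero _)
    intro θ hθ
    simp only [bpt, mem_preimage, mem_singleton_iff, Complex.exp_eq_one_iff] at hθ
    obtain ⟨n, hn⟩ := hθ
    refine ⟨n, ?_⟩
    have := congrArg Complex.im hn
    simpa using this.symm
  · have : ∀ᵐ y ∂arcm, y ∉ ({x} : Set ℂ) := arcm_ae fun y hy h => hx (by rw [← h, hy])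
    simpa [ae_iff] using this

instance : NullSingletonClass aream := by unfold aream; infer_instance

instance : NullSingletonClass Lam := ⟨fun x => by simp [Lam]⟩

lemma Lam_ae_ne (x : ℂ) : ∀ᵐ y ∂Lam, y ≠ x := by simp [ae_iff]

lemma riesz_arc {α : ℝ} (h0 : 0 ≤ α) (hα : α < 1) : ∃ C, 0 ≤ C ∧ ∀ x : ℂ, ‖x‖ ≤ 1 →
    Integrable (fun y => ‖x - y‖ ^ (-α)) arcm ∧ ∫ y, ‖x - y‖ ^ (-α) ∂arcm ≤ C := by
  set I := ∫ y, ‖1 - y‖ ^ (-α) ∂arcm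
  have hI : 0 ≤ I := integral_nonneg fun y => by positivity
  refine ⟨2 ^ α * I, by positivity, fun x hx => ?_⟩
  obtain ⟨c, hc, hxc⟩ : ∃ c : ℂ, ‖c‖ = 1 ∧ ∀ y : ℂ, ‖y‖ = 1 → ‖c - y‖ ≤ 2 * ‖x - y‖ := by
    by_cases hx0 : x = 0
    · refine ⟨1, by simp, fun y hy => ?_⟩
      have := norm_sub_le (1 : ℂ) y
      simp [hx0, hy] at *
      linarith
    · have hn : 0 < ‖x‖ := norm_pos_iff.2 hx0
      refine ⟨x / (‖x‖ : ℂ), by simp [hn.ne'], fun y hy => ?_⟩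
      have h1 : ‖x / (‖x‖ : ℂ) - x‖ = 1 - ‖x‖ := by
        have : x / (‖x‖ : ℂ) - x = x / (‖x‖ : ℂ) * ((1 - ‖x‖ : ℝ) : ℂ) := by
          have : (‖x‖ : ℂ) ≠ 0 := by exact_mod_cast hn.ne'
          push_cast
          field_simp
        rw [this, norm_mul, Complex.norm_real, Real.norm_of_nonneg (by linarith)]
        simp [hn.ne']
      have h2 : 1 - ‖x‖ ≤ ‖x - y‖ := by
        have := norm_sub_norm_le y x
        rw [norm_sub_rev] at this
        linarith
      calc ‖x / (‖x‖ : ℂ) - y‖ = ‖(x / (‖x‖ : ℂ) - x) + (x - y)‖ := by ring_nf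
        _ ≤ _ := norm_add_le _ _
        _ ≤ _ := by linarith
  have hc0 : c ≠ 0 := by intro h; simp [h] at hc
  have hmp : MeasurePreserving (fun x : ℂ => c * x) arcm arcm := ⟨by fun_prop, arcm_map_mul hc⟩
  have hem := (Homeomorph.mulLeft₀ c hc0).measurableEmbedding
  have heq : (fun y => ‖c - y‖ ^ (-α)) ∘ (fun x => c * x) = fun y => ‖1 - y‖ ^ (-α) := by
    funext y
    simp only [Function.comp]
    rw [show c - c * y = c * (1 - y) by ring, norm_mul, hc, one_mul]
  have hint : Integrable (fun y => ‖c - y‖ ^ (-α)) arcm := by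
    rw [← hmp.integrable_comp_emb hem, heq]
    exact integrable_norm_rpow_arc h0 hα
  have hIc : ∫ y, ‖c - y‖ ^ (-α) ∂arcm = I := by
    have := hmp.integral_comp hem (fun y => ‖c - y‖ ^ (-α))
    rw [← this]
    exact congrArg (fun g => ∫ y, g y ∂arcm) heq
  have hle : ∀ᵐ y ∂arcm, ‖x - y‖ ^ (-α) ≤ 2 ^ α * ‖c - y‖ ^ (-α) := by
    filter_upwards [arcm_ae (p := fun y => ‖y‖ = 1) (fun y h => h),
      show ∀ᵐ y ∂arcm, y ≠ c by simp [ae_iff]] with y hy hyc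
    have h1 : 0 < ‖c - y‖ := norm_pos_iff.2 (sub_ne_zero.2 hyc.symm)
    have h2 := hxc y hy
    calc ‖x - y‖ ^ (-α) ≤ (‖c - y‖ / 2) ^ (-α) :=
          Real.rpow_le_rpow_of_nonpos (by positivity) (by linarith) (by linarith)
      _ = 2 ^ α * ‖c - y‖ ^ (-α) := by
          rw [Real.div_rpow (by positivity) (by positivity), Real.rpow_neg (by norm_num : (0:ℝ) ≤ 2)]
          field_simp
  have hint' : Integrable (fun y => ‖x - y‖ ^ (-α)) arcm :=
    Integrable.mono' (hint.const_mul (2 ^ α)) (by fun_prop : Measurable _).aestronglyMeasurable (hle.mono fun y hy => by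
      rwa [Real.norm_of_nonneg (by positivity)])
  refine ⟨hint', ?_⟩
  calc _ ≤ ∫ y, 2 ^ α * ‖c - y‖ ^ (-α) ∂arcm := integral_mono_ae hint' (hint.const_mul _) hle
    _ = _ := by rw [integral_const_mul, hIc]

lemma riesz_area {α : ℝ} (hα : α < 2) : ∃ C, 0 ≤ C ∧ ∀ x : ℂ, ‖x‖ ≤ 1 →
    Integrable (fun y => ‖x - y‖ ^ (-α)) aream ∧ ∫ y, ‖x - y‖ ^ (-α) ∂aream ≤ C := by
  have hb : IntegrableOn (fun y : ℂ => ‖y‖ ^ (-α)) (ball 0 2) :=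
    integrableOn_ball_of_norm_le_rpow (C := 1) (α := α) (by simp)
      (by simpa using hα) (Eventually.of_forall fun x => by
        rw [Real.norm_of_nonneg (by positivity), one_mul]) (by fun_prop : Measurable _).aestronglyMeasurable
  refine ⟨∫ y in ball (0 : ℂ) 2, ‖y‖ ^ (-α), integral_nonneg fun y => by positivity,
    fun x hx => ?_⟩
  have hmp : MeasurePreserving (fun y : ℂ => x - y) volume volume :=
    Measure.measurePreserving_sub_left volume x
  have hem : MeasurableEmbedding (fun y : ℂ => x - y) :=
    (Homeomorph.subLeft x).measurableEmbedding
  have hsub : ball (0 : ℂ) 1 ⊆ (fun y : ℂ => x - y) ⁻¹' ball 0 2 := by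
    intro y hy
    simp only [mem_preimage, mem_ball_zero_iff] at *
    linarith [norm_sub_le x y]
  have h1 : IntegrableOn (fun y => ‖x - y‖ ^ (-α)) ((fun y : ℂ => x - y) ⁻¹' ball 0 2) :=
    (hmp.integrableOn_comp_preimage hem).2 hb
  refine ⟨h1.mono_set hsub, ?_⟩
  rw [← hmp.setIntegral_preimage_emb hem (fun y => ‖y‖ ^ (-α)) (ball 0 2)]
  exact setIntegral_mono_set h1 (Eventually.of_forall fun y => by positivity)
    (LE.le.eventuallyLE hsub)

lemma kap_pos (x : ℂ) : 0 < kap x := by unfold kap; split_ifs <;> norm_num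

lemma one_le_kap (x : ℂ) : 1 ≤ kap x := by unfold kap; split_ifs <;> norm_num

lemma kap_le_two (x : ℂ) : kap x ≤ 2 := by unfold kap; split_ifs <;> norm_num

lemma kap_of_lt {x : ℂ} (h : ‖x‖ < 1) : kap x = 2 := by simp [kap, h]

lemma kap_of_eq {x : ℂ} (h : ‖x‖ = 1) : kap x = 1 := by simp [kap, h]

@[fun_prop]
lemma measurable_kap : Measurable kap :=
  Measurable.ite (measurableSet_lt measurable_norm measurable_const) measurable_const
    measurable_const

/-- Uniform integrability of `‖x - y‖ ^ (-κ(y) γ)` for `γ < 1`. -/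
lemma riesz_kap {γ : ℝ} (h0 : 0 ≤ γ) (hγ : γ < 1) : ∃ C, 0 ≤ C ∧ ∀ x : ℂ, ‖x‖ ≤ 1 →
    Integrable (fun y => ‖x - y‖ ^ (-(kap y * γ))) Lam ∧
      ∫ y, ‖x - y‖ ^ (-(kap y * γ)) ∂Lam ≤ C := by
  obtain ⟨A, hA, hA'⟩ := riesz_area (α := 2 * γ) (by linarith)
  obtain ⟨B, hB, hB'⟩ := riesz_arc h0 hγ
  refine ⟨A + B, by positivity, fun x hx => ?_⟩
  obtain ⟨a1, a2⟩ := hA' x hx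
  obtain ⟨b1, b2⟩ := hB' x hx
  have e1 : (fun y => ‖x - y‖ ^ (-(2 * γ))) =ᵐ[aream] fun y => ‖x - y‖ ^ (-(kap y * γ)) :=
    aream_ae fun y hy => by simp only [kap_of_lt hy]
  have e2 : (fun y => ‖x - y‖ ^ (-γ)) =ᵐ[arcm] fun y => ‖x - y‖ ^ (-(kap y * γ)) :=
    arcm_ae fun y hy => by simp only [kap_of_eq hy, one_mul]
  have i : Integrable (fun y => ‖x - y‖ ^ (-(kap y * γ))) Lam :=
    integrable_add_measure.2 ⟨a1.congr e1, b1.congr e2⟩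
  refine ⟨i, ?_⟩
  rw [integral_Lam i, ← integral_congr_ae e1, ← integral_congr_ae e2]
  linarith

/-- Uniform integrability of `1 / √‖x - y‖`. -/
lemma riesz_sqrt : ∃ C, 0 ≤ C ∧ ∀ x : ℂ, ‖x‖ ≤ 1 →
    Integrable (fun y => (√‖x - y‖)⁻¹) Lam ∧ ∫ y, (√‖x - y‖)⁻¹ ∂Lam ≤ C := by
  obtain ⟨A, hA, hA'⟩ := riesz_area (α := 1 / 2) (by norm_num)
  obtain ⟨B, hB, hB'⟩ := riesz_arc (α := 1 / 2) (by norm_num) (by norm_num)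
  refine ⟨A + B, by positivity, fun x hx => ?_⟩
  have e : (fun y => (√‖x - y‖)⁻¹) = fun y => ‖x - y‖ ^ (-(1 / 2) : ℝ) := by
    funext y
    rw [Real.sqrt_eq_rpow, Real.rpow_neg (norm_nonneg _)]
  have i : Integrable (fun y => ‖x - y‖ ^ (-(1 / 2) : ℝ)) Lam :=
    integrable_add_measure.2 ⟨(hA' x hx).1, (hB' x hx).1⟩
  rw [e]
  refine ⟨i, ?_⟩
  rw [integral_Lam i]
  linarith [(hA' x hx).2, (hB' x hx).2]

/-! ### The Neumann kernel and its potentials -/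

/-- Radial retraction of the plane onto the closed unit disc. -/
def clamp (z : ℂ) : ℂ := (max 1 ‖z‖)⁻¹ • z

lemma clamp_of_le {z : ℂ} (h : ‖z‖ ≤ 1) : clamp z = z := by simp [clamp, max_eq_left h]

lemma norm_clamp_le (z : ℂ) : ‖clamp z‖ ≤ 1 := by
  have h : 0 < max 1 ‖z‖ := lt_of_lt_of_le one_pos (le_max_left _ _)
  rw [clamp, norm_smul, Real.norm_of_nonneg (by positivity), inv_mul_le_iff₀ h, mul_one]
  exact le_max_right _ _

@[fun_prop]
lemma continuous_clamp : Continuous clamp := by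
  have h : ∀ z : ℂ, max 1 ‖z‖ ≠ 0 := fun z =>
    (lt_of_lt_of_le one_pos (le_max_left _ _)).ne'
  unfold clamp
  exact ((continuous_const.max continuous_norm).inv₀ h).smul continuous_id

/-- The Neumann function of the unit disc (up to the factor `1 / 2π`). -/
def nker (x y : ℂ) : ℝ := -Real.log ‖x - y‖ - Real.log ‖1 - x * (starRingEnd ℂ) y‖

lemma norm_one_sub_conj_sq (x y : ℂ) :
    ‖1 - x * (starRingEnd ℂ) y‖ ^ 2 = ‖x - y‖ ^ 2 + (1 - ‖x‖ ^ 2) * (1 - ‖y‖ ^ 2) := by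
  simp only [← Complex.normSq_eq_norm_sq, Complex.normSq_apply, Complex.sub_re, Complex.sub_im,
    Complex.mul_re, Complex.mul_im, Complex.conj_re, Complex.conj_im, Complex.one_re,
    Complex.one_im]
  ring

lemma norm_sub_le_norm_one_sub {x y : ℂ} (hx : ‖x‖ ≤ 1) (hy : ‖y‖ ≤ 1) :
    ‖x - y‖ ≤ ‖1 - x * (starRingEnd ℂ) y‖ := by
  have h := norm_one_sub_conj_sq x y
  have h1 : 0 ≤ 1 - ‖x‖ ^ 2 := by nlinarith [norm_nonneg x]
  have h2 : 0 ≤ 1 - ‖y‖ ^ 2 := by nlinarith [norm_nonneg y]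
  exact (pow_le_pow_iff_left₀ (norm_nonneg _) (norm_nonneg _) two_ne_zero).1
    (by nlinarith [mul_nonneg h1 h2])

lemma nker_symm (x y : ℂ) : nker x y = nker y x := by
  unfold nker
  rw [norm_sub_rev x y]
  congr 2
  rw [← Complex.norm_conj]
  simp [mul_comm]

lemma norm_one_sub_conj_le {x y : ℂ} (hx : ‖x‖ ≤ 1) (hy : ‖y‖ ≤ 1) :
    ‖1 - x * (starRingEnd ℂ) y‖ ≤ 2 := by
  have := norm_sub_le 1 (x * (starRingEnd ℂ) y)
  rw [norm_mul, Complex.norm_conj, norm_one] at this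
  nlinarith [norm_nonneg x, norm_nonneg y]

lemma log_le_log_two {d : ℝ} (h0 : 0 ≤ d) (h : d ≤ 2) : Real.log d ≤ Real.log 2 := by
  rcases h0.eq_or_lt with rfl | h1
  · simp [Real.log_nonneg]
  · exact Real.log_le_log h1 h

lemma neg_log_four_le_nker {x y : ℂ} (hx : ‖x‖ ≤ 1) (hy : ‖y‖ ≤ 1) :
    -Real.log 4 ≤ nker x y := by
  have h1 := log_le_log_two (norm_nonneg _) ((norm_sub_le x y).trans (by linarith))
  have h2 := log_le_log_two (norm_nonneg _) (norm_one_sub_conj_le hx hy)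
  have h4 : Real.log 4 = 2 * Real.log 2 := by
    rw [show (4 : ℝ) = 2 ^ 2 by norm_num, Real.log_pow]; norm_num
  unfold nker
  linarith

lemma nker_le {x y : ℂ} (hx : ‖x‖ ≤ 1) (hy : ‖y‖ ≤ 1) (h : x ≠ y) :
    nker x y ≤ -2 * Real.log ‖x - y‖ := by
  have := Real.log_le_log (norm_pos_iff.2 (sub_ne_zero.2 h)) (norm_sub_le_norm_one_sub hx hy)
  unfold nker
  linarith

lemma abs_nker_le {x y : ℂ} (hx : ‖x‖ ≤ 1) (hy : ‖y‖ ≤ 1) (h : x ≠ y) :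
    |nker x y| ≤ 4 * (√‖x - y‖)⁻¹ := by
  have hd : 0 < ‖x - y‖ := norm_pos_iff.2 (sub_ne_zero.2 h)
  have hs : 0 < √‖x - y‖ := Real.sqrt_pos.2 hd
  have h2 : ‖x - y‖ ≤ 2 := (norm_sub_le x y).trans (by linarith)
  have hs2 : √‖x - y‖ ≤ 2 := by
    rw [Real.sqrt_le_left (by norm_num)]; linarith
  have hinv : (1 : ℝ) / 2 ≤ (√‖x - y‖)⁻¹ := by
    rw [one_div]; exact inv_anti₀ hs hs2
  have h4 : Real.log 4 ≤ 2 := by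
    rw [show (4 : ℝ) = 2 ^ 2 by norm_num, Real.log_pow]
    have := Real.log_two_lt_d9
    push_cast; linarith
  rw [abs_le]
  constructor
  · linarith [neg_log_four_le_nker hx hy]
  · have h5 : -Real.log ‖x - y‖ = 2 * Real.log ((√‖x - y‖)⁻¹) := by
      rw [Real.log_inv, Real.log_sqrt hd.le]; ring
    have h6 := Real.log_le_sub_one_of_pos (inv_pos.2 hs)
    linarith [nker_le hx hy h]

lemma abs_log_sub_log_le {a b : ℝ} (ha : 0 < a) (hb : 0 < b) :
    |Real.log a - Real.log b| ≤ 2 * √|a - b| * ((√a)⁻¹ + (√b)⁻¹) := by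
  have key : ∀ a b : ℝ, 0 < a → a ≤ b → Real.log b - Real.log a ≤ 2 * √(b - a) * (√a)⁻¹ := by
    intro a b ha hab
    have hs : 0 < √a := Real.sqrt_pos.2 ha
    have h1 : b ≤ (√a + √(b - a)) ^ 2 := by
      have h3 := Real.sq_sqrt ha.le
      have h4 := Real.sq_sqrt (sub_nonneg.2 hab)
      nlinarith [mul_nonneg hs.le (Real.sqrt_nonneg (b - a))]
    have h2 : Real.log b ≤ 2 * Real.log (√a + √(b - a)) := by
      have := Real.log_le_log (ha.trans_le hab) h1
      rwa [Real.log_pow, Nat.cast_ofNat] at this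
    have h3 : Real.log (√a + √(b - a)) - Real.log √a ≤ √(b - a) * (√a)⁻¹ := by
      rw [← Real.log_div (by positivity) hs.ne', add_div, div_self hs.ne', div_eq_mul_inv]
      have := Real.log_le_sub_one_of_pos (x := 1 + √(b - a) * (√a)⁻¹) (by positivity)
      linarith
    rw [Real.log_sqrt ha.le] at h3
    linarith
  have hsa : 0 ≤ (√a)⁻¹ := by positivity
  have hsb : 0 ≤ (√b)⁻¹ := by positivity
  rcases le_total a b with h | h
  · rw [abs_sub_comm, abs_sub_comm a b, abs_of_nonneg (sub_nonneg.2 (Real.log_le_log ha h)),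
      abs_of_nonneg (sub_nonneg.2 h)]
    refine (key a b ha h).trans ?_
    gcongr; linarith
  · rw [abs_of_nonneg (sub_nonneg.2 (Real.log_le_log hb h)), abs_of_nonneg (sub_nonneg.2 h)]
    refine (key b a hb h).trans ?_
    gcongr; linarith

lemma abs_nker_sub_le {x x' y : ℂ} (hx : ‖x‖ ≤ 1) (hx' : ‖x'‖ ≤ 1) (hy : ‖y‖ ≤ 1)
    (h : y ≠ x) (h' : y ≠ x') :
    |nker x y - nker x' y| ≤ 4 * √‖x - x'‖ * ((√‖x - y‖)⁻¹ + (√‖x' - y‖)⁻¹) := by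
  have hd : 0 < ‖x - y‖ := norm_pos_iff.2 (sub_ne_zero.2 h.symm)
  have hd' : 0 < ‖x' - y‖ := norm_pos_iff.2 (sub_ne_zero.2 h'.symm)
  have he := norm_sub_le_norm_one_sub hx hy
  have he' := norm_sub_le_norm_one_sub hx' hy
  have h1 : |Real.log ‖x - y‖ - Real.log ‖x' - y‖|
      ≤ 2 * √‖x - x'‖ * ((√‖x - y‖)⁻¹ + (√‖x' - y‖)⁻¹) := by
    refine (abs_log_sub_log_le hd hd').trans ?_
    gcongr
    refine (abs_norm_sub_norm_le _ _).trans_eq ?_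
    congr 1; ring
  have h2 : |Real.log ‖1 - x * (starRingEnd ℂ) y‖ - Real.log ‖1 - x' * (starRingEnd ℂ) y‖|
      ≤ 2 * √‖x - x'‖ * ((√‖x - y‖)⁻¹ + (√‖x' - y‖)⁻¹) := by
    refine (abs_log_sub_log_le (hd.trans_le he) (hd'.trans_le he')).trans ?_
    gcongr
    refine (abs_norm_sub_norm_le _ _).trans ?_
    rw [show 1 - x * (starRingEnd ℂ) y - (1 - x' * (starRingEnd ℂ) y)
      = (x' - x) * (starRingEnd ℂ) y by ring, norm_mul, Complex.norm_conj, norm_sub_rev]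
    exact mul_le_of_le_one_right (norm_nonneg _) hy
  unfold nker
  rw [abs_le] at *
  constructor <;> linarith [h1.1, h1.2, h2.1, h2.2]

@[fun_prop]
lemma measurable_nker : Measurable (fun p : ℂ × ℂ => nker p.1 p.2) := by
  unfold nker
  have : Measurable (starRingEnd ℂ) := Complex.continuous_conj.measurable
  fun_prop

@[fun_prop]
lemma measurable_nker_left (x : ℂ) : Measurable (nker x) :=
  measurable_nker.comp (measurable_const.prodMk measurable_id)

/-- The Neumann potential of the density `s`. -/
def pot (s : ℂ → ℝ) (x : ℂ) : ℝ := (2 * π)⁻¹ * ∫ y, nker (clamp x) y * s y ∂Lam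

/-- Bounded measurable densities. -/
structure BM (s : ℂ → ℝ) (M : ℝ) : Prop where
  meas : Measurable s
  bd : ∀ x, |s x| ≤ M

lemma BM.nonneg {s : ℂ → ℝ} {M : ℝ} (h : BM s M) : 0 ≤ M := (abs_nonneg _).trans (h.bd 0)

lemma BM.integrable {s : ℂ → ℝ} {M : ℝ} (h : BM s M) : Integrable s Lam :=
  Integrable.of_bound h.meas.aestronglyMeasurable M (Eventually.of_forall h.bd)

lemma BM.mul_integrable {s g : ℂ → ℝ} {M : ℝ} (h : BM s M) (hg : Integrable g Lam) :
    Integrable (fun x => g x * s x) Lam :=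
  hg.mul_bdd h.meas.aestronglyMeasurable (c := M) (Eventually.of_forall h.bd)

lemma integrable_nker {x : ℂ} (hx : ‖x‖ ≤ 1) : Integrable (nker x) Lam := by
  obtain ⟨C, -, hC⟩ := riesz_sqrt
  refine Integrable.mono' ((hC x hx).1.const_mul 4)
    (measurable_nker_left x).aestronglyMeasurable ?_
  filter_upwards [Lam_ae (p := fun y => ‖y‖ ≤ 1) (fun _ h => h), Lam_ae_ne x] with y hy hne
  exact abs_nker_le hx hy hne.symm

lemma exists_integral_abs_nker_le : ∃ C, 0 ≤ C ∧ ∀ x : ℂ, ‖x‖ ≤ 1 → ∫ y, |nker x y| ∂Lam ≤ C := by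
  obtain ⟨C, hC0, hC⟩ := riesz_sqrt
  refine ⟨4 * C, by positivity, fun x hx => ?_⟩
  calc _ ≤ ∫ y, 4 * (√‖x - y‖)⁻¹ ∂Lam := by
        refine integral_mono_ae (integrable_nker hx).abs ((hC x hx).1.const_mul 4) ?_
        filter_upwards [Lam_ae (p := fun y => ‖y‖ ≤ 1) (fun _ h => h), Lam_ae_ne x] with y hy hne
        exact abs_nker_le hx hy hne.symm
    _ ≤ _ := by
        rw [integral_const_mul]
        have := (hC x hx).2
        linarith

lemma exists_pot_bound : ∃ P, 0 ≤ P ∧ ∀ s M, BM s M →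
    (∀ x, |pot s x| ≤ P * M) ∧
      ∀ x x', ‖x‖ ≤ 1 → ‖x'‖ ≤ 1 → |pot s x - pot s x'| ≤ P * M * √‖x - x'‖ := by
  obtain ⟨A, hA0, hA⟩ := exists_integral_abs_nker_le
  obtain ⟨C, hC0, hC⟩ := riesz_sqrt
  have hpi : 0 < (2 * π)⁻¹ := by positivity
  refine ⟨(2 * π)⁻¹ * (A + 8 * C), by positivity, fun s M h => ⟨fun x => ?_, fun x x' hx hx' => ?_⟩⟩
  · have hx := norm_clamp_le x
    rw [pot, abs_mul, abs_of_pos hpi, mul_assoc]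
    gcongr
    calc |∫ y, nker (clamp x) y * s y ∂Lam| ≤ ∫ y, |nker (clamp x) y * s y| ∂Lam :=
          abs_integral_le_integral_abs
      _ ≤ ∫ y, |nker (clamp x) y| * M ∂Lam := by
          refine integral_mono (h.mul_integrable (integrable_nker hx)).abs
            ((integrable_nker hx).abs.mul_const M) fun y => ?_
          simp only [abs_mul]
          gcongr
          exact h.bd y
      _ ≤ (A + 8 * C) * M := by
          rw [integral_mul_const]
          have := h.nonneg
          gcongr
          linarith [hA _ hx]
  · have hM := h.nonneg
    rw [pot, pot, clamp_of_le hx, clamp_of_le hx', ← mul_sub, abs_mul, abs_of_pos hpi, mul_assoc,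
      mul_assoc]
    gcongr
    rw [← integral_sub (h.mul_integrable (integrable_nker hx))
      (h.mul_integrable (integrable_nker hx'))]
    have hi := ((hC x hx).1.add (hC x' hx').1).const_mul (4 * √‖x - x'‖ * M)
    calc _ ≤ ∫ y, |nker x y * s y - nker x' y * s y| ∂Lam := abs_integral_le_integral_abs
      _ ≤ ∫ y, 4 * √‖x - x'‖ * M * ((√‖x - y‖)⁻¹ + (√‖x' - y‖)⁻¹) ∂Lam := by
          refine integral_mono_ae ((h.mul_integrable (integrable_nker hx)).sub
            (h.mul_integrable (integrable_nker hx'))).abs hi ?_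
          filter_upwards [Lam_ae (p := fun y => ‖y‖ ≤ 1) (fun _ h => h), Lam_ae_ne x,
            Lam_ae_ne x'] with y hy hne hne'
          rw [← sub_mul, abs_mul]
          have := mul_le_mul (abs_nker_sub_le hx hx' hy hne hne') (h.bd y) (abs_nonneg _)
            (by positivity)
          linarith
      _ ≤ _ := by
          rw [integral_const_mul, integral_add (hC x hx).1 (hC x' hx').1]
          have h1 := (hC x hx).2
          have h2 := (hC x' hx').2
          have h3 : 4 * √‖x - x'‖ * M * ((∫ y, (√‖x - y‖)⁻¹ ∂Lam) + ∫ y, (√‖x' - y‖)⁻¹ ∂Lam)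
            ≤ 4 * √‖x - x'‖ * M * (2 * C) := by gcongr; linarith
          refine h3.trans ?_
          have : 0 ≤ A * (M * √‖x - x'‖) := by positivity
          linarith

lemma pot_clamp (s : ℂ → ℝ) (x : ℂ) : pot s (clamp x) = pot s x := by
  rw [pot, pot, clamp_of_le (norm_clamp_le x)]

lemma BM.continuous_pot {s : ℂ → ℝ} {M : ℝ} (h : BM s M) : Continuous (pot s) := by
  obtain ⟨P, hP, hP'⟩ := exists_pot_bound
  have hc : ContinuousOn (pot s) (closedBall 0 1) := by
    intro x hx
    rw [ContinuousWithinAt, tendsto_iff_dist_tendsto_zero]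
    have hlim : Tendsto (fun y => P * M * √‖y - x‖) (𝓝[closedBall 0 1] x) (𝓝 0) := by
      have : Continuous (fun y : ℂ => P * M * √‖y - x‖) := by fun_prop
      have h2 := this.tendsto x
      simp only [sub_self, norm_zero, Real.sqrt_zero, mul_zero] at h2
      exact h2.mono_left nhdsWithin_le_nhds
    refine squeeze_zero' (Eventually.of_forall fun _ => dist_nonneg) ?_ hlim
    filter_upwards [self_mem_nhdsWithin] with y hy
    rw [Real.dist_eq]
    exact (hP' s M h).2 y x (by simpa using hy) (by simpa using hx)
  have : pot s = pot s ∘ clamp := funext fun x => (pot_clamp s x).symm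
  rw [this]
  exact hc.comp_continuous continuous_clamp fun x => by simpa using norm_clamp_le x

lemma BM.pot {s : ℂ → ℝ} {M : ℝ} (h : BM s M) : ∃ M', BM (pot s) M' := by
  obtain ⟨P, hP, hP'⟩ := exists_pot_bound
  exact ⟨P * M, h.continuous_pot.measurable, (hP' s M h).1⟩

lemma BM.add {s t : ℂ → ℝ} {M M' : ℝ} (h : BM s M) (h' : BM t M') :
    BM (fun x => s x + t x) (M + M') :=
  ⟨h.meas.add h'.meas, fun x => (abs_add_le _ _).trans (add_le_add (h.bd x) (h'.bd x))⟩

lemma BM.sub {s t : ℂ → ℝ} {M M' : ℝ} (h : BM s M) (h' : BM t M') :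
    BM (fun x => s x - t x) (M + M') :=
  ⟨h.meas.sub h'.meas, fun x => (abs_sub _ _).trans (add_le_add (h.bd x) (h'.bd x))⟩

lemma BM.mul {s t : ℂ → ℝ} {M M' : ℝ} (h : BM s M) (h' : BM t M') :
    BM (fun x => s x * t x) (M * M') :=
  ⟨h.meas.mul h'.meas, fun x => by
    rw [abs_mul]; exact mul_le_mul (h.bd x) (h'.bd x) (abs_nonneg _) h.nonneg⟩

lemma BM.const (c : ℝ) : BM (fun _ => c) |c| := ⟨measurable_const, fun _ => le_rfl⟩

lemma pot_sub {s t : ℂ → ℝ} {M M' : ℝ} (h : BM s M) (h' : BM t M') (x : ℂ) :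
    pot (fun y => s y - t y) x = pot s x - pot t x := by
  have hx := norm_clamp_le x
  simp only [_root_.pot, mul_sub]
  rw [integral_sub (h.mul_integrable (integrable_nker hx)) (h'.mul_integrable (integrable_nker hx)),
    mul_sub]

/-- The energy pairing. -/
def inn (s t : ℂ → ℝ) : ℝ := ∫ x, s x * pot t x ∂Lam

lemma integrable_prod_nker : Integrable (fun p : ℂ × ℂ => nker p.1 p.2) (Lam.prod Lam) := by
  obtain ⟨A, hA0, hA⟩ := exists_integral_abs_nker_le
  rw [integrable_prod_iff measurable_nker.aestronglyMeasurable]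
  refine ⟨Lam_ae fun x hx => integrable_nker hx, ?_⟩
  refine Integrable.of_bound ?_ A (Lam_ae fun x hx => ?_)
  · exact (measurable_nker.norm.stronglyMeasurable.integral_prod_right).aestronglyMeasurable
  · rw [Real.norm_of_nonneg (integral_nonneg fun y => norm_nonneg _)]
    exact hA x hx

lemma BM.integrable_prod {s t : ℂ → ℝ} {M M' : ℝ} (h : BM s M) (h' : BM t M') :
    Integrable (fun p : ℂ × ℂ => nker p.1 p.2 * (s p.1 * t p.2)) (Lam.prod Lam) := by
  refine integrable_prod_nker.mul_bdd (c := M * M')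
    ((h.meas.comp measurable_fst).mul (h'.meas.comp measurable_snd)).aestronglyMeasurable
    (Eventually.of_forall fun p => ?_)
  rw [Real.norm_eq_abs, abs_mul]
  exact mul_le_mul (h.bd _) (h'.bd _) (abs_nonneg _) h.nonneg

lemma inn_eq {s t : ℂ → ℝ} : inn s t =
    (2 * π)⁻¹ * ∫ x, ∫ y, nker x y * (s x * t y) ∂Lam ∂Lam := by
  unfold inn
  rw [← integral_const_mul]
  refine integral_congr_ae (Lam_ae fun x hx => ?_)
  simp only
  rw [_root_.pot, clamp_of_le hx, mul_left_comm, ← integral_const_mul]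
  congr 2; funext y; ring

lemma inn_eq_prod {s t : ℂ → ℝ} {M M' : ℝ} (h : BM s M) (h' : BM t M') : inn s t =
    (2 * π)⁻¹ * ∫ p, nker p.1 p.2 * (s p.1 * t p.2) ∂(Lam.prod Lam) := by
  rw [inn_eq, integral_prod _ (h.integrable_prod h')]

lemma inn_comm {s t : ℂ → ℝ} {M M' : ℝ} (h : BM s M) (h' : BM t M') : inn s t = inn t s := by
  rw [inn_eq, inn_eq, integral_integral_swap (h.integrable_prod h')]
  simp only [nker_symm, mul_comm]

lemma inn_sub_left {s t r : ℂ → ℝ} {M M' M'' : ℝ} (h : BM s M) (h' : BM t M') (h'' : BM r M'') :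
    inn (fun x => s x - t x) r = inn s r - inn t r := by
  obtain ⟨K, hK⟩ := h''.pot
  unfold inn
  simp only [sub_mul]
  exact integral_sub (h.mul hK).integrable (h'.mul hK).integrable

lemma inn_sub_self {s t : ℂ → ℝ} {M M' : ℝ} (h : BM s M) (h' : BM t M') :
    inn (fun x => s x - t x) (fun x => s x - t x) = inn s s - 2 * inn s t + inn t t := by
  rw [inn_sub_left h h' (h.sub h'), inn_comm h (h.sub h'), inn_comm h' (h.sub h'),
    inn_sub_left h h' h, inn_sub_left h h' h', inn_comm h' h]
  ring

/-! ### Positivity of the energy on densities of zero mass -/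

/-- The quadratic form with kernel `k`, evaluated at the density `s`. -/
def qform (s : ℂ → ℝ) (k : ℂ × ℂ → ℝ) : ℝ := ∫ p, k p * (s p.1 * s p.2) ∂(Lam.prod Lam)

lemma BM.prod_meas {s : ℂ → ℝ} {M : ℝ} (h : BM s M) :
    Measurable (fun p : ℂ × ℂ => s p.1 * s p.2) :=
  (h.meas.comp measurable_fst).mul (h.meas.comp measurable_snd)

lemma BM.prod_bd {s : ℂ → ℝ} {M : ℝ} (h : BM s M) (p : ℂ × ℂ) : |s p.1 * s p.2| ≤ M * M := by
  rw [abs_mul]; exact mul_le_mul (h.bd _) (h.bd _) (abs_nonneg _) h.nonneg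

lemma BM.qform_integrable {s : ℂ → ℝ} {M : ℝ} (h : BM s M) {k : ℂ × ℂ → ℝ}
    (hk : Integrable k (Lam.prod Lam)) :
    Integrable (fun p : ℂ × ℂ => k p * (s p.1 * s p.2)) (Lam.prod Lam) :=
  hk.mul_bdd h.prod_meas.aestronglyMeasurable (c := M * M) (Eventually.of_forall h.prod_bd)

lemma qform_tendsto_nonneg {s : ℂ → ℝ} {M : ℝ} (h : BM s M) {k : ℕ → ℂ × ℂ → ℝ}
    {k' b : ℂ × ℂ → ℝ} (hk : ∀ n, Measurable (k n)) (hb : Integrable b (Lam.prod Lam))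
    (hkb : ∀ n, ∀ᵐ p ∂(Lam.prod Lam), |k n p| ≤ b p)
    (hlim : ∀ᵐ p ∂(Lam.prod Lam), Tendsto (fun n => k n p) atTop (𝓝 (k' p)))
    (hpos : ∀ n, 0 ≤ qform s (k n)) : 0 ≤ qform s k' := by
  have : Tendsto (fun n => qform s (k n)) atTop (𝓝 (qform s k')) := by
    refine tendsto_integral_of_dominated_convergence (fun p => b p * (M * M)) (fun n => ?_)
      (hb.mul_const _) (fun n => ?_) ?_
    · exact ((hk n).mul h.prod_meas).aestronglyMeasurable
    · filter_upwards [hkb n] with p hp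
      rw [Real.norm_eq_abs, abs_mul]
      exact mul_le_mul hp (h.prod_bd p) (abs_nonneg _) ((abs_nonneg _).trans hp)
    · filter_upwards [hlim] with p hp using hp.mul_const _
  exact ge_of_tendsto' this hpos

lemma qform_integral_nonneg {Ω : Type*} [MeasurableSpace Ω] {μ : Measure Ω} [SFinite μ]
    {s : ℂ → ℝ} {M : ℝ} (h : BM s M) {k : Ω → ℂ × ℂ → ℝ} {b : Ω → ℝ}
    (hk : Measurable (Function.uncurry k)) (hb : Integrable b μ)
    (hkb : ∀ᵐ ω ∂μ, ∀ p, |k ω p| ≤ b ω) (hpos : ∀ᵐ ω ∂μ, 0 ≤ qform s (k ω)) :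
    0 ≤ qform s (fun p => ∫ ω, k ω p ∂μ) := by
  have hint : Integrable (fun q : (ℂ × ℂ) × Ω => k q.2 q.1 * (s q.1.1 * s q.1.2))
      ((Lam.prod Lam).prod μ) := by
    have hb' : Integrable (fun q : (ℂ × ℂ) × Ω => (1 : ℝ) * b q.2) ((Lam.prod Lam).prod μ) :=
      (integrable_const (1 : ℝ)).mul_prod hb
    refine Integrable.mono' (hb'.mul_const (M * M)) ?_ ?_
    · exact ((hk.comp measurable_swap).mul (h.prod_meas.comp measurable_fst)).aestronglyMeasurable
    · have : ∀ᵐ q ∂((Lam.prod Lam).prod μ), ∀ p, |k q.2 p| ≤ b q.2 :=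
        Measure.quasiMeasurePreserving_snd.ae hkb
      filter_upwards [this] with q hq
      rw [Real.norm_eq_abs, abs_mul, one_mul]
      exact mul_le_mul (hq _) (h.prod_bd _) (abs_nonneg _) ((abs_nonneg _).trans (hq q.1))
  have : qform s (fun p => ∫ ω, k ω p ∂μ) = ∫ ω, qform s (k ω) ∂μ := by
    unfold qform
    simp_rw [← integral_mul_const]
    exact integral_integral_swap hint
  rw [this]
  exact integral_nonneg_of_ae hpos

lemma qform_char_nonneg {s : ℂ → ℝ} {M : ℝ} (h : BM s M) {e : ℂ → ℂ} {C : ℝ} (he : Measurable e)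
    (hC : ∀ x, ‖x‖ ≤ 1 → ‖e x‖ ≤ C) :
    0 ≤ qform s (fun p => (e p.1 * (starRingEnd ℂ) (e p.2)).re) := by
  have hi : Integrable (fun x => (s x : ℂ) * e x) Lam := by
    refine Integrable.of_bound (C := M * C)
      ((Complex.measurable_ofReal.comp h.meas).mul he).aestronglyMeasurable
      (Lam_ae fun x hx => ?_)
    rw [norm_mul, Complex.norm_real]
    exact mul_le_mul (h.bd x) (hC x hx) (norm_nonneg _) h.nonneg
  have hc : Integrable (fun x => (starRingEnd ℂ) ((s x : ℂ) * e x)) Lam := by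
    have := (Complex.conjCLE : ℂ →L[ℝ] ℂ).integrable_comp hi
    exact this
  have h1 : ∀ p : ℂ × ℂ, (e p.1 * (starRingEnd ℂ) (e p.2)).re * (s p.1 * s p.2) =
      Complex.reCLM (((s p.1 : ℂ) * e p.1) * (starRingEnd ℂ) ((s p.2 : ℂ) * e p.2)) := by
    intro p
    simp [Complex.mul_re, Complex.mul_im]
    ring
  unfold qform
  simp_rw [h1]
  rw [ContinuousLinearMap.integral_comp_comm Complex.reCLM (hi.mul_prod hc),
    integral_prod_mul (fun x => (s x : ℂ) * e x) (fun x => (starRingEnd ℂ) ((s x : ℂ) * e x)),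
    integral_conj, Complex.mul_conj]
  simp [Complex.normSq_nonneg]

lemma gaussian_char (t : ℝ) (ht : 0 ≤ t) (z : ℂ) :
    ∫ q, (Complex.exp ((z.re * q.1 + z.im * q.2 : ℝ) * Complex.I)).re
      ∂((ProbabilityTheory.gaussianReal 0 (Real.toNNReal (2 * t))).prod
        (ProbabilityTheory.gaussianReal 0 (Real.toNNReal (2 * t)))) = Real.exp (-t * ‖z‖ ^ 2) := by
  set γ := ProbabilityTheory.gaussianReal 0 (Real.toNNReal (2 * t))
  have hc : ∀ a : ℝ, ∫ x, Complex.exp ((a * x : ℝ) * Complex.I) ∂γ = Real.exp (-t * a ^ 2) := by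
    intro a
    have := ProbabilityTheory.charFun_gaussianReal (μ := 0) (v := (Real.toNNReal (2 * t))) a
    rw [charFun_apply_real] at this
    simp only [Complex.ofReal_mul]
    rw [this]
    rw [Real.coe_toNNReal _ (by positivity)]
    push_cast
    congr 1
    ring
  have hint : Integrable (fun q : ℝ × ℝ =>
      Complex.exp ((z.re * q.1 + z.im * q.2 : ℝ) * Complex.I)) (γ.prod γ) := by
    refine Integrable.of_bound (C := 1) (by fun_prop) (Eventually.of_forall fun q => ?_)
    rw [Complex.norm_exp_ofReal_mul_I]
  have h1 : ∫ q : ℝ × ℝ, Complex.exp ((z.re * q.1 + z.im * q.2 : ℝ) * Complex.I) ∂(γ.prod γ)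
      = Real.exp (-t * ‖z‖ ^ 2) := by
    have : ∀ q : ℝ × ℝ, Complex.exp ((z.re * q.1 + z.im * q.2 : ℝ) * Complex.I) =
        Complex.exp ((z.re * q.1 : ℝ) * Complex.I) * Complex.exp ((z.im * q.2 : ℝ) * Complex.I) := by
      intro q
      rw [← Complex.exp_add, ← add_mul]; push_cast; rfl
    simp_rw [this]
    rw [integral_prod_mul (fun x : ℝ => Complex.exp ((z.re * x : ℝ) * Complex.I))
      (fun x : ℝ => Complex.exp ((z.im * x : ℝ) * Complex.I)), hc, hc, ← Complex.ofReal_mul,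
      ← Real.exp_add]
    congr 2
    rw [← Complex.normSq_eq_norm_sq, Complex.normSq_apply]; ring
  have h2 := ContinuousLinearMap.integral_comp_comm Complex.reCLM hint
  rw [h1] at h2
  exact h2

lemma qform_gaussian_nonneg {s : ℂ → ℝ} {M : ℝ} (h : BM s M) {t : ℝ} (ht : 0 ≤ t) :
    0 ≤ qform s (fun p => Real.exp (-t * ‖p.1 - p.2‖ ^ 2)) := by
  simp_rw [← gaussian_char t ht]
  refine qform_integral_nonneg h (b := fun _ => 1) (by unfold Function.uncurry; fun_prop)
    (integrable_const _)
    (Eventually.of_forall fun ω p => ?_) (Eventually.of_forall fun ω => ?_)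
  · refine (Complex.abs_re_le_norm _).trans ?_
    rw [Complex.norm_exp_ofReal_mul_I]
  · have := qform_char_nonneg h (e := fun x => Complex.exp ((x.re * ω.1 + x.im * ω.2 : ℝ) * Complex.I))
      (C := 1) (by fun_prop) (fun x _ => by rw [Complex.norm_exp_ofReal_mul_I])
    convert this using 4 with p
    rw [← Complex.exp_conj, ← Complex.exp_add]
    congr 1
    simp only [map_mul, Complex.conj_ofReal, Complex.conj_I, Complex.sub_re, Complex.sub_im]
    push_cast
    ring

lemma qform_inv_nonneg {s : ℂ → ℝ} {M : ℝ} (h : BM s M) {l : ℝ} (hl : 0 < l) :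
    0 ≤ qform s (fun p => (‖p.1 - p.2‖ ^ 2 + l)⁻¹) := by
  have h1 : ∀ p : ℂ × ℂ, (‖p.1 - p.2‖ ^ 2 + l)⁻¹ =
      ∫ t in Ioi (0:ℝ), Real.exp (-t * ‖p.1 - p.2‖ ^ 2) * Real.exp (-l * t) := by
    intro p
    have ha : 0 < ‖p.1 - p.2‖ ^ 2 + l := by positivity
    have := integral_exp_mul_Ioi (a := -(‖p.1 - p.2‖ ^ 2 + l)) (by linarith) 0
    simp only [mul_zero, Real.exp_zero] at this
    rw [show (‖p.1 - p.2‖ ^ 2 + l)⁻¹ = -1 / -(‖p.1 - p.2‖ ^ 2 + l) by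
      rw [neg_div_neg_eq, one_div], ← this]
    refine integral_congr_ae (Eventually.of_forall fun t => ?_)
    simp only [← Real.exp_add]
    congr 1; ring
  simp_rw [h1]
  refine qform_integral_nonneg h (b := fun t => Real.exp (-l * t))
    (by unfold Function.uncurry; fun_prop)
    (integrableOn_exp_mul_Ioi (by linarith) 0) ?_ ?_
  · filter_upwards [ae_restrict_mem measurableSet_Ioi] with t ht p
    have ht' : 0 < t := ht
    rw [abs_of_pos (by positivity)]
    refine mul_le_of_le_one_left (by positivity) (Real.exp_le_one_iff.2 ?_)
    nlinarith [sq_nonneg ‖p.1 - p.2‖]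
  · filter_upwards [ae_restrict_mem measurableSet_Ioi] with t ht
    have := mul_nonneg (qform_gaussian_nonneg h (le_of_lt ht)) (Real.exp_pos (-l * t)).le
    unfold qform at this ⊢
    rw [← integral_mul_const] at this
    refine this.trans_eq (integral_congr_ae (Eventually.of_forall fun p => ?_))
    simp only; ring

lemma qform_const {s : ℂ → ℝ} (c : ℝ) (h0 : ∫ x, s x ∂Lam = 0) :
    qform s (fun _ => c) = 0 := by
  unfold qform
  rw [integral_const_mul, integral_prod_mul, h0]; simp

lemma prod_Lam_ae {q : ℂ × ℂ → Prop} (h : ∀ x y, ‖x‖ ≤ 1 → ‖y‖ ≤ 1 → x ≠ y → q (x, y)) :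
    ∀ᵐ p ∂(Lam.prod Lam), q p := by
  have h1 : ∀ᵐ p ∂(Lam.prod Lam), ‖p.1‖ ≤ 1 :=
    Measure.quasiMeasurePreserving_fst.ae (Lam_ae (p := fun x => ‖x‖ ≤ 1) fun x h => h)
  have h2 : ∀ᵐ p ∂(Lam.prod Lam), ‖p.2‖ ≤ 1 :=
    Measure.quasiMeasurePreserving_snd.ae (Lam_ae (p := fun x => ‖x‖ ≤ 1) fun x h => h)
  have h3 : ∀ᵐ p ∂(Lam.prod Lam), p.1 ≠ p.2 := by
    have hm : MeasurableSet {p : ℂ × ℂ | p.1 ≠ p.2} :=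
      (measurableSet_eq_fun measurable_fst measurable_snd).compl
    rw [Measure.ae_prod_iff_ae_ae hm]
    exact Eventually.of_forall fun x => (Lam_ae_ne x).mono fun y hy => hy.symm
  filter_upwards [h1, h2, h3] with p a b c using h p.1 p.2 a b c

lemma qform_sub_const {s : ℂ → ℝ} {M : ℝ} (h : BM s M) (h0 : ∫ x, s x ∂Lam = 0) {k : ℂ × ℂ → ℝ}
    (hk : Integrable k (Lam.prod Lam)) (c : ℝ) : qform s (fun p => k p - c) = qform s k := by
  have h1 := qform_const c h0
  have h2 : qform s (fun p => k p - c) = qform s k - qform s (fun _ => c) := by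
    unfold qform
    rw [← integral_sub (h.qform_integrable hk) (h.qform_integrable (integrable_const c))]
    simp only [sub_mul]
  rw [h2, h1, sub_zero]

lemma qform_neg_log_reg_nonneg {s : ℂ → ℝ} {M : ℝ} (h : BM s M) (h0 : ∫ x, s x ∂Lam = 0) {l : ℝ}
    (hl : 0 < l) : 0 ≤ qform s (fun p => -Real.log (‖p.1 - p.2‖ ^ 2 + l)) := by
  have hd : ∀ x y : ℂ, ‖x‖ ≤ 1 → ‖y‖ ≤ 1 → ‖x - y‖ ^ 2 ≤ 4 := by
    intro x y hx hy
    have := (norm_sub_le x y).trans (by linarith : _ ≤ (2:ℝ))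
    nlinarith [norm_nonneg (x - y)]
  have hbd : ∀ (n : ℕ) (d : ℝ), 0 ≤ d → d ≤ 4 →
      |Real.log (d + (l + n)) - Real.log (d + l) - Real.log (l + n)|
        ≤ 4 / l + (|Real.log l| + |Real.log (4 + l)|) := by
    intro n d hd0 hd4
    have hn : (0:ℝ) ≤ n := n.cast_nonneg
    have e1 : Real.log (l + n) ≤ Real.log (d + (l + n)) :=
      Real.log_le_log (by positivity) (by linarith)
    have e2 : Real.log (d + (l + n)) - Real.log (l + n) ≤ 4 / l := by
      rw [← Real.log_div (by positivity) (by positivity), add_div, div_self (by positivity)]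
      refine (Real.log_le_sub_one_of_pos (by positivity)).trans ?_
      rw [add_sub_cancel_right]
      exact div_le_div₀ (by norm_num) hd4 hl (by linarith)
    have e3 : Real.log l ≤ Real.log (d + l) := Real.log_le_log hl (by linarith)
    have e4 : Real.log (d + l) ≤ Real.log (4 + l) := Real.log_le_log (by linarith) (by linarith)
    have e5 := neg_abs_le (Real.log l)
    have e6 := le_abs_self (Real.log (4 + l))
    have e7 := abs_nonneg (Real.log l)
    have e8 := abs_nonneg (Real.log (4 + l))
    rw [abs_le]
    constructor <;> linarith
  refine qform_tendsto_nonneg h (k := fun n p => Real.log (‖p.1 - p.2‖ ^ 2 + (l + n)) -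
      Real.log (‖p.1 - p.2‖ ^ 2 + l) - Real.log (l + n))
    (b := fun _ => 4 / l + (|Real.log l| + |Real.log (4 + l)|)) (fun n => by fun_prop)
    (integrable_const _) (fun n => prod_Lam_ae fun x y hx hy _ => ?_)
    (Eventually.of_forall fun p => ?_) (fun n => ?_)
  · exact hbd n _ (by positivity) (hd x y hx hy)
  · have h1 : Tendsto (fun n : ℕ => ‖p.1 - p.2‖ ^ 2 / (l + n)) atTop (𝓝 0) :=
      tendsto_const_nhds.div_atTop (tendsto_atTop_add_const_left _ _ tendsto_natCast_atTop_atTop)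
    have h2 : Tendsto (fun n : ℕ => Real.log (‖p.1 - p.2‖ ^ 2 / (l + n) + 1)) atTop (𝓝 0) := by
      have := ((Real.continuousAt_log one_ne_zero).tendsto.comp
        (by simpa using h1.add_const 1 : Tendsto (fun n : ℕ => ‖p.1 - p.2‖ ^ 2 / (l + n) + 1)
          atTop (𝓝 1)))
      simpa [Function.comp_def] using this
    have h3 := h2.sub_const (Real.log (‖p.1 - p.2‖ ^ 2 + l))
    rw [zero_sub] at h3
    refine h3.congr fun n => ?_
    have hn : (0:ℝ) ≤ n := n.cast_nonneg
    have : ‖p.1 - p.2‖ ^ 2 / (l + n) + 1 = (‖p.1 - p.2‖ ^ 2 + (l + n)) / (l + n) := by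
      field_simp
    rw [this, Real.log_div (by positivity) (by positivity)]
    ring
  · have hn : (0:ℝ) ≤ n := n.cast_nonneg
    have hint : Integrable (fun p : ℂ × ℂ => Real.log (‖p.1 - p.2‖ ^ 2 + (l + n)) -
        Real.log (‖p.1 - p.2‖ ^ 2 + l)) (Lam.prod Lam) := by
      refine Integrable.of_bound
        (C := 4 / l + (|Real.log l| + |Real.log (4 + l)|) + |Real.log (l + n)|)
        (by fun_prop : Measurable _).aestronglyMeasurable (prod_Lam_ae fun x y hx hy _ => ?_)
      have h1 := abs_le.1 (hbd n _ (by positivity) (hd x y hx hy))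
      rw [Real.norm_eq_abs, abs_le]
      constructor <;> linarith [h1.1, h1.2, neg_abs_le (Real.log (l + n)),
        le_abs_self (Real.log (l + n))]
    rw [qform_sub_const h h0 hint]
    have h1 : ∀ p : ℂ × ℂ, Real.log (‖p.1 - p.2‖ ^ 2 + (l + n)) -
        Real.log (‖p.1 - p.2‖ ^ 2 + l) = ∫ μ in Ioc l (l + n), (‖p.1 - p.2‖ ^ 2 + μ)⁻¹ := by
      intro p
      rw [← intervalIntegral.integral_of_le (by linarith),
        intervalIntegral.integral_comp_add_left (fun μ => μ⁻¹),
        integral_inv_of_pos (by positivity) (by positivity),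
        Real.log_div (by positivity) (by positivity)]
    simp_rw [h1]
    refine qform_integral_nonneg h (b := fun _ => l⁻¹) (by unfold Function.uncurry; fun_prop)
      (integrable_const _) ?_ ?_
    · filter_upwards [ae_restrict_mem measurableSet_Ioc] with μ hμ p
      have hμ' : 0 < μ := hl.trans hμ.1
      have : 0 < ‖p.1 - p.2‖ ^ 2 + μ := by positivity
      rw [abs_of_pos (by positivity)]
      exact inv_anti₀ hl (by nlinarith [sq_nonneg ‖p.1 - p.2‖, hμ.1])
    · filter_upwards [ae_restrict_mem measurableSet_Ioc] with μ hμ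
      exact qform_inv_nonneg h (hl.trans hμ.1)

lemma integrable_prod_sqrt :
    Integrable (fun p : ℂ × ℂ => (√‖p.1 - p.2‖)⁻¹) (Lam.prod Lam) := by
  obtain ⟨A, hA0, hA⟩ := riesz_sqrt
  have hm : Measurable (fun p : ℂ × ℂ => (√‖p.1 - p.2‖)⁻¹) := by fun_prop
  rw [integrable_prod_iff hm.aestronglyMeasurable]
  refine ⟨Lam_ae fun x hx => (hA x hx).1, ?_⟩
  refine Integrable.of_bound ?_ A (Lam_ae fun x hx => ?_)
  · exact (hm.norm.stronglyMeasurable.integral_prod_right).aestronglyMeasurable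
  · rw [Real.norm_of_nonneg (integral_nonneg fun y => norm_nonneg _)]
    refine (hA x hx).2.trans' (le_of_eq ?_)
    exact integral_congr_ae (Eventually.of_forall fun y => Real.norm_of_nonneg (by positivity))

/-- `|log d| ≤ 2 / √d + 2` for `0 < d ≤ 2`. -/
lemma abs_log_le_inv_sqrt {d : ℝ} (hd : 0 < d) (h2 : d ≤ 2) :
    |Real.log d| ≤ 2 * (√d)⁻¹ + 2 := by
  have hs : 0 < √d := Real.sqrt_pos.2 hd
  have h5 : -Real.log d = 2 * Real.log ((√d)⁻¹) := by
    rw [Real.log_inv, Real.log_sqrt hd.le]; ring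
  have h6 := Real.log_le_sub_one_of_pos (inv_pos.2 hs)
  have h7 := Real.log_le_sub_one_of_pos hd
  have : 0 < (√d)⁻¹ := by positivity
  rw [abs_le]; constructor <;> linarith

lemma qform_neg_log_nonneg {s : ℂ → ℝ} {M : ℝ} (h : BM s M) (h0 : ∫ x, s x ∂Lam = 0) :
    0 ≤ qform s (fun p => -Real.log ‖p.1 - p.2‖) := by
  have h2 : 0 ≤ qform s (fun p => -Real.log (‖p.1 - p.2‖ ^ 2)) := by
    refine qform_tendsto_nonneg h
      (k := fun n p => -Real.log (‖p.1 - p.2‖ ^ 2 + ((n : ℝ) + 1)⁻¹))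
      (b := fun p => 2 * (2 * (√‖p.1 - p.2‖)⁻¹ + 2) + 4) (fun n => by fun_prop)
      ((((integrable_prod_sqrt.const_mul 2).add (integrable_const 2)).const_mul 2).add
        (integrable_const 4)) (fun n => prod_Lam_ae fun x y hx hy hne => ?_)
      (prod_Lam_ae fun x y hx hy hne => ?_)
      (fun n => qform_neg_log_reg_nonneg h h0 (by positivity))
    · have hd : 0 < ‖x - y‖ := norm_pos_iff.2 (sub_ne_zero.2 hne)
      have hd2 : ‖x - y‖ ≤ 2 := (norm_sub_le x y).trans (by linarith)
      have hn : 0 < ((n : ℝ) + 1)⁻¹ := by positivity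
      have hn1 : ((n : ℝ) + 1)⁻¹ ≤ 1 := inv_le_one_of_one_le₀ (by linarith [n.cast_nonneg (α := ℝ)])
      have e1 := abs_le.1 (abs_log_le_inv_sqrt hd hd2)
      have e2 : 2 * Real.log ‖x - y‖ ≤ Real.log (‖x - y‖ ^ 2 + ((n : ℝ) + 1)⁻¹) := by
        have := Real.log_le_log (by positivity)
          (by linarith : ‖x - y‖ ^ 2 ≤ ‖x - y‖ ^ 2 + ((n : ℝ) + 1)⁻¹)
        rwa [Real.log_pow, Nat.cast_ofNat] at this
      have e3 := Real.log_le_sub_one_of_pos (x := ‖x - y‖ ^ 2 + ((n : ℝ) + 1)⁻¹) (by positivity)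
      have e4 : ‖x - y‖ ^ 2 ≤ 4 := by nlinarith
      have e5 : 0 < (√‖x - y‖)⁻¹ := by positivity
      simp only [abs_neg]
      rw [abs_le]
      constructor <;> linarith
    · have hd : 0 < ‖x - y‖ := norm_pos_iff.2 (sub_ne_zero.2 hne)
      have h1 : Tendsto (fun n : ℕ => ‖x - y‖ ^ 2 + ((n : ℝ) + 1)⁻¹) atTop (𝓝 (‖x - y‖ ^ 2 + 0)) :=
        tendsto_const_nhds.add (by simpa using tendsto_one_div_add_atTop_nhds_zero_nat (𝕜 := ℝ))
      rw [add_zero] at h1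
      exact ((Real.continuousAt_log (by positivity)).tendsto.comp h1).neg
  have h3 : qform s (fun p => -Real.log (‖p.1 - p.2‖ ^ 2)) =
      2 * qform s (fun p => -Real.log ‖p.1 - p.2‖) := by
    unfold qform
    rw [← integral_const_mul]
    refine integral_congr_ae (Eventually.of_forall fun p => ?_)
    simp only [Real.log_pow]; push_cast; ring
  linarith

lemma qform_conj_pow_nonneg {s : ℂ → ℝ} {M : ℝ} (h : BM s M) (n : ℕ) :
    0 ≤ qform s (fun p => ((p.1 * (starRingEnd ℂ) p.2) ^ n).re) := by
  have := qform_char_nonneg h (e := fun x => x ^ n) (C := 1) (by fun_prop)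
    (fun x hx => by rw [norm_pow]; exact pow_le_one₀ (norm_nonneg _) hx)
  simpa [mul_pow] using this

lemma measurable_starRingEnd : Measurable (starRingEnd ℂ) := Complex.continuous_conj.measurable

lemma qform_sum {s : ℂ → ℝ} {M : ℝ} (h : BM s M) (N : ℕ) {k : ℕ → ℂ × ℂ → ℝ}
    (hk : ∀ n, Integrable (k n) (Lam.prod Lam)) :
    qform s (fun p => ∑ n ∈ Finset.range N, k n p) = ∑ n ∈ Finset.range N, qform s (k n) := by
  unfold qform
  simp only [Finset.sum_mul]
  exact integral_finsetSum _ fun n _ => h.qform_integrable (hk n)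

lemma qform_neg_log_conj_reg_nonneg {s : ℂ → ℝ} {M : ℝ} (h : BM s M) {r : ℝ} (hr : 0 ≤ r)
    (hr1 : r < 1) :
    0 ≤ qform s (fun p => -Real.log ‖1 - r * (p.1 * (starRingEnd ℂ) p.2)‖) := by
  have hmc := measurable_starRingEnd
  have hw : ∀ x y : ℂ, ‖x‖ ≤ 1 → ‖y‖ ≤ 1 → ‖(r : ℂ) * (x * (starRingEnd ℂ) y)‖ ≤ r := by
    intro x y hx hy
    rw [norm_mul, norm_mul, Complex.norm_conj, Complex.norm_real, Real.norm_of_nonneg hr]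
    exact mul_le_of_le_one_right hr (mul_le_one₀ hx (norm_nonneg _) hy)
  have hterm : ∀ x y : ℂ, ‖x‖ ≤ 1 → ‖y‖ ≤ 1 → ∀ n : ℕ,
      |r ^ n / n * ((x * (starRingEnd ℂ) y) ^ n).re| ≤ r ^ n := by
    intro x y hx hy n
    have e1 : |((x * (starRingEnd ℂ) y) ^ n).re| ≤ 1 := by
      refine (Complex.abs_re_le_norm _).trans ?_
      rw [norm_pow, norm_mul, Complex.norm_conj]
      exact pow_le_one₀ (by positivity) (mul_le_one₀ hx (norm_nonneg _) hy)
    have e2 : r ^ n / n ≤ r ^ n := by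
      rcases n.eq_zero_or_pos with rfl | hn
      · simp
      · exact div_le_self (by positivity) (by exact_mod_cast hn)
    rw [abs_mul, abs_of_nonneg (by positivity : 0 ≤ r ^ n / n)]
    calc _ ≤ r ^ n / n * 1 := by gcongr
      _ ≤ _ := by linarith
  have hbd : ∀ x y : ℂ, ‖x‖ ≤ 1 → ‖y‖ ≤ 1 → ∀ N : ℕ,
      |∑ n ∈ Finset.range N, r ^ n / n * ((x * (starRingEnd ℂ) y) ^ n).re| ≤ (1 - r)⁻¹ := by
    intro x y hx hy N
    calc _ ≤ ∑ n ∈ Finset.range N, |r ^ n / n * ((x * (starRingEnd ℂ) y) ^ n).re| :=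
          Finset.abs_sum_le_sum_abs _ _
      _ ≤ ∑ n ∈ Finset.range N, r ^ n := Finset.sum_le_sum fun n _ => hterm x y hx hy n
      _ ≤ ∑' n, r ^ n := (summable_geometric_of_lt_one hr hr1).sum_le_tsum _
          (fun n _ => by positivity)
      _ = _ := tsum_geometric_of_lt_one hr hr1
  refine qform_tendsto_nonneg h
    (k := fun N p => ∑ n ∈ Finset.range N, r ^ n / n * ((p.1 * (starRingEnd ℂ) p.2) ^ n).re)
    (b := fun _ => (1 - r)⁻¹) (fun n => by fun_prop) (integrable_const _)
    (fun N => prod_Lam_ae fun x y hx hy _ => hbd x y hx hy N)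
    (prod_Lam_ae fun x y hx hy _ => ?_) (fun N => ?_)
  · have h1 := Complex.hasSum_taylorSeries_neg_log ((hw x y hx hy).trans_lt hr1)
    have h2 := (Complex.hasSum_re h1).tendsto_sum_nat
    convert h2 using 2
    · refine Finset.sum_congr rfl fun n _ => ?_
      rw [mul_pow (r : ℂ), ← Complex.ofReal_pow, mul_div_right_comm, ← Complex.ofReal_natCast,
        ← Complex.ofReal_div, Complex.re_ofReal_mul]
    · rw [Complex.neg_re, Complex.log_re]
  · rw [qform_sum h N (k := fun n p => r ^ n / n * ((p.1 * (starRingEnd ℂ) p.2) ^ n).re)]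
    · refine Finset.sum_nonneg fun n _ => ?_
      have := mul_nonneg (by positivity : 0 ≤ r ^ n / n) (qform_conj_pow_nonneg h n)
      unfold qform at this ⊢
      rw [← integral_const_mul] at this
      refine this.trans_eq (integral_congr_ae (Eventually.of_forall fun p => ?_))
      simp only; ring
    · exact fun n => Integrable.of_bound (C := r ^ n) (by fun_prop : Measurable _).aestronglyMeasurable
        (prod_Lam_ae fun x y hx hy _ => hterm x y hx hy n)

lemma qform_neg_log_conj_nonneg {s : ℂ → ℝ} {M : ℝ} (h : BM s M) :
    0 ≤ qform s (fun p => -Real.log ‖1 - p.1 * (starRingEnd ℂ) p.2‖) := by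
  have hmc := measurable_starRingEnd
  have hr : ∀ n : ℕ, 0 ≤ 1 - ((n : ℝ) + 1)⁻¹ ∧ 1 - ((n : ℝ) + 1)⁻¹ < 1 := by
    intro n
    have hn : 0 < ((n : ℝ) + 1)⁻¹ := by positivity
    have hn1 : ((n : ℝ) + 1)⁻¹ ≤ 1 := inv_le_one_of_one_le₀ (by linarith [n.cast_nonneg (α := ℝ)])
    constructor <;> linarith
  refine qform_tendsto_nonneg h
    (k := fun n p => -Real.log ‖1 - ((1 - ((n : ℝ) + 1)⁻¹ : ℝ) : ℂ) * (p.1 * (starRingEnd ℂ) p.2)‖)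
    (b := fun p => 2 * (√2 * (√‖p.1 - p.2‖)⁻¹) + 2) (fun n => by fun_prop)
    (((integrable_prod_sqrt.const_mul √2).const_mul 2).add (integrable_const 2))
    (fun n => prod_Lam_ae fun x y hx hy hne => ?_)
    (prod_Lam_ae fun x y hx hy hne => ?_)
    (fun n => qform_neg_log_conj_reg_nonneg h (hr n).1 (hr n).2)
  · have hd : 0 < ‖x - y‖ := norm_pos_iff.2 (sub_ne_zero.2 hne)
    set r := 1 - ((n : ℝ) + 1)⁻¹
    set w := x * (starRingEnd ℂ) y
    have hw : ‖w‖ ≤ 1 := by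
      simp only [w, norm_mul, Complex.norm_conj]
      exact mul_le_one₀ hx (norm_nonneg _) hy
    have hrw : ‖(r : ℂ) * w‖ ≤ r := by
      rw [norm_mul, Complex.norm_real, Real.norm_of_nonneg (hr n).1]
      exact mul_le_of_le_one_right (hr n).1 hw
    have e1 : ‖x - y‖ ≤ ‖1 - w‖ := norm_sub_le_norm_one_sub hx hy
    have e2 : 1 - r ≤ ‖1 - r * w‖ := by
      have := norm_sub_norm_le (1 : ℂ) (r * w)
      rw [norm_one] at this
      linarith
    have e3 : ‖1 - w‖ ≤ 2 * ‖1 - r * w‖ := by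
      have h1 : 1 - w = (1 - r * w) - ((1 - r : ℝ) : ℂ) * w := by push_cast; ring
      have h2 : ‖((1 - r : ℝ) : ℂ) * w‖ ≤ 1 - r := by
        rw [norm_mul, Complex.norm_real, Real.norm_of_nonneg (by linarith [(hr n).2])]
        exact mul_le_of_le_one_right (by linarith [(hr n).2]) hw
      have h3 := norm_sub_le (1 - r * w) (((1 - r : ℝ) : ℂ) * w)
      rw [← h1] at h3
      linarith
    have e4 : ‖1 - r * w‖ ≤ 2 := by
      have := norm_sub_le (1 : ℂ) (r * w)
      rw [norm_one] at this
      linarith [(hr n).2]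
    have e5 : ‖x - y‖ / 2 ≤ ‖1 - r * w‖ := by linarith
    have e6 := abs_log_le_inv_sqrt (lt_of_lt_of_le (by positivity) e5) e4
    have e7 : (√‖1 - r * w‖)⁻¹ ≤ √2 * (√‖x - y‖)⁻¹ := by
      have : (√(‖x - y‖ / 2))⁻¹ = √2 * (√‖x - y‖)⁻¹ := by
        rw [Real.sqrt_div' _ (by norm_num), inv_div, div_eq_mul_inv]
      rw [← this]
      exact inv_anti₀ (Real.sqrt_pos.2 (by positivity)) (Real.sqrt_le_sqrt e5)
    simp only [abs_neg]
    linarith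
  · have hd : 0 < ‖x - y‖ := norm_pos_iff.2 (sub_ne_zero.2 hne)
    have e1 : ‖x - y‖ ≤ ‖1 - x * (starRingEnd ℂ) y‖ := norm_sub_le_norm_one_sub hx hy
    have h1 : Tendsto (fun n : ℕ => 1 - ((n : ℝ) + 1)⁻¹) atTop (𝓝 (1 - 0)) :=
      tendsto_const_nhds.sub (by simpa using tendsto_one_div_add_atTop_nhds_zero_nat (𝕜 := ℝ))
    have hc : ContinuousAt (fun t : ℝ => -Real.log ‖1 - (t : ℂ) * (x * (starRingEnd ℂ) y)‖) 1 := by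
      refine ContinuousAt.neg (ContinuousAt.log (by fun_prop) ?_)
      simp only [Complex.ofReal_one, one_mul]
      linarith
    rw [sub_zero] at h1
    have := hc.tendsto.comp h1
    simpa only [Function.comp_def, Complex.ofReal_one, one_mul] using this

/-- The energy pairing is nonnegative on densities of zero mass. -/
lemma inn_self_nonneg {s : ℂ → ℝ} {M : ℝ} (h : BM s M) (h0 : ∫ x, s x ∂Lam = 0) :
    0 ≤ inn s s := by
  have hmc := measurable_starRingEnd
  rw [inn_eq_prod h h]
  have i1 : Integrable (fun p : ℂ × ℂ => -Real.log ‖p.1 - p.2‖) (Lam.prod Lam) := by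
    refine Integrable.mono' ((integrable_prod_sqrt.const_mul 2).add (integrable_const 2))
      (by fun_prop : Measurable _).aestronglyMeasurable (prod_Lam_ae fun x y hx hy hne => ?_)
    simp only [norm_neg, Pi.add_apply]
    exact abs_log_le_inv_sqrt (norm_pos_iff.2 (sub_ne_zero.2 hne))
      ((norm_sub_le x y).trans (by linarith))
  have i2 : Integrable (fun p : ℂ × ℂ => -Real.log ‖1 - p.1 * (starRingEnd ℂ) p.2‖)
      (Lam.prod Lam) := by
    refine (integrable_prod_nker.sub i1).congr (Eventually.of_forall fun p => ?_)
    simp only [nker, Pi.sub_apply]; ring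
  have e : ∫ p, nker p.1 p.2 * (s p.1 * s p.2) ∂(Lam.prod Lam) =
      qform s (fun p => -Real.log ‖p.1 - p.2‖) +
        qform s (fun p => -Real.log ‖1 - p.1 * (starRingEnd ℂ) p.2‖) := by
    unfold qform
    rw [← integral_add (h.qform_integrable i1) (h.qform_integrable i2)]
    refine integral_congr_ae (Eventually.of_forall fun p => ?_)
    simp only [nker]; ring
  rw [e]
  have := qform_neg_log_nonneg h h0
  have := qform_neg_log_conj_nonneg h
  positivity

/-! ### The free energy -/

/-- Measurable functions bounded above and bounded below by a positive constant. -/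
structure PB (F : ℂ → ℝ) : Prop where
  meas : Measurable F
  bd : ∃ c C, 0 < c ∧ ∀ x, c ≤ F x ∧ F x ≤ C

/-- Densities of total mass `2π`. -/
structure Dens (s : ℂ → ℝ) : Prop extends PB s where
  mass : ∫ x, s x ∂Lam = 2 * π

lemma PB.pos {F : ℂ → ℝ} (h : PB F) (x : ℂ) : 0 < F x := by
  obtain ⟨c, C, hc, hx⟩ := h.bd
  exact hc.trans_le (hx x).1

lemma PB.bm {F : ℂ → ℝ} (h : PB F) : ∃ M, BM F M := by
  obtain ⟨c, C, hc, hx⟩ := h.bd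
  exact ⟨C, h.meas, fun x => by rw [abs_of_pos (h.pos x)]; exact (hx x).2⟩

lemma PB.mul {F G : ℂ → ℝ} (hF : PB F) (hG : PB G) : PB (fun x => F x * G x) := by
  obtain ⟨c, C, hc, hx⟩ := hF.bd
  obtain ⟨c', C', hc', hx'⟩ := hG.bd
  exact ⟨hF.meas.mul hG.meas, c * c', C * C', by positivity, fun x =>
    ⟨mul_le_mul (hx x).1 (hx' x).1 hc'.le (hF.pos x).le,
      mul_le_mul (hx x).2 (hx' x).2 (hG.pos x).le ((hF.pos x).le.trans (hx x).2)⟩⟩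

lemma PB.inv {F : ℂ → ℝ} (hF : PB F) : PB (fun x => (F x)⁻¹) := by
  obtain ⟨c, C, hc, hx⟩ := hF.bd
  have hC : 0 < C := (hF.pos 0).trans_le (hx 0).2
  exact ⟨hF.meas.inv, C⁻¹, c⁻¹, by positivity, fun x =>
    ⟨inv_anti₀ (hF.pos x) (hx x).2, inv_anti₀ hc (hx x).1⟩⟩

lemma PB.div {F G : ℂ → ℝ} (hF : PB F) (hG : PB G) : PB (fun x => F x / G x) := by
  simp only [div_eq_mul_inv]
  exact hF.mul hG.inv

lemma PB.log {F : ℂ → ℝ} (hF : PB F) : ∃ M, BM (fun x => Real.log (F x)) M := by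
  obtain ⟨c, C, hc, hx⟩ := hF.bd
  refine ⟨|Real.log c| + |Real.log C|, hF.meas.log, fun x => ?_⟩
  have h1 := Real.log_le_log hc (hx x).1
  have h2 := Real.log_le_log (hF.pos x) (hx x).2
  rw [abs_le]
  constructor <;> linarith [neg_abs_le (Real.log c), le_abs_self (Real.log C),
    abs_nonneg (Real.log c), abs_nonneg (Real.log C)]

lemma PB.kap : PB kap := ⟨measurable_kap, 1, 2, one_pos, fun x => ⟨one_le_kap x, kap_le_two x⟩⟩

lemma BM.exp_kap {v : ℂ → ℝ} {M : ℝ} (h : BM v M) : PB (fun x => Real.exp (kap x * v x)) := by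
  refine ⟨(measurable_kap.mul h.meas).exp, Real.exp (-(2 * M)), Real.exp (2 * M), Real.exp_pos _,
    fun x => ?_⟩
  have h1 := abs_le.1 (h.bd x)
  have h2 := one_le_kap x
  have h3 := kap_le_two x
  have h4 := h.nonneg
  have h5 : |_root_.kap x * v x| ≤ 2 * M := by
    rw [abs_mul, abs_of_pos (kap_pos x)]
    exact mul_le_mul h3 (h.bd x) (abs_nonneg _) (by norm_num)
  rw [abs_le] at h5
  exact ⟨Real.exp_le_exp.2 h5.1, Real.exp_le_exp.2 h5.2⟩

lemma PB.integrable {F : ℂ → ℝ} (h : PB F) : Integrable F Lam := by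
  obtain ⟨M, hM⟩ := h.bm
  exact hM.integrable

/-- The entropy relative to the weight `F`. -/
def ent (F s : ℂ → ℝ) : ℝ := ∫ x, s x / kap x * (Real.log (s x / F x) - 1) ∂Lam

/-- The free energy. -/
def En (F s : ℂ → ℝ) : ℝ := ent F s - 1 / 2 * inn s s

lemma ent_bm {F s : ℂ → ℝ} (hF : PB F) (hs : PB s) :
    ∃ M, BM (fun x => s x / kap x * (Real.log (s x / F x) - 1)) M := by
  obtain ⟨A, hA⟩ := (hs.div PB.kap).bm
  obtain ⟨B, hB⟩ := (hs.div hF).log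
  exact ⟨_, hA.mul (hB.sub (BM.const 1))⟩

/-- Young's inequality for the entropy. -/
lemma young {s F k g : ℝ} (hs : 0 < s) (hF : 0 < F) (hk : 0 < k) :
    s * g ≤ s / k * (Real.log (s / F) - 1) + F / k * Real.exp (k * g) := by
  have h := Real.log_le_sub_one_of_pos (x := F * Real.exp (k * g) / s) (by positivity)
  rw [Real.log_div (by positivity) hs.ne', Real.log_mul hF.ne' (by positivity), Real.log_exp] at h
  rw [Real.log_div hs.ne' hF.ne']
  have h2 := mul_le_mul_of_nonneg_left h (by positivity : 0 ≤ s / k)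
  have e1 : s / k * (F * Real.exp (k * g) / s - 1) = F / k * Real.exp (k * g) - s / k := by
    field_simp
  have e2 : s / k * (Real.log F + k * g - Real.log s) =
      s * g - s / k * (Real.log s - Real.log F) := by
    field_simp
    ring
  rw [e1, e2] at h2
  linarith

lemma young_eq {s F k g : ℝ} (hs : 0 < s) (hF : 0 < F) (hk : 0 < k)
    (h : s * g = s / k * (Real.log (s / F) - 1) + F / k * Real.exp (k * g)) :
    s = F * Real.exp (k * g) := by
  by_contra hne
  have hne' : F * Real.exp (k * g) / s ≠ 1 := by
    intro h1
    rw [div_eq_one_iff_eq hs.ne'] at h1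
    exact hne h1.symm
  have h' := Real.log_lt_sub_one_of_pos (x := F * Real.exp (k * g) / s) (by positivity) hne'
  rw [Real.log_div (by positivity) hs.ne', Real.log_mul hF.ne' (by positivity), Real.log_exp] at h'
  rw [Real.log_div hs.ne' hF.ne'] at h
  have h2 := mul_lt_mul_of_pos_left h' (by positivity : 0 < s / k)
  have e1 : s / k * (F * Real.exp (k * g) / s - 1) = F / k * Real.exp (k * g) - s / k := by
    field_simp
  have e2 : s / k * (Real.log F + k * g - Real.log s) =
      s * g - s / k * (Real.log s - Real.log F) := by
    field_simp
    ring
  rw [e1, e2] at h2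
  linarith

/-- The density `F e^{κ v}`. -/
def wexp (F v : ℂ → ℝ) (x : ℂ) : ℝ := F x * Real.exp (kap x * v x)

lemma PB.wexp {F v : ℂ → ℝ} {M : ℝ} (hF : PB F) (hv : BM v M) : PB (wexp F v) :=
  hF.mul hv.exp_kap

lemma wexp_add_const_integral {F v : ℂ → ℝ} {M : ℝ} (hF : PB F) (hv : BM v M) (c : ℝ) :
    ∫ x, wexp F (fun y => v y + c) x ∂Lam = Real.exp c ^ 2 * ∫ x, wexp F v x ∂aream +
      Real.exp c * ∫ x, wexp F v x ∂arcm := by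
  rw [integral_Lam (hF.wexp (hv.add (BM.const c))).integrable]
  congr 1
  · rw [← integral_const_mul]
    refine integral_congr_ae (aream_ae fun x hx => ?_)
    simp only [_root_.wexp, kap_of_lt hx, mul_add, Real.exp_add, ← Real.exp_nat_mul]
    push_cast; ring
  · rw [← integral_const_mul]
    refine integral_congr_ae (arcm_ae fun x hx => ?_)
    simp only [_root_.wexp, kap_of_eq hx, mul_add, Real.exp_add, one_mul]
    ring

lemma arcm_univ : arcm.real univ = 2 * π := by
  unfold arcm
  rw [measureReal_def, Measure.map_apply continuous_bpt.measurable MeasurableSet.univ]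
  simp [Real.pi_pos.le]

lemma PB.arc_integral_pos {F : ℂ → ℝ} (hF : PB F) : 0 < ∫ x, F x ∂arcm := by
  obtain ⟨c, C, hc, hx⟩ := hF.bd
  have hi : Integrable F arcm := by
    have := hF.integrable
    unfold Lam at this
    exact (integrable_add_measure.1 this).2
  have : ∫ _, c ∂arcm ≤ ∫ x, F x ∂arcm := integral_mono (integrable_const c) hi fun x => (hx x).1
  rw [integral_const, arcm_univ, smul_eq_mul] at this
  exact lt_of_lt_of_le (by positivity) this

lemma exists_normalizer {F v : ℂ → ℝ} {M : ℝ} (hF : PB F) (hv : BM v M) :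
    ∃ c, ∫ x, wexp F (fun y => v y + c) x ∂Lam = 2 * π := by
  set A := ∫ x, wexp F v x ∂aream with hA
  set B := ∫ x, wexp F v x ∂arcm with hB
  have hB0 : 0 < B := (hF.wexp hv).arc_integral_pos
  have hA0 : 0 ≤ A := integral_nonneg fun x => ((hF.wexp hv).pos x).le
  have hcont : ContinuousOn (fun X : ℝ => X ^ 2 * A + X * B) (Icc 0 (2 * π / B)) := by fun_prop
  obtain ⟨X, hX, hX2⟩ := intermediate_value_Icc (by positivity) hcont
    (show 2 * π ∈ Icc _ _ by
      constructor
      · simp; positivity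
      · have : 2 * π / B * B = 2 * π := by field_simp
        simp only [this]
        have : 0 ≤ (2 * π / B) ^ 2 * A := by positivity
        linarith)
  have hXpos : 0 < X := by
    rcases hX.1.eq_or_lt with h | h
    · rw [← h] at hX2
      simp at hX2
    · exact h
  refine ⟨Real.log X, ?_⟩
  rw [wexp_add_const_integral hF hv, Real.exp_log hXpos]
  exact hX2

open Classical in
/-- The constant that normalises the mass of `F e^{κ(v+c)}` to `2π`. -/
def nrm (F v : ℂ → ℝ) : ℝ := Classical.epsilon fun c => ∫ x, wexp F (fun y => v y + c) x ∂Lam = 2 * π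

lemma nrm_spec {F v : ℂ → ℝ} {M : ℝ} (hF : PB F) (hv : BM v M) :
    ∫ x, wexp F (fun y => v y + nrm F v) x ∂Lam = 2 * π :=
  Classical.epsilon_spec (exists_normalizer hF hv)

lemma Dens.of_nrm {F v : ℂ → ℝ} {M : ℝ} (hF : PB F) (hv : BM v M) :
    Dens (wexp F (fun y => v y + nrm F v)) :=
  ⟨hF.wexp (hv.add (BM.const _)), nrm_spec hF hv⟩

/-- The normalised potential of the density `s`. -/
def npot (F s : ℂ → ℝ) (x : ℂ) : ℝ := pot s x + nrm F (pot s)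

lemma PB.npot_bm {F s : ℂ → ℝ} (hs : PB s) : ∃ M, BM (npot F s) M := by
  obtain ⟨A, hA⟩ := hs.bm
  obtain ⟨B, hB⟩ := hA.pot
  exact ⟨_, hB.add (BM.const _)⟩

lemma PB.continuous_npot {F s : ℂ → ℝ} (hs : PB s) : Continuous (npot F s) := by
  obtain ⟨A, hA⟩ := hs.bm
  exact hA.continuous_pot.add continuous_const

lemma Dens.wexp_npot {F s : ℂ → ℝ} (hF : PB F) (hs : PB s) : Dens (wexp F (npot F s)) := by
  obtain ⟨A, hA⟩ := hs.bm
  obtain ⟨B, hB⟩ := hA.pot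
  exact Dens.of_nrm hF hB

/-- The nonnegative defect in Young's inequality for the potential `g`. -/
def ygap (F s g : ℂ → ℝ) (x : ℂ) : ℝ :=
  s x / kap x * (Real.log (s x / F x) - 1) + F x / kap x * Real.exp (kap x * g x) - s x * g x

lemma ygap_nonneg {F s : ℂ → ℝ} (hF : PB F) (hs : PB s) (g : ℂ → ℝ) (x : ℂ) :
    0 ≤ ygap F s g x := by
  have := young (g := g x) (hs.pos x) (hF.pos x) (kap_pos x)
  unfold ygap; linarith

lemma ygap_bm {F s g : ℂ → ℝ} {M : ℝ} (hF : PB F) (hs : PB s) (hg : BM g M) :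
    ∃ M', BM (ygap F s g) M' := by
  obtain ⟨A, hA⟩ := ent_bm hF hs
  obtain ⟨B, hB⟩ := ((hF.div PB.kap).mul hg.exp_kap).bm
  obtain ⟨C, hC⟩ := hs.bm
  exact ⟨_, (hA.add hB).sub (hC.mul hg)⟩

lemma integral_mul_npot {F s t : ℂ → ℝ} (hs : PB s) (ht : Dens t) :
    ∫ x, t x * npot F s x ∂Lam = inn t s + 2 * π * nrm F (pot s) := by
  obtain ⟨A, hA⟩ := hs.bm
  obtain ⟨B, hB⟩ := hA.pot
  obtain ⟨C, hC⟩ := ht.bm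
  unfold npot inn
  simp only [mul_add]
  rw [integral_add (hC.mul hB).integrable (ht.integrable.mul_const _), integral_mul_const, ht.mass]

/-- The free energy of `s` in terms of the dual functional. -/
lemma En_eq {F s : ℂ → ℝ} (hF : PB F) (hs : Dens s) :
    En F s = ∫ x, ygap F s (npot F s) x ∂Lam + (1 / 2 * inn s s + 2 * π * nrm F (pot s)
      - ∫ x, wexp F (npot F s) x / kap x ∂Lam) := by
  obtain ⟨A, hA⟩ := ent_bm hF hs.toPB
  obtain ⟨G, hG⟩ := hs.toPB.npot_bm (F := F)
  obtain ⟨C, hC⟩ := hs.bm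
  have hB := ((hF.wexp hG).div PB.kap).integrable
  have h1 : ∫ x, ygap F s (npot F s) x ∂Lam =
      ent F s + ∫ x, wexp F (npot F s) x / kap x ∂Lam - ∫ x, s x * npot F s x ∂Lam := by
    have hAB : Integrable (fun x => s x / kap x * (Real.log (s x / F x) - 1)
        + wexp F (npot F s) x / kap x) Lam := hA.integrable.add hB
    unfold ent
    rw [← integral_add hA.integrable hB, ← integral_sub hAB (hC.mul hG).integrable]
    refine integral_congr_ae (Eventually.of_forall fun x => ?_)
    simp only [ygap, wexp]; ring
  rw [h1, integral_mul_npot hs.toPB hs, En]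
  ring

/-- The dual upper bound for the free energy of the updated density. -/
lemma En_update_le_dual {F s : ℂ → ℝ} (hF : PB F) (hs : Dens s) :
    En F (wexp F (npot F s)) ≤ 1 / 2 * inn s s + 2 * π * nrm F (pot s)
      - ∫ x, wexp F (npot F s) x / kap x ∂Lam := by
  have ht := Dens.wexp_npot (s := s) hF hs.toPB
  set t := wexp F (npot F s) with ht'
  obtain ⟨G, hG⟩ := hs.toPB.npot_bm (F := F)
  obtain ⟨C, hC⟩ := hs.bm
  obtain ⟨D, hD⟩ := ht.bm
  have hB := (ht.toPB.div PB.kap).integrable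
  have h1 : ent F t = ∫ x, t x * npot F s x ∂Lam - ∫ x, t x / kap x ∂Lam := by
    rw [← integral_sub (hD.mul hG).integrable hB]
    refine integral_congr_ae (Eventually.of_forall fun x => ?_)
    have hFx := hF.pos x
    have hk := kap_pos x
    have : t x / F x = Real.exp (kap x * npot F s x) := by
      rw [ht', wexp]; field_simp
    simp only [this, Real.log_exp]
    field_simp
  have h2 := inn_self_nonneg (hC.sub hD) (by
    rw [integral_sub hs.integrable ht.integrable, hs.mass, ht.mass, sub_self])
  rw [inn_sub_self hC hD, inn_comm hC hD] at h2
  rw [En, h1, integral_mul_npot hs.toPB ht]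
  linarith

lemma En_update_le {F s : ℂ → ℝ} (hF : PB F) (hs : Dens s) :
    En F (wexp F (npot F s)) + ∫ x, ygap F s (npot F s) x ∂Lam ≤ En F s := by
  have := En_update_le_dual hF hs
  rw [En_eq hF hs]
  linarith

lemma En_update_le_self {F s : ℂ → ℝ} (hF : PB F) (hs : Dens s) :
    En F (wexp F (npot F s)) ≤ En F s := by
  have h1 := En_update_le hF hs
  have : 0 ≤ ∫ x, ygap F s (npot F s) x ∂Lam := integral_nonneg (ygap_nonneg hF hs.toPB _)
  linarith

/-- Fixed points of the update map: continuous solutions of the integral equation. -/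
structure Sol (F u : ℂ → ℝ) : Prop where
  cont : Continuous u
  dens : Dens (wexp F u)
  eq : ∃ c, ∀ x, u x = pot (wexp F u) x + c

lemma pot_congr {s t : ℂ → ℝ} (h : s =ᵐ[Lam] t) : pot s = pot t := by
  funext x
  unfold pot
  congr 1
  exact integral_congr_ae (h.mono fun y hy => by simp only [hy])

/-- A minimiser of the free energy coincides almost everywhere with the density of a solution. -/
lemma exists_sol_of_minimizer {F s : ℂ → ℝ} (hF : PB F) (hs : Dens s)
    (hmin : ∀ t, Dens t → En F s ≤ En F t) : ∃ u, Sol F u ∧ s =ᵐ[Lam] wexp F u := by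
  obtain ⟨G, hG⟩ := hs.toPB.npot_bm (F := F)
  obtain ⟨Y, hY⟩ := ygap_bm hF hs.toPB hG
  have ht := Dens.wexp_npot (s := s) hF hs.toPB
  have h1 := En_update_le hF hs
  have h2 := hmin _ ht
  have h3 : ∫ x, ygap F s (npot F s) x ∂Lam = 0 :=
    le_antisymm (by linarith) (integral_nonneg (ygap_nonneg hF hs.toPB _))
  rw [integral_eq_zero_iff_of_nonneg (ygap_nonneg hF hs.toPB _) hY.integrable] at h3
  have h4 : s =ᵐ[Lam] wexp F (npot F s) := by
    filter_upwards [h3] with x hx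
    refine young_eq (hs.pos x) (hF.pos x) (kap_pos x) ?_
    simp only [ygap, Pi.zero_apply] at hx
    linarith
  refine ⟨npot F s, ⟨hs.toPB.continuous_npot, ht, nrm F (pot s), fun x => ?_⟩, h4⟩
  rw [← pot_congr h4]; rfl

/-- The entropy density shifted to be nonnegative. -/
def entp (F s : ℂ → ℝ) (x : ℂ) : ℝ := s x / kap x * (Real.log (s x / F x) - 1) + F x

lemma mul_le_entp {F s : ℂ → ℝ} (hF : PB F) (hs : PB s) (x : ℂ) (g : ℝ) (hg : 0 ≤ g) :
    s x * g ≤ entp F s x + F x * (Real.exp (kap x * g) - 1) := by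
  have h := young (g := g) (hs.pos x) (hF.pos x) (kap_pos x)
  have h1 : 1 ≤ Real.exp (kap x * g) := Real.one_le_exp (mul_nonneg (kap_pos x).le hg)
  have h2 : F x / kap x * Real.exp (kap x * g) ≤ F x * Real.exp (kap x * g) :=
    mul_le_mul_of_nonneg_right (div_le_self (hF.pos x).le (one_le_kap x)) (Real.exp_pos _).le
  unfold entp
  linarith

lemma mul_le_entp' {F s : ℂ → ℝ} (hF : PB F) (hs : PB s) (x : ℂ) (g : ℝ) :
    s x * g ≤ entp F s x + F x * Real.exp (kap x * g) := by
  have h := young (g := g) (hs.pos x) (hF.pos x) (kap_pos x)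
  have h2 : F x / kap x * Real.exp (kap x * g) ≤ F x * Real.exp (kap x * g) :=
    mul_le_mul_of_nonneg_right (div_le_self (hF.pos x).le (one_le_kap x)) (Real.exp_pos _).le
  have := hF.pos x
  unfold entp
  linarith

lemma entp_nonneg {F s : ℂ → ℝ} (hF : PB F) (hs : PB s) (x : ℂ) : 0 ≤ entp F s x := by
  simpa using mul_le_entp hF hs x 0 le_rfl

lemma entp_bm {F s : ℂ → ℝ} (hF : PB F) (hs : PB s) : ∃ M, BM (entp F s) M := by
  obtain ⟨A, hA⟩ := ent_bm hF hs
  obtain ⟨B, hB⟩ := hF.bm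
  exact ⟨_, hA.add hB⟩

lemma integral_entp {F s : ℂ → ℝ} (hF : PB F) (hs : PB s) :
    ∫ x, entp F s x ∂Lam = ent F s + ∫ x, F x ∂Lam := by
  obtain ⟨A, hA⟩ := ent_bm hF hs
  exact integral_add hA.integrable hF.integrable

/-- Pointwise near/far bound for the kernel against a density. -/
lemma nker_mul_le {F s : ℂ → ℝ} (hF : PB F) (hs : PB s) {CF η r γ b : ℝ} (hCF : ∀ x, F x ≤ CF)
    (hη : 0 < η) (hη1 : η ≤ 1 / 2) (hr : 0 < r) (hr1 : r ≤ 1) (hγ1 : (1 + η)⁻¹ ≤ γ)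
    (hγ2 : 3 / 4 ≤ γ) {x y : ℂ} (hx : ‖x‖ ≤ 1) (hy : ‖y‖ ≤ 1) (hxy : x ≠ y)
    (hb : b = if 1 - r < ‖x‖ then 2 * (1 + η) else 4 / 3) :
    nker x y * s y ≤ b * (if ‖x - y‖ < r then 1 else 0) * entp F s y
      + 3 * CF * ‖x - y‖ ^ (-(kap y * γ)) + 2 * Real.log (1 / r) * s y := by
  have hd : 0 < ‖x - y‖ := norm_pos_iff.2 (sub_ne_zero.2 hxy)
  have hsy := hs.pos y
  have hFy := hF.pos y
  have hk := kap_pos y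
  have hN := nker_le hx hy hxy
  have hlr : 0 ≤ Real.log (1 / r) := Real.log_nonneg (by rw [le_div_iff₀ hr]; linarith)
  have hCF0 : 0 < CF := hFy.trans_le (hCF y)
  have hlr' : Real.log (1 / r) = - Real.log r := by rw [one_div, Real.log_inv]
  split_ifs with hnear
  · have hd1 : ‖x - y‖ ≤ 1 := hnear.le.trans hr1
    have hb0 : 0 < b := by rw [hb]; split_ifs <;> positivity
    have hb3 : b ≤ 3 := by rw [hb]; split_ifs <;> linarith
    have hexp : ∀ γ' : ℝ, γ' ≤ γ →
        Real.exp (kap y * (-γ' * Real.log ‖x - y‖)) ≤ ‖x - y‖ ^ (-(kap y * γ)) := by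
      intro γ' h
      rw [Real.rpow_def_of_pos hd, Real.exp_le_exp]
      have := Real.log_nonpos hd.le hd1
      nlinarith [mul_nonneg hk.le (sub_nonneg.2 h)]
    have key : ∀ γ' : ℝ, γ' ≤ γ → b * (s y * (-γ' * Real.log ‖x - y‖)) ≤
        b * 1 * entp F s y + 3 * CF * ‖x - y‖ ^ (-(kap y * γ)) := by
      intro γ' h
      have h1 := mul_le_entp' hF hs y (-γ' * Real.log ‖x - y‖)
      have h2 : F y * Real.exp (kap y * (-γ' * Real.log ‖x - y‖)) ≤
          CF * ‖x - y‖ ^ (-(kap y * γ)) :=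
        mul_le_mul (hCF y) (hexp γ' h) (Real.exp_pos _).le hCF0.le
      have h3 : 0 ≤ CF * ‖x - y‖ ^ (-(kap y * γ)) := by positivity
      have h4 := mul_le_mul_of_nonneg_left (h1.trans (add_le_add_right h2 _)) hb0.le
      have h5 := mul_le_mul_of_nonneg_right hb3 h3
      nlinarith
    by_cases hout : 1 - r < ‖x‖
    · rw [if_pos hout] at hb
      have h1 := key (1 + η)⁻¹ hγ1
      have h2 : b * (s y * (-(1 + η)⁻¹ * Real.log ‖x - y‖)) = -2 * Real.log ‖x - y‖ * s y := by
        rw [hb]; field_simp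
      rw [h2] at h1
      have h3 := mul_le_mul_of_nonneg_right hN hsy.le
      have h4 : 0 ≤ 2 * Real.log (1 / r) * s y := by positivity
      linarith
    · rw [if_neg hout] at hb
      have h1 := key (3 / 4) hγ2
      have h2 : b * (s y * (-(3 / 4) * Real.log ‖x - y‖)) = - Real.log ‖x - y‖ * s y := by
        rw [hb]; ring
      rw [h2] at h1
      have h5 : r ≤ ‖1 - x * (starRingEnd ℂ) y‖ := by
        have := norm_sub_norm_le 1 (x * (starRingEnd ℂ) y)
        rw [norm_mul, Complex.norm_conj, norm_one] at this
        nlinarith [norm_nonneg x, norm_nonneg y]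
      have h6 := Real.log_le_log hr h5
      have h3 : nker x y ≤ - Real.log ‖x - y‖ + 2 * Real.log (1 / r) := by
        unfold nker; linarith
      have h4 := mul_le_mul_of_nonneg_right h3 hsy.le
      linarith
  · have h1 := Real.log_le_log hr (not_lt.1 hnear)
    have h2 : nker x y ≤ 2 * Real.log (1 / r) := by linarith
    have h3 := mul_le_mul_of_nonneg_right h2 hsy.le
    have h4 : 0 ≤ 3 * CF * ‖x - y‖ ^ (-(kap y * γ)) := by positivity
    simp only [mul_zero, zero_mul, zero_add]
    linarith

/-- The nonconcentration bound gives a bound for the weighted mass of small discs. -/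
lemma integral_near_le {s : ℂ → ℝ} (hs : Dens s) {R κ r B : ℝ} (hr : 0 < r) (hr1 : r ≤ 1 / 2)
    (hrR : 3 * r ≤ R) (hB : 0 ≤ B) (hκ : 0 ≤ κ)
    (hnc : ∀ z : ℂ, ‖z‖ = 1 → ∫ x in ball z R, s x ∂Lam ≤ κ * (2 * π)) (y : ℂ) :
    ∫ x, s x * (if 1 - r < ‖x‖ then 4 / 3 + B else 4 / 3) * (if ‖x - y‖ < r then 1 else 0) ∂Lam
      ≤ 4 / 3 * (2 * π) + B * (κ * (2 * π)) := by
  have hi := hs.integrable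
  by_cases hex : ∃ x0 : ℂ, ‖x0‖ ≤ 1 ∧ 1 - r < ‖x0‖ ∧ ‖x0 - y‖ < r
  · obtain ⟨x0, h1, h2, h3⟩ := hex
    have hx0 : 0 < ‖x0‖ := by linarith
    set z : ℂ := (‖x0‖⁻¹ : ℝ) • x0
    have hz : ‖z‖ = 1 := by
      simp [z, hx0.ne']
    have hz2 : ‖x0 - z‖ < r := by
      have : x0 - z = ((1 - ‖x0‖⁻¹ : ℝ)) • x0 := by simp [z, sub_smul]
      rw [this, norm_smul, Real.norm_eq_abs, ← abs_of_pos hx0, ← abs_mul, abs_of_pos hx0, sub_mul,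
        inv_mul_cancel₀ hx0.ne', abs_sub_comm, abs_of_nonneg (by linarith)]
      linarith
    have hint2 : Integrable ((ball z R).indicator s) Lam := hi.indicator measurableSet_ball
    calc _ ≤ ∫ x, (4 / 3 * s x + B * (ball z R).indicator s x) ∂Lam := by
          obtain ⟨M, hM⟩ := hs.bm
          refine integral_mono_ae ?_ ((hi.const_mul _).add (hint2.const_mul _)) (Lam_ae ?_)
          · refine Integrable.mono' (hi.const_mul (4 / 3 + B)) ?_ (Eventually.of_forall fun x => ?_)
            · refine Measurable.aestronglyMeasurable ?_
              refine (hs.meas.mul (Measurable.ite (measurableSet_lt measurable_const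
                measurable_norm) measurable_const measurable_const)).mul
                (Measurable.ite (measurableSet_lt (by fun_prop) measurable_const)
                measurable_const measurable_const)
            · have := hs.pos x
              rw [Real.norm_eq_abs, abs_of_nonneg (by split_ifs <;> positivity)]
              split_ifs <;> nlinarith [mul_nonneg hB this.le]
          · intro x hx
            have hsx := hs.pos x
            have hind : 0 ≤ (ball z R).indicator s x := indicator_nonneg (fun x _ => (hs.pos x).le) x
            have hBi := mul_nonneg hB hind
            dsimp only
            split_ifs with ha hb
            · have hmem : x ∈ ball z R := by
                rw [mem_ball, dist_eq_norm]
                have : x - z = (x - y) - (x0 - y) + (x0 - z) := by ring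
                rw [this]
                linarith [norm_add_le ((x - y) - (x0 - y)) (x0 - z), norm_sub_le (x - y) (x0 - y)]
              rw [indicator_of_mem hmem]
              linarith
            · linarith
            · linarith
            · linarith
      _ = 4 / 3 * (2 * π) + B * ∫ x in ball z R, s x ∂Lam := by
          rw [integral_add (hi.const_mul _) (hint2.const_mul _), integral_const_mul,
            integral_const_mul, hs.mass, integral_indicator measurableSet_ball]
      _ ≤ _ := by gcongr; exact hnc z hz
  · calc _ ≤ ∫ x, 4 / 3 * s x ∂Lam := by
          refine integral_mono_of_nonneg (Eventually.of_forall fun x => ?_) (hi.const_mul _)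
            (Lam_ae fun x hx => ?_)
          · have := hs.pos x
            simp only [Pi.zero_apply]
            split_ifs <;> positivity
          · have := hs.pos x
            dsimp only
            split_ifs with ha hb
            · exact absurd ⟨x, hx, ha, hb⟩ hex
            · linarith
            · linarith
            · linarith
      _ ≤ _ := by
          rw [integral_const_mul, hs.mass]
          have : 0 ≤ B * (κ * (2 * π)) := by positivity
          linarith

/-- Coercivity of the free energy on densities that do not concentrate at the boundary. -/
theorem En_coercive {F : ℂ → ℝ} (hF : PB F) {R κ : ℝ} (hR : 0 < R) (hκ0 : 0 ≤ κ) (hκ1 : κ < 1) :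
    ∃ δ C, 0 < δ ∧ ∀ s, Dens s →
      (∀ z : ℂ, ‖z‖ = 1 → ∫ x in ball z R, s x ∂Lam ≤ κ * (2 * π)) →
        δ * ent F s - C ≤ En F s := by
  obtain ⟨cF, CF, hcF, hCF⟩ := hF.bd
  set η := (1 - κ) / 6 with hη
  have hη0 : 0 < η := by rw [hη]; linarith
  have hη1 : η ≤ 1 / 2 := by rw [hη]; linarith
  set r := min (R / 3) (1 / 2) with hr
  have hr0 : 0 < r := by rw [hr]; positivity
  have hr1 : r ≤ 1 / 2 := min_le_right _ _
  have hrR : 3 * r ≤ R := by have := min_le_left (R / 3) (1 / 2); linarith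
  set γ := max ((1 + η)⁻¹) (3 / 4) with hγ
  have hγ1 : γ < 1 := max_lt (inv_lt_one_of_one_lt₀ (by linarith)) (by norm_num)
  have hγ0 : 0 ≤ γ := le_max_of_le_right (by norm_num)
  obtain ⟨G, hG0, hG⟩ := riesz_kap hγ0 hγ1
  set L := Real.log (1 / r) with hL
  set D := 3 * CF * G + 2 * L * (2 * π) with hD
  refine ⟨η, (1 - η) * ∫ x, F x ∂Lam + 1 / 2 * D, hη0, fun s hs hnc => ?_⟩
  obtain ⟨Ms, hMs⟩ := hs.bm
  obtain ⟨Me, hMe⟩ := entp_bm hF hs.toPB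
  set B := 2 * (1 + η) - 4 / 3 with hB
  have hB0 : 0 ≤ B := by rw [hB]; linarith
  set b : ℂ → ℝ := fun x => if 1 - r < ‖x‖ then 4 / 3 + B else 4 / 3 with hb
  have hbm : Measurable b := Measurable.ite (measurableSet_lt measurable_const
    measurable_norm) measurable_const measurable_const
  have hb0 : ∀ x, 0 ≤ b x := fun x => by simp only [hb]; split_ifs <;> positivity
  have hb3 : ∀ x, b x ≤ 3 := fun x => by simp only [hb, hB]; split_ifs <;> linarith
  set ι : ℂ × ℂ → ℝ := fun p => if ‖p.1 - p.2‖ < r then 1 else 0 with hι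
  have hιm : Measurable ι := Measurable.ite (measurableSet_lt (by fun_prop) measurable_const)
    measurable_const measurable_const
  have hι0 : ∀ p, 0 ≤ ι p := fun p => by simp only [hι]; split_ifs <;> norm_num
  have hι1 : ∀ p, ι p ≤ 1 := fun p => by simp only [hι]; split_ifs <;> norm_num
  have hh : Integrable (fun p : ℂ × ℂ => s p.1 * b p.1 * ι p * entp F s p.2) (Lam.prod Lam) := by
    refine Integrable.of_bound (C := Ms * 3 * 1 * Me) ?_ (Eventually.of_forall fun p => ?_)
    · exact ((((hs.meas.comp measurable_fst).mul (hbm.comp measurable_fst)).mul hιm).mul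
        (hMe.meas.comp measurable_snd)).aestronglyMeasurable
    · rw [Real.norm_eq_abs, abs_mul, abs_mul, abs_mul, abs_of_nonneg (hb0 _), abs_of_nonneg (hι0 _)]
      have := hMs.nonneg
      gcongr
      · exact hMs.bd _
      · exact hb3 _
      · exact hι1 _
      · exact hMe.bd _
  have hinner : ∀ x : ℂ, ‖x‖ ≤ 1 → ∫ y, nker x y * (s x * s y) ∂Lam ≤
      (∫ y, s x * b x * ι (x, y) * entp F s y ∂Lam) + s x * D := by
    intro x hx
    have hsx := hs.pos x
    have hI1 : Integrable (fun y => b x * ι (x, y) * entp F s y) Lam := by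
      refine Integrable.mono' (hMe.integrable.norm.const_mul 3)
        (((measurable_const.mul (hιm.comp (measurable_const.prodMk measurable_id))).mul
          hMe.meas).aestronglyMeasurable) (Eventually.of_forall fun y => ?_)
      rw [norm_mul, norm_mul, Real.norm_of_nonneg (hb0 x), Real.norm_of_nonneg (hι0 _)]
      refine mul_le_mul_of_nonneg_right ?_ (norm_nonneg _)
      nlinarith [hb0 x, hb3 x, hι0 (x, y), hι1 (x, y)]
    have hI2 : Integrable (fun y => b x * ι (x, y) * entp F s y
        + 3 * CF * ‖x - y‖ ^ (-(kap y * γ))) Lam := hI1.add ((hG x hx).1.const_mul _)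
    have hI3 : Integrable (fun y => b x * ι (x, y) * entp F s y
        + 3 * CF * ‖x - y‖ ^ (-(kap y * γ)) + 2 * L * s y) Lam :=
      hI2.add (hs.integrable.const_mul _)
    have h1 : ∫ y, nker x y * s y ∂Lam ≤
        ∫ y, (b x * ι (x, y) * entp F s y + 3 * CF * ‖x - y‖ ^ (-(kap y * γ)) + 2 * L * s y) ∂Lam := by
      refine integral_mono_ae (hMs.mul_integrable (integrable_nker hx)) hI3 ?_
      filter_upwards [Lam_ae (p := fun y => ‖y‖ ≤ 1) fun _ h => h, Lam_ae_ne x] with y hy hne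
      refine nker_mul_le hF hs.toPB (fun x => (hCF x).2) hη0 hη1 hr0 (by linarith)
        (le_max_left _ _) (le_max_right _ _) hx hy hne.symm ?_
      simp only [hb, hB]; ring_nf
    rw [integral_add hI2 (hs.integrable.const_mul _), integral_add hI1 ((hG x hx).1.const_mul _),
      integral_const_mul, integral_const_mul, hs.mass] at h1
    have hCF0 : 0 ≤ CF := (hF.pos 0).le.trans (hCF 0).2
    have h2 : 3 * CF * ∫ y, ‖x - y‖ ^ (-(kap y * γ)) ∂Lam ≤ 3 * CF * G := by
      gcongr; exact (hG x hx).2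
    have h3 : ∫ y, nker x y * (s x * s y) ∂Lam = s x * ∫ y, nker x y * s y ∂Lam := by
      rw [← integral_const_mul]; congr 1; funext y; ring
    have h4 : ∫ y, s x * b x * ι (x, y) * entp F s y ∂Lam =
        s x * ∫ y, b x * ι (x, y) * entp F s y ∂Lam := by
      rw [← integral_const_mul]; congr 1; funext y; ring
    rw [h3, h4, ← mul_add]
    refine mul_le_mul_of_nonneg_left ?_ hsx.le
    rw [hD]; linarith
  have hJ := hh.integral_prod_left
  have houter : ∫ x, ∫ y, nker x y * (s x * s y) ∂Lam ∂Lam ≤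
      (∫ y, entp F s y ∂Lam) * (4 / 3 * (2 * π) + B * (κ * (2 * π))) + 2 * π * D := by
    calc _ ≤ ∫ x, ((∫ y, s x * b x * ι (x, y) * entp F s y ∂Lam) + s x * D) ∂Lam := by
          exact integral_mono_ae (hMs.integrable_prod hMs).integral_prod_left
            (hJ.add (hs.integrable.mul_const _)) (Lam_ae hinner)
      _ = (∫ x, ∫ y, s x * b x * ι (x, y) * entp F s y ∂Lam ∂Lam) + 2 * π * D := by
          rw [integral_add hJ (hs.integrable.mul_const _), integral_mul_const, hs.mass]
      _ = (∫ y, ∫ x, s x * b x * ι (x, y) * entp F s y ∂Lam ∂Lam) + 2 * π * D := by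
          rw [integral_integral_swap hh]
      _ ≤ _ := by
          gcongr
          rw [← integral_mul_const]
          refine integral_mono_of_nonneg (Eventually.of_forall fun y => integral_nonneg fun x => ?_)
            (hMe.integrable.mul_const _) (Eventually.of_forall fun y => ?_)
          · have h1 := (hs.pos x).le
            have h2 := entp_nonneg hF hs.toPB y
            have h3 := hb0 x
            have h4 := hι0 (x, y)
            simp only [Pi.zero_apply]
            positivity
          · simp only
            rw [integral_mul_const, mul_comm]
            exact mul_le_mul_of_nonneg_left
              (integral_near_le hs hr0 hr1 hrR hB0 hκ0 hnc y) (entp_nonneg hF hs.toPB y)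
  have hI0 : 0 ≤ ∫ y, entp F s y ∂Lam := integral_nonneg (entp_nonneg hF hs.toPB)
  have hinn : inn s s ≤ (∫ y, entp F s y ∂Lam) * (4 / 3 + B * κ) + D := by
    rw [inn_eq, inv_mul_le_iff₀ (by positivity)]
    refine houter.trans (le_of_eq ?_)
    ring
  have hθ : 1 / 2 * (4 / 3 + B * κ) ≤ 1 - η := by
    have : κ = 1 - 6 * η := by rw [hη]; ring
    rw [hB, this]; nlinarith
  have := mul_le_mul_of_nonneg_left hθ hI0
  rw [integral_entp hF hs.toPB] at this hinn
  rw [En]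
  nlinarith

/-- Bounded entropy gives bounded potential. -/
lemma exists_pot_bound_of_ent {F : ℂ → ℝ} (hF : PB F) (C : ℝ) : ∃ B, 0 ≤ B ∧ ∀ s, Dens s →
    ent F s ≤ C → BM (pot s) B := by
  obtain ⟨cF, CF, hcF, hCF⟩ := hF.bd
  obtain ⟨G, hG0, hG⟩ := riesz_kap (γ := 1 / 2) (by norm_num) (by norm_num)
  have hCF0 : 0 ≤ CF := (hF.pos 0).le.trans (hCF 0).2
  have hl4 : 0 ≤ Real.log 4 := Real.log_nonneg (by norm_num)
  set A := (2 * π)⁻¹ * (4 * (|C| + ∫ x, F x ∂Lam + CF * G)) with hA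
  have hIF : 0 ≤ ∫ x, F x ∂Lam := integral_nonneg fun x => (hF.pos x).le
  have hA0 : 0 ≤ A := by rw [hA]; positivity
  refine ⟨Real.log 4 + A, by positivity, fun s hs hent => ?_⟩
  obtain ⟨Ms, hMs⟩ := hs.bm
  obtain ⟨Me, hMe⟩ := entp_bm hF hs.toPB
  refine ⟨hMs.continuous_pot.measurable, fun x => ?_⟩
  have hx := norm_clamp_le x
  set x' := clamp x with hx'
  have hint := hMs.mul_integrable (integrable_nker hx)
  rw [abs_le]
  constructor
  · have h1 : ∫ y, -Real.log 4 * s y ∂Lam ≤ ∫ y, nker x' y * s y ∂Lam := by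
      refine integral_mono_ae (hs.integrable.const_mul _) hint (Lam_ae fun y hy => ?_)
      exact mul_le_mul_of_nonneg_right (neg_log_four_le_nker hx hy) (hs.pos y).le
    rw [integral_const_mul, hs.mass] at h1
    have : -Real.log 4 ≤ pot s x := by
      rw [pot, ← hx', le_inv_mul_iff₀ (by positivity)]
      linarith
    linarith
  · have h1 : ∫ y, nker x' y * s y ∂Lam ≤
        ∫ y, 4 * (entp F s y + CF * ‖x' - y‖ ^ (-(kap y * (1 / 2)))) ∂Lam := by
      refine integral_mono_ae hint ((hMe.integrable.add ((hG x' hx).1.const_mul _)).const_mul _) ?_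
      filter_upwards [Lam_ae (p := fun y => ‖y‖ ≤ 1) fun _ h => h, Lam_ae_ne x'] with y hy hne
      have hd : 0 < ‖x' - y‖ := norm_pos_iff.2 (sub_ne_zero.2 hne.symm)
      have h2 := mul_le_entp' hF hs.toPB y (-(1 / 2) * Real.log ‖x' - y‖)
      have h3 := mul_le_mul_of_nonneg_right (nker_le hx hy hne.symm) (hs.pos y).le
      have h4 : Real.exp (kap y * (-(1 / 2) * Real.log ‖x' - y‖)) =
          ‖x' - y‖ ^ (-(kap y * (1 / 2))) := by
        rw [Real.rpow_def_of_pos hd]; ring_nf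
      rw [h4] at h2
      have h5 : F y * ‖x' - y‖ ^ (-(kap y * (1 / 2))) ≤ CF * ‖x' - y‖ ^ (-(kap y * (1 / 2))) := by
        gcongr; exact (hCF y).2
      linarith
    rw [integral_const_mul, integral_add hMe.integrable ((hG x' hx).1.const_mul _),
      integral_entp hF hs.toPB, integral_const_mul] at h1
    have h6 : CF * ∫ y, ‖x' - y‖ ^ (-(kap y * (1 / 2))) ∂Lam ≤ CF * G := by
      gcongr; exact (hG x' hx).2
    have : pot s x ≤ A := by
      rw [pot, ← hx', hA]
      gcongr
      linarith [le_abs_self C]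
    linarith

/-- The normalising constant is controlled by the potential. -/
lemma exists_nrm_bound {F : ℂ → ℝ} (hF : PB F) (B : ℝ) : ∃ B', 0 ≤ B' ∧ ∀ v, BM v B →
    |nrm F v| ≤ B' := by
  obtain ⟨cF, CF, hcF, hCF⟩ := hF.bd
  have hI : 0 < ∫ x, F x ∂Lam := by
    rw [integral_Lam hF.integrable]
    have := hF.arc_integral_pos
    have : 0 ≤ ∫ x, F x ∂aream := integral_nonneg fun x => (hF.pos x).le
    linarith
  set T := |Real.log (2 * π / ∫ x, F x ∂Lam)| with hT
  refine ⟨|B| + T, by positivity, fun v hv => ?_⟩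
  have h := nrm_spec hF hv
  set c := nrm F v
  have hB : B = |B| := (abs_of_nonneg hv.nonneg).symm
  have hlt : Real.log (2 * π / ∫ x, F x ∂Lam) = Real.log (2 * π) - Real.log (∫ x, F x ∂Lam) :=
    Real.log_div (by positivity) hI.ne'
  have hpb := hF.wexp (hv.add (BM.const c))
  by_contra hcon
  rw [not_le] at hcon
  have hT0 : 0 ≤ T := abs_nonneg _
  rcases le_total 0 c with hc | hc
  · rw [abs_of_nonneg hc, ← hB] at hcon
    have h1 : ∫ x, Real.exp (c - B) * F x ∂Lam ≤ 2 * π := by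
      rw [← h]
      refine integral_mono (hF.integrable.const_mul _) hpb.integrable fun x => ?_
      have := (abs_le.1 (hv.bd x)).1
      simp only [wexp]
      rw [mul_comm]
      refine mul_le_mul_of_nonneg_left (Real.exp_le_exp.2 ?_) (hF.pos x).le
      nlinarith [one_le_kap x]
    rw [integral_const_mul] at h1
    have h2 := Real.log_le_log (by positivity) h1
    rw [Real.log_mul (Real.exp_pos _).ne' hI.ne', Real.log_exp] at h2
    have := le_abs_self (Real.log (2 * π / ∫ x, F x ∂Lam))
    linarith
  · rw [abs_of_nonpos hc, ← hB] at hcon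
    have h1 : 2 * π ≤ ∫ x, Real.exp (c + B) * F x ∂Lam := by
      rw [← h]
      refine integral_mono hpb.integrable (hF.integrable.const_mul _) fun x => ?_
      have := (abs_le.1 (hv.bd x)).2
      simp only [wexp]
      rw [mul_comm (Real.exp _)]
      refine mul_le_mul_of_nonneg_left (Real.exp_le_exp.2 ?_) (hF.pos x).le
      nlinarith [one_le_kap x]
    rw [integral_const_mul] at h1
    have h2 := Real.log_le_log (by positivity) h1
    rw [Real.log_mul (Real.exp_pos _).ne' hI.ne', Real.log_exp] at h2
    have := neg_abs_le (Real.log (2 * π / ∫ x, F x ∂Lam))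
    linarith

lemma exists_wexp_bound {F : ℂ → ℝ} (hF : PB F) (K : ℝ) : ∃ M, ∀ v, BM v K → BM (wexp F v) M := by
  obtain ⟨cF, CF, hcF, hCF⟩ := hF.bd
  refine ⟨CF * Real.exp (2 * K), fun v hv => ⟨(hF.wexp hv).meas, fun x => ?_⟩⟩
  rw [abs_of_pos ((hF.wexp hv).pos x), wexp]
  refine mul_le_mul (hCF x).2 (Real.exp_le_exp.2 ?_) (Real.exp_pos _).le ((hF.pos 0).le.trans (hCF 0).2)
  have h1 := abs_le.1 (hv.bd x)
  have h2 := hv.nonneg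
  nlinarith [kap_le_two x, kap_pos x, one_le_kap x]

lemma log_wexp_div {F v : ℂ → ℝ} (hF : PB F) (x : ℂ) :
    Real.log (wexp F v x / F x) = kap x * v x := by
  have := (hF.pos x).ne'
  rw [wexp, mul_div_cancel_left₀ _ this, Real.log_exp]

lemma tendsto_wexp {F : ℂ → ℝ} {v : ℕ → ℂ → ℝ} {w : ℂ → ℝ}
    (h : ∀ x, Tendsto (fun n => v n x) atTop (𝓝 (w x))) (x : ℂ) :
    Tendsto (fun n => wexp F (v n) x) atTop (𝓝 (wexp F w x)) := by
  unfold wexp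
  exact ((Real.continuous_exp.tendsto _).comp ((h x).const_mul (kap x))).const_mul (F x)

lemma BM.of_tendsto {K : ℝ} {v : ℕ → ℂ → ℝ} {w : ℂ → ℝ} (hv : ∀ n, BM (v n) K)
    (h : ∀ x, Tendsto (fun n => v n x) atTop (𝓝 (w x))) : BM w K :=
  ⟨measurable_of_tendsto_metrizable (fun n => (hv n).meas) (tendsto_pi_nhds.2 h), fun x =>
    le_of_tendsto (h x).abs (Eventually.of_forall fun n => (hv n).bd x)⟩

lemma tendsto_integral_of_bm {K : ℝ} {v : ℕ → ℂ → ℝ} {w : ℂ → ℝ} (hv : ∀ n, BM (v n) K)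
    (h : ∀ x, Tendsto (fun n => v n x) atTop (𝓝 (w x))) :
    Tendsto (fun n => ∫ x, v n x ∂Lam) atTop (𝓝 (∫ x, w x ∂Lam)) :=
  tendsto_integral_of_dominated_convergence (fun _ => K) (fun n => (hv n).meas.aestronglyMeasurable)
    (integrable_const K) (fun n => Eventually.of_forall (hv n).bd) (Eventually.of_forall h)

lemma tendsto_inn {K : ℝ} {v : ℕ → ℂ → ℝ} {w : ℂ → ℝ} (hv : ∀ n, BM (v n) K)
    (h : ∀ x, Tendsto (fun n => v n x) atTop (𝓝 (w x))) :
    Tendsto (fun n => inn (v n) (v n)) atTop (𝓝 (inn w w)) := by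
  have hw := BM.of_tendsto hv h
  simp only [inn_eq_prod (hv _) (hv _), inn_eq_prod hw hw]
  refine Tendsto.const_mul _ (tendsto_integral_of_dominated_convergence
    (fun p => |nker p.1 p.2| * (K * K)) (fun n => ((hv n).integrable_prod (hv n)).1)
    (integrable_prod_nker.abs.mul_const _) (fun n => Eventually.of_forall fun p => ?_)
    (Eventually.of_forall fun p => ?_))
  · rw [Real.norm_eq_abs, abs_mul, abs_mul]
    have := (hv 0).nonneg
    gcongr
    · exact (hv n).bd _
    · exact (hv n).bd _
  · exact ((h p.1).mul (h p.2)).const_mul _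

lemma tendsto_En_wexp {F : ℂ → ℝ} (hF : PB F) {K : ℝ} {v : ℕ → ℂ → ℝ} {w : ℂ → ℝ}
    (hv : ∀ n, BM (v n) K) (h : ∀ x, Tendsto (fun n => v n x) atTop (𝓝 (w x))) :
    Tendsto (fun n => En F (wexp F (v n))) atTop (𝓝 (En F (wexp F w))) := by
  obtain ⟨M, hM⟩ := exists_wexp_bound hF K
  obtain ⟨Q, hQ⟩ := PB.kap.inv.bm
  obtain ⟨Q', hQ'⟩ := PB.kap.bm
  refine Tendsto.sub ?_ (Tendsto.const_mul _ (tendsto_inn (fun n => hM _ (hv n)) (tendsto_wexp h)))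
  unfold ent
  simp only [log_wexp_div hF]
  simp only [div_eq_mul_inv]
  refine tendsto_integral_of_bm (fun n => ((hM _ (hv n)).mul hQ).mul
    ((hQ'.mul (hv n)).sub (BM.const 1))) fun x => ?_
  exact ((tendsto_wexp h x).mul_const _).mul (((h x).const_mul _).sub_const 1)

/-- Compactness for uniformly bounded, equi-Hölder, clamp-invariant sequences. -/
lemma exists_subseq_tendsto {K P : ℝ} {v : ℕ → ℂ → ℝ} (hb : ∀ n x, |v n x| ≤ K)
    (hh : ∀ n x y, ‖x‖ ≤ 1 → ‖y‖ ≤ 1 → |v n x - v n y| ≤ P * √‖x - y‖)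
    (hcl : ∀ n x, v n (clamp x) = v n x) :
    ∃ (φ : ℕ → ℕ) (w : ℂ → ℝ), StrictMono φ ∧ ∀ x, Tendsto (fun n => v (φ n) x) atTop (𝓝 (w x)) := by
  let X := closedBall (0 : ℂ) 1
  have hX : ∀ x : X, ‖(x : ℂ)‖ ≤ 1 := fun x => mem_closedBall_zero_iff.1 x.2
  have : CompactSpace X := isCompact_iff_compactSpace.1 (isCompact_closedBall 0 1)
  have hequi : UniformEquicontinuous (fun n (x : X) => v n x) := by
    refine Metric.uniformEquicontinuous_of_continuity_modulus (fun t => P * √t) ?_ _ ?_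
    · have : Continuous fun t : ℝ => P * √t := by fun_prop
      simpa using this.tendsto 0
    · intro x y n
      rw [Real.dist_eq, Subtype.dist_eq, dist_eq_norm]
      exact hh n x y (hX x) (hX y)
  have hcont : ∀ n, Continuous (fun x : X => v n x) := fun n => hequi.equicontinuous.continuous n
  let U : ℕ → BoundedContinuousFunction X ℝ := fun n =>
    BoundedContinuousFunction.mkOfCompact ⟨_, hcont n⟩
  have hcomp : IsCompact (closure (range U)) := by
    refine BoundedContinuousFunction.arzela_ascoli (Icc (-K) K) isCompact_Icc _ ?_ ?_
    · rintro f x ⟨n, rfl⟩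
      exact abs_le.1 (hb n x)
    · intro x0 W hW
      filter_upwards [hequi.equicontinuous x0 W hW] with x hx
      rintro ⟨f, n, rfl⟩
      exact hx n
  obtain ⟨g, -, φ, hφ, hg⟩ := hcomp.tendsto_subseq fun n => subset_closure (mem_range_self n)
  refine ⟨φ, fun x => g ⟨clamp x, by simpa [X] using norm_clamp_le x⟩, hφ, fun x => ?_⟩
  have h1 := ((BoundedContinuousFunction.tendsto_iff_tendstoUniformly.1 hg).tendsto_at
    ⟨clamp x, by simpa [X] using norm_clamp_le x⟩)
  refine h1.congr fun n => ?_
  simp only [Function.comp, U, BoundedContinuousFunction.mkOfCompact_apply, ContinuousMap.coe_mk]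
  exact hcl _ x

/-- A minimising sequence with bounded entropy yields a minimiser. -/
theorem exists_sol_of_minimizing {F : ℂ → ℝ} (hF : PB F) {m C : ℝ}
    (hm : ∀ t, Dens t → m ≤ En F t) {s : ℕ → ℂ → ℝ} (hs : ∀ n, Dens (s n))
    (hlim : Tendsto (fun n => En F (s n)) atTop (𝓝 m)) (hC : ∀ n, ent F (s n) ≤ C) :
    ∃ u, Sol F u ∧ En F (wexp F u) = m := by
  obtain ⟨B, hB0, hB⟩ := exists_pot_bound_of_ent hF C
  obtain ⟨B', hB'0, hB'⟩ := exists_nrm_bound hF B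
  have hnp : ∀ (t : ℂ → ℝ) (b b' : ℝ), BM (pot t) b → |nrm F (pot t)| ≤ b' →
      BM (npot F t) (b + b') := fun t b b' h h' =>
    ⟨h.meas.add_const _, fun x => (abs_add_le _ _).trans (add_le_add (h.bd x) h')⟩
  obtain ⟨M, hM⟩ := exists_wexp_bound hF (B + B')
  set t := fun n => wexp F (npot F (s n)) with ht
  have htM : ∀ n, BM (t n) M := fun n => hM _ (hnp _ _ _ (hB _ (hs n) (hC n)) (hB' _ (hB _ (hs n) (hC n))))
  have htD : ∀ n, Dens (t n) := fun n => Dens.wexp_npot hF (hs n).toPB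
  obtain ⟨P, hP0, hP⟩ := exists_pot_bound
  have hpb : ∀ n, BM (pot (t n)) (P * M) := fun n =>
    ⟨(htM n).continuous_pot.measurable, (hP _ _ (htM n)).1⟩
  obtain ⟨B2, hB20, hB2⟩ := exists_nrm_bound hF (P * M)
  set v := fun n => npot F (t n) with hv
  have hvb : ∀ n, BM (v n) (P * M + B2) := fun n => hnp _ _ _ (hpb n) (hB2 _ (hpb n))
  obtain ⟨φ, w, hφ, hw⟩ := exists_subseq_tendsto (v := v) (P := P * M) (fun n => (hvb n).bd)
    (fun n x y hx hy => by
      have := (hP _ _ (htM n)).2 x y hx hy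
      simpa [hv, npot] using this)
    (fun n x => by simp only [hv, npot, pot_clamp])
  have hwb := BM.of_tendsto (fun n => hvb (φ n)) hw
  obtain ⟨M2, hM2⟩ := exists_wexp_bound hF (P * M + B2)
  have hvD : ∀ n, Dens (wexp F (v n)) := fun n => Dens.wexp_npot hF (htD n).toPB
  have hwD : Dens (wexp F w) := by
    refine ⟨hF.wexp hwb, ?_⟩
    have h1 := tendsto_integral_of_bm (fun n => hM2 _ (hvb (φ n))) (tendsto_wexp (F := F) hw)
    refine tendsto_nhds_unique h1 ?_
    simp only [(hvD _).mass]
    exact tendsto_const_nhds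
  have hE := tendsto_En_wexp hF (fun n => hvb (φ n)) hw
  have hle : En F (wexp F w) ≤ m := by
    refine le_of_tendsto_of_tendsto hE (hlim.comp hφ.tendsto_atTop) (Eventually.of_forall fun n => ?_)
    exact (En_update_le_self hF (htD (φ n))).trans (En_update_le_self hF (hs (φ n)))
  have heq : En F (wexp F w) = m := le_antisymm hle (hm _ hwD)
  obtain ⟨u, hu, hue⟩ := exists_sol_of_minimizer hF hwD fun t ht => heq.le.trans (hm t ht)
  refine ⟨u, hu, ?_⟩
  rw [← heq, En, En, ent, ent, inn, inn, pot_congr hue]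
  congr 1
  · refine integral_congr_ae (hue.mono fun x hx => ?_)
    simp only [hx]
  · congr 1
    refine integral_congr_ae (hue.mono fun x hx => ?_)
    simp only [hx]

/-- The disc automorphism sending `0` to `a`. -/
def mob (a x : ℂ) : ℂ := (clamp x + a) / (1 + (starRingEnd ℂ) a * clamp x)

/-- The conformal factor of `mob a`. -/
def mdr (a x : ℂ) : ℝ := (1 - ‖a‖ ^ 2) / ‖1 + (starRingEnd ℂ) a * clamp x‖ ^ 2

/-- The density of `Lam` under `mob a`. -/
def mw (a x : ℂ) : ℝ := mdr a x ^ kap x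

lemma one_sub_le_norm_one_add {a x : ℂ} (hx : ‖x‖ ≤ 1) :
    1 - ‖a‖ ≤ ‖1 + (starRingEnd ℂ) a * x‖ := by
  have := norm_sub_norm_le 1 (-((starRingEnd ℂ) a * x))
  rw [norm_neg, norm_mul, Complex.norm_conj, norm_one, sub_neg_eq_add] at this
  nlinarith [norm_nonneg a, norm_nonneg x]

lemma one_add_ne_zero {a x : ℂ} (ha : ‖a‖ < 1) (hx : ‖x‖ ≤ 1) : 1 + (starRingEnd ℂ) a * x ≠ 0 := by
  have := one_sub_le_norm_one_add (a := a) hx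
  intro h
  rw [h, norm_zero] at this
  linarith

lemma one_add_ne_zero' {a x : ℂ} (ha : ‖a‖ < 1) (hx : ‖x‖ ≤ 1) :
    1 + x * (starRingEnd ℂ) a ≠ 0 := by
  rw [mul_comm]; exact one_add_ne_zero ha hx

lemma norm_one_add_le_two {a x : ℂ} (ha : ‖a‖ < 1) (hx : ‖x‖ ≤ 1) :
    ‖1 + (starRingEnd ℂ) a * x‖ ≤ 2 := by
  have := norm_add_le 1 ((starRingEnd ℂ) a * x)
  rw [norm_mul, Complex.norm_conj, norm_one] at this
  nlinarith [norm_nonneg a, norm_nonneg x]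

lemma one_sub_sq_pos {a : ℂ} (ha : ‖a‖ < 1) : 0 < 1 - ‖a‖ ^ 2 := by nlinarith [norm_nonneg a]

lemma mdr_pos {a : ℂ} (ha : ‖a‖ < 1) (x : ℂ) : 0 < mdr a x := by
  have h1 := one_sub_sq_pos ha
  have h2 := norm_pos_iff.2 (one_add_ne_zero ha (norm_clamp_le x))
  unfold mdr; positivity

lemma continuous_mdr {a : ℂ} (ha : ‖a‖ < 1) : Continuous (mdr a) := by
  unfold mdr
  refine Continuous.div (by fun_prop) (by have := continuous_clamp; fun_prop) fun x => ?_
  have := one_add_ne_zero ha (norm_clamp_le x)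
  positivity

lemma continuous_mob {a : ℂ} (ha : ‖a‖ < 1) : Continuous (mob a) := by
  unfold mob
  have := continuous_clamp
  exact Continuous.div (by fun_prop) (by fun_prop) fun x => one_add_ne_zero ha (norm_clamp_le x)

lemma mdr_pb {a : ℂ} (ha : ‖a‖ < 1) : PB (mdr a) := by
  refine ⟨(continuous_mdr ha).measurable, (1 - ‖a‖ ^ 2) / 2 ^ 2, (1 - ‖a‖ ^ 2) / (1 - ‖a‖) ^ 2, ?_,
    fun x => ⟨?_, ?_⟩⟩
  · have := one_sub_sq_pos ha; positivity
  · have h1 := one_sub_sq_pos ha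
    have h2 := norm_pos_iff.2 (one_add_ne_zero ha (norm_clamp_le x))
    unfold mdr
    gcongr
    exact norm_one_add_le_two ha (norm_clamp_le x)
  · have h1 := one_sub_sq_pos ha
    have h2 : 0 < 1 - ‖a‖ := by linarith
    unfold mdr
    gcongr
    exact one_sub_le_norm_one_add (norm_clamp_le x)

lemma mw_eq {a : ℂ} (ha : ‖a‖ < 1) (x : ℂ) : mw a x = Real.exp (kap x * Real.log (mdr a x)) := by
  rw [mw, Real.rpow_def_of_pos (mdr_pos ha x), mul_comm]

lemma mw_pb {a : ℂ} (ha : ‖a‖ < 1) : PB (mw a) := by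
  obtain ⟨M, hM⟩ := (mdr_pb ha).log
  have : mw a = fun x => Real.exp (kap x * Real.log (mdr a x)) := funext (mw_eq ha)
  rw [this]
  exact hM.exp_kap

lemma one_sub_norm_mob_sq {a x : ℂ} (ha : ‖a‖ < 1) (hx : ‖x‖ ≤ 1) :
    1 - ‖mob a x‖ ^ 2 = (1 - ‖x‖ ^ 2) * mdr a x := by
  have h2 := one_add_ne_zero ha hx
  rw [mob, mdr, clamp_of_le hx, norm_div, div_pow]
  have h3 : ‖1 + (starRingEnd ℂ) a * x‖ ^ 2 ≠ 0 := by positivity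
  have e : ‖1 + (starRingEnd ℂ) a * x‖ ^ 2 = ‖x + a‖ ^ 2 + (1 - ‖x‖ ^ 2) * (1 - ‖a‖ ^ 2) := by
    have := norm_one_sub_conj_sq x (-a)
    simpa [mul_comm] using this
  rw [mul_div_assoc', eq_div_iff h3, sub_mul, div_mul_cancel₀ _ h3]
  linarith

lemma norm_mob_lt {a x : ℂ} (ha : ‖a‖ < 1) (hx : ‖x‖ < 1) : ‖mob a x‖ < 1 := by
  have h := one_sub_norm_mob_sq ha hx.le
  have := mul_pos (one_sub_sq_pos hx) (mdr_pos ha x)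
  nlinarith [norm_nonneg (mob a x)]

lemma norm_mob_eq {a x : ℂ} (ha : ‖a‖ < 1) (hx : ‖x‖ = 1) : ‖mob a x‖ = 1 := by
  have h := one_sub_norm_mob_sq ha hx.le
  rw [hx] at h
  have : ‖mob a x‖ ^ 2 = 1 := by linarith
  nlinarith [norm_nonneg (mob a x)]

lemma norm_mob_le {a : ℂ} (ha : ‖a‖ < 1) (x : ℂ) : ‖mob a x‖ ≤ 1 := by
  have : mob a x = mob a (clamp x) := by unfold mob; rw [clamp_of_le (norm_clamp_le x)]
  rw [this]
  rcases (norm_clamp_le x).lt_or_eq with h | h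
  · exact (norm_mob_lt ha h).le
  · exact (norm_mob_eq ha h).le

lemma norm_clamp_of_ge {x : ℂ} (hx : 1 ≤ ‖x‖) : ‖clamp x‖ = 1 := by
  have : 0 < ‖x‖ := by linarith
  rw [clamp, max_eq_right hx, norm_smul, norm_inv, norm_norm, inv_mul_cancel₀ this.ne']

lemma norm_mob_of_ge {a x : ℂ} (ha : ‖a‖ < 1) (hx : 1 ≤ ‖x‖) : ‖mob a x‖ = 1 := by
  have : mob a x = mob a (clamp x) := by unfold mob; rw [clamp_of_le (norm_clamp_le x)]
  rw [this]
  exact norm_mob_eq ha (norm_clamp_of_ge hx)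

lemma norm_mob_lt_iff {a x : ℂ} (ha : ‖a‖ < 1) : ‖mob a x‖ < 1 ↔ ‖x‖ < 1 := by
  refine ⟨fun h => ?_, norm_mob_lt ha⟩
  by_contra h'
  exact absurd (norm_mob_of_ge ha (not_lt.1 h')) h.ne

lemma kap_mob {a : ℂ} (ha : ‖a‖ < 1) (x : ℂ) : kap (mob a x) = kap x := by
  simp only [kap, norm_mob_lt_iff ha]

lemma mob_neg_mob {a x : ℂ} (ha : ‖a‖ < 1) (hx : ‖x‖ ≤ 1) : mob (-a) (mob a x) = x := by
  have h1 := one_add_ne_zero ha hx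
  have h1' := one_add_ne_zero' ha hx
  have h2 : (1 : ℂ) - (starRingEnd ℂ) a * a ≠ 0 := by
    rw [mul_comm, Complex.mul_conj, Complex.normSq_eq_norm_sq]
    have := one_sub_sq_pos ha
    exact_mod_cast this.ne'
  have h3 : (starRingEnd ℂ) a * x + 1 - (starRingEnd ℂ) a * (x + a) ≠ 0 := by
    convert h2 using 1; ring
  have e : mob (-a) (mob a x) = (mob a x - a) / (1 - (starRingEnd ℂ) a * mob a x) := by
    rw [mob, clamp_of_le (norm_mob_le ha x)]; simp [sub_eq_add_neg]
  rw [e, mob, clamp_of_le hx]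
  have h4 : (1 : ℂ) - (starRingEnd ℂ) a * ((x + a) / (1 + (starRingEnd ℂ) a * x)) =
      (1 - (starRingEnd ℂ) a * a) / (1 + (starRingEnd ℂ) a * x) := by
    field_simp; ring
  have h2' : (1 : ℂ) - a * (starRingEnd ℂ) a ≠ 0 := by rwa [mul_comm] at h2
  rw [h4]
  field_simp
  ring

lemma mob_mob_neg {a x : ℂ} (ha : ‖a‖ < 1) (hx : ‖x‖ ≤ 1) : mob a (mob (-a) x) = x := by
  have := mob_neg_mob (a := -a) (x := x) (by simpa using ha) hx
  rwa [neg_neg] at this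

/-- Chain rule for the conformal factors. -/
lemma mdr_mob {a b y : ℂ} (ha : ‖a‖ < 1) (hb : ‖b‖ < 1) (hy : ‖y‖ ≤ 1) :
    mdr b (mob a y) * mdr a y = mdr (mob a b) y := by
  have h1 := one_add_ne_zero ha hy
  have h1' := one_add_ne_zero' ha hy
  have h2 := one_add_ne_zero ha hb.le
  have h2' : (1 : ℂ) + a * (starRingEnd ℂ) b ≠ 0 := one_add_ne_zero' hb ha.le
  have h2'' : (1 : ℂ) + (starRingEnd ℂ) b * a ≠ 0 := one_add_ne_zero hb ha.le
  have e1 : ‖1 + (starRingEnd ℂ) b * mob a y‖ * ‖1 + (starRingEnd ℂ) a * y‖ =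
      ‖1 + (starRingEnd ℂ) (mob a b) * y‖ * ‖1 + (starRingEnd ℂ) a * b‖ := by
    have : ‖1 + (starRingEnd ℂ) a * b‖ = ‖1 + a * (starRingEnd ℂ) b‖ := by
      rw [← Complex.norm_conj]; simp
    rw [this, ← norm_mul, ← norm_mul]
    congr 1
    simp only [mob, clamp_of_le hy, clamp_of_le hb.le, map_div₀, map_add, map_mul, map_one,
      Complex.conj_conj]
    field_simp
    ring
  have e2 := one_sub_norm_mob_sq ha hb.le
  have h3 : 0 < ‖1 + (starRingEnd ℂ) a * y‖ := norm_pos_iff.2 h1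
  have h4 : 0 < ‖1 + (starRingEnd ℂ) a * b‖ := norm_pos_iff.2 h2
  have h5 : 0 < ‖1 + (starRingEnd ℂ) b * mob a y‖ :=
    norm_pos_iff.2 (one_add_ne_zero hb (norm_mob_le ha y))
  have h6 : 0 < ‖1 + (starRingEnd ℂ) (mob a b) * y‖ :=
    norm_pos_iff.2 (one_add_ne_zero (norm_mob_lt ha hb) hy)
  rw [mdr, mdr, mdr, e2, mdr, clamp_of_le hb.le, clamp_of_le hy, clamp_of_le (norm_mob_le ha y)]
  rw [div_mul_div_comm, ← mul_pow, e1]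
  field_simp

lemma nker_mob {a x y : ℂ} (ha : ‖a‖ < 1) (hx : ‖x‖ ≤ 1) (hy : ‖y‖ ≤ 1) (hxy : x ≠ y) :
    nker (mob a x) (mob a y) = nker x y - Real.log (mdr a x) - Real.log (mdr a y) := by
  have h1 := one_add_ne_zero ha hx
  have h1' := one_add_ne_zero' ha hx
  have h2 := one_add_ne_zero ha hy
  have h3' := one_add_ne_zero' ha hy
  have h2' : (1 : ℂ) + a * (starRingEnd ℂ) y ≠ 0 := by
    intro h
    apply h2
    have := congrArg (starRingEnd ℂ) h
    simpa using this
  have hn : ‖1 + a * (starRingEnd ℂ) y‖ = ‖1 + (starRingEnd ℂ) a * y‖ := by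
    rw [← Complex.norm_conj]; simp
  have hreal : ((1 - ‖a‖ ^ 2 : ℝ) : ℂ) = 1 - a * (starRingEnd ℂ) a := by
    rw [Complex.mul_conj, Complex.normSq_eq_norm_sq]; push_cast; ring
  have hsq := one_sub_sq_pos ha
  have e1 : ‖mob a x - mob a y‖ = ‖x - y‖ * (1 - ‖a‖ ^ 2) /
      (‖1 + (starRingEnd ℂ) a * x‖ * ‖1 + (starRingEnd ℂ) a * y‖) := by
    rw [← abs_of_pos hsq, ← Real.norm_eq_abs, ← Complex.norm_real, ← norm_mul, ← norm_mul,
      ← norm_div, hreal]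
    congr 1
    simp only [mob, clamp_of_le hx, clamp_of_le hy]
    field_simp
    ring
  have e2 : ‖1 - mob a x * (starRingEnd ℂ) (mob a y)‖ = ‖1 - x * (starRingEnd ℂ) y‖ *
      (1 - ‖a‖ ^ 2) / (‖1 + (starRingEnd ℂ) a * x‖ * ‖1 + (starRingEnd ℂ) a * y‖) := by
    rw [← hn, ← abs_of_pos hsq, ← Real.norm_eq_abs, ← Complex.norm_real, ← norm_mul, ← norm_mul,
      ← norm_div, hreal]
    congr 1
    simp only [mob, clamp_of_le hx, clamp_of_le hy, map_div₀, map_add, map_mul, map_one,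
      Complex.conj_conj]
    field_simp
    ring
  have p1 : 0 < ‖x - y‖ := norm_pos_iff.2 (sub_ne_zero.2 hxy)
  have p2 : 0 < ‖1 - x * (starRingEnd ℂ) y‖ := p1.trans_le (norm_sub_le_norm_one_sub hx hy)
  have p3 : 0 < ‖1 + (starRingEnd ℂ) a * x‖ := norm_pos_iff.2 h1
  have p4 : 0 < ‖1 + (starRingEnd ℂ) a * y‖ := norm_pos_iff.2 h2
  rw [nker, nker, e1, e2, mdr, mdr, clamp_of_le hx, clamp_of_le hy]
  rw [Real.log_div (by positivity) (by positivity), Real.log_div (by positivity) (by positivity),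
    Real.log_div (by positivity) (by positivity), Real.log_div (by positivity) (by positivity),
    Real.log_mul (by positivity) (by positivity), Real.log_mul (by positivity) (by positivity),
    Real.log_mul (by positivity) (by positivity), Real.log_pow, Real.log_pow]
  push_cast
  ring

lemma hasDerivAt_mob {a x : ℂ} (ha : ‖a‖ < 1) (hx : ‖x‖ ≤ 1) :
    HasDerivAt (fun z => (z + a) / (1 + (starRingEnd ℂ) a * z))
      ((1 - a * (starRingEnd ℂ) a) / (1 + (starRingEnd ℂ) a * x) ^ 2) x := by
  have h := one_add_ne_zero ha hx
  have h1 : HasDerivAt (fun z : ℂ => z + a) 1 x := (hasDerivAt_id x).add_const a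
  have h2 : HasDerivAt (fun z : ℂ => 1 + (starRingEnd ℂ) a * z) ((starRingEnd ℂ) a) x := by
    simpa using ((hasDerivAt_id x).const_mul ((starRingEnd ℂ) a)).const_add 1
  have e : 1 - a * (starRingEnd ℂ) a = 1 * (1 + (starRingEnd ℂ) a * x) -
      (x + a) * (starRingEnd ℂ) a := by ring
  rw [e]
  exact h1.div h2 h

lemma aream_map_mob {a : ℂ} (ha : ‖a‖ < 1) :
    (aream.withDensity fun x => ENNReal.ofReal (mw a x)).map (mob a) = aream := by
  have himg : mob a '' ball 0 1 = ball 0 1 := by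
    ext y
    simp only [mem_image, mem_ball_zero_iff]
    constructor
    · rintro ⟨x, hx, rfl⟩
      exact norm_mob_lt ha hx
    · intro hy
      exact ⟨mob (-a) y, norm_mob_lt (by simpa using ha) hy, mob_mob_neg ha hy.le⟩
  have hinj : InjOn (mob a) (ball 0 1) := by
    intro x hx y hy hxy
    rw [mem_ball_zero_iff] at hx hy
    rw [← mob_neg_mob ha hx.le, hxy, mob_neg_mob ha hy.le]
  let D : ℂ → ℂ := fun x => (1 - a * (starRingEnd ℂ) a) / (1 + (starRingEnd ℂ) a * x) ^ 2
  have hD : ∀ x ∈ ball (0 : ℂ) 1, HasFDerivWithinAt (mob a)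
      ((ContinuousLinearMap.toSpanSingleton ℂ (D x)).restrictScalars ℝ) (ball 0 1) x := by
    intro x hx
    have hx' := mem_ball_zero_iff.1 hx
    refine (((hasDerivAt_mob ha hx'.le).hasFDerivAt.restrictScalars ℝ).hasFDerivWithinAt).congr
      (fun z hz => ?_) ?_
    · rw [mob, clamp_of_le (mem_ball_zero_iff.1 hz).le]
    · rw [mob, clamp_of_le hx'.le]
  have hmain := map_withDensity_abs_det_fderiv_eq_addHaar volume
    measurableSet_ball.nullMeasurableSet hD hinj
  rw [himg] at hmain
  rw [aream]
  conv_rhs => rw [← hmain]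
  congr 1
  refine withDensity_congr_ae ?_
  filter_upwards [ae_restrict_mem measurableSet_ball] with x hx
  have hx' := mem_ball_zero_iff.1 hx
  have hdet : ((ContinuousLinearMap.toSpanSingleton ℂ (D x)).restrictScalars ℝ).det =
      ‖D x‖ ^ 2 := by
    rw [← Complex.normSq_eq_norm_sq]
    simp [ContinuousLinearMap.det, LinearMap.det_restrictScalars, Algebra.norm_complex_apply]
  have hn : ‖(1 : ℂ) - a * (starRingEnd ℂ) a‖ = 1 - ‖a‖ ^ 2 := by
    rw [Complex.mul_conj, Complex.normSq_eq_norm_sq]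
    rw [← Complex.ofReal_one, ← Complex.ofReal_sub, Complex.norm_real, Real.norm_of_nonneg
      (one_sub_sq_pos ha).le]
  rw [hdet, abs_of_nonneg (by positivity), mw, kap_of_lt hx', mdr, clamp_of_le hx'.le]
  simp only [D, norm_div, hn, norm_pow]
  norm_num

lemma integral_arcm_mob {a : ℂ} (ha : ‖a‖ < 1) {g : ℂ → ℝ} (hg : Continuous g) :
    ∫ x, mdr a x * g (mob a x) ∂arcm = ∫ x, g x ∂arcm := by
  have hc : Continuous fun x => mdr a x * g (mob a x) :=
    (continuous_mdr ha).mul (hg.comp (continuous_mob ha))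
  rw [integral_arcm hc.aestronglyMeasurable,
    integral_arcm hg.aestronglyMeasurable]
  let w : ℝ → ℂ := fun θ => 1 + a * bpt (-θ)
  let ψ : ℝ → ℝ := fun θ => θ + 2 * (Complex.log (w θ)).im
  have hre : ∀ θ, 0 < (w θ).re := by
    intro θ
    have h1 : ‖a * bpt (-θ)‖ < 1 := by rw [norm_mul, norm_bpt, mul_one]; exact ha
    have := (abs_le.1 (Complex.abs_re_le_norm (a * bpt (-θ)))).1
    simp only [w, Complex.add_re, Complex.one_re]
    linarith
  have hw0 : ∀ θ, w θ ≠ 0 := fun θ h => by have := hre θ; rw [h] at this; simp at this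
  have hconj : ∀ θ, (starRingEnd ℂ) (bpt θ) = bpt (-θ) := by
    intro θ
    simp only [bpt, ← Complex.exp_conj, map_mul, Complex.conj_ofReal, Complex.conj_I]
    push_cast
    ring_nf
  have hbb : ∀ θ, bpt θ * bpt (-θ) = 1 := by
    intro θ; rw [← bpt_add]; simp [bpt]
  have hwc : ∀ θ, (starRingEnd ℂ) (w θ) = 1 + (starRingEnd ℂ) a * bpt θ := by
    intro θ
    simp only [w, map_add, map_one, map_mul]
    rw [← hconj, Complex.conj_conj]
  have hdw : ∀ θ : ℝ, HasDerivAt w (a * (bpt (-θ) * (-Complex.I))) θ := by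
    intro θ
    have h1 : HasDerivAt (fun t : ℝ => ((-t : ℝ) : ℂ) * Complex.I) (-Complex.I) θ := by
      have := ((hasDerivAt_id θ).neg.ofReal_comp).mul_const Complex.I
      simpa using this
    exact ((h1.cexp).const_mul a).const_add 1
  have hψ : ∀ θ, HasDerivAt ψ (mdr a (bpt θ)) θ := by
    intro θ
    have h1 : HasDerivAt (fun t => Complex.log (w t)) (a * (bpt (-θ) * (-Complex.I)) / w θ) θ :=
      (hdw θ).clog_real (Or.inl (hre θ))
    have h2 : HasDerivAt (fun t => (Complex.log (w t)).im)
        ((a * (bpt (-θ) * (-Complex.I)) / w θ).im) θ :=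
      Complex.imCLM.hasFDerivAt.comp_hasDerivAt θ h1
    have h3 : HasDerivAt ψ (1 + 2 * (a * (bpt (-θ) * (-Complex.I)) / w θ).im) θ :=
      (hasDerivAt_id θ).add (h2.const_mul 2)
    refine h3.congr_deriv (Eq.symm ?_)
    have hwn : ‖w θ‖ ^ 2 = ‖1 + (starRingEnd ℂ) a * bpt θ‖ ^ 2 := by
      rw [← hwc, Complex.norm_conj]
    rw [mdr, clamp_of_le (norm_bpt θ).le, ← hwn]
    have hwp : 0 < ‖w θ‖ ^ 2 := by have := norm_pos_iff.2 (hw0 θ); positivity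
    have ea : ‖a‖ ^ 2 = ‖w θ - 1‖ ^ 2 := by
      simp [w, norm_bpt]
    have e3 : a * (bpt (-θ) * (-Complex.I)) = (w θ - 1) * (-Complex.I) := by simp only [w]; ring
    rw [e3, ea, Complex.div_im]
    simp only [← Complex.normSq_eq_norm_sq] at hwp ⊢
    field_simp
    simp [Complex.normSq_apply]
    ring
  have hbψ : ∀ θ, bpt (ψ θ) = mob a (bpt θ) := by
    intro θ
    have h1 : bpt (2 * (Complex.log (w θ)).im) = w θ / (starRingEnd ℂ) (w θ) := by
      have e1 : w θ = Complex.exp (Complex.log (w θ)) := (Complex.exp_log (hw0 θ)).symm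
      have e2 : (starRingEnd ℂ) (w θ) = Complex.exp ((starRingEnd ℂ) (Complex.log (w θ))) := by
        rw [Complex.exp_conj, ← e1]
      rw [e2]
      nth_rewrite 2 [e1]
      rw [← Complex.exp_sub, Complex.sub_conj, bpt]
    rw [show ψ θ = θ + 2 * (Complex.log (w θ)).im from rfl, bpt_add, h1, hwc, mob,
      clamp_of_le (norm_bpt θ).le]
    have h2 := one_add_ne_zero ha (norm_bpt θ).le
    rw [← mul_div_assoc]
    congr 1
    simp only [w]
    linear_combination a * hbb θ
  have hcd : Continuous fun θ => mdr a (bpt θ) := (continuous_mdr ha).comp continuous_bpt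
  have hsub := intervalIntegral.integral_comp_mul_deriv (a := 0) (b := 2 * π) (f := ψ)
    (f' := fun θ => mdr a (bpt θ)) (g := fun t => g (bpt t)) (fun x _ => hψ x) hcd.continuousOn
    (hg.comp continuous_bpt)
  have hper : ψ (2 * π) = ψ 0 + 2 * π := by
    have : w (2 * π) = w 0 := by
      simp only [w]
      have := bpt_periodic (-(2 * π))
      simp at this
      simp [this]
    simp only [ψ, this]; ring
  have hp : Function.Periodic (fun t => g (bpt t)) (2 * π) := fun t => by
    simp only [bpt_periodic t]
  rw [hper, hp.intervalIntegral_add_eq (ψ 0) 0, zero_add] at hsub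
  rw [← hsub]
  refine intervalIntegral.integral_congr fun θ _ => ?_
  simp only [Function.comp, hbψ]
  ring

lemma arcm_map_mob {a : ℂ} (ha : ‖a‖ < 1) :
    (arcm.withDensity fun x => ENNReal.ofReal (mw a x)).map (mob a) = arcm := by
  have hm : Measurable fun x => ENNReal.ofReal (mw a x) := (mw_pb ha).meas.ennreal_ofReal
  obtain ⟨c, C, hc, hC⟩ := (mw_pb ha).bd
  have : IsFiniteMeasure (arcm.withDensity fun x => ENNReal.ofReal (mw a x)) := by
    refine isFiniteMeasure_withDensity_ofReal (f := mw a) ?_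
    refine HasFiniteIntegral.of_bounded (C := C) (Eventually.of_forall fun x => ?_)
    rw [Real.norm_of_nonneg ((mw_pb ha).pos x).le]
    exact (hC x).2
  refine ext_of_forall_integral_eq_of_IsFiniteMeasure fun g => ?_
  rw [integral_map (continuous_mob ha).measurable.aemeasurable
    g.continuous.aestronglyMeasurable,
    integral_withDensity_eq_integral_toReal_smul hm (Eventually.of_forall fun x =>
      ENNReal.ofReal_lt_top), ← integral_arcm_mob ha g.continuous]
  refine integral_congr_ae (arcm_ae fun x hx => ?_)
  simp only [smul_eq_mul, mw, kap_of_eq hx, Real.rpow_one,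
    ENNReal.toReal_ofReal (mdr_pos ha x).le]

lemma Lam_map_mob {a : ℂ} (ha : ‖a‖ < 1) :
    (Lam.withDensity fun x => ENNReal.ofReal (mw a x)).map (mob a) = Lam := by
  conv_rhs => rw [Lam, ← aream_map_mob ha, ← arcm_map_mob ha]
  rw [← Measure.map_add _ _ (continuous_mob ha).measurable, Lam, withDensity_add_measure]

/-- Change of variables for the disc automorphisms. -/
lemma integral_Lam_mob {a : ℂ} (ha : ‖a‖ < 1) {g : ℂ → ℝ} (hg : AEStronglyMeasurable g Lam) :
    ∫ x, g (mob a x) * mw a x ∂Lam = ∫ x, g x ∂Lam := by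
  have hm : Measurable fun x => ENNReal.ofReal (mw a x) := (mw_pb ha).meas.ennreal_ofReal
  have h := Lam_map_mob ha
  conv_rhs => rw [← h]
  rw [integral_map (continuous_mob ha).measurable.aemeasurable (by rwa [h]),
    integral_withDensity_eq_integral_toReal_smul hm (Eventually.of_forall fun x =>
      ENNReal.ofReal_lt_top)]
  congr 1; funext x
  rw [ENNReal.toReal_ofReal ((mw_pb ha).pos x).le, smul_eq_mul, mul_comm]

lemma integral_add_add {μ : Measure ℂ} {f g h : ℂ → ℝ} (hf : Integrable f μ) (hg : Integrable g μ)
    (hh : Integrable h μ) : ∫ x, (f x + g x + h x) ∂μ = ∫ x, f x ∂μ + ∫ x, g x ∂μ + ∫ x, h x ∂μ := by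
  rw [← integral_add hf hg]; exact integral_add (hf.add hg) hh

lemma integral_sub_sub {μ : Measure ℂ} {f g h : ℂ → ℝ} (hf : Integrable f μ) (hg : Integrable g μ)
    (hh : Integrable h μ) : ∫ x, (f x - g x - h x) ∂μ = ∫ x, f x ∂μ - ∫ x, g x ∂μ - ∫ x, h x ∂μ := by
  rw [← integral_sub hf hg]; exact integral_sub (hf.sub hg) hh

/-- The transport of a density by a disc automorphism. -/
def push (a : ℂ) (s : ℂ → ℝ) (x : ℂ) : ℝ := s (mob a x) * mw a x

lemma PB.comp_mob {F : ℂ → ℝ} (hF : PB F) {a : ℂ} (ha : ‖a‖ < 1) : PB (fun x => F (mob a x)) := by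
  obtain ⟨c, C, hc, hx⟩ := hF.bd
  exact ⟨hF.meas.comp (continuous_mob ha).measurable, c, C, hc, fun x => hx _⟩

lemma PB.push {s : ℂ → ℝ} (hs : PB s) {a : ℂ} (ha : ‖a‖ < 1) : PB (push a s) :=
  (hs.comp_mob ha).mul (mw_pb ha)

lemma Dens.push {s : ℂ → ℝ} (hs : Dens s) {a : ℂ} (ha : ‖a‖ < 1) : Dens (push a s) :=
  ⟨hs.toPB.push ha, by
    rw [← hs.mass, ← integral_Lam_mob ha hs.meas.aestronglyMeasurable]; rfl⟩

lemma pot_push {s : ℂ → ℝ} (hs : Dens s) {a : ℂ} (ha : ‖a‖ < 1) {x : ℂ} (hx : ‖x‖ ≤ 1) :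
    pot (push a s) x = pot s (mob a x) + Real.log (mdr a x) +
      (2 * π)⁻¹ * ∫ y, push a s y * Real.log (mdr a y) ∂Lam := by
  have hm := norm_mob_le ha x
  have hpi : (2 * π) ≠ 0 := by positivity
  obtain ⟨A, hA⟩ := (hs.toPB.push ha).bm
  obtain ⟨B, hB⟩ := (mdr_pb ha).log
  rw [pot, pot, clamp_of_le hx, clamp_of_le hm, ← integral_Lam_mob ha
    (g := fun y => nker (mob a x) y * s y)
    (((measurable_nker_left (mob a x)).mul hs.meas).aestronglyMeasurable)]
  have h1 : ∫ y, nker (mob a x) (mob a y) * s (mob a y) * mw a y ∂Lam =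
      ∫ y, (nker x y * push a s y - Real.log (mdr a x) * push a s y
        - push a s y * Real.log (mdr a y)) ∂Lam := by
    refine integral_congr_ae ?_
    filter_upwards [Lam_ae (p := fun y => ‖y‖ ≤ 1) (fun _ h => h), Lam_ae_ne x] with y hy hne
    rw [nker_mob ha hx hy hne.symm, push]
    ring
  have i1 : Integrable (fun y => nker x y * push a s y) Lam := hA.mul_integrable (integrable_nker hx)
  have i2 : Integrable (fun y => Real.log (mdr a x) * push a s y) Lam := hA.integrable.const_mul _
  have i3 : Integrable (fun y => push a s y * Real.log (mdr a y)) Lam := (hA.mul hB).integrable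
  rw [h1, integral_sub_sub i1 i2 i3, integral_const_mul, (hs.push ha).mass]
  field_simp
  ring

lemma inn_push {s : ℂ → ℝ} (hs : Dens s) {a : ℂ} (ha : ‖a‖ < 1) :
    inn (push a s) (push a s) = inn s s + 2 * ∫ y, push a s y * Real.log (mdr a y) ∂Lam := by
  have hpi : (2 * π) ≠ 0 := by positivity
  obtain ⟨A, hA⟩ := (hs.toPB.push ha).bm
  obtain ⟨B, hB⟩ := (mdr_pb ha).log
  obtain ⟨D, hD⟩ := hs.toPB.bm
  obtain ⟨P, hP⟩ := hD.pot
  set I := ∫ y, push a s y * Real.log (mdr a y) ∂Lam with hI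
  have h1 : inn (push a s) (push a s) = ∫ x, (s (mob a x) * pot s (mob a x) * mw a x +
      push a s x * Real.log (mdr a x) + push a s x * ((2 * π)⁻¹ * I)) ∂Lam := by
    refine integral_congr_ae (Lam_ae fun x hx => ?_)
    simp only
    rw [pot_push hs ha hx, ← hI]
    simp only [push]
    ring
  have hPm : Measurable fun x => pot s (mob a x) := hP.meas.comp (continuous_mob ha).measurable
  have hP2 : BM (fun x => pot s (mob a x)) P := ⟨hPm, fun x => hP.bd _⟩
  have i1 : Integrable (fun x => s (mob a x) * pot s (mob a x) * mw a x) Lam := by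
    refine (hA.mul hP2).integrable.congr (Eventually.of_forall fun x => ?_)
    simp only [push]; ring
  have i2 : Integrable (fun y => push a s y * Real.log (mdr a y)) Lam := (hA.mul hB).integrable
  have i3 : Integrable (fun y => push a s y * ((2 * π)⁻¹ * I)) Lam := hA.integrable.mul_const _
  rw [h1, integral_add_add i1 i2 i3, integral_mul_const, (hs.push ha).mass,
    integral_Lam_mob ha (g := fun x => s x * pot s x) (hD.mul hP).meas.aestronglyMeasurable, ← hI,
    inn]
  field_simp
  ring

lemma ent_push {F s : ℂ → ℝ} (hF : PB F) (hs : PB s) {a : ℂ} (ha : ‖a‖ < 1) :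
    ent (fun x => F (mob a x)) (push a s) =
      ent F s + ∫ y, push a s y * Real.log (mdr a y) ∂Lam := by
  obtain ⟨A, hA⟩ := (hs.push ha).bm
  obtain ⟨B, hB⟩ := (mdr_pb ha).log
  obtain ⟨E, hE⟩ := ent_bm hF hs
  obtain ⟨M, hM⟩ := (mw_pb ha).bm
  have i1 : Integrable (fun x => s (mob a x) / kap (mob a x) *
      (Real.log (s (mob a x) / F (mob a x)) - 1) * mw a x) Lam :=
    ((⟨hE.meas.comp (continuous_mob ha).measurable, fun x => hE.bd _⟩ :
      BM (fun x => s (mob a x) / kap (mob a x) *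
      (Real.log (s (mob a x) / F (mob a x)) - 1)) E).mul hM).integrable
  have i2 : Integrable (fun y => push a s y * Real.log (mdr a y)) Lam := (hA.mul hB).integrable
  conv_rhs => rw [ent, ← integral_Lam_mob ha hE.meas.aestronglyMeasurable]
  rw [← integral_add i1 i2, ent]
  congr 1; funext x
  have p1 := hs.pos (mob a x)
  have p2 := hF.pos (mob a x)
  have p3 := (mw_pb ha).pos x
  have p4 := kap_pos x
  have e : Real.log (mw a x) = kap x * Real.log (mdr a x) := by rw [mw_eq ha, Real.log_exp]
  rw [kap_mob ha, push, Real.log_div (by positivity) p2.ne', Real.log_mul p1.ne' p3.ne',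
    Real.log_div p1.ne' p2.ne', e]
  field_simp
  ring

/-- Conformal invariance of the free energy. -/
lemma En_push {F s : ℂ → ℝ} (hF : PB F) (hs : Dens s) {a : ℂ} (ha : ‖a‖ < 1) :
    En (fun x => F (mob a x)) (push a s) = En F s := by
  rw [En, En, ent_push hF hs.toPB ha, inn_push hs ha]
  ring

lemma mw_mul_mw_neg {a x : ℂ} (ha : ‖a‖ < 1) (hx : ‖x‖ ≤ 1) : mw (-a) (mob a x) * mw a x = 1 := by
  have h0 : ‖-a‖ < 1 := by simpa using ha
  have h := mdr_mob (a := a) (b := -a) ha h0 hx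
  have e : mob a (-a) = 0 := by simp [mob, clamp_of_le h0.le]
  have e2 : mdr 0 x = 1 := by simp [mdr]
  rw [e, e2] at h
  rw [mw, mw, kap_mob ha, ← Real.mul_rpow (mdr_pos h0 _).le (mdr_pos ha _).le, h, Real.one_rpow]

lemma push_neg_push {a : ℂ} (ha : ‖a‖ < 1) (s : ℂ → ℝ) : push a (push (-a) s) =ᵐ[Lam] s := by
  refine Lam_ae fun x hx => ?_
  rw [push, push, mob_neg_mob ha hx, mul_assoc, mw_mul_mw_neg ha hx, mul_one]

lemma ent_congr {F s t : ℂ → ℝ} (h : s =ᵐ[Lam] t) : ent F s = ent F t :=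
  integral_congr_ae (by filter_upwards [h] with x hx; rw [hx])

lemma inn_congr {s t : ℂ → ℝ} (h : s =ᵐ[Lam] t) : inn s s = inn t t := by
  rw [inn, inn, pot_congr h]
  exact integral_congr_ae (by filter_upwards [h] with x hx; rw [hx])

lemma En_congr {F s t : ℂ → ℝ} (h : s =ᵐ[Lam] t) : En F s = En F t := by
  rw [En, En, ent_congr h, inn_congr h]

lemma log_mdr {a : ℂ} (ha : ‖a‖ < 1) {y : ℂ} (hy : ‖y‖ ≤ 1) :
    Real.log (mdr a y) = Real.log (1 - ‖a‖ ^ 2) - 2 * Real.log ‖1 + (starRingEnd ℂ) a * y‖ := by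
  have h1 := one_sub_sq_pos ha
  have h2 := norm_pos_iff.2 (one_add_ne_zero ha hy)
  rw [mdr, clamp_of_le hy, Real.log_div h1.ne' (by positivity), Real.log_pow]
  norm_num

lemma log_mdr_le {a : ℂ} (ha : ‖a‖ < 1) {y : ℂ} (hy : ‖y‖ ≤ 1) (hne : y ≠ -a) :
    Real.log (mdr a y) ≤ Real.log (1 - ‖a‖ ^ 2) + nker (-a) y := by
  have h0 : ‖-a‖ ≤ 1 := by simpa using ha.le
  have h1 := norm_sub_le_norm_one_sub h0 hy
  have h2 : 0 < ‖-a - y‖ := norm_pos_iff.2 (sub_ne_zero.2 hne.symm)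
  have h3 := Real.log_le_log h2 h1
  have e : ‖1 - -a * (starRingEnd ℂ) y‖ = ‖1 + (starRingEnd ℂ) a * y‖ := by
    rw [← Complex.norm_conj]; simp
  rw [log_mdr ha hy, nker]
  rw [e] at h3 ⊢
  linarith

/-- The functional whose minimiser yields the balanced normalisation. -/
def hbal (s : ℂ → ℝ) (a : ℂ) : ℝ := -∫ y, Real.log (mdr a y) * s y ∂Lam

lemma hbal_zero (s : ℂ → ℝ) : hbal s 0 = 0 := by simp [hbal, mdr]

lemma hbal_ge {s : ℂ → ℝ} (hs : Dens s) {P : ℝ} (hP : ∀ x, |pot s x| ≤ P) {a : ℂ} (ha : ‖a‖ < 1) :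
    2 * π * (-Real.log (1 - ‖a‖ ^ 2) - P) ≤ hbal s a := by
  obtain ⟨A, hA⟩ := hs.toPB.bm
  obtain ⟨B, hB⟩ := (mdr_pb ha).log
  have h0 : ‖-a‖ ≤ 1 := by simpa using ha.le
  have i1 : Integrable (fun y => Real.log (1 - ‖a‖ ^ 2) * s y) Lam := hA.integrable.const_mul _
  have i2 : Integrable (fun y => nker (-a) y * s y) Lam := hA.mul_integrable (integrable_nker h0)
  have h1 : ∫ y, Real.log (mdr a y) * s y ∂Lam ≤
      ∫ y, (Real.log (1 - ‖a‖ ^ 2) * s y + nker (-a) y * s y) ∂Lam := by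
    refine integral_mono_ae (hB.mul hA).integrable (i1.add i2) ?_
    filter_upwards [Lam_ae (p := fun y => ‖y‖ ≤ 1) (fun _ h => h), Lam_ae_ne (-a)] with y hy hne
    have := mul_le_mul_of_nonneg_right (log_mdr_le ha hy hne) (hs.pos y).le
    linarith
  rw [integral_add i1 i2, integral_const_mul, hs.mass] at h1
  have h2 := (abs_le.1 (hP (-a))).2
  rw [pot, clamp_of_le h0, inv_mul_le_iff₀ (by positivity)] at h2
  unfold hbal
  nlinarith

lemma continuousOn_hbal {s : ℂ → ℝ} (hs : Dens s) {ρ : ℝ} (hρ : ρ < 1) :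
    ContinuousOn (hbal s) (closedBall 0 ρ) := by
  rcases lt_or_ge ρ 0 with h0 | h0
  · rw [closedBall_eq_empty.2 h0]; exact continuousOn_empty _
  obtain ⟨A, hA⟩ := hs.toPB.bm
  have hlt : ∀ a ∈ closedBall (0 : ℂ) ρ, ‖a‖ < 1 := fun a ha =>
    (mem_closedBall_zero_iff.1 ha).trans_lt hρ
  refine ContinuousOn.neg (continuousOn_of_dominated
    (bound := fun _ => (|Real.log (1 - ρ ^ 2)| + 2 * (|Real.log (1 - ρ)| + |Real.log 2|)) * A)
    ?_ ?_ ?_ ?_)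
  · intro a ha
    obtain ⟨B, hB⟩ := (mdr_pb (hlt a ha)).log
    exact (hB.mul hA).meas.aestronglyMeasurable
  · intro a ha
    refine Lam_ae fun y hy => ?_
    have ha1 := hlt a ha
    have ha2 := mem_closedBall_zero_iff.1 ha
    rw [norm_mul, Real.norm_eq_abs, Real.norm_eq_abs, log_mdr ha1 hy]
    have h1 := norm_pos_iff.2 (one_add_ne_zero ha1 hy)
    have h2 := Real.log_le_log h1 (norm_one_add_le_two ha1 hy)
    have h3 := Real.log_le_log (by linarith) ((sub_le_sub_left ha2 1).trans
      (one_sub_le_norm_one_add (a := a) hy))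
    have h4 : Real.log (1 - ρ ^ 2) ≤ Real.log (1 - ‖a‖ ^ 2) :=
      Real.log_le_log (by nlinarith) (by nlinarith [norm_nonneg a])
    have h5 : Real.log (1 - ‖a‖ ^ 2) ≤ 0 :=
      Real.log_nonpos (one_sub_sq_pos ha1).le (by nlinarith [norm_nonneg a])
    have h6 : |2 * Real.log ‖1 + (starRingEnd ℂ) a * y‖| ≤
        2 * (|Real.log (1 - ρ)| + |Real.log 2|) := by
      rw [abs_mul, abs_two]
      gcongr
      rw [abs_le]
      have := neg_abs_le (Real.log (1 - ρ))
      have := le_abs_self (Real.log 2)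
      have := abs_nonneg (Real.log (1 - ρ))
      have := abs_nonneg (Real.log 2)
      constructor <;> linarith
    have h7 : |Real.log (1 - ‖a‖ ^ 2)| ≤ |Real.log (1 - ρ ^ 2)| := by
      rw [abs_of_nonpos h5, abs_of_nonpos (h4.trans h5)]; linarith
    exact mul_le_mul ((abs_sub _ _).trans (add_le_add h7 h6)) (hA.bd y) (abs_nonneg _)
      (by positivity)
  · exact integrable_const _
  · refine Lam_ae fun y hy => ContinuousOn.mul (ContinuousOn.log ?_ fun a ha =>
      (mdr_pos (hlt a ha) y).ne') continuousOn_const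
    unfold mdr
    refine ContinuousOn.div (by fun_prop) (by fun_prop) fun a ha => ?_
    have := one_add_ne_zero (hlt a ha) (norm_clamp_le y)
    positivity

lemma exists_hbal_min {s : ℂ → ℝ} (hs : Dens s) :
    ∃ a, ‖a‖ < 1 ∧ ∀ b, ‖b‖ < 1 → hbal s a ≤ hbal s b := by
  obtain ⟨A, hA⟩ := hs.toPB.bm
  obtain ⟨P, hP⟩ := hA.pot
  have hP0 := hP.nonneg
  have hE : Real.exp (-P) ≤ 1 := Real.exp_le_one_iff.2 (by linarith)
  have hE0 := Real.exp_pos (-P)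
  set ρ := √(1 - Real.exp (-P)) with hρ
  have hρ2 : ρ ^ 2 = 1 - Real.exp (-P) := Real.sq_sqrt (by linarith)
  have hρ0 : 0 ≤ ρ := Real.sqrt_nonneg _
  have hρ1 : ρ < 1 := by nlinarith
  obtain ⟨a, ha, hmin⟩ := (isCompact_closedBall (0 : ℂ) ρ).exists_isMinOn
    ⟨0, mem_closedBall_self hρ0⟩ (continuousOn_hbal hs hρ1)
  refine ⟨a, (mem_closedBall_zero_iff.1 ha).trans_lt hρ1, fun b hb => ?_⟩
  by_cases hbρ : ‖b‖ ≤ ρ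
  · exact hmin (mem_closedBall_zero_iff.2 hbρ)
  · have h1 : hbal s a ≤ 0 := by
      rw [← hbal_zero s]; exact hmin (mem_closedBall_self hρ0)
    have h2 := hbal_ge hs hP.bd hb
    have h3 : Real.log (1 - ‖b‖ ^ 2) ≤ -P := by
      rw [← Real.log_exp (-P)]
      refine Real.log_le_log (one_sub_sq_pos hb) ?_
      nlinarith [not_le.1 hbρ]
    have : 0 ≤ 2 * π * (-Real.log (1 - ‖b‖ ^ 2) - P) :=
      mul_nonneg (by positivity) (by linarith)
    linarith

/-- Balanced densities. -/
def BalD (s : ℂ → ℝ) : Prop := ∀ b, ‖b‖ < 1 → ∫ x, Real.log (mdr b x) * s x ∂Lam ≤ 0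

lemma exists_balanced {s : ℂ → ℝ} (hs : Dens s) : ∃ a, ‖a‖ < 1 ∧ BalD (push a s) := by
  obtain ⟨a, ha, hmin⟩ := exists_hbal_min hs
  have ha' : ‖-a‖ < 1 := by simpa using ha
  refine ⟨-a, ha', fun b hb => ?_⟩
  obtain ⟨A, hA⟩ := hs.toPB.bm
  obtain ⟨B, hB⟩ := (mdr_pb hb).log
  obtain ⟨D, hD⟩ := (mdr_pb ha).log
  obtain ⟨E, hE⟩ := (mdr_pb (norm_mob_lt ha hb)).log
  have hcm : Measurable fun y => Real.log (mdr b (mob a y)) :=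
    hB.meas.comp (continuous_mob ha).measurable
  have e1 : ∫ x, Real.log (mdr b x) * push (-a) s x ∂Lam =
      ∫ y, Real.log (mdr b (mob a y)) * s y ∂Lam := by
    rw [← integral_Lam_mob ha' (g := fun y => Real.log (mdr b (mob a y)) * s y)
      (hcm.mul hs.meas).aestronglyMeasurable]
    refine integral_congr_ae (Lam_ae fun x hx => ?_)
    simp only [mob_mob_neg ha hx, push]
    ring
  have e2 : ∫ y, Real.log (mdr b (mob a y)) * s y ∂Lam =
      ∫ y, (Real.log (mdr (mob a b) y) * s y - Real.log (mdr a y) * s y) ∂Lam := by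
    refine integral_congr_ae (Lam_ae fun y hy => ?_)
    simp only
    rw [← mdr_mob ha hb hy, Real.log_mul (mdr_pos hb _).ne' (mdr_pos ha _).ne']
    ring
  rw [e1, e2, integral_sub (hE.mul hA).integrable (hD.mul hA).integrable]
  have := hmin _ (norm_mob_lt ha hb)
  unfold hbal at this
  linarith

lemma BalD.integral_ball_le {s : ℂ → ℝ} (h : BalD s) (hs : Dens s) {z : ℂ} (hz : ‖z‖ = 1) :
    ∫ x in ball z (1 / 16), s x ∂Lam ≤ 3 / 4 * (2 * π) := by
  set b : ℂ := -((15 / 16 : ℝ) : ℂ) * z with hb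
  have hbn : ‖b‖ = 15 / 16 := by
    rw [hb, norm_mul, norm_neg, Complex.norm_real, hz]; norm_num
  have hb1 : ‖b‖ < 1 := by rw [hbn]; norm_num
  obtain ⟨A, hA⟩ := hs.toPB.bm
  obtain ⟨B, hB⟩ := (mdr_pb hb1).log
  have hi := (hB.mul hA).integrable
  have hb0 := h b hb1
  rw [← integral_add_compl measurableSet_ball hi] at hb0
  have hm := hs.mass
  rw [← integral_add_compl (measurableSet_ball (x := z) (ε := 1 / 16)) hA.integrable] at hm
  have hfar : ∀ x, Real.log (31 / 1024) ≤ Real.log (mdr b x) := by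
    intro x
    refine Real.log_le_log (by norm_num) ?_
    have h1 := norm_one_add_le_two hb1 (norm_clamp_le x)
    have h2 := norm_pos_iff.2 (one_add_ne_zero hb1 (norm_clamp_le x))
    rw [mdr, hbn, le_div_iff₀ (by positivity)]
    nlinarith
  have hnear : ∀ x ∈ ball z (1 / 16), ‖x‖ ≤ 1 → Real.log (31 / 4) ≤ Real.log (mdr b x) := by
    intro x hx hx1
    refine Real.log_le_log (by norm_num) ?_
    have h2 := norm_pos_iff.2 (one_add_ne_zero hb1 hx1)
    have h3 : ‖1 + (starRingEnd ℂ) b * x‖ ≤ 1 / 8 := by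
      have e : 1 + (starRingEnd ℂ) b * x =
          ((1 / 16 : ℝ) : ℂ) - ((15 / 16 : ℝ) : ℂ) * ((starRingEnd ℂ) z * (x - z)) := by
        have hzz : (starRingEnd ℂ) z * z = 1 := by
          rw [mul_comm, Complex.mul_conj, Complex.normSq_eq_norm_sq, hz]; simp
        rw [hb, map_mul, map_neg, Complex.conj_ofReal]
        push_cast
        linear_combination (-15 / 16) * hzz
      rw [e]
      refine (norm_sub_le _ _).trans ?_
      rw [norm_mul, norm_mul, Complex.norm_conj, hz, Complex.norm_real, Complex.norm_real]
      rw [mem_ball, dist_eq_norm] at hx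
      norm_num
      linarith
    rw [mdr, hbn, clamp_of_le hx1, le_div_iff₀ (by positivity)]
    nlinarith
  have hAi := hA.integrable
  have l1 : Real.log (31 / 4) * ∫ x in ball z (1 / 16), s x ∂Lam ≤
      ∫ x in ball z (1 / 16), Real.log (mdr b x) * s x ∂Lam := by
    rw [← integral_const_mul]
    refine integral_mono_ae (hAi.integrableOn.const_mul _) hi.integrableOn ?_
    filter_upwards [ae_restrict_mem measurableSet_ball,
      ae_restrict_of_ae (Lam_ae (p := fun y => ‖y‖ ≤ 1) (fun _ h => h))] with x hx hx1
    exact mul_le_mul_of_nonneg_right (hnear x hx hx1) (hs.pos x).le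
  have l2 : Real.log (31 / 1024) * ∫ x in (ball z (1 / 16))ᶜ, s x ∂Lam ≤
      ∫ x in (ball z (1 / 16))ᶜ, Real.log (mdr b x) * s x ∂Lam := by
    rw [← integral_const_mul]
    refine integral_mono_ae (hAi.integrableOn.const_mul _) hi.integrableOn ?_
    exact Eventually.of_forall fun x => mul_le_mul_of_nonneg_right (hfar x) (hs.pos x).le
  have hl : 0 < 3 * Real.log (31 / 4) + Real.log (31 / 1024) := by
    have : 3 * Real.log (31 / 4) + Real.log (31 / 1024) =
        Real.log ((31 / 4) ^ 3 * (31 / 1024)) := by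
      rw [Real.log_mul (by norm_num) (by norm_num), Real.log_pow]; norm_num
    rw [this]
    exact Real.log_pos (by norm_num)
  have hl2 : Real.log (31 / 1024) < 0 := Real.log_neg (by norm_num) (by norm_num)
  by_contra hcon
  push Not at hcon
  have hpi := Real.pi_pos
  set M := ∫ x in ball z (1 / 16), s x ∂Lam
  set N := ∫ x in (ball z (1 / 16))ᶜ, s x ∂Lam
  have hN : N = 2 * π - M := by linarith
  rw [hN] at l2
  nlinarith

lemma BalD.integral_re_nonneg {s : ℂ → ℝ} (h : BalD s) (hs : Dens s) (c : ℂ) :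
    0 ≤ ∫ x, ((starRingEnd ℂ) c * clamp x).re * s x ∂Lam := by
  obtain ⟨A, hA⟩ := hs.toPB.bm
  have hR : BM (fun x => ((starRingEnd ℂ) c * clamp x).re) ‖c‖ := by
    refine ⟨(Complex.continuous_re.comp (continuous_const.mul continuous_clamp)).measurable,
      fun x => (Complex.abs_re_le_norm _).trans ?_⟩
    rw [norm_mul, Complex.norm_conj]
    exact mul_le_of_le_one_right (norm_nonneg _) (norm_clamp_le x)
  set I := ∫ x, ((starRingEnd ℂ) c * clamp x).re * s x ∂Lam with hI
  have hev : ∀ᶠ t : ℝ in 𝓝[>] 0, -(3 * π * ‖c‖ ^ 2 * t) ≤ I := by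
    have h1 : ∀ᶠ t : ℝ in 𝓝[>] 0, t * ‖c‖ < 1 / 2 := by
      have : Tendsto (fun t : ℝ => t * ‖c‖) (𝓝[>] 0) (𝓝 (0 * ‖c‖)) :=
        (tendsto_nhdsWithin_of_tendsto_nhds tendsto_id).mul_const _
      rw [zero_mul] at this
      exact this.eventually (gt_mem_nhds (by norm_num))
    filter_upwards [h1, self_mem_nhdsWithin] with t ht ht0
    have ht0 : 0 < t := ht0
    have hbn : ‖(t : ℂ) * c‖ = t * ‖c‖ := by
      rw [norm_mul, Complex.norm_real, Real.norm_of_nonneg ht0.le]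
    have hb1 : ‖(t : ℂ) * c‖ < 1 := by rw [hbn]; linarith
    obtain ⟨B, hB⟩ := (mdr_pb hb1).log
    have hpt : ∀ x, (-3 * (t * ‖c‖) ^ 2) * s x - 2 * t * (((starRingEnd ℂ) c * clamp x).re * s x) ≤
        Real.log (mdr (t * c) x) * s x := by
      intro x
      have hx := norm_clamp_le x
      have e : mdr (t * c) x = mdr (t * c) (clamp x) := by simp only [mdr, clamp_of_le hx]
      have k1 := norm_pos_iff.2 (one_add_ne_zero hb1 hx)
      have k2 : 2 * Real.log ‖1 + (starRingEnd ℂ) (t * c) * clamp x‖ ≤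
          2 * t * ((starRingEnd ℂ) c * clamp x).re + (t * ‖c‖) ^ 2 := by
        have : 2 * Real.log ‖1 + (starRingEnd ℂ) (t * c) * clamp x‖ =
            Real.log (‖1 + (starRingEnd ℂ) (t * c) * clamp x‖ ^ 2) := by
          rw [Real.log_pow]; norm_num
        rw [this]
        refine (Real.log_le_sub_one_of_pos (by positivity)).trans ?_
        have e2 : (starRingEnd ℂ) (t * c) * clamp x = t * ((starRingEnd ℂ) c * clamp x) := by
          rw [map_mul, Complex.conj_ofReal]; ring
        have e3 : ‖(starRingEnd ℂ) c * clamp x‖ ≤ ‖c‖ := by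
          rw [norm_mul, Complex.norm_conj]
          exact mul_le_of_le_one_right (norm_nonneg _) hx
        have e4 : ‖(starRingEnd ℂ) c * clamp x‖ ^ 2 ≤ ‖c‖ ^ 2 :=
          pow_le_pow_left₀ (norm_nonneg _) e3 2
        rw [e2]
        rw [← Complex.normSq_eq_norm_sq, Complex.normSq_apply] at e4 ⊢
        simp only [Complex.add_re, Complex.add_im, Complex.one_re, Complex.one_im,
          Complex.re_ofReal_mul, Complex.im_ofReal_mul]
        nlinarith [mul_le_mul_of_nonneg_left e4 (sq_nonneg t)]
      have k3 : -2 * (t * ‖c‖) ^ 2 ≤ Real.log (1 - ‖(t : ℂ) * c‖ ^ 2) := by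
        rw [hbn]
        have hq : (t * ‖c‖) ^ 2 ≤ 1 / 4 := by nlinarith [mul_nonneg ht0.le (norm_nonneg c)]
        have := Real.one_sub_inv_le_log_of_pos (x := 1 - (t * ‖c‖) ^ 2) (by linarith)
        refine le_trans ?_ this
        have h3 : (1 - (t * ‖c‖) ^ 2)⁻¹ ≤ 1 + 2 * (t * ‖c‖) ^ 2 := by
          rw [inv_le_iff_one_le_mul₀ (by linarith)]
          nlinarith [sq_nonneg (t * ‖c‖)]
        linarith
      rw [e, log_mdr hb1 hx]
      have := mul_le_mul_of_nonneg_right (show -3 * (t * ‖c‖) ^ 2 -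
        2 * t * ((starRingEnd ℂ) c * clamp x).re ≤ Real.log (1 - ‖(t : ℂ) * c‖ ^ 2) -
          2 * Real.log ‖1 + (starRingEnd ℂ) (t * c) * clamp x‖ by linarith) (hs.pos x).le
      linarith
    have i1 : Integrable (fun x => (-3 * (t * ‖c‖) ^ 2) * s x) Lam := hA.integrable.const_mul _
    have i2 : Integrable (fun x => 2 * t * (((starRingEnd ℂ) c * clamp x).re * s x)) Lam :=
      (hR.mul hA).integrable.const_mul _
    have hint : ∫ x, ((-3 * (t * ‖c‖) ^ 2) * s x - 2 * t * (((starRingEnd ℂ) c * clamp x).re * s x)) ∂Lam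
        ≤ 0 := (integral_mono (i1.sub i2) (hB.mul hA).integrable hpt).trans (h _ hb1)
    rw [integral_sub i1 i2, integral_const_mul, integral_const_mul, hs.mass] at hint
    have : 0 ≤ (2 * t) * (I + 3 * π * ‖c‖ ^ 2 * t) := by nlinarith
    have := nonneg_of_mul_nonneg_right this (by linarith)
    linarith
  have hlim : Tendsto (fun t : ℝ => -(3 * π * ‖c‖ ^ 2 * t)) (𝓝[>] 0)
      (𝓝 (-(3 * π * ‖c‖ ^ 2 * 0))) :=
    ((tendsto_nhdsWithin_of_tendsto_nhds tendsto_id).const_mul _).neg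
  have := le_of_tendsto hlim hev
  simpa using this

lemma BalD.integral_re {s : ℂ → ℝ} (h : BalD s) (hs : Dens s) (c : ℂ) :
    ∫ x, ((starRingEnd ℂ) c * clamp x).re * s x ∂Lam = 0 := by
  have h1 := h.integral_re_nonneg hs c
  have h2 := h.integral_re_nonneg hs (-c)
  simp only [map_neg, neg_mul, Complex.neg_re, integral_neg] at h2
  linarith

/-- The weight equal to `f₀` inside the disc and to `j₀` elsewhere. -/
def cwt (f₀ j₀ : ℝ) (x : ℂ) : ℝ := if ‖x‖ < 1 then f₀ else j₀

lemma cwt_pb {f₀ j₀ : ℝ} (hf : 0 < f₀) (hj : 0 < j₀) : PB (cwt f₀ j₀) := by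
  refine ⟨Measurable.ite (measurableSet_lt measurable_norm measurable_const) measurable_const
    measurable_const, min f₀ j₀, max f₀ j₀, lt_min hf hj, fun x => ?_⟩
  unfold cwt
  split_ifs <;> simp

lemma cwt_mob {f₀ j₀ : ℝ} {a : ℂ} (ha : ‖a‖ < 1) (x : ℂ) : cwt f₀ j₀ (mob a x) = cwt f₀ j₀ x := by
  simp only [cwt, norm_mob_lt_iff ha]

lemma En_cwt_push {f₀ j₀ : ℝ} (hf : 0 < f₀) (hj : 0 < j₀) {s : ℂ → ℝ} (hs : Dens s) {a : ℂ}
    (ha : ‖a‖ < 1) : En (cwt f₀ j₀) (push a s) = En (cwt f₀ j₀) s := by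
  rw [← En_push (cwt_pb hf hj) hs ha]
  simp only [cwt_mob ha]

lemma ent_ge {F s : ℂ → ℝ} (hF : PB F) (hs : PB s) : -∫ x, F x ∂Lam ≤ ent F s := by
  have h := integral_entp hF hs
  have : 0 ≤ ∫ x, entp F s x ∂Lam := integral_nonneg fun x => entp_nonneg hF hs x
  linarith

lemma En_cwt_bddBelow {f₀ j₀ : ℝ} (hf : 0 < f₀) (hj : 0 < j₀) :
    ∃ m, ∀ s, Dens s → m ≤ En (cwt f₀ j₀) s := by
  have hF := cwt_pb hf hj
  obtain ⟨δ, C, hδ, hco⟩ := En_coercive hF (R := 1 / 16) (κ := 3 / 4) (by norm_num) (by norm_num)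
    (by norm_num)
  refine ⟨δ * (-∫ x, cwt f₀ j₀ x ∂Lam) - C, fun s hs => ?_⟩
  obtain ⟨a, ha, hbal⟩ := exists_balanced hs
  rw [← En_cwt_push hf hj hs ha]
  refine le_trans ?_ (hco _ (hs.push ha) fun z hz => hbal.integral_ball_le (hs.push ha) hz)
  have := mul_le_mul_of_nonneg_left (ent_ge hF (hs.push ha).toPB) hδ.le
  linarith

lemma En_anti {F G s : ℂ → ℝ} (hF : PB F) (hG : PB G) (hs : PB s) (h : ∀ x, F x ≤ G x) :
    En G s ≤ En F s := by
  obtain ⟨A, hA⟩ := ent_bm hF hs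
  obtain ⟨B, hB⟩ := ent_bm hG hs
  refine sub_le_sub_right (integral_mono hB.integrable hA.integrable fun x => ?_) _
  refine mul_le_mul_of_nonneg_left (sub_le_sub_right (Real.log_le_log
    (div_pos (hs.pos x) (hG.pos x)) ?_) _) (div_pos (hs.pos x) (kap_pos x)).le
  exact div_le_div_of_nonneg_left (hs.pos x).le (hF.pos x) (h x)

lemma En_bddBelow {F : ℂ → ℝ} (hF : PB F) : ∃ m, ∀ s, Dens s → m ≤ En F s := by
  obtain ⟨c, C, hc, hb⟩ := hF.bd
  have hC : 0 < C := hc.trans_le ((hb 0).1.trans (hb 0).2)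
  obtain ⟨m, hm⟩ := En_cwt_bddBelow hC hC
  refine ⟨m, fun s hs => (hm s hs).trans (En_anti hF (cwt_pb hC hC) hs.toPB fun x => ?_)⟩
  simpa [cwt] using (hb x).2

lemma exists_dens {F : ℂ → ℝ} (hF : PB F) : ∃ s, Dens s :=
  ⟨_, Dens.of_nrm hF (BM.const 0)⟩

/-- A minimising sequence for the free energy. -/
lemma exists_minimizing_seq {F : ℂ → ℝ} (hF : PB F) : ∃ (m : ℝ) (s : ℕ → ℂ → ℝ),
    (∀ t, Dens t → m ≤ En F t) ∧ (∀ n, Dens (s n)) ∧ Tendsto (fun n => En F (s n)) atTop (𝓝 m) := by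
  obtain ⟨b, hb⟩ := En_bddBelow hF
  obtain ⟨s₀, hs₀⟩ := exists_dens hF
  have hne : (En F '' {s | Dens s}).Nonempty := ⟨_, s₀, hs₀, rfl⟩
  have hbd : BddBelow (En F '' {s | Dens s}) := ⟨b, by rintro _ ⟨s, hs, rfl⟩; exact hb s hs⟩
  obtain ⟨v, -, hv, hmem⟩ := exists_seq_tendsto_sInf hne hbd
  choose s hs hsv using hmem
  refine ⟨_, s, fun t ht => csInf_le hbd ⟨t, ht, rfl⟩, hs, ?_⟩
  simpa only [hsv] using hv

/-- For constant weights the free energy has a balanced minimiser. -/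
theorem exists_balanced_sol {f₀ j₀ : ℝ} (hf : 0 < f₀) (hj : 0 < j₀) :
    ∃ u, Sol (cwt f₀ j₀) u ∧ (∀ t, Dens t → En (cwt f₀ j₀) (wexp (cwt f₀ j₀) u) ≤ En (cwt f₀ j₀) t) ∧
      ∀ c, ∫ x, ((starRingEnd ℂ) c * clamp x).re * wexp (cwt f₀ j₀) u x ∂Lam = 0 := by
  have hF := cwt_pb hf hj
  set F := cwt f₀ j₀ with hFdef
  obtain ⟨m, s, hm, hs, hlim⟩ := exists_minimizing_seq hF
  choose a ha hbal using fun n => exists_balanced (hs n)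
  have hEn : ∀ n, En F (push (a n) (s n)) = En F (s n) := fun n => En_cwt_push hf hj (hs n) (ha n)
  obtain ⟨δ, C, hδ, hco⟩ := En_coercive hF (R := 1 / 16) (κ := 3 / 4) (by norm_num) (by norm_num)
    (by norm_num)
  obtain ⟨E, hE⟩ := hlim.bddAbove_range
  obtain ⟨v, hv, hvm⟩ := exists_sol_of_minimizing hF hm (fun n => (hs n).push (ha n))
    (by simpa only [hEn] using hlim) (C := (E + C) / δ) (fun n => by
      rw [le_div_iff₀ hδ]
      have h1 := hco _ ((hs n).push (ha n)) fun z hz => (hbal n).integral_ball_le ((hs n).push (ha n)) hz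
      have h2 := hE ⟨n, rfl⟩
      rw [hEn] at h1
      simp only at h2
      linarith)
  obtain ⟨b, hb, hbalb⟩ := exists_balanced hv.dens
  have hd := hv.dens.push hb
  have hmin : ∀ t, Dens t → En F (push b (wexp F v)) ≤ En F t := fun t ht => by
    rw [En_cwt_push hf hj hv.dens hb, hvm]; exact hm t ht
  obtain ⟨u, hu, hae⟩ := exists_sol_of_minimizer hF hd hmin
  refine ⟨u, hu, fun t ht => by rw [← En_congr hae]; exact hmin t ht, fun c => ?_⟩
  rw [← hbalb.integral_re hd c]
  refine integral_congr_ae ?_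
  filter_upwards [hae] with x hx
  rw [hx]

/-- Uniform convergence as the parameter tends to zero. -/
def UC (w : ℝ → ℂ → ℝ) (w₀ : ℂ → ℝ) : Prop :=
  ∀ ε > 0, ∀ᶠ t in 𝓝[≠] (0 : ℝ), ∀ x, |w t x - w₀ x| ≤ ε

/-- The rotational difference quotient. -/
def dq (g : ℂ → ℝ) (t : ℝ) (x : ℂ) : ℝ := (g (bpt t * x) - g x) / t

/-- Uniform differentiability with respect to rotations. -/
structure RD (g g' : ℂ → ℝ) : Prop where
  bm : ∃ M, BM g M
  bm' : ∃ M, BM g' M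
  lim : UC (dq g) g'

lemma UC.congr {w v : ℝ → ℂ → ℝ} {w₀ v₀ : ℂ → ℝ} (h : UC w w₀) (e : ∀ t ≠ 0, ∀ x, v t x = w t x)
    (e₀ : ∀ x, v₀ x = w₀ x) : UC v v₀ := fun ε hε => by
  filter_upwards [h ε hε, self_mem_nhdsWithin] with t ht ht0 x
  rw [e t ht0, e₀]; exact ht x

lemma UC.const (g : ℂ → ℝ) : UC (fun _ => g) g := fun ε hε =>
  Eventually.of_forall fun t x => by simpa using hε.le

lemma UC.add {w v : ℝ → ℂ → ℝ} {w₀ v₀ : ℂ → ℝ} (h : UC w w₀) (h' : UC v v₀) :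
    UC (fun t x => w t x + v t x) (fun x => w₀ x + v₀ x) := fun ε hε => by
  filter_upwards [h (ε / 2) (by linarith), h' (ε / 2) (by linarith)] with t h1 h2 x
  have := abs_add_le (w t x - w₀ x) (v t x - v₀ x)
  rw [show w t x + v t x - (w₀ x + v₀ x) = w t x - w₀ x + (v t x - v₀ x) by ring]
  linarith [h1 x, h2 x]

lemma UC.mul {w v : ℝ → ℂ → ℝ} {w₀ v₀ : ℂ → ℝ} {A B : ℝ} (h : UC w w₀) (h' : UC v v₀)
    (hA : ∀ x, |w₀ x| ≤ A) (hB : ∀ x, |v₀ x| ≤ B) :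
    UC (fun t x => w t x * v t x) (fun x => w₀ x * v₀ x) := fun ε hε => by
  have hA0 := (abs_nonneg _).trans (hA 0)
  have hB0 := (abs_nonneg _).trans (hB 0)
  set η := min 1 (ε / (A + B + 1)) with hη
  have hη0 : 0 < η := lt_min one_pos (by positivity)
  filter_upwards [h η hη0, h' η hη0] with t h1 h2 x
  have e : w t x * v t x - w₀ x * v₀ x =
    (w t x - w₀ x) * (v t x - v₀ x) + (w t x - w₀ x) * v₀ x + w₀ x * (v t x - v₀ x) := by ring
  rw [e]
  have b1 : |(w t x - w₀ x) * (v t x - v₀ x)| ≤ η * 1 := by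
    rw [abs_mul]
    exact mul_le_mul (h1 x) ((h2 x).trans (min_le_left _ _)) (abs_nonneg _) hη0.le
  have b2 : |(w t x - w₀ x) * v₀ x| ≤ η * B := by
    rw [abs_mul]; exact mul_le_mul (h1 x) (hB x) (abs_nonneg _) hη0.le
  have b3 : |w₀ x * (v t x - v₀ x)| ≤ A * η := by
    rw [abs_mul]; exact mul_le_mul (hA x) (h2 x) (abs_nonneg _) hA0
  have b4 : η * (A + B + 1) ≤ ε := by
    rw [← le_div_iff₀ (by positivity)]; exact min_le_right _ _
  have := abs_add_three ((w t x - w₀ x) * (v t x - v₀ x)) ((w t x - w₀ x) * v₀ x)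
    (w₀ x * (v t x - v₀ x))
  linarith

lemma UC.tendsto {w : ℝ → ℂ → ℝ} {w₀ : ℂ → ℝ} (h : UC w w₀) (x : ℂ) :
    Tendsto (fun t => w t x) (𝓝[≠] 0) (𝓝 (w₀ x)) := by
  rw [Metric.tendsto_nhds]
  intro ε hε
  filter_upwards [h (ε / 2) (by linarith)] with t ht
  rw [Real.dist_eq]
  linarith [ht x]

lemma UC.bound {w : ℝ → ℂ → ℝ} {w₀ : ℂ → ℝ} {A : ℝ} (h : UC w w₀) (hA : ∀ x, |w₀ x| ≤ A) :
    ∀ᶠ t in 𝓝[≠] (0 : ℝ), ∀ x, |w t x| ≤ A + 1 := by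
  filter_upwards [h 1 one_pos] with t ht x
  have := abs_add_le (w t x - w₀ x) (w₀ x)
  rw [sub_add_cancel] at this
  linarith [ht x, hA x]

lemma exists_UC_limit {w : ℝ → ℂ → ℝ} (hc : ∀ ε > 0, ∀ᶠ t in 𝓝[≠] (0 : ℝ),
    ∀ᶠ t' in 𝓝[≠] (0 : ℝ), ∀ x, |w t x - w t' x| ≤ ε) : ∃ w₀, UC w w₀ := by
  have hlim : ∀ x, ∃ l, Tendsto (fun t => w t x) (𝓝[≠] 0) (𝓝 l) := by
    intro x
    refine cauchy_map_iff_exists_tendsto.1 (Metric.cauchy_iff.2 ⟨inferInstance, fun ε hε => ?_⟩)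
    obtain ⟨t, ht⟩ := (hc (ε / 3) (by linarith)).exists
    refine ⟨_, image_mem_map ht, ?_⟩
    rintro _ ⟨t1, h1, rfl⟩ _ ⟨t2, h2, rfl⟩
    have h1 := h1 x
    have h2 := h2 x
    rw [Real.dist_eq]
    rw [abs_sub_comm] at h1
    have := abs_add_le (w t1 x - w t x) (w t x - w t2 x)
    rw [sub_add_sub_cancel] at this
    linarith
  choose l hl using hlim
  refine ⟨l, fun ε hε => ?_⟩
  filter_upwards [hc ε hε] with t ht x
  refine le_of_tendsto ((tendsto_const_nhds.sub (hl x)).abs) ?_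
  filter_upwards [ht] with t' ht'
  exact ht' x

lemma clamp_bpt_mul (t : ℝ) (x : ℂ) : clamp (bpt t * x) = bpt t * clamp x := by
  simp only [clamp, norm_mul, norm_bpt, one_mul, mul_smul_comm]

lemma norm_bpt_mul (t : ℝ) (x : ℂ) : ‖bpt t * x‖ = ‖x‖ := by rw [norm_mul, norm_bpt, one_mul]

lemma kap_bpt_mul (t : ℝ) (x : ℂ) : kap (bpt t * x) = kap x := by
  simp only [kap, norm_bpt_mul]

lemma norm_bpt_sub_one_le (t : ℝ) : ‖bpt t - 1‖ ≤ |t| := by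
  have := Real.norm_exp_I_mul_ofReal_sub_one_le (x := t)
  rwa [mul_comm, Real.norm_eq_abs] at this

lemma bpt_conj (t : ℝ) : bpt t * (starRingEnd ℂ) (bpt t) = 1 := by
  rw [Complex.mul_conj, Complex.normSq_eq_norm_sq, norm_bpt]; simp

lemma nker_bpt_mul (t : ℝ) (x y : ℂ) : nker (bpt t * x) (bpt t * y) = nker x y := by
  have e : bpt t * x * (starRingEnd ℂ) (bpt t * y) = x * (starRingEnd ℂ) y := by
    rw [map_mul]; linear_combination x * (starRingEnd ℂ) y * bpt_conj t
  rw [nker, nker, e, ← mul_sub, norm_bpt_mul]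

lemma pot_comp_bpt (t : ℝ) (s : ℂ → ℝ) (x : ℂ) :
    pot (fun y => s (bpt t * y)) x = pot s (bpt t * x) := by
  rw [pot, pot, clamp_bpt_mul,
    ← integral_Lam_mul (norm_bpt t) (fun y => nker (bpt t * clamp x) y * s y)]
  simp only [nker_bpt_mul]

lemma BM.comp_bpt {s : ℂ → ℝ} {M : ℝ} (h : BM s M) (t : ℝ) : BM (fun x => s (bpt t * x)) M :=
  ⟨h.meas.comp (measurable_const.mul measurable_id), fun _ => h.bd _⟩

lemma BM.dq {s : ℂ → ℝ} {M : ℝ} (h : BM s M) (t : ℝ) : BM (dq s t) ((M + M) * |t⁻¹|) := by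
  have := ((h.comp_bpt t).sub h).mul (BM.const t⁻¹)
  simp only [← div_eq_mul_inv] at this
  exact this

lemma pot_const_mul (c : ℝ) (s : ℂ → ℝ) (x : ℂ) : pot (fun y => s y * c) x = pot s x * c := by
  simp only [pot, ← mul_assoc, integral_mul_const]

lemma pot_dq {s : ℂ → ℝ} {M : ℝ} (h : BM s M) (t : ℝ) (x : ℂ) : pot (dq s t) x = dq (pot s) t x := by
  have e : dq s t = fun y => (s (bpt t * y) - s y) * t⁻¹ := by
    funext y; rw [dq, div_eq_mul_inv]
  rw [e, pot_const_mul, pot_sub (h.comp_bpt t) h, pot_comp_bpt, dq, div_eq_mul_inv]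

lemma exists_pot_rot_bound : ∃ P, 0 < P ∧ ∀ s M, BM s M → (∀ x, |pot s x| ≤ P * M) ∧
    ∀ x t, |pot s (bpt t * x) - pot s x| ≤ P * M * √|t| := by
  obtain ⟨P, hP0, hP⟩ := exists_pot_bound
  refine ⟨P + 1, by linarith, fun s M hs => ⟨fun x => ?_, fun x t => ?_⟩⟩
  · have := hs.nonneg
    nlinarith [(hP s M hs).1 x]
  · have h := (hP s M hs).2 (clamp (bpt t * x)) (clamp x) (norm_clamp_le _) (norm_clamp_le _)
    rw [pot_clamp, pot_clamp, clamp_bpt_mul] at h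
    have h0 := hs.nonneg
    have h2 : ‖bpt t * clamp x - clamp x‖ ≤ |t| := by
      rw [show bpt t * clamp x - clamp x = (bpt t - 1) * clamp x by ring, norm_mul]
      exact (mul_le_of_le_one_right (norm_nonneg _) (norm_clamp_le x)).trans (norm_bpt_sub_one_le t)
    have h3 := Real.sqrt_le_sqrt h2
    refine h.trans (mul_le_mul ?_ h3 (Real.sqrt_nonneg _) (by positivity))
    nlinarith

/-- Average over rotations by angles in `[0, h]`. -/
def ravg (h : ℝ) (φ : ℂ → ℝ) (x : ℂ) : ℝ := h⁻¹ * ∫ τ in (0 : ℝ)..h, φ (bpt τ * x)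

lemma continuous_rot {φ : ℂ → ℝ} (hφ : Continuous φ) (x : ℂ) : Continuous fun τ => φ (bpt τ * x) :=
  hφ.comp (continuous_bpt.mul continuous_const)

lemma ravg_sub_le {φ : ℂ → ℝ} (hφ : Continuous φ) {H h : ℝ} (hh : 0 < h)
    (hH : ∀ x t, |φ (bpt t * x) - φ x| ≤ H * √|t|) (x : ℂ) : |φ x - ravg h φ x| ≤ H * √h := by
  have hH0 : 0 ≤ H := by
    have := (abs_nonneg _).trans (hH 0 1); simpa using this
  have e : φ x - ravg h φ x = h⁻¹ * ∫ τ in (0 : ℝ)..h, (φ x - φ (bpt τ * x)) := by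
    rw [intervalIntegral.integral_sub intervalIntegrable_const
      ((continuous_rot hφ x).intervalIntegrable _ _), intervalIntegral.integral_const, ravg, sub_zero, smul_eq_mul, mul_sub,
      inv_mul_cancel_left₀ hh.ne']
  rw [e, abs_mul, abs_of_pos (inv_pos.2 hh), inv_mul_le_iff₀ hh]
  have := intervalIntegral.norm_integral_le_of_norm_le_const (a := 0) (b := h) (C := H * √h)
    (f := fun τ => φ x - φ (bpt τ * x)) (fun τ hτ => by
      rw [uIoc_of_le hh.le] at hτ
      rw [Real.norm_eq_abs, abs_sub_comm]
      refine (hH x τ).trans (mul_le_mul_of_nonneg_left (Real.sqrt_le_sqrt ?_) hH0)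
      rw [abs_of_pos hτ.1]; exact hτ.2)
  rw [sub_zero, abs_of_pos hh, Real.norm_eq_abs] at this
  linarith

lemma UC_ravg_dq {φ : ℂ → ℝ} (hφ : Continuous φ) {H h : ℝ} (hh : 0 < h)
    (hH : ∀ x t, |φ (bpt t * x) - φ x| ≤ H * √|t|) :
    UC (fun t => ravg h (dq φ t)) (fun x => h⁻¹ * (φ (bpt h * x) - φ x)) := by
  intro ε hε
  have hH0 : 0 ≤ H := by
    have := (abs_nonneg _).trans (hH 0 1); simpa using this
  have hlim : Tendsto (fun t : ℝ => h⁻¹ * (2 * (H * √|t|))) (𝓝[≠] 0) (𝓝 0) := by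
    have : Continuous fun t : ℝ => h⁻¹ * (2 * (H * √|t|)) := by fun_prop
    have := this.tendsto 0
    simp only [abs_zero, Real.sqrt_zero, mul_zero] at this
    exact tendsto_nhdsWithin_of_tendsto_nhds this
  filter_upwards [hlim.eventually (gt_mem_nhds hε), self_mem_nhdsWithin] with t ht ht0 x
  have ht0 : t ≠ 0 := ht0
  refine le_trans ?_ ht.le
  have hc := continuous_rot hφ x
  have hi : ∀ a b, IntervalIntegrable (fun τ => φ (bpt τ * x)) volume a b :=
    fun a b => hc.intervalIntegrable a b
  have key : ∀ a, |(∫ τ in a..(a + t), φ (bpt τ * x)) - t * φ (bpt a * x)| ≤ |t| * (H * √|t|) := by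
    intro a
    have e : (∫ τ in a..(a + t), φ (bpt τ * x)) - t * φ (bpt a * x) =
        ∫ τ in a..(a + t), (φ (bpt τ * x) - φ (bpt a * x)) := by
      rw [intervalIntegral.integral_sub (hi _ _) intervalIntegrable_const,
        intervalIntegral.integral_const]
      simp
    rw [e]
    have := intervalIntegral.norm_integral_le_of_norm_le_const (a := a) (b := a + t)
      (C := H * √|t|) (f := fun τ => φ (bpt τ * x) - φ (bpt a * x)) (fun τ hτ => by
        have e2 : bpt τ * x = bpt (τ - a) * (bpt a * x) := by
          rw [← mul_assoc, ← bpt_add, sub_add_cancel]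
        rw [e2, Real.norm_eq_abs]
        refine (hH _ _).trans (mul_le_mul_of_nonneg_left (Real.sqrt_le_sqrt ?_) hH0)
        rcases mem_uIoc.1 hτ with h | h
        · rw [abs_of_pos (by linarith : 0 < τ - a)]
          exact (by linarith [h.2] : τ - a ≤ t).trans (le_abs_self t)
        · rw [abs_of_nonpos (by linarith [h.2] : τ - a ≤ 0)]
          exact (by linarith [h.1] : -(τ - a) ≤ -t).trans (neg_le_abs t))
    rw [add_sub_cancel_left, Real.norm_eq_abs] at this
    linarith
  have e1 : ∫ τ in (0 : ℝ)..h, dq φ t (bpt τ * x) =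
      t⁻¹ * ((∫ τ in h..(h + t), φ (bpt τ * x)) - ∫ τ in (0 : ℝ)..(0 + t), φ (bpt τ * x)) := by
    have e2 : ∀ τ, dq φ t (bpt τ * x) = t⁻¹ * (φ (bpt (τ + t) * x) - φ (bpt τ * x)) := by
      intro τ
      rw [dq, ← mul_assoc, ← bpt_add, add_comm t τ, div_eq_inv_mul]
    simp only [e2]
    have hi' : IntervalIntegrable (fun τ => φ (bpt (τ + t) * x)) volume 0 h :=
      (hc.comp (continuous_add_const t)).intervalIntegrable _ _
    rw [intervalIntegral.integral_const_mul, intervalIntegral.integral_sub hi' (hi _ _),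
      intervalIntegral.integral_comp_add_right (fun τ => φ (bpt τ * x))]
    congr 1
    rw [zero_add]
    have a1 := intervalIntegral.integral_add_adjacent_intervals (hi 0 t) (hi t (h + t))
    have a2 := intervalIntegral.integral_add_adjacent_intervals (hi 0 h) (hi h (h + t))
    linarith
  rw [ravg, e1, ← mul_sub, abs_mul, abs_of_pos (inv_pos.2 hh)]
  refine mul_le_mul_of_nonneg_left ?_ (inv_pos.2 hh).le
  have k1 := key h
  have k2 := key 0
  have e0 : bpt 0 = 1 := by simp [bpt]
  rw [e0, one_mul] at k2
  set A := ∫ τ in h..(h + t), φ (bpt τ * x)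
  set B := ∫ τ in (0 : ℝ)..(0 + t), φ (bpt τ * x)
  have e3 : t⁻¹ * (A - B) - (φ (bpt h * x) - φ x) =
      t⁻¹ * ((A - t * φ (bpt h * x)) - (B - t * φ x)) := by field_simp; ring
  rw [e3, abs_mul, abs_inv, inv_mul_le_iff₀ (abs_pos.2 ht0)]
  have := abs_sub (A - t * φ (bpt h * x)) (B - t * φ x)
  linarith

lemma bound_of_half {w : ℂ → ℝ} {C M : ℝ} (hb : ∀ x, |w x| ≤ M)
    (h : ∀ S, (∀ x, |w x| ≤ S) → ∀ x, |w x| ≤ S / 2 + C) (x : ℂ) : |w x| ≤ 2 * C := by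
  have hbd : BddAbove (range fun x => |w x|) := ⟨M, by rintro _ ⟨x, rfl⟩; exact hb x⟩
  have h1 : ∀ x, |w x| ≤ ⨆ y, |w y| := le_ciSup hbd
  have h2 := ciSup_le (h _ h1)
  linarith [h1 x]

/-- A potential is uniformly differentiable along rotations as soon as the difference quotients of
its density are, up to a uniformly convergent multiple of those of the potential. -/
theorem RD_pot {s : ℂ → ℝ} {M A B : ℝ} (hs : BM s M) {k e : ℝ → ℂ → ℝ} {k₀ e₀ : ℂ → ℝ}
    (hk : UC k k₀) (he : UC e e₀) (hk₀ : BM k₀ A) (he₀ : BM e₀ B)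
    (heq : ∀ t ≠ 0, ∀ x, dq s t x = k t x * dq (pot s) t x + e t x) :
    ∃ v, Continuous v ∧ RD (pot s) v ∧ RD s (fun x => k₀ x * v x + e₀ x) ∧
      ∀ x, v x = pot (fun y => k₀ y * v y + e₀ y) x := by
  obtain ⟨P, hP0, hP⟩ := exists_pot_rot_bound
  obtain ⟨Q, hQ⟩ := hs.pot
  have hA0 := hk₀.nonneg
  have hB0 := he₀.nonneg
  set w := dq (pot s) with hw
  have hcont : ∀ t, Continuous (w t) := fun t =>
    ((hs.continuous_pot.comp (continuous_const.mul continuous_id)).sub hs.continuous_pot).div_const _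
  obtain ⟨h, hh, hhP⟩ : ∃ h : ℝ, 0 < h ∧ P * √h * (A + 1) ≤ 1 / 2 := by
    refine ⟨(1 / (2 * P * (A + 1))) ^ 2, by positivity, ?_⟩
    rw [Real.sqrt_sq (by positivity)]
    apply le_of_eq
    field_simp
  set r : ℂ → ℝ := fun x => h⁻¹ * (pot s (bpt h * x) - pot s x) with hr
  have hrb : ∀ x, |r x| ≤ h⁻¹ * (Q + Q) := fun x => by
    rw [hr, abs_mul, abs_of_pos (inv_pos.2 hh)]
    exact mul_le_mul_of_nonneg_left ((abs_sub _ _).trans (add_le_add (hQ.bd _) (hQ.bd _)))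
      (inv_pos.2 hh).le
  have hra : UC (fun t => ravg h (w t)) r :=
    UC_ravg_dq hs.continuous_pot hh (hP s M hs).2
  have hPh : 0 ≤ P * √h := by positivity
  -- a priori bound
  obtain ⟨D, hD⟩ : ∃ D, ∀ᶠ t in 𝓝[≠] (0 : ℝ), ∀ x, |w t x| ≤ D := by
    refine ⟨2 * (P * √h * (B + 1) + (h⁻¹ * (Q + Q) + 1)), ?_⟩
    filter_upwards [hk.bound hk₀.bd, he.bound he₀.bd, hra.bound hrb, self_mem_nhdsWithin]
      with t h1 h2 h3 ht0
    refine bound_of_half (hQ.dq t).bd fun S hS x => ?_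
    have hS0 := (abs_nonneg _).trans (hS 0)
    have hbm : BM (dq s t) ((A + 1) * S + (B + 1)) := ⟨(hs.dq t).meas, fun y => by
      rw [heq t ht0]
      refine (abs_add_le _ _).trans (add_le_add ?_ (h2 y))
      rw [abs_mul]
      exact mul_le_mul (h1 y) (hS y) (abs_nonneg _) (by linarith)⟩
    have hp : pot (dq s t) = w t := funext fun y => pot_dq hs t y
    have h4 := (hP _ _ hbm).2
    rw [hp] at h4
    have h5 := ravg_sub_le (hcont t) hh h4 x
    have h6 := abs_add_le (w t x - ravg h (w t) x) (ravg h (w t) x)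
    rw [sub_add_cancel] at h6
    have h7 := mul_le_mul_of_nonneg_right hhP hS0
    have h8 := h3 x
    calc |w t x| ≤ _ := h6
      _ ≤ P * ((A + 1) * S + (B + 1)) * √h + (h⁻¹ * (Q + Q) + 1) := add_le_add h5 h8
      _ ≤ _ := by linarith
  have hD0 : 0 ≤ D := by
    obtain ⟨t, ht⟩ := hD.exists
    exact (abs_nonneg _).trans (ht 0)
  obtain ⟨v, hv⟩ : ∃ v, UC w v := by
    refine exists_UC_limit fun ε hε => ?_
    set ε' := ε / (4 * (P * √h * (D + 1) + 1)) with hε'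
    have hε'0 : 0 < ε' := by positivity
    have hev : ∀ᶠ t in 𝓝[≠] (0 : ℝ), t ≠ 0 ∧ (∀ x, |w t x| ≤ D) ∧ (∀ x, |k t x| ≤ A + 1) ∧
        (∀ x, |k t x - k₀ x| ≤ ε') ∧ (∀ x, |e t x - e₀ x| ≤ ε') ∧
        ∀ x, |ravg h (w t) x - r x| ≤ ε' := by
      filter_upwards [self_mem_nhdsWithin, hD, hk.bound hk₀.bd, hk ε' hε'0, he ε' hε'0,
        hra ε' hε'0] with t h1 h2 h3 h4 h5 h6
      exact ⟨h1, h2, h3, h4, h5, h6⟩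
    filter_upwards [hev] with t ⟨t1, t2, t3, t4, t5, t6⟩
    filter_upwards [hev] with t' ⟨t1', t2', t3', t4', t5', t6'⟩
    have hgoal : ∀ x, |w t x - w t' x| ≤ 2 * (P * √h * (2 * ε' * D + 2 * ε') + 2 * ε') := by
      refine bound_of_half (M := D + D)
        (fun x => (abs_sub _ _).trans (add_le_add (t2 x) (t2' x))) fun S hS x => ?_
      have hS0 := (abs_nonneg _).trans (hS 0)
      have hbm : BM (fun y => dq s t y - dq s t' y) ((A + 1) * S + (2 * ε' * D + 2 * ε')) :=
        ⟨((hs.dq t).meas.sub (hs.dq t').meas), fun y => by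
          rw [heq t t1, heq t' t1', show k t y * w t y + e t y - (k t' y * w t' y + e t' y) =
            k t y * (w t y - w t' y) + ((k t y - k₀ y) - (k t' y - k₀ y)) * w t' y +
              ((e t y - e₀ y) - (e t' y - e₀ y)) by ring]
          have b1 : |k t y * (w t y - w t' y)| ≤ (A + 1) * S := by
            rw [abs_mul]; exact mul_le_mul (t3 y) (hS y) (abs_nonneg _) (by linarith)
          have b2 : |((k t y - k₀ y) - (k t' y - k₀ y)) * w t' y| ≤ 2 * ε' * D := by
            rw [abs_mul]
            refine mul_le_mul ((abs_sub _ _).trans ?_) (t2' y) (abs_nonneg _) (by linarith)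
            linarith [t4 y, t4' y]
          have b3 : |(e t y - e₀ y) - (e t' y - e₀ y)| ≤ 2 * ε' :=
            (abs_sub _ _).trans (by linarith [t5 y, t5' y])
          have := abs_add_three (k t y * (w t y - w t' y))
            (((k t y - k₀ y) - (k t' y - k₀ y)) * w t' y) ((e t y - e₀ y) - (e t' y - e₀ y))
          linarith⟩
      have hp : pot (fun y => dq s t y - dq s t' y) = fun y => w t y - w t' y := funext fun y => by
        rw [pot_sub (hs.dq t) (hs.dq t'), pot_dq hs t y, pot_dq hs t' y]
      have h4 := (hP _ _ hbm).2
      rw [hp] at h4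
      have h5 := ravg_sub_le ((hcont t).sub (hcont t')) hh h4 x
      have e7 : ravg h (fun y => w t y - w t' y) x = ravg h (w t) x - ravg h (w t') x := by
        rw [ravg, intervalIntegral.integral_sub ((continuous_rot (hcont t) x).intervalIntegrable _ _)
          ((continuous_rot (hcont t') x).intervalIntegrable _ _), mul_sub, ravg, ravg]
      have h6 := abs_add_le ((w t x - w t' x) - ravg h (fun y => w t y - w t' y) x)
        (ravg h (fun y => w t y - w t' y) x)
      rw [sub_add_cancel] at h6
      have h7 := mul_le_mul_of_nonneg_right hhP hS0
      have h8 : |ravg h (fun y => w t y - w t' y) x| ≤ 2 * ε' := by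
        rw [e7, show ravg h (w t) x - ravg h (w t') x =
          (ravg h (w t) x - r x) - (ravg h (w t') x - r x) by ring]
        exact (abs_sub _ _).trans (by linarith [t6 x, t6' x])
      calc |w t x - w t' x| ≤ _ := h6
        _ ≤ P * ((A + 1) * S + (2 * ε' * D + 2 * ε')) * √h + 2 * ε' := add_le_add h5 h8
        _ ≤ _ := by linarith
    intro x
    refine (hgoal x).trans (le_of_eq ?_)
    rw [hε']
    field_simp
    ring
  have hvb : ∀ x, |v x| ≤ D := fun x =>
    le_of_tendsto (hv.tendsto x).abs (hD.mono fun t ht => ht x)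
  have hvc : Continuous v := by
    have hu : TendstoUniformly w v (𝓝[≠] (0 : ℝ)) := by
      rw [Metric.tendstoUniformly_iff]
      intro ε hε
      filter_upwards [hv (ε / 2) (by linarith)] with t ht x
      rw [dist_comm, Real.dist_eq]
      linarith [ht x]
    exact hu.continuous (Eventually.of_forall hcont).frequently
  have hvm : BM v D := ⟨hvc.measurable, hvb⟩
  have hsU : UC (dq s) (fun x => k₀ x * v x + e₀ x) :=
    ((hk.mul hv hk₀.bd hvb).add he).congr heq fun _ => rfl
  have hs'm := (hk₀.mul hvm).add he₀
  refine ⟨v, hvc, ⟨⟨Q, hQ⟩, ⟨D, hvm⟩, hv⟩, ⟨⟨M, hs⟩, ⟨_, hs'm⟩, hsU⟩, fun x => ?_⟩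
  refine tendsto_nhds_unique (hv.tendsto x) ?_
  rw [Metric.tendsto_nhds]
  intro ε hε
  filter_upwards [hsU (ε / (2 * P)) (by positivity)] with t ht
  have hbm : BM (fun y => dq s t y - (k₀ y * v y + e₀ y)) (ε / (2 * P)) :=
    ⟨(hs.dq t).meas.sub hs'm.meas, ht⟩
  have h1 := (hP _ _ hbm).1 x
  rw [pot_sub (hs.dq t) hs'm, pot_dq hs] at h1
  rw [Real.dist_eq]
  refine h1.trans_lt ?_
  rw [show P * (ε / (2 * P)) = ε / 2 by field_simp]
  linarith

lemma UC.comp_const {w : ℝ → ℂ → ℝ} {g : ℝ → ℝ} {c : ℝ} (h : UC w (fun _ => c))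
    (hg : ContinuousAt g c) : UC (fun t x => g (w t x)) (fun _ => g c) := fun ε hε => by
  obtain ⟨δ, hδ, hd⟩ := Metric.continuousAt_iff.1 hg ε hε
  filter_upwards [h (δ / 2) (by linarith)] with t ht x
  have := hd (x := w t x) (by rw [Real.dist_eq]; linarith [ht x])
  rw [Real.dist_eq] at this
  exact this.le

lemma UC_id : UC (fun t _ => t) (fun _ => 0) := fun ε hε => by
  have : Tendsto (fun t : ℝ => |t - 0|) (𝓝[≠] 0) (𝓝 0) := by
    have h : Continuous fun t : ℝ => |t - 0| := by fun_prop
    have := h.tendsto 0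
    simp only [sub_zero, abs_zero] at this ⊢
    exact tendsto_nhdsWithin_of_tendsto_nhds this
  filter_upwards [this.eventually (gt_mem_nhds hε)] with t ht x
  exact ht.le

lemma mul_dq {g : ℂ → ℝ} {t : ℝ} (ht : t ≠ 0) (x : ℂ) : t * dq g t x = g (bpt t * x) - g x := by
  rw [dq, mul_div_cancel₀ _ ht]

lemma RD.rot_sub {g g' : ℂ → ℝ} (h : RD g g') :
    UC (fun t x => g (bpt t * x) - g x) (fun _ => 0) := by
  obtain ⟨M, hM⟩ := h.bm'
  refine (UC_id.mul h.lim (A := 0) (fun x => by simp) hM.bd).congr (fun t ht x => (mul_dq ht x).symm)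
    fun x => by simp

lemma RD.rot {g g' : ℂ → ℝ} (h : RD g g') : UC (fun t x => g (bpt t * x)) g :=
  (h.rot_sub.add (UC.const g)).congr (fun t _ x => by ring) fun x => by ring

lemma RD.add {g g' h h' : ℂ → ℝ} (hg : RD g g') (hh : RD h h') :
    RD (fun x => g x + h x) (fun x => g' x + h' x) := by
  obtain ⟨A, hA⟩ := hg.bm
  obtain ⟨A', hA'⟩ := hg.bm'
  obtain ⟨B, hB⟩ := hh.bm
  obtain ⟨B', hB'⟩ := hh.bm'
  exact ⟨⟨_, hA.add hB⟩, ⟨_, hA'.add hB'⟩, (hg.lim.add hh.lim).congr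
    (fun t _ x => by simp only [dq]; ring) fun _ => rfl⟩

lemma RD.mul {g g' h h' : ℂ → ℝ} (hg : RD g g') (hh : RD h h') :
    RD (fun x => g x * h x) (fun x => g' x * h x + g x * h' x) := by
  obtain ⟨A, hA⟩ := hg.bm
  obtain ⟨A', hA'⟩ := hg.bm'
  obtain ⟨B, hB⟩ := hh.bm
  obtain ⟨B', hB'⟩ := hh.bm'
  exact ⟨⟨_, hA.mul hB⟩, ⟨_, (hA'.mul hB).add (hA.mul hB')⟩,
    ((hg.lim.mul hh.rot hA'.bd hB.bd).add ((UC.const g).mul hh.lim hA.bd hB'.bd)).congr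
    (fun t _ x => by simp only [dq]; ring) fun _ => rfl⟩

lemma RD.of_invariant {g : ℂ → ℝ} {M : ℝ} (hg : BM g M) (h : ∀ t x, g (bpt t * x) = g x) :
    RD g (fun _ => 0) :=
  ⟨⟨M, hg⟩, ⟨_, BM.const 0⟩, (UC.const _).congr (fun t _ x => by simp [dq, h]) fun _ => rfl⟩

lemma RD_kap : RD kap (fun _ => 0) := by
  obtain ⟨M, hM⟩ := PB.kap.bm
  exact RD.of_invariant hM kap_bpt_mul

lemma RD.congr {g g' h h' : ℂ → ℝ} (hg : RD g g') (e : ∀ x, h x = g x) (e' : ∀ x, h' x = g' x) :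
    RD h h' := by
  rw [show h = g from funext e, show h' = g' from funext e']; exact hg

lemma BM.exp {g : ℂ → ℝ} {M : ℝ} (h : BM g M) : BM (fun x => Real.exp (g x)) (Real.exp M) :=
  ⟨h.meas.exp, fun x => by
    rw [abs_of_pos (Real.exp_pos _)]; exact Real.exp_le_exp.2 ((le_abs_self _).trans (h.bd x))⟩

lemma exp_sub_one_eq (z : ℝ) : Real.exp z - 1 = z * dslope Real.exp 0 z := by
  have := sub_smul_dslope Real.exp 0 z
  simp only [sub_zero, Real.exp_zero, smul_eq_mul] at this
  exact this.symm

lemma UC_dslope_exp {w : ℝ → ℂ → ℝ} (h : UC w (fun _ => 0)) :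
    UC (fun t x => dslope Real.exp 0 (w t x)) (fun _ => 1) := by
  have := h.comp_const (g := dslope Real.exp 0) (continuousAt_dslope_same.2 Real.differentiableAt_exp)
  simpa [dslope_same] using this

lemma UC_exp {w : ℝ → ℂ → ℝ} (h : UC w (fun _ => 0)) :
    UC (fun t x => Real.exp (w t x)) (fun _ => 1) := by
  have := h.comp_const (g := Real.exp) Real.continuous_exp.continuousAt
  simpa using this

lemma RD.exp {g g' : ℂ → ℝ} (hg : RD g g') :
    RD (fun x => Real.exp (g x)) (fun x => Real.exp (g x) * g' x) := by
  obtain ⟨A, hA⟩ := hg.bm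
  obtain ⟨A', hA'⟩ := hg.bm'
  refine ⟨⟨_, hA.exp⟩, ⟨_, hA.exp.mul hA'⟩, ?_⟩
  have h1 := (UC_dslope_exp hg.rot_sub).mul hg.lim (A := 1) (fun x => by simp) hA'.bd
  have h2 := (UC.const fun x => Real.exp (g x)).mul h1 hA.exp.bd
    (B := A') (fun x => by simpa using hA'.bd x)
  refine h2.congr (fun t ht x => ?_) fun x => by ring
  have e := exp_sub_one_eq (g (bpt t * x) - g x)
  rw [← mul_dq ht, mul_assoc] at e
  have e2 : Real.exp (g (bpt t * x)) - Real.exp (g x) =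
      t * (Real.exp (g x) * (dslope Real.exp 0 (g (bpt t * x) - g x) * dq g t x)) := by
    rw [← mul_dq ht x]
    have : Real.exp (g (bpt t * x)) = Real.exp (g x) * Real.exp (t * dq g t x) := by
      rw [← Real.exp_add, mul_dq ht]; congr 1; ring
    rw [this]
    linear_combination Real.exp (g x) * e
  rw [dq, e2, mul_div_cancel_left₀ _ ht]

/-- Rotational differentiability for linear potential equations. -/
lemma RD_linear {s s' v r a a' : ℂ → ℝ} (hs : RD s s') (ha : RD a a') {M : ℝ} (hr : BM r M)
    (hv : ∀ x, v x = pot r x) (hre : ∀ x, r x = kap x * s x * v x + a x) :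
    ∃ v' r', Continuous v' ∧ RD v v' ∧ RD r r' ∧ (∀ x, v' x = pot r' x) ∧
      ∀ x, r' x = kap x * s x * v' x + (kap x * s' x * v x + a' x) := by
  obtain rfl : v = pot r := funext hv
  obtain ⟨A, hA⟩ := hs.bm
  obtain ⟨A', hA'⟩ := hs.bm'
  obtain ⟨B', hB'⟩ := ha.bm'
  obtain ⟨K, hK⟩ := PB.kap.bm
  obtain ⟨Q, hQ⟩ := hr.pot
  obtain ⟨v', hc, h1, h2, h3⟩ := RD_pot hr (k := fun t x => kap x * s (bpt t * x))
    (e := fun t x => kap x * dq s t x * pot r x + dq a t x) (k₀ := fun x => kap x * s x)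
    (e₀ := fun x => kap x * s' x * pot r x + a' x)
    ((UC.const kap).mul hs.rot hK.bd hA.bd)
    ((((UC.const kap).mul hs.lim hK.bd hA'.bd).mul (UC.const (pot r)) (hK.mul hA').bd hQ.bd).add ha.lim)
    (hK.mul hA) (((hK.mul hA').mul hQ).add hB') (fun t ht x => by
      simp only [dq, hre, kap_bpt_mul]
      ring)
  exact ⟨v', _, hc, h1, h2, h3, fun x => rfl⟩

/-- Solutions of the potential equation are three times differentiable along rotations. -/
theorem Sol.RD_three {F F₁ F₂ F₃ u : ℂ → ℝ} (hu : Sol F u) (hF₁ : RD F F₁) (hF₂ : RD F₁ F₂)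
    (hF₃ : RD F₂ F₃) : ∃ u₁ u₂ u₃, Continuous u₁ ∧ Continuous u₂ ∧ Continuous u₃ ∧
      RD u u₁ ∧ RD u₁ u₂ ∧ RD u₂ u₃ := by
  obtain ⟨c, hc⟩ := hu.eq
  obtain ⟨M, hM⟩ := hu.dens.toPB.bm
  set s := wexp F u with hs
  obtain ⟨Q, hQ⟩ := hM.pot
  have hub : BM u (Q + |c|) := by
    have := hQ.add (BM.const c)
    rwa [← show u = fun x => pot s x + c from funext hc] at this
  obtain ⟨K, hK⟩ := PB.kap.bm
  obtain ⟨E, hE⟩ := hub.exp_kap.bm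
  obtain ⟨B, hB⟩ := hF₁.bm'
  have hdq : ∀ t x, dq u t x = dq (pot s) t x := fun t x => by simp only [dq, hc]; ring
  have hus : UC (fun t x => kap x * (u (bpt t * x) - u x)) (fun _ => 0) := by
    obtain ⟨P, hP0, hP⟩ := exists_pot_rot_bound
    have h1 : UC (fun t x => u (bpt t * x) - u x) (fun _ => 0) := fun ε hε => by
      have hlim : Tendsto (fun t : ℝ => P * M * √|t|) (𝓝[≠] 0) (𝓝 0) := by
        have h : Continuous fun t : ℝ => P * M * √|t| := by fun_prop
        have := h.tendsto 0
        simp only [abs_zero, Real.sqrt_zero, mul_zero] at this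
        exact tendsto_nhdsWithin_of_tendsto_nhds this
      filter_upwards [hlim.eventually (gt_mem_nhds hε)] with t ht x
      rw [sub_zero, hc, hc, add_sub_add_right_eq_sub]
      exact ((hP s M hM).2 x t).trans ht.le
    exact ((UC.const kap).mul h1 hK.bd (B := 0) (by simp)).congr (fun _ _ _ => rfl) fun x => by simp
  have hk : UC (fun t x => kap x * s x * dslope Real.exp 0 (kap x * (u (bpt t * x) - u x)))
      (fun x => kap x * s x) :=
    ((UC.const fun x => kap x * s x).mul (UC_dslope_exp hus) (hK.mul hM).bd (B := 1) (by simp)).congr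
      (fun _ _ _ => rfl) fun x => by ring
  have he : UC (fun t x => dq F t x * Real.exp (kap x * u (bpt t * x)))
      (fun x => F₁ x * Real.exp (kap x * u x)) := by
    have h1 : UC (fun t x => Real.exp (kap x * u (bpt t * x))) (fun x => Real.exp (kap x * u x)) :=
      ((UC.const fun x => Real.exp (kap x * u x)).mul (UC_exp hus) hE.bd (B := 1) (by simp)).congr
        (fun t _ x => by rw [← Real.exp_add]; congr 1; ring) fun x => by ring
    exact hF₁.lim.mul h1 hB.bd hE.bd
  obtain ⟨u₁, hc₁, hr, hrs, hp⟩ := RD_pot hM hk he (hK.mul hM) (hB.mul hE) (fun t ht x => by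
    have e := exp_sub_one_eq (kap x * (u (bpt t * x) - u x))
    rw [← mul_dq ht, hdq] at e
    have e2 : Real.exp (kap x * u (bpt t * x)) =
        Real.exp (kap x * u x) * Real.exp (kap x * (t * dq (pot s) t x)) := by
      rw [← Real.exp_add, ← hdq, mul_dq ht]; congr 1; ring
    have e3 : t * dq s t x = t * (kap x * s x * dslope Real.exp 0 (kap x * (u (bpt t * x) - u x)) *
        dq (pot s) t x + dq F t x * Real.exp (kap x * u (bpt t * x))) := by
      have e4 := mul_dq (g := F) ht x
      rw [mul_dq ht]
      simp only [hs, wexp, kap_bpt_mul]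
      rw [← mul_dq ht x, hdq]
      linear_combination Real.exp (kap x * u (bpt t * x)) * (-e4) + F x * e2 +
        F x * Real.exp (kap x * u x) * e
    exact mul_left_cancel₀ ht e3)
  have hr' : RD u u₁ := ⟨⟨_, hub⟩, hr.bm', hr.lim.congr (fun t _ x => hdq t x) fun _ => rfl⟩
  have hexp := (RD_kap.mul hr').exp
  have ha := hF₂.mul hexp
  obtain ⟨N, hN⟩ := hrs.bm'
  obtain ⟨u₂, s₂, hc₂, hr₂, hrs₂, hp₂, hs₂⟩ := RD_linear hrs ha hN hp fun x => rfl
  have hhe' := (hexp.mul ((RD_kap.mul hr₂).congr (h := fun x => 0 * u x + kap x * u₁ x)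
    (fun x => by ring) fun x => rfl))
  have ha₂ := ((RD_kap.mul hrs₂).mul hr₂).add ((hF₃.mul hexp).add (hF₂.mul hhe'))
  obtain ⟨N₂, hN₂⟩ := hrs₂.bm'
  obtain ⟨u₃, s₃, hc₃, hr₃, -, -, -⟩ := RD_linear hrs ha₂ hN₂ hp₂ hs₂
  exact ⟨u₁, u₂, u₃, hc₁, hc₂, hc₃, hr', hr₂, hr₃⟩

/-- The weight equal to `f` in the open disc and to `j` on the unit circle. -/
def glue (f j : ℂ → ℝ) (x : ℂ) : ℝ := if ‖x‖ < 1 then f (clamp x) else j (clamp x)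

/-- The rotational derivative. -/
def rder (f : ℂ → ℝ) (x : ℂ) : ℝ := fderivWithin ℝ f cdisc x (Complex.I * x)

lemma mem_cdisc {x : ℂ} : x ∈ cdisc ↔ ‖x‖ ≤ 1 := mem_closedBall_zero_iff

lemma mem_odisc {x : ℂ} : x ∈ odisc ↔ ‖x‖ < 1 := mem_ball_zero_iff

lemma mem_bdry {x : ℂ} : x ∈ bdry ↔ ‖x‖ = 1 := mem_sphere_zero_iff_norm

lemma uniqueDiffOn_cdisc : UniqueDiffOn ℝ cdisc :=
  uniqueDiffOn_convex (convex_closedBall 0 1) (by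
    rw [cdisc, interior_closedBall _ one_ne_zero]; exact ⟨0, mem_ball_self one_pos⟩)

lemma glue_of_lt {f j : ℂ → ℝ} {x : ℂ} (h : ‖x‖ < 1) : glue f j x = f x := by
  rw [glue, if_pos h, clamp_of_le h.le]

lemma glue_of_eq {f j : ℂ → ℝ} {x : ℂ} (h : ‖x‖ = 1) : glue f j x = j x := by
  rw [glue, if_neg h.not_lt, clamp_of_le h.le]

lemma continuous_comp_clamp {f : ℂ → ℝ} (hf : ContinuousOn f cdisc) :
    Continuous fun x => f (clamp x) :=
  hf.comp_continuous continuous_clamp fun x => mem_cdisc.2 (norm_clamp_le x)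

lemma glue_bm {f j : ℂ → ℝ} (hf : ContinuousOn f cdisc) (hj : ContinuousOn j cdisc) :
    ∃ M, BM (glue f j) M := by
  obtain ⟨A, hA⟩ := (isCompact_closedBall (0 : ℂ) 1).exists_bound_of_continuousOn hf
  obtain ⟨B, hB⟩ := (isCompact_closedBall (0 : ℂ) 1).exists_bound_of_continuousOn hj
  refine ⟨max A B, Measurable.ite (measurableSet_lt measurable_norm measurable_const)
    (continuous_comp_clamp hf).measurable (continuous_comp_clamp hj).measurable, fun x => ?_⟩
  have hx : clamp x ∈ cdisc := mem_cdisc.2 (norm_clamp_le x)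
  unfold glue
  split_ifs
  · exact (hA _ hx).trans (le_max_left _ _)
  · exact (hB _ hx).trans (le_max_right _ _)

lemma glue_pb {f j : ℂ → ℝ} (hf : ContinuousOn f cdisc) (hj : ContinuousOn j cdisc)
    (hf0 : ∀ z ∈ cdisc, 0 < f z) (hj0 : ∀ z ∈ bdry, 0 < j z) : PB (glue f j) := by
  obtain ⟨M, hM⟩ := glue_bm hf hj
  obtain ⟨a, ha, hamin⟩ := (isCompact_closedBall (0 : ℂ) 1).exists_isMinOn
    ⟨0, mem_closedBall_self zero_le_one⟩ hf
  have hb1 : (1 : ℂ) ∈ bdry := mem_bdry.2 (by simp)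
  obtain ⟨b, hb, hbmin⟩ := (isCompact_sphere (0 : ℂ) 1).exists_isMinOn ⟨1, hb1⟩
    (hj.mono sphere_subset_closedBall)
  refine ⟨hM.meas, min (f a) (j b), M, lt_min (hf0 a ha) (hj0 b hb), fun x =>
    ⟨?_, (le_abs_self _).trans (hM.bd x)⟩⟩
  unfold glue
  split_ifs with h
  · exact (min_le_left _ _).trans (hamin (mem_cdisc.2 (norm_clamp_le x)))
  · exact (min_le_right _ _).trans (hbmin (mem_bdry.2 (norm_clamp_of_ge (not_lt.1 h))))

lemma rder_contDiffOn {f : ℂ → ℝ} (hf : ContDiffOn ℝ (⊤ : ℕ∞) f cdisc) :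
    ContDiffOn ℝ (⊤ : ℕ∞) (rder f) cdisc := by
  have h1 : ContDiffOn ℝ (⊤ : ℕ∞) (fderivWithin ℝ f cdisc) cdisc :=
    hf.fderivWithin uniqueDiffOn_cdisc (by simp)
  exact h1.clm_apply (contDiff_const.mul contDiff_id).contDiffOn

lemma hasDerivAt_bpt (t : ℝ) : HasDerivAt bpt (Complex.I * bpt t) t := by
  have h : HasDerivAt (fun θ : ℝ => Complex.exp ((θ : ℂ) * Complex.I))
      (Complex.exp ((t : ℂ) * Complex.I) * (((1 : ℝ) : ℂ) * Complex.I)) t :=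
    ((Complex.ofRealCLM.hasDerivAt (x := t)).mul_const Complex.I).cexp
  exact h.congr_deriv (by unfold bpt; push_cast; ring)

lemma hasDerivAt_rot {f : ℂ → ℝ} (hf : DifferentiableOn ℝ f cdisc) {x : ℂ} (hx : ‖x‖ ≤ 1) (t : ℝ) :
    HasDerivAt (fun τ => f (bpt τ * x)) (rder f (bpt t * x)) t := by
  have hm : ∀ τ, bpt τ * x ∈ cdisc := fun τ => mem_cdisc.2 (by rw [norm_bpt_mul]; exact hx)
  have h1 := (hf _ (hm t)).hasFDerivWithinAt
  have h2 : HasDerivAt (fun τ => bpt τ * x) (Complex.I * (bpt t * x)) t := by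
    have := (hasDerivAt_bpt t).mul_const x
    rwa [mul_assoc] at this
  exact hasDerivWithinAt_univ.1 (h1.comp_hasDerivWithinAt t h2.hasDerivWithinAt fun τ _ => hm τ)

lemma rot_taylor {f : ℂ → ℝ} (hf : ContDiffOn ℝ (⊤ : ℕ∞) f cdisc) {ε : ℝ} (hε : 0 < ε) :
    ∃ δ > 0, ∀ t, |t| < δ → ∀ x, ‖x‖ ≤ 1 → |f (bpt t * x) - f x - t * rder f x| ≤ ε * |t| := by
  have huc := (isCompact_closedBall (0 : ℂ) 1).uniformContinuousOn_of_continuous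
    (rder_contDiffOn hf).continuousOn
  obtain ⟨δ, hδ, hd⟩ := Metric.uniformContinuousOn_iff.1 huc ε hε
  refine ⟨δ, hδ, fun t ht x hx => ?_⟩
  have hder : ∀ τ, HasDerivAt (fun τ => f (bpt τ * x) - τ * rder f x)
      (rder f (bpt τ * x) - rder f x) τ := fun τ => by
    have := (hasDerivAt_rot (hf.differentiableOn (by simp)) hx τ).sub
      ((hasDerivAt_id τ).mul_const (rder f x))
    simp only [one_mul] at this
    exact this
  have := (convex_uIcc (0 : ℝ) t).norm_image_sub_le_of_norm_hasDerivWithin_le (C := ε)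
    (fun τ _ => (hder τ).hasDerivWithinAt) (fun τ hτ => ?_) left_mem_uIcc right_mem_uIcc
  · have e0 : bpt 0 = 1 := by simp [bpt]
    simp only [Real.norm_eq_abs, sub_zero, e0, one_mul, zero_mul] at this
    rwa [show f (bpt t * x) - f x - t * rder f x = f (bpt t * x) - t * rder f x - f x by ring]
  · have hτ' : |τ| ≤ |t| := by
      have := abs_sub_left_of_mem_uIcc hτ
      simpa using this
    refine (hd _ (mem_cdisc.2 (by rw [norm_bpt_mul]; exact hx)) x (mem_cdisc.2 hx) ?_).le
    rw [dist_eq_norm, show bpt τ * x - x = (bpt τ - 1) * x by ring, norm_mul]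
    exact ((mul_le_of_le_one_right (norm_nonneg _) hx).trans (norm_bpt_sub_one_le τ)).trans_lt
      (hτ'.trans_lt ht)

lemma RD_glue {f j : ℂ → ℝ} (hf : ContDiffOn ℝ (⊤ : ℕ∞) f cdisc)
    (hj : ContDiffOn ℝ (⊤ : ℕ∞) j cdisc) : RD (glue f j) (glue (rder f) (rder j)) := by
  refine ⟨glue_bm hf.continuousOn hj.continuousOn,
    glue_bm (rder_contDiffOn hf).continuousOn (rder_contDiffOn hj).continuousOn, fun ε hε => ?_⟩
  obtain ⟨δ, hδ, h1⟩ := rot_taylor hf hε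
  obtain ⟨δ', hδ', h2⟩ := rot_taylor hj hε
  have hlt : ∀ᶠ t in 𝓝[≠] (0 : ℝ), |t| < min δ δ' := by
    have : ∀ᶠ t in 𝓝 (0 : ℝ), |t| < min δ δ' := by
      have := ball_mem_nhds (0 : ℝ) (lt_min hδ hδ')
      filter_upwards [this] with t ht
      simpa using ht
    exact this.filter_mono nhdsWithin_le_nhds
  filter_upwards [hlt, self_mem_nhdsWithin] with t ht ht0 x
  have ht0 : 0 < |t| := abs_pos.2 ht0
  have hx := norm_clamp_le x
  rw [← mul_le_mul_iff_left₀ ht0, ← abs_mul, sub_mul, mul_comm (dq _ _ _), mul_dq (abs_pos.1 ht0),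
    mul_comm _ t]
  simp only [glue, norm_bpt_mul, clamp_bpt_mul]
  split_ifs
  · exact h1 t (ht.trans_le (min_le_left _ _)) _ hx
  · exact h2 t (ht.trans_le (min_le_right _ _)) _ hx

/-- Rotational derivatives of solutions for smooth weights. -/
theorem Sol.exists_rot_derivs {f j u : ℂ → ℝ} (hf : ContDiffOn ℝ (⊤ : ℕ∞) f cdisc)
    (hj : ContDiffOn ℝ (⊤ : ℕ∞) j cdisc) (hu : Sol (glue f j) u) :
    ∃ u₁ u₂ u₃, Continuous u₁ ∧ Continuous u₂ ∧ Continuous u₃ ∧ RD u u₁ ∧ RD u₁ u₂ ∧ RD u₂ u₃ :=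
  hu.RD_three (RD_glue hf hj) (RD_glue (rder_contDiffOn hf) (rder_contDiffOn hj))
    (RD_glue (rder_contDiffOn (rder_contDiffOn hf)) (rder_contDiffOn (rder_contDiffOn hj)))

/-! ### The logarithmic potential -/

lemma abs_log_sub_log_le_mul_inv {a b h : ℝ} (ha : 0 < a) (hb : 0 < b) (hab : |b - a| ≤ h) :
    |Real.log b - Real.log a| ≤ h * a⁻¹ + h * b⁻¹ := by
  have h0 : 0 ≤ h := (abs_nonneg _).trans hab
  have key : ∀ x y : ℝ, 0 < x → 0 < y → |y - x| ≤ h → Real.log y - Real.log x ≤ h * x⁻¹ := by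
    intro x y hx hy hxy
    rw [← Real.log_div hy.ne' hx.ne']
    refine (Real.log_le_sub_one_of_pos (div_pos hy hx)).trans ?_
    rw [show y / x - 1 = (y - x) * x⁻¹ by field_simp]
    exact mul_le_mul_of_nonneg_right ((le_abs_self _).trans hxy) (by positivity)
  have h1 : 0 ≤ h * a⁻¹ := by positivity
  have h2 : 0 ≤ h * b⁻¹ := by positivity
  exact abs_le.2 ⟨by linarith [key b a hb ha (by rwa [abs_sub_comm])],
    by linarith [key a b ha hb hab]⟩

lemma rpow_neg_three_half {a : ℝ} (ha : 0 < a) : a ^ (-(3 / 2) : ℝ) = (√a)⁻¹ ^ 3 := by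
  rw [Real.sqrt_eq_rpow, ← Real.rpow_neg ha.le, ← Real.rpow_natCast, ← Real.rpow_mul ha.le]
  norm_num

lemma inv_le_sqrt_mul {a c h : ℝ} (ha : 0 < a) (hh : 0 ≤ h) (hc : 0 ≤ c) (hah : a ≤ c ^ 2 * h) :
    h * a⁻¹ ≤ c * (√h ^ 3 * a ^ (-(3 / 2) : ℝ)) := by
  rw [rpow_neg_three_half ha]
  have hs := Real.sqrt_pos.2 ha
  have h1 : √a ≤ c * √h := by
    rw [← Real.sqrt_sq hc, ← Real.sqrt_mul (sq_nonneg c)]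
    exact Real.sqrt_le_sqrt hah
  have e1 : h = √h ^ 2 := (Real.sq_sqrt hh).symm
  have e2 : a⁻¹ = (√a)⁻¹ ^ 3 * √a := by
    nth_rw 1 [← Real.sq_sqrt ha.le]
    field_simp
  rw [e2]
  calc h * ((√a)⁻¹ ^ 3 * √a) ≤ h * ((√a)⁻¹ ^ 3 * (c * √h)) := by gcongr
    _ = c * (√h ^ 3 * (√a)⁻¹ ^ 3) := by nth_rw 1 [e1]; ring

/-- First order Taylor bound for the logarithm of the modulus, uniform near the singularity. -/
lemma log_norm_taylor {z h : ℂ} (hz : z ≠ 0) (hzh : z + h ≠ 0) :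
    |Real.log ‖z + h‖ - Real.log ‖z‖ - (h / z).re| ≤
      4 * √‖h‖ ^ 3 * (‖z‖ ^ (-(3 / 2) : ℝ) + ‖z + h‖ ^ (-(3 / 2) : ℝ)) := by
  have pz := norm_pos_iff.2 hz
  have pzh := norm_pos_iff.2 hzh
  have n1 : 0 ≤ ‖z‖ ^ (-(3 / 2) : ℝ) := by positivity
  have n2 : 0 ≤ ‖z + h‖ ^ (-(3 / 2) : ℝ) := by positivity
  have n3 : 0 ≤ √‖h‖ ^ 3 := by positivity
  rcases le_or_gt (2 * ‖h‖) ‖z‖ with hc | hc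
  · have hw : ‖h / z‖ ≤ 1 / 2 := by
      rw [norm_div, div_le_iff₀ pz]; linarith
    have e : Real.log ‖z + h‖ - Real.log ‖z‖ = (Complex.log (1 + h / z)).re := by
      rw [Complex.log_re, ← Real.log_div pzh.ne' pz.ne', ← norm_div, add_div, div_self hz]
    rw [e, ← Complex.sub_re]
    refine (Complex.abs_re_le_norm _).trans
      ((Complex.norm_log_one_add_sub_self_le (by linarith)).trans ?_)
    have i1 : (1 - ‖h / z‖)⁻¹ ≤ 2 := by
      rw [inv_le_comm₀ (by linarith) two_pos]; linarith
    have : ‖h / z‖ ^ 2 * (1 - ‖h / z‖)⁻¹ / 2 ≤ ‖h / z‖ ^ 2 := by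
      nlinarith [sq_nonneg ‖h / z‖]
    refine this.trans ?_
    have h2 : ‖h / z‖ ^ 2 ≤ √‖h‖ ^ 3 * ‖z‖ ^ (-(3 / 2) : ℝ) := by
      rw [rpow_neg_three_half pz, norm_div, div_eq_mul_inv, mul_pow]
      have e1 : ‖h‖ ^ 2 = √‖h‖ ^ 3 * √‖h‖ := by
        nth_rw 1 [← Real.sq_sqrt (norm_nonneg h)]; ring
      have hs := Real.sqrt_pos.2 pz
      have e2 : ‖z‖⁻¹ ^ 2 = (√‖z‖)⁻¹ ^ 3 * (√‖z‖)⁻¹ := by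
        nth_rw 1 [← Real.sq_sqrt pz.le]
        field_simp
      have h3 : √‖h‖ * (√‖z‖)⁻¹ ≤ 1 := by
        rw [← div_eq_mul_inv, div_le_one hs]
        exact Real.sqrt_le_sqrt (by linarith [norm_nonneg h])
      rw [e1, e2]
      calc √‖h‖ ^ 3 * √‖h‖ * ((√‖z‖)⁻¹ ^ 3 * (√‖z‖)⁻¹)
          = √‖h‖ ^ 3 * (√‖z‖)⁻¹ ^ 3 * (√‖h‖ * (√‖z‖)⁻¹) := by ring
        _ ≤ √‖h‖ ^ 3 * (√‖z‖)⁻¹ ^ 3 * 1 := by gcongr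
        _ = _ := mul_one _
    nlinarith [mul_nonneg n3 n1, mul_nonneg n3 n2]
  · have b1 := inv_le_sqrt_mul (c := 2) pz (norm_nonneg h) (by norm_num)
      (by linarith [norm_nonneg h])
    have b2 := inv_le_sqrt_mul (c := 2) pzh (norm_nonneg h) (by norm_num)
      (by linarith [norm_add_le z h, norm_nonneg h])
    have b3 := abs_log_sub_log_le_mul_inv pz pzh (h := ‖h‖) (by
      have := abs_norm_sub_norm_le (z + h) z
      simpa using this)
    have b4 : |(h / z).re| ≤ ‖h‖ * ‖z‖⁻¹ := by
      refine (Complex.abs_re_le_norm _).trans ?_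
      rw [norm_div, div_eq_mul_inv]
    have := abs_sub (Real.log ‖z + h‖ - Real.log ‖z‖) (h / z).re
    nlinarith [mul_nonneg n3 n1, mul_nonneg n3 n2]

/-- The real linear form `h ↦ Re (p h)`. -/
def reMul (p : ℂ) : ℂ →L[ℝ] ℝ := Complex.reCLM.comp ((ContinuousLinearMap.mul ℝ ℂ) p)

@[simp] lemma reMul_apply (p h : ℂ) : reMul p h = (p * h).re := rfl

lemma integrable_log_mul {g : ℂ → ℝ} {M : ℝ} (hg : BM g M) {x : ℂ} (hx : ‖x‖ ≤ 1) :
    Integrable (fun y => Real.log ‖x - y‖ * g y) aream := by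
  obtain ⟨C, -, hC⟩ := riesz_area (α := 1) (by norm_num)
  refine (((hC x hx).1.add (integrable_const 2)).mul_const M).mono'
    ((by fun_prop : Measurable fun y : ℂ => Real.log ‖x - y‖).mul hg.meas).aestronglyMeasurable ?_
  filter_upwards [aream_ae (p := fun y => ‖x - y‖ ≤ 2) fun y hy => (norm_sub_le x y).trans
    (by linarith)] with y hy
  rw [Real.norm_eq_abs, abs_mul]
  refine mul_le_mul ?_ (hg.bd y) (abs_nonneg _) (by simp; positivity)
  simp only [Pi.add_apply, Real.rpow_neg_one]
  rcases (norm_nonneg (x - y)).eq_or_lt with h | h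
  · simp [← h]
  · have h1 := Real.log_le_sub_one_of_pos h
    have h2 := Real.one_sub_inv_le_log_of_pos h
    have : 0 ≤ ‖x - y‖⁻¹ := by positivity
    exact abs_le.2 ⟨by linarith, by linarith⟩

lemma integrable_inv_mul {g : ℂ → ℝ} {M : ℝ} (hg : BM g M) {x : ℂ} (hx : ‖x‖ ≤ 1) :
    Integrable (fun y => (x - y)⁻¹ * (g y : ℂ)) aream := by
  obtain ⟨C, -, hC⟩ := riesz_area (α := 1) (by norm_num)
  refine ((hC x hx).1.mul_const M).mono'
    ((by fun_prop : Measurable fun y : ℂ => (x - y)⁻¹).mul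
      (Complex.measurable_ofReal.comp hg.meas)).aestronglyMeasurable
      (Eventually.of_forall fun y => ?_)
  rw [norm_mul, norm_inv, Complex.norm_real, Real.norm_eq_abs, Real.rpow_neg_one]
  exact mul_le_mul_of_nonneg_left (hg.bd y) (by positivity)

lemma aream_ae_ne (x : ℂ) : ∀ᵐ y ∂aream, y ≠ x := by
  have h : ∀ᵐ y ∂(volume : Measure ℂ), y ≠ x := by simp [ae_iff]
  exact ae_restrict_of_ae h

/-- The gradient of the logarithmic potential of a bounded density. -/
lemma hasFDerivAt_logPotential {g : ℂ → ℝ} {M : ℝ} (hg : BM g M) {x : ℂ} (hx : ‖x‖ < 1) :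
    HasFDerivAt (fun x => ∫ y, Real.log ‖x - y‖ * g y ∂aream)
      (reMul (∫ y, (x - y)⁻¹ * (g y : ℂ) ∂aream)) x := by
  obtain ⟨C, hC0, hC⟩ := riesz_area (α := 3 / 2) (by norm_num)
  rw [hasFDerivAt_iff_isLittleO_nhds_zero]
  have hM := hg.nonneg
  have main : ∀ᶠ h in 𝓝 (0 : ℂ), ‖(∫ y, Real.log ‖x + h - y‖ * g y ∂aream) -
      (∫ y, Real.log ‖x - y‖ * g y ∂aream) - reMul (∫ y, (x - y)⁻¹ * (g y : ℂ) ∂aream) h‖ ≤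
      (8 * C * M * √‖h‖) * ‖h‖ := by
    filter_upwards [ball_mem_nhds (0 : ℂ) (sub_pos.2 hx)] with h hh
    have hh : ‖h‖ < 1 - ‖x‖ := by simpa using hh
    have hxh : ‖x + h‖ ≤ 1 := (norm_add_le x h).trans (by linarith)
    have i1 := integrable_log_mul hg hxh
    have i2 := integrable_log_mul hg hx.le
    have i3 := (integrable_inv_mul hg hx.le).mul_const h
    have i4 : Integrable (fun y => ((x - y)⁻¹ * (g y : ℂ) * h).re) aream := i3.re
    have e : reMul (∫ y, (x - y)⁻¹ * (g y : ℂ) ∂aream) h =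
        ∫ y, ((x - y)⁻¹ * (g y : ℂ) * h).re ∂aream := by
      rw [reMul_apply, ← integral_mul_const]
      exact (integral_re i3).symm
    rw [e, ← integral_sub_sub i1 i2 i4]
    have j1 := (hC x hx.le).1
    have j2 := (hC (x + h) hxh).1
    have hbd : Integrable (fun y => 4 * √‖h‖ ^ 3 * M *
        (‖x - y‖ ^ (-(3 / 2) : ℝ) + ‖x + h - y‖ ^ (-(3 / 2) : ℝ))) aream :=
      (j1.add j2).const_mul _
    refine (norm_integral_le_of_norm_le hbd ?_).trans ?_
    · filter_upwards [aream_ae_ne x, aream_ae_ne (x + h)] with y hy1 hy2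
      have t := log_norm_taylor (z := x - y) (h := h) (sub_ne_zero.2 hy1.symm)
        (by rw [sub_add_eq_add_sub]; exact sub_ne_zero.2 hy2.symm)
      rw [sub_add_eq_add_sub] at t
      have e2 : Real.log ‖x + h - y‖ * g y - Real.log ‖x - y‖ * g y -
          ((x - y)⁻¹ * (g y : ℂ) * h).re =
          (Real.log ‖x + h - y‖ - Real.log ‖x - y‖ - (h / (x - y)).re) * g y := by
        rw [show (x - y)⁻¹ * (g y : ℂ) * h = h / (x - y) * (g y : ℂ) by ring,
          Complex.re_mul_ofReal]
        ring
      rw [e2, Real.norm_eq_abs, abs_mul]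
      calc _ ≤ _ * M := mul_le_mul t (hg.bd y) (abs_nonneg _) (by positivity)
        _ = _ := by ring
    · rw [integral_const_mul, integral_add j1 j2]
      have s1 : √‖h‖ ^ 3 = √‖h‖ * ‖h‖ := by
        nth_rw 3 [← Real.sq_sqrt (norm_nonneg h)]; ring
      calc _ ≤ 4 * √‖h‖ ^ 3 * M * (C + C) := by
            gcongr
            · exact (hC x hx.le).2
            · exact (hC _ hxh).2
        _ = _ := by rw [s1]; ring
  refine (Asymptotics.IsBigO.of_bound' (g := fun h : ℂ => (8 * C * M * √‖h‖) * ‖h‖)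
    (main.mono fun h hh => hh.trans (le_abs_self _))).trans_isLittleO ?_
  have ht : Tendsto (fun h : ℂ => 8 * C * M * √‖h‖) (𝓝 0) (𝓝 0) := by
    have : Continuous fun h : ℂ => 8 * C * M * √‖h‖ := by fun_prop
    simpa using this.tendsto 0
  have := ((Asymptotics.isLittleO_one_iff ℝ).2 ht).mul_isBigO
    (Asymptotics.isBigO_refl (fun h : ℂ => ‖h‖) (𝓝 0))
  simp only [one_mul] at this
  exact this.of_norm_right

/-! ### The Cauchy transform -/

/-- The Cauchy transform `x ↦ ∫ g y / (x - y)` of a real density, as a convolution. -/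
def cauchyT (g : ℂ → ℝ) : ℂ → ℂ :=
  convolution (fun z : ℂ => z⁻¹) g (ContinuousLinearMap.lsmul ℝ ℝ : ℝ →L[ℝ] ℂ →L[ℝ] ℂ).flip volume

lemma cauchyT_eq (g : ℂ → ℝ) (x : ℂ) : cauchyT g x = ∫ y, (x - y)⁻¹ * (g y : ℂ) := by
  rw [cauchyT, convolution_eq_swap]
  refine integral_congr_ae (Eventually.of_forall fun y => ?_)
  simp [mul_comm]

lemma cauchyT_apply (g : ℂ → ℝ) (x : ℂ) : cauchyT g x = ∫ t, t⁻¹ * (g (x - t) : ℂ) := by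
  rw [cauchyT, convolution_def]
  refine integral_congr_ae (Eventually.of_forall fun y => ?_)
  simp [mul_comm]

lemma locallyIntegrable_inv : LocallyIntegrable (fun z : ℂ => z⁻¹) volume :=
  locallyIntegrable_of_norm_le_rpow (C := 1) (α := 1) (by simp) (by simp)
    (Eventually.of_forall fun x => by rw [norm_inv, Real.rpow_neg_one, one_mul])
    (by fun_prop : Measurable _).aestronglyMeasurable

lemma contDiff_cauchyT {g : ℂ → ℝ} {n : ℕ} (hc : HasCompactSupport g) (hg : ContDiff ℝ n g) :
    ContDiff ℝ n (cauchyT g) :=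
  hc.contDiff_convolution_right (n := (n : ℕ∞)) _ locallyIntegrable_inv (by exact_mod_cast hg)

lemma fderiv_cauchyT {g : ℂ → ℝ} (hc : HasCompactSupport g) (hg : ContDiff ℝ 1 g) (x h : ℂ) :
    fderiv ℝ (cauchyT g) x h = cauchyT (fun y => fderiv ℝ g y h) x := by
  have := hc.hasFDerivAt_convolution_right
    (ContinuousLinearMap.lsmul ℝ ℝ : ℝ →L[ℝ] ℂ →L[ℝ] ℂ).flip locallyIntegrable_inv hg x
  unfold cauchyT
  rw [this.fderiv]
  exact convolution_precompR_apply _ locallyIntegrable_inv (hc.fderiv ℝ)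
    (hg.continuous_fderiv (by norm_num)) x h

lemma integrable_cauchyT {g : ℂ → ℝ} (hc : HasCompactSupport g) (hg : Continuous g) (x : ℂ) :
    Integrable fun t => t⁻¹ * (g (x - t) : ℂ) := by
  have := (hc.convolutionExists_right
    (ContinuousLinearMap.lsmul ℝ ℝ : ℝ →L[ℝ] ℂ →L[ℝ] ℂ).flip locallyIntegrable_inv hg x).integrable
  refine this.congr (Eventually.of_forall fun y => ?_)
  simp [mul_comm]

lemma re_inv_mul_fderiv (L : ℂ →L[ℝ] ℝ) {r θ : ℝ} (hr : 0 < r) :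
    r * (((r * bpt θ)⁻¹ : ℂ) * (L 1 : ℂ) + Complex.I * (((r * bpt θ)⁻¹ : ℂ) * (L Complex.I : ℂ))).re
      = L (bpt θ) := by
  have hb : (bpt θ)⁻¹ = Real.cos θ - Real.sin θ * Complex.I := by
    rw [bpt, ← Complex.exp_neg, ← neg_mul, Complex.exp_mul_I]
    push_cast [Complex.cos_neg, Complex.sin_neg]; ring
  have hb' : bpt θ = (Real.cos θ) • (1 : ℂ) + (Real.sin θ) • Complex.I := by
    rw [bpt, Complex.exp_mul_I]; simp
  have e : L (bpt θ) = Real.cos θ * L 1 + Real.sin θ * L Complex.I := by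
    rw [hb', map_add, map_smul, map_smul]; simp
  rw [e, mul_inv, hb, ← Complex.ofReal_inv]
  simp only [Complex.add_re, Complex.mul_re, Complex.mul_im, Complex.sub_re, Complex.sub_im,
    Complex.ofReal_re, Complex.ofReal_im, Complex.I_re, Complex.I_im]
  field_simp
  ring

lemma integral_radial {g : ℂ → ℝ} (hc : HasCompactSupport g) (hg : ContDiff ℝ 1 g) (x e : ℂ)
    (he : ‖e‖ = 1) : ∫ r in Ioi (0 : ℝ), fderiv ℝ g (x - r * e) e = g x := by
  obtain ⟨R, hR0, hR⟩ := hc.isCompact.isBounded.exists_pos_norm_lt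
  have hz : ∀ r : ℝ, R + ‖x‖ < r → x - r * e ∉ tsupport g := fun r hr hm => by
    have h1 := hR _ hm
    have h2 : ‖(r : ℂ) * e‖ = |r| := by rw [norm_mul, he, mul_one, Complex.norm_real, Real.norm_eq_abs]
    have h3 := norm_sub_norm_le ((r : ℂ) * e) x
    rw [norm_sub_rev, h2] at h3
    linarith [le_abs_self r]
  have hd : ∀ r : ℝ, HasDerivAt (fun r : ℝ => -g (x - r * e)) (fderiv ℝ g (x - r * e) e) r := by
    intro r
    have h1 : HasDerivAt (fun r : ℝ => x - (r : ℂ) * e) (-e) r := by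
      have h0 : HasDerivAt (fun r : ℝ => (r : ℂ)) 1 r := Complex.ofRealCLM.hasDerivAt
      simpa using (h0.mul_const e).const_sub x
    have h2 := ((hg.differentiable (by norm_num)) (x - r * e)).hasFDerivAt.comp_hasDerivAt r h1
    have h3 : HasDerivAt (fun r : ℝ => -g (x - r * e)) (-(fderiv ℝ g (x - r * e) (-e))) r := h2.neg
    rwa [map_neg, neg_neg] at h3
  have hcont : Continuous fun r : ℝ => fderiv ℝ g (x - r * e) e :=
    ((hg.continuous_fderiv (by norm_num)).comp (by fun_prop)).clm_apply continuous_const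
  have hint : IntegrableOn (fun r : ℝ => fderiv ℝ g (x - r * e) e) (Ioi 0) := by
    have h1 : IntegrableOn (fun r : ℝ => fderiv ℝ g (x - r * e) e) (Ioc 0 (R + ‖x‖)) :=
      (hcont.integrableOn_Icc).mono_set Ioc_subset_Icc_self
    refine h1.of_forall_sdiff_eq_zero measurableSet_Ioi fun r hr => ?_
    have : R + ‖x‖ < r := by
      by_contra hcon
      exact hr.2 ⟨hr.1, not_lt.1 hcon⟩
    have h0 : fderiv ℝ g (x - r * e) = 0 := by
      have := image_eq_zero_of_notMem_tsupport
        (fun hm => hz r this ((tsupport_fderiv_subset ℝ) hm) : x - r * e ∉ tsupport (fderiv ℝ g))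
      exact this
    rw [h0]; simp
  have ht : Tendsto (fun r : ℝ => -g (x - r * e)) atTop (𝓝 0) := by
    refine tendsto_const_nhds.congr' ?_
    filter_upwards [eventually_gt_atTop (R + ‖x‖)] with r hr
    rw [image_eq_zero_of_notMem_tsupport (hz r hr), neg_zero]
  have := integral_Ioi_of_hasDerivAt_of_tendsto' (fun r _ => hd r) hint ht
  simpa using this

/-- The real part of `∂̄` of the Cauchy transform recovers the density. -/
lemma re_dbar_cauchyT {g : ℂ → ℝ} (hc : HasCompactSupport g) (hg : ContDiff ℝ 1 g) (x : ℂ) :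
    (fderiv ℝ (cauchyT g) x 1 + Complex.I * fderiv ℝ (cauchyT g) x Complex.I).re
      = 2 * π * g x := by
  have hcf : Continuous (fderiv ℝ g) := hg.continuous_fderiv (by norm_num)
  have hch : ∀ h, HasCompactSupport fun y => fderiv ℝ g y h := fun h => by
    refine (hc.fderiv ℝ).comp_left (g := fun L : ℂ →L[ℝ] ℝ => L h) (by simp)
  have i1 := integrable_cauchyT (hch 1) (hcf.clm_apply continuous_const) x
  have i2 := integrable_cauchyT (hch Complex.I) (hcf.clm_apply continuous_const) x
  rw [fderiv_cauchyT hc hg, fderiv_cauchyT hc hg, cauchyT_apply, cauchyT_apply,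
    ← integral_const_mul, ← integral_add i1 (i2.const_mul _)]
  have i3 := i1.add (i2.const_mul Complex.I)
  have e1 : (∫ t, (t⁻¹ * ((fderiv ℝ g (x - t) 1 : ℝ) : ℂ) +
      Complex.I * (t⁻¹ * ((fderiv ℝ g (x - t) Complex.I : ℝ) : ℂ)))).re =
      ∫ t, (t⁻¹ * ((fderiv ℝ g (x - t) 1 : ℝ) : ℂ) +
      Complex.I * (t⁻¹ * ((fderiv ℝ g (x - t) Complex.I : ℝ) : ℂ))).re := (integral_re i3).symm
  rw [e1, ← Complex.integral_comp_polarCoord_symm]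
  have e2 : ∫ p in polarCoord.target, p.1 • (fun t : ℂ => (t⁻¹ * ((fderiv ℝ g (x - t) 1 : ℝ) : ℂ) +
      Complex.I * (t⁻¹ * ((fderiv ℝ g (x - t) Complex.I : ℝ) : ℂ))).re) (Complex.polarCoord.symm p)
      = ∫ p in Ioi (0 : ℝ) ×ˢ Ioo (-π) π, fderiv ℝ g (x - p.1 * bpt p.2) (bpt p.2) := by
    refine setIntegral_congr_fun (measurableSet_Ioi.prod measurableSet_Ioo) fun p hp => ?_
    have hp1 : Complex.polarCoord.symm p = p.1 * bpt p.2 := by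
      rw [Complex.polarCoord_symm_apply, bpt, Complex.exp_mul_I]; push_cast; ring
    simp only [hp1, smul_eq_mul]
    exact re_inv_mul_fderiv _ hp.1
  have hcont : Continuous fun p : ℝ × ℝ => fderiv ℝ g (x - p.1 * bpt p.2) (bpt p.2) :=
    (hcf.comp (continuous_const.sub ((Complex.continuous_ofReal.comp continuous_fst).mul
      (continuous_bpt.comp continuous_snd)))).clm_apply (continuous_bpt.comp continuous_snd)
  obtain ⟨R, hR0, hR⟩ := hc.isCompact.isBounded.exists_pos_norm_lt
  have hint : IntegrableOn (fun p : ℝ × ℝ => fderiv ℝ g (x - p.1 * bpt p.2) (bpt p.2))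
      (Ioi (0 : ℝ) ×ˢ Ioo (-π) π) := by
    have h1 : IntegrableOn (fun p : ℝ × ℝ => fderiv ℝ g (x - p.1 * bpt p.2) (bpt p.2))
        (Icc 0 (R + ‖x‖) ×ˢ Icc (-π) π) :=
      hcont.continuousOn.integrableOn_compact (isCompact_Icc.prod isCompact_Icc)
    refine h1.of_forall_sdiff_eq_zero (measurableSet_Ioi.prod measurableSet_Ioo) fun p hp => ?_
    have hlt : R + ‖x‖ < p.1 := by
      by_contra hcon
      exact hp.2 ⟨⟨(hp.1.1 : (0 : ℝ) < p.1).le, not_lt.1 hcon⟩, Ioo_subset_Icc_self hp.1.2⟩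
    have h0 : fderiv ℝ g (x - p.1 * bpt p.2) = 0 := by
      refine image_eq_zero_of_notMem_tsupport fun hm => ?_
      have h1 := hR _ (tsupport_fderiv_subset ℝ hm)
      have h2 : ‖(p.1 : ℂ) * bpt p.2‖ = |p.1| := by
        rw [norm_mul, norm_bpt, mul_one, Complex.norm_real, Real.norm_eq_abs]
      have h3 := norm_sub_norm_le ((p.1 : ℂ) * bpt p.2) x
      rw [norm_sub_rev, h2] at h3
      linarith [le_abs_self p.1]
    rw [h0]; simp
  refine e2.trans ?_
  rw [IntegrableOn, Measure.volume_eq_prod, ← Measure.prod_restrict] at hint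
  rw [Measure.volume_eq_prod, ← Measure.prod_restrict, integral_prod_symm _ hint]
  simp only [integral_radial hc hg x _ (norm_bpt _), integral_const]
  simp [Real.pi_pos.le]
  left; ring

/-! ### Interior regularity -/

lemma norm_mul_le_half {x x₀ b : ℂ} {K : ℝ} (hK : 0 < K) (hb : ‖b‖ ≤ K)
    (hx : x ∈ ball x₀ (2 * K)⁻¹) : ‖(x - x₀) * b‖ ≤ 1 / 2 := by
  have h1 : ‖x - x₀‖ < (2 * K)⁻¹ := by rwa [← dist_eq_norm]
  rw [norm_mul]
  calc ‖x - x₀‖ * ‖b‖ ≤ (2 * K)⁻¹ * K := by gcongr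
    _ = 1 / 2 := by field_simp

lemma exists_analytic_log_integral {b : ℂ → ℂ} {g : ℂ → ℝ} {K M : ℝ} (hK : 0 < K)
    (hbm : Measurable b) (hb : ∀ y, ‖b y‖ ≤ K) (hg : BM g M) (x₀ : ℂ) :
    ∃ Φ : ℂ → ℂ, AnalyticAt ℂ Φ x₀ ∧ ∀ᶠ x in 𝓝 x₀,
      Integrable (fun y => Real.log ‖1 + (x - x₀) * b y‖ * g y) Lam ∧
      ∫ y, Real.log ‖1 + (x - x₀) * b y‖ * g y ∂Lam = (Φ x).re := by
  have hM := hg.nonneg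
  have hgm : Measurable fun y => (g y : ℂ) := Complex.measurable_ofReal.comp hg.meas
  have hmeas : ∀ x, Measurable fun y => Complex.log (1 + (x - x₀) * b y) * (g y : ℂ) := fun x =>
    (Complex.measurable_log.comp (by fun_prop)).mul hgm
  have hint : ∀ x ∈ ball x₀ (2 * K)⁻¹,
      Integrable (fun y => Complex.log (1 + (x - x₀) * b y) * (g y : ℂ)) Lam := by
    intro x hx
    refine (integrable_const (1 * M)).mono' (hmeas x).aestronglyMeasurable
      (Eventually.of_forall fun y => ?_)
    have h1 := norm_mul_le_half hK (hb y) hx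
    have h2 := Complex.norm_log_one_add_half_le_self h1
    rw [norm_mul, Complex.norm_real, Real.norm_eq_abs]
    exact mul_le_mul (by linarith) (hg.bd y) (abs_nonneg _) zero_le_one
  have hder : ∀ x ∈ ball x₀ (2 * K)⁻¹,
      DifferentiableAt ℂ (fun x => ∫ y, Complex.log (1 + (x - x₀) * b y) * (g y : ℂ) ∂Lam) x := by
    intro x hx
    have := hasDerivAt_integral_of_dominated_loc_of_deriv_le (μ := Lam)
      (F := fun x y => Complex.log (1 + (x - x₀) * b y) * (g y : ℂ))
      (F' := fun x y => b y / (1 + (x - x₀) * b y) * (g y : ℂ)) (bound := fun _ => K * 2 * M)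
      (isOpen_ball.mem_nhds hx) (Eventually.of_forall fun x => (hmeas x).aestronglyMeasurable)
      (hint x hx) ((hbm.div (by fun_prop)).mul hgm).aestronglyMeasurable
      (Eventually.of_forall fun y x hx => ?_) (integrable_const _)
      (Eventually.of_forall fun y x hx => ?_)
    · exact this.2.differentiableAt
    · have h1 := norm_mul_le_half hK (hb y) hx
      have h2 : 1 / 2 ≤ ‖1 + (x - x₀) * b y‖ := by
        have := norm_sub_norm_le (1 : ℂ) (-((x - x₀) * b y))
        rw [norm_neg, norm_one, sub_neg_eq_add] at this
        linarith
      rw [norm_mul, Complex.norm_real, Real.norm_eq_abs, norm_div]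
      have h3 : ‖b y‖ / ‖1 + (x - x₀) * b y‖ ≤ K * 2 := by
        rw [div_le_iff₀ (by linarith)]
        nlinarith [hb y]
      exact mul_le_mul h3 (hg.bd y) (abs_nonneg _) (by positivity)
    · have h1 := norm_mul_le_half hK (hb y) hx
      have hs : 1 + (x - x₀) * b y ∈ Complex.slitPlane := by
        refine Complex.mem_slitPlane_of_norm_lt_one (by linarith)
      have h2 : HasDerivAt (fun x => 1 + (x - x₀) * b y) (b y) x := by
        simpa using (((hasDerivAt_id x).sub_const x₀).mul_const (b y)).const_add 1
      exact (h2.clog hs).mul_const _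
  refine ⟨_, DifferentiableOn.analyticAt (s := ball x₀ (2 * K)⁻¹)
    (fun x hx => (hder x hx).differentiableWithinAt) (ball_mem_nhds _ (by positivity)), ?_⟩
  filter_upwards [ball_mem_nhds x₀ (by positivity : 0 < (2 * K)⁻¹)] with x hx
  have e : ∀ y, Real.log ‖1 + (x - x₀) * b y‖ * g y =
      (Complex.log (1 + (x - x₀) * b y) * (g y : ℂ)).re := fun y => by
    rw [Complex.re_mul_ofReal, Complex.log_re]
  simp only [e]
  exact ⟨(hint x hx).re, integral_re (hint x hx)⟩

/-- Near an interior point, a potential is a local logarithmic potential plus a harmonic term. -/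
lemma pot_decomp {s : ℂ → ℝ} {M : ℝ} (hs : BM s M) {x₀ : ℂ} (hx₀ : ‖x₀‖ < 1) :
    ∃ χ : ContDiffBump x₀, closedBall x₀ χ.rOut ⊆ ball 0 1 ∧ ∃ Φ : ℂ → ℂ, AnalyticAt ℂ Φ x₀ ∧
      ∀ᶠ x in 𝓝 x₀, pot s x =
        -(2 * π)⁻¹ * ∫ y, Real.log ‖x - y‖ * (χ y * s y) ∂aream + (Φ x).re := by
  have hd : 0 < 1 - ‖x₀‖ := sub_pos.2 hx₀
  set χ : ContDiffBump x₀ := ⟨(1 - ‖x₀‖) / 4, (1 - ‖x₀‖) / 2, by linarith, by linarith⟩ with hχ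
  have hsub : closedBall x₀ χ.rOut ⊆ ball 0 1 := by
    intro y hy
    rw [mem_closedBall, dist_eq_norm] at hy
    rw [mem_ball_zero_iff]
    have := norm_le_norm_add_norm_sub' y x₀
    have hr : χ.rOut = (1 - ‖x₀‖) / 2 := rfl
    linarith
  have hχ0 : ∀ y, ‖y‖ = 1 → χ y = 0 := fun y hy => by
    refine χ.zero_of_le_dist ?_
    by_contra hcon
    have := mem_ball_zero_iff.1 (hsub (mem_closedBall.2 (not_le.1 hcon).le))
    linarith
  have bmχ : BM χ 1 := ⟨χ.continuous.measurable, fun x => by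
    rw [abs_of_nonneg χ.nonneg]; exact χ.le_one⟩
  have bmg := bmχ.mul hs
  have bmh := hs.sub bmg
  set b₁ : ℂ → ℂ := fun y => if (1 - ‖x₀‖) / 4 < ‖x₀ - y‖ then (x₀ - y)⁻¹ else 0 with hb₁
  set b₂ : ℂ → ℂ := fun y => if ‖y‖ ≤ 1 then
    -((starRingEnd ℂ) y / (1 - x₀ * (starRingEnd ℂ) y)) else 0 with hb₂
  have hmc := measurable_starRingEnd
  have m1 : Measurable b₁ := Measurable.ite
    (measurableSet_lt measurable_const (by fun_prop)) (by fun_prop) measurable_const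
  have m2 : Measurable b₂ := Measurable.ite
    (measurableSet_le measurable_norm measurable_const)
    ((hmc.div (measurable_const.sub (measurable_const.mul hmc))).neg) measurable_const
  have hlow : ∀ y : ℂ, ‖y‖ ≤ 1 → 1 - ‖x₀‖ ≤ ‖1 - x₀ * (starRingEnd ℂ) y‖ := fun y hy => by
    have h1 := norm_sub_norm_le (1 : ℂ) (x₀ * (starRingEnd ℂ) y)
    rw [norm_one, norm_mul, RCLike.norm_conj] at h1
    nlinarith [norm_nonneg x₀, norm_nonneg y]
  have n1 : ∀ y, ‖b₁ y‖ ≤ 4 / (1 - ‖x₀‖) := fun y => by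
    simp only [hb₁]
    split_ifs with h
    · rw [norm_inv, inv_le_comm₀ (by linarith) (by positivity), inv_div]; exact h.le
    · simp; positivity
  have n2 : ∀ y, ‖b₂ y‖ ≤ 4 / (1 - ‖x₀‖) := fun y => by
    simp only [hb₂]
    split_ifs with h
    · rw [norm_neg, norm_div, RCLike.norm_conj]
      have := hlow y h
      gcongr
      linarith
    · simp; positivity
  have hK : 0 < 4 / (1 - ‖x₀‖) := by positivity
  obtain ⟨Φ₁, a1, e1⟩ := exists_analytic_log_integral hK m1 n1 bmh x₀
  obtain ⟨Φ₂, a2, e2⟩ := exists_analytic_log_integral hK m2 n2 hs x₀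
  have hlogint : ∀ x, ‖x‖ ≤ 1 →
      Integrable (fun y => Real.log ‖x - y‖ * (χ y * s y)) Lam ∧
      ∫ y, Real.log ‖x - y‖ * (χ y * s y) ∂Lam = ∫ y, Real.log ‖x - y‖ * (χ y * s y) ∂aream := by
    intro x hx
    have hz : (fun y => Real.log ‖x - y‖ * (χ y * s y)) =ᵐ[arcm] 0 :=
      arcm_ae fun y hy => by simp [hχ0 y hy]
    have hi : Integrable (fun y => Real.log ‖x - y‖ * (χ y * s y)) Lam := by
      unfold Lam
      exact (integrable_log_mul bmg hx).add_measure ((integrable_congr hz).2 (integrable_zero _ _ _))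
    refine ⟨hi, ?_⟩
    rw [integral_Lam hi, integral_congr_ae hz]
    simp
  set c : ℝ := pot s x₀ + (2 * π)⁻¹ * ∫ y, Real.log ‖x₀ - y‖ * (χ y * s y) ∂aream with hc
  refine ⟨χ, hsub, fun x => c - ((2 * π)⁻¹ : ℝ) * Φ₁ x - ((2 * π)⁻¹ : ℝ) * Φ₂ x, ?_, ?_⟩
  · exact (analyticAt_const.sub (analyticAt_const.mul a1)).sub (analyticAt_const.mul a2)
  filter_upwards [e1, e2, ball_mem_nhds x₀ hd] with x h1 h2 hx
  have hx1 : ‖x‖ < 1 := by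
    have := norm_le_norm_add_norm_sub' x x₀
    rw [mem_ball, dist_eq_norm] at hx
    linarith
  have key : (fun y => nker x y * s y) =ᵐ[Lam] fun y => nker x₀ y * s y -
      (Real.log ‖x - y‖ * (χ y * s y) - Real.log ‖x₀ - y‖ * (χ y * s y)) -
      Real.log ‖1 + (x - x₀) * b₁ y‖ * (s y - χ y * s y) -
      Real.log ‖1 + (x - x₀) * b₂ y‖ * s y := by
    filter_upwards [Lam_ae (p := fun y => ‖y‖ ≤ 1) fun _ h => h, Lam_ae_ne x, Lam_ae_ne x₀]
      with y hy hyx hyx₀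
    have p1 := norm_pos_iff.2 (sub_ne_zero.2 hyx.symm)
    have p2 := norm_pos_iff.2 (sub_ne_zero.2 hyx₀.symm)
    have q1 : 0 < ‖1 - x₀ * (starRingEnd ℂ) y‖ := by linarith [hlow y hy]
    have q2 : 0 < ‖1 - x * (starRingEnd ℂ) y‖ := by
      have h1 := norm_sub_norm_le (1 : ℂ) (x * (starRingEnd ℂ) y)
      rw [norm_one, norm_mul, RCLike.norm_conj] at h1
      nlinarith [norm_nonneg x, norm_nonneg y]
    have t2 : Real.log ‖1 + (x - x₀) * b₂ y‖ =
        Real.log ‖1 - x * (starRingEnd ℂ) y‖ - Real.log ‖1 - x₀ * (starRingEnd ℂ) y‖ := by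
      rw [← Real.log_div q2.ne' q1.ne', ← norm_div]
      congr 2
      simp only [hb₂, if_pos hy]
      have := norm_pos_iff.1 q1
      field_simp
      ring
    have t1 : Real.log ‖1 + (x - x₀) * b₁ y‖ * (s y - χ y * s y) =
        (Real.log ‖x - y‖ - Real.log ‖x₀ - y‖) * (s y - χ y * s y) := by
      by_cases h : (1 - ‖x₀‖) / 4 < ‖x₀ - y‖
      · congr 1
        rw [← Real.log_div p1.ne' p2.ne', ← norm_div]
        congr 2
        simp only [hb₁, if_pos h]
        have := norm_pos_iff.1 p2
        field_simp
        ring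
      · have : χ y = 1 := χ.one_of_mem_closedBall (by
          rw [mem_closedBall, dist_eq_norm, norm_sub_rev]; exact not_lt.1 h)
        simp [this]
    rw [t1, t2]
    unfold nker
    ring
  have i0 : Integrable (fun y => nker x₀ y * s y) Lam := hs.mul_integrable (integrable_nker hx₀.le)
  have i1 := (hlogint x hx1.le).1
  have i2 := (hlogint x₀ hx₀.le).1
  have hpot : ∀ z, ‖z‖ ≤ 1 → pot s z = (2 * π)⁻¹ * ∫ y, nker z y * s y ∂Lam := fun z hz => by
    rw [pot, clamp_of_le hz]
  have i12 : Integrable (fun y => Real.log ‖x - y‖ * (χ y * s y) -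
    Real.log ‖x₀ - y‖ * (χ y * s y)) Lam := i1.sub i2
  have i012 : Integrable (fun y => nker x₀ y * s y -
      (Real.log ‖x - y‖ * (χ y * s y) - Real.log ‖x₀ - y‖ * (χ y * s y))) Lam := i0.sub i12
  rw [hpot x hx1.le, integral_congr_ae key, integral_sub_sub i012 h1.1 h2.1,
    integral_sub i0 i12, integral_sub i1 i2, (hlogint x hx1.le).2, (hlogint x₀ hx₀.le).2, h1.2, h2.2,
    Complex.sub_re, Complex.sub_re, Complex.re_ofReal_mul, Complex.re_ofReal_mul, Complex.ofReal_re,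
    hc, hpot x₀ hx₀.le]
  ring

lemma reMul_add (p q : ℂ) : reMul (p + q) = reMul p + reMul q := by
  refine ContinuousLinearMap.ext fun h => ?_
  simp [add_mul]

lemma reMul_smul (c : ℝ) (p : ℂ) : reMul (c * p) = c • reMul p := by
  refine ContinuousLinearMap.ext fun h => ?_
  simp [mul_assoc]

lemma reMul_injective : Function.Injective reMul := fun p q h => by
  have h1 := congrArg (fun L => L 1) h
  have h2 := congrArg (fun L => L Complex.I) h
  simp at h1 h2
  exact Complex.ext h1 (by linarith)

/-- `reMul` as a continuous linear map. -/
def reMulL : ℂ →L[ℝ] ℂ →L[ℝ] ℝ :=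
  (ContinuousLinearMap.compL ℝ ℂ ℂ ℝ Complex.reCLM).comp (ContinuousLinearMap.mul ℝ ℂ)

lemma reMulL_apply (p : ℂ) : reMulL p = reMul p := rfl

lemma HasDerivAt.hasFDerivAt_re {Φ : ℂ → ℂ} {d x : ℂ} (h : HasDerivAt Φ d x) :
    HasFDerivAt (fun x => (Φ x).re) (reMul d) x := by
  have e : reMul d = Complex.reCLM.comp (d • (1 : ℂ →L[ℝ] ℂ)) :=
    ContinuousLinearMap.ext fun y => by simp
  rw [e]
  exact Complex.reCLM.hasFDerivAt.comp x h.complexToReal_fderiv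

/-- Local form of the gradient of a potential whose density is smooth near an interior point. -/
lemma exists_local_gradient {s : ℂ → ℝ} {M : ℝ} (hs : BM s M) {n : ℕ}
    (hsn : ∀ x, ‖x‖ < 1 → ContDiffAt ℝ n s x) {x₀ : ℂ} (hx₀ : ‖x₀‖ < 1) :
    ∃ p : ℂ → ℂ, ContDiffAt ℝ n p x₀ ∧ (∀ᶠ x in 𝓝 x₀, HasFDerivAt (pot s) (reMul (p x)) x) ∧
      (1 ≤ n → (fderiv ℝ p x₀ 1 + Complex.I * fderiv ℝ p x₀ Complex.I).re = -s x₀) := by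
  obtain ⟨χ, hsub, Φ, hΦ, hdec⟩ := pot_decomp hs hx₀
  set g : ℂ → ℝ := fun y => χ y * s y with hg
  have hgs : tsupport g ⊆ closedBall x₀ χ.rOut := by
    rw [← χ.tsupport_eq]; exact tsupport_mul_subset_left
  have hgc : HasCompactSupport g :=
    (isCompact_closedBall x₀ χ.rOut).of_isClosed_subset (isClosed_tsupport g) hgs
  have hgn : ContDiff ℝ n g := by
    rw [contDiff_iff_contDiffAt]
    intro x
    by_cases hx : x ∈ tsupport g
    · exact χ.contDiffAt.mul (hsn x (mem_ball_zero_iff.1 (hsub (hgs hx))))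
    · exact contDiffAt_const.congr_of_eventuallyEq (notMem_tsupport_iff_eventuallyEq.1 hx)
  have bmg : BM g (1 * M) := BM.mul ⟨χ.continuous.measurable, fun x => by
    rw [abs_of_nonneg χ.nonneg]; exact χ.le_one⟩ hs
  have hcau : ∀ x, ∫ y, (x - y)⁻¹ * (g y : ℂ) ∂aream = cauchyT g x := fun x => by
    rw [cauchyT_eq, aream]
    refine setIntegral_eq_integral_of_forall_compl_eq_zero fun y hy => ?_
    rw [image_eq_zero_of_notMem_tsupport fun h => hy (hsub (hgs h))]
    simp
  refine ⟨fun x => ((-(2 * π)⁻¹ : ℝ) : ℂ) * cauchyT g x + deriv Φ x, ?_, ?_, ?_⟩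
  · exact (contDiffAt_const.mul (contDiff_cauchyT hgc hgn).contDiffAt).add
      (hΦ.deriv.contDiffAt.restrict_scalars ℝ)
  · have hev : ∀ᶠ x in 𝓝 x₀, ‖x‖ < 1 := (isOpen_lt continuous_norm continuous_const).mem_nhds hx₀
    filter_upwards [hdec.eventually_nhds, hev, hΦ.eventually_analyticAt] with x h1 h2 h3
    have d1 := (hasFDerivAt_logPotential bmg h2).const_mul (-(2 * π)⁻¹)
    rw [hcau] at d1
    have d2 := d1.add h3.differentiableAt.hasDerivAt.hasFDerivAt_re
    rw [reMul_add, reMul_smul]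
    exact d2.congr_of_eventuallyEq h1
  · intro hn
    have hgn1 : ContDiff ℝ 1 g := hgn.of_le (by exact_mod_cast hn)
    have dc : DifferentiableAt ℝ (cauchyT g) x₀ :=
      ((contDiff_cauchyT (n := 1) hgc (by exact_mod_cast hgn1)).differentiable (by norm_num)) x₀
    have dΦ := hΦ.deriv.differentiableAt.hasDerivAt.complexToReal_fderiv
    have hd : HasFDerivAt (fun x => ((-(2 * π)⁻¹ : ℝ) : ℂ) * cauchyT g x + deriv Φ x)
        (((-(2 * π)⁻¹ : ℝ) : ℂ) • fderiv ℝ (cauchyT g) x₀ + deriv (deriv Φ) x₀ • (1 : ℂ →L[ℝ] ℂ))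
        x₀ := (dc.hasFDerivAt.const_mul ((-(2 * π)⁻¹ : ℝ) : ℂ)).add dΦ
    have e := re_dbar_cauchyT hgc hgn1 x₀
    have hg0 : g x₀ = s x₀ := by
      simp only [hg]
      rw [χ.one_of_mem_closedBall (mem_closedBall_self χ.rIn_pos.le), one_mul]
    rw [hd.fderiv]
    simp only [add_apply, smul_apply, smul_eq_mul,
      one_apply_eq_self]
    have e3 : ∀ (c A B D : ℂ), c * A + D * 1 + Complex.I * (c * B + D * Complex.I) =
        c * (A + Complex.I * B) := fun c A B D => by
      linear_combination D * Complex.I_mul_I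
    rw [e3, Complex.re_ofReal_mul, e, hg0]
    field_simp

lemma wexp_glue_contDiffAt {f j u : ℂ → ℝ} (hf : ContDiffOn ℝ (⊤ : ℕ∞) f cdisc) {n : ℕ} {x : ℂ}
    (hx : ‖x‖ < 1) (hu : ContDiffAt ℝ n u x) : ContDiffAt ℝ n (wexp (glue f j) u) x := by
  have hev : ∀ᶠ y in 𝓝 x, ‖y‖ < 1 := (isOpen_lt continuous_norm continuous_const).mem_nhds hx
  have hf' : ContDiffAt ℝ n f x := (hf.contDiffAt (mem_of_superset hev fun y hy =>
    mem_cdisc.2 (le_of_lt hy))).of_le (by exact_mod_cast le_top)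
  refine (hf'.mul (contDiffAt_const (c := (2 : ℝ)) |>.mul hu).exp).congr_of_eventuallyEq ?_
  filter_upwards [hev] with y hy
  rw [wexp, glue_of_lt hy, kap_of_lt hy]

/-- Interior regularity of solutions of the integral equation. -/
lemma Sol.contDiffAt {f j u : ℂ → ℝ} (hf : ContDiffOn ℝ (⊤ : ℕ∞) f cdisc) (hu : Sol (glue f j) u)
    (n : ℕ) : ∀ x, ‖x‖ < 1 → ContDiffAt ℝ n u x := by
  obtain ⟨M, hM⟩ := hu.dens.bm
  obtain ⟨c, hc⟩ := hu.eq
  induction n with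
  | zero => exact fun x _ => contDiff_zero.2 hu.cont |>.contDiffAt
  | succ n ih =>
    intro x₀ hx₀
    obtain ⟨p, hp, hder, -⟩ := exists_local_gradient hM (fun x hx => wexp_glue_contDiffAt hf hx (ih x hx)) hx₀
    have e : u = fun x => pot (wexp (glue f j) u) x + c := funext hc
    rw [e]
    push_cast
    refine ContDiffAt.add (contDiffAt_succ_iff_hasFDerivAt.2 ⟨fun x => reMul (p x), ?_, ?_⟩)
      contDiffAt_const
    · exact ⟨_, hder, fun x hx => hx⟩
    · exact reMulL.contDiff.contDiffAt.comp x₀ hp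

/-- The complex gradient `2 ∂_z u = u_x - i u_y`. -/
def cgrad (u : ℂ → ℝ) (x : ℂ) : ℂ := fderiv ℝ u x 1 - Complex.I * fderiv ℝ u x Complex.I

lemma reMul_cgrad (u : ℂ → ℝ) (x : ℂ) : reMul (cgrad u x) = fderiv ℝ u x := by
  refine ContinuousLinearMap.ext fun h => ?_
  have e : h = h.re • (1 : ℂ) + h.im • Complex.I := by simp
  have e' : fderiv ℝ u x h = h.re * fderiv ℝ u x 1 + h.im * fderiv ℝ u x Complex.I := by
    conv_lhs => rw [e, map_add, map_smul, map_smul]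
    rfl
  rw [e']
  simp [cgrad]
  ring

lemma cgrad_of_hasFDerivAt {u : ℂ → ℝ} {x p : ℂ} (h : HasFDerivAt u (reMul p) x) :
    cgrad u x = p := reMul_injective (by rw [reMul_cgrad, h.fderiv])

lemma contDiffAt_cgrad {u : ℂ → ℝ} {x : ℂ} {n : ℕ} (h : ContDiffAt ℝ (n + 1) u x) :
    ContDiffAt ℝ n (cgrad u) x := by
  have h1 : ContDiffAt ℝ n (fderiv ℝ u) x := h.fderiv_right le_rfl
  exact (Complex.ofRealCLM.contDiff.contDiffAt.comp x (h1.clm_apply contDiffAt_const)).sub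
    (contDiffAt_const.mul
      (Complex.ofRealCLM.contDiff.contDiffAt.comp x (h1.clm_apply contDiffAt_const)))

/-- Symmetry of second derivatives in terms of the complex gradient. -/
lemma im_dbar_cgrad {u : ℂ → ℝ} {x : ℂ} (h : ContDiffAt ℝ 2 u x) :
    (fderiv ℝ (cgrad u) x 1 + Complex.I * fderiv ℝ (cgrad u) x Complex.I).im = 0 := by
  have h1 : DifferentiableAt ℝ (cgrad u) x :=
    (contDiffAt_cgrad (n := 1) (by exact_mod_cast h)).differentiableAt (by norm_num)
  have h2 : HasFDerivAt (fun y => reMul (cgrad u y)) (reMulL.comp (fderiv ℝ (cgrad u) x)) x :=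
    reMulL.hasFDerivAt.comp x h1.hasFDerivAt
  have h3 : ∀ᶠ y in 𝓝 x, HasFDerivAt u (reMul (cgrad u y)) y := by
    filter_upwards [h.eventually (by simp)] with y hy
    rw [reMul_cgrad]
    exact (hy.differentiableAt (by norm_num)).hasFDerivAt
  have := second_derivative_symmetric_of_eventually h3 h2 1 Complex.I
  simp [reMulL_apply] at this
  simp
  linarith

/-- The equation `-Δu = f e^{2u}` in terms of the complex gradient. -/
lemma Sol.dbar_cgrad {f j u : ℂ → ℝ} (hf : ContDiffOn ℝ (⊤ : ℕ∞) f cdisc)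
    (hu : Sol (glue f j) u) {x : ℂ} (hx : ‖x‖ < 1) :
    fderiv ℝ (cgrad u) x 1 + Complex.I * fderiv ℝ (cgrad u) x Complex.I =
      -((f x * Real.exp (2 * u x) : ℝ) : ℂ) := by
  obtain ⟨M, hM⟩ := hu.dens.bm
  obtain ⟨c, hc⟩ := hu.eq
  obtain ⟨p, hp, hder, hlap⟩ := exists_local_gradient (n := 1) hM
    (fun x hx => wexp_glue_contDiffAt hf hx (hu.contDiffAt hf 1 x hx)) hx
  have e : cgrad u =ᶠ[𝓝 x] p := by
    filter_upwards [hder] with y hy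
    refine cgrad_of_hasFDerivAt ?_
    have e : u = fun x => pot (wexp (glue f j) u) x + c := funext hc
    rw [e]
    exact hy.add_const c
  have hw : wexp (glue f j) u x = f x * Real.exp (2 * u x) := by
    rw [wexp, glue_of_lt hx, kap_of_lt hx]
  refine Complex.ext ?_ ?_
  · rw [e.fderiv_eq, hlap le_rfl, hw, Complex.neg_re, Complex.ofReal_re]
  · rw [im_dbar_cgrad (hu.contDiffAt hf 2 x hx), Complex.neg_im, Complex.ofReal_im,
      neg_zero]

lemma fderiv_apply_comm {g : ℂ → ℝ} {x : ℂ} (h : ContDiffAt ℝ 2 g x) (p q : ℂ) :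
    fderiv ℝ (fun y => fderiv ℝ g y p) x q = fderiv ℝ (fun y => fderiv ℝ g y q) x p := by
  have h1 : DifferentiableAt ℝ (fderiv ℝ g) x :=
    (h.fderiv_right (m := 1) (by norm_num)).differentiableAt (by norm_num)
  have e : ∀ r s, fderiv ℝ (fun y => fderiv ℝ g y r) x s = fderiv ℝ (fderiv ℝ g) x s r := by
    intro r s
    have := (h1.hasFDerivAt.clm_apply (hasFDerivAt_const r x)).fderiv
    rw [this]
    simp
  rw [e, e]
  exact (h.isSymmSndFDerivAt (by simp)).eq q p

lemma isOpen_lhp : IsOpen {ζ : ℂ | ζ.re < 0} := isOpen_lt Complex.continuous_re continuous_const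

lemma hasFDerivAt_reMul {g : ℂ → ℝ} {x : ℂ} (h : DifferentiableAt ℝ g x) {a b : ℝ}
    (ha : fderiv ℝ g x 1 = a) (hb : fderiv ℝ g x Complex.I = b) :
    HasFDerivAt g (reMul (a - Complex.I * b)) x := by
  have : reMul (a - Complex.I * b) = fderiv ℝ g x := by rw [← reMul_cgrad, cgrad, ha, hb]
  rw [this]
  exact h.hasFDerivAt

/-- Continuity of the partial derivatives up to the boundary of the left half-plane gives
differentiability on the closed half-plane. -/
lemma hasFDerivWithinAt_lhp {g a b : ℂ → ℝ} (hg : Continuous g) (ha : Continuous a)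
    (hb : Continuous b) (h : ∀ ζ : ℂ, ζ.re < 0 → HasFDerivAt g (reMul (a ζ - Complex.I * b ζ)) ζ)
    (ζ : ℂ) : HasFDerivWithinAt g (reMul (a ζ - Complex.I * b ζ)) {ζ | ζ.re ≤ 0} ζ := by
  rw [← Complex.closure_setOfPred_re_lt]
  refine hasFDerivWithinAt_closure_of_tendsto_fderiv
    (fun x hx => (h x hx).differentiableAt.differentiableWithinAt) (convex_halfSpace_re_lt 0)
    isOpen_lhp (fun y _ => hg.continuousWithinAt) ?_
  have hc : Continuous fun ζ : ℂ => reMul (a ζ - Complex.I * b ζ) :=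
    reMulL.continuous.comp (by fun_prop)
  refine ((hc.tendsto ζ).mono_left nhdsWithin_le_nhds).congr' ?_
  filter_upwards [self_mem_nhdsWithin] with y hy
  exact (h y hy).fderiv.symm

/-- A function on the left half-plane whose horizontal derivative is continuous up to the boundary
extends continuously. -/
lemma exists_continuous_extension {a k : ℂ → ℝ} (hk : Continuous k)
    (hd : ∀ ζ : ℂ, ζ.re < 0 → DifferentiableAt ℝ a ζ)
    (h : ∀ ζ : ℂ, ζ.re < 0 → fderiv ℝ a ζ 1 = k ζ) :
    ∃ A : ℂ → ℝ, Continuous A ∧ ∀ ζ : ℂ, ζ.re < 0 → A ζ = a ζ := by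
  refine ⟨fun ζ => a (-1 + ζ.im * Complex.I) +
    ∫ σ in (-1 : ℝ)..ζ.re, k (σ + ζ.im * Complex.I), ?_, fun ζ hζ => ?_⟩
  · refine Continuous.add ?_ ?_
    · refine continuous_iff_continuousAt.2 fun ζ => ?_
      have h1 : ContinuousAt a (-1 + ζ.im * Complex.I) := (hd _ (by simp)).continuousAt
      exact ContinuousAt.comp (f := fun ζ : ℂ => (-1 + ζ.im * Complex.I : ℂ)) h1
        (by fun_prop)
    · exact intervalIntegral.continuous_parametric_intervalIntegral_of_continuous
        (f := fun (ζ : ℂ) (σ : ℝ) => k (σ + ζ.im * Complex.I)) (by fun_prop) Complex.continuous_re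
  · have hder : ∀ σ ∈ uIcc (-1 : ℝ) ζ.re, HasDerivAt (fun σ : ℝ => a (σ + ζ.im * Complex.I))
        (k (σ + ζ.im * Complex.I)) σ := fun σ hσ => by
      have hlt : σ < 0 := hσ.2.trans_lt (max_lt (by norm_num) hζ)
      have hre : ((σ : ℂ) + ζ.im * Complex.I).re < 0 := by simpa using hlt
      have h1 : HasDerivAt (fun σ : ℝ => (σ + ζ.im * Complex.I : ℂ)) 1 σ :=
        (Complex.ofRealCLM.hasDerivAt (x := σ)).add_const _
      have h2 := (hd _ hre).hasFDerivAt.comp_hasDerivAt σ h1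
      rw [h _ hre] at h2
      exact h2
    have := intervalIntegral.integral_eq_sub_of_hasDerivAt hder
      ((by fun_prop : Continuous fun σ : ℝ => k (σ + ζ.im * Complex.I)).intervalIntegrable _ _)
    simp only [this, Complex.re_add_im]
    push_cast
    ring

/-- Second-order regularity up to the boundary of the left half-plane, from tangential regularity
and an expression for the second normal derivative. -/
lemma exists_lhp_derivs {v b l k k' : ℂ → ℝ} (hv : Continuous v) (hb : Continuous b)
    (hl : Continuous l) (hk : Continuous k) (hk' : Continuous k')
    (hv3 : ∀ ζ : ℂ, ζ.re < 0 → ContDiffAt ℝ 3 v ζ)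
    (h1 : ∀ ζ : ℂ, ζ.re < 0 → fderiv ℝ v ζ Complex.I = b ζ)
    (h2 : ∀ ζ : ℂ, ζ.re < 0 → fderiv ℝ b ζ Complex.I = l ζ)
    (h3 : ∀ ζ : ℂ, ζ.re < 0 → fderiv ℝ (fun y => fderiv ℝ v y 1) ζ 1 = k ζ)
    (h4 : ∀ ζ : ℂ, ζ.re < 0 → fderiv ℝ k ζ Complex.I = k' ζ) :
    ∃ a m : ℂ → ℝ, Continuous a ∧ Continuous m ∧
      (∀ ζ, HasFDerivWithinAt v (reMul (a ζ - Complex.I * b ζ)) {ζ | ζ.re ≤ 0} ζ) ∧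
      (∀ ζ, HasFDerivWithinAt a (reMul (k ζ - Complex.I * m ζ)) {ζ | ζ.re ≤ 0} ζ) ∧
      (∀ ζ, HasFDerivWithinAt b (reMul (m ζ - Complex.I * l ζ)) {ζ | ζ.re ≤ 0} ζ) := by
  have hd : ∀ p (ζ : ℂ), ζ.re < 0 → ContDiffAt ℝ 2 (fun y => fderiv ℝ v y p) ζ := fun p ζ hζ =>
    ((hv3 ζ hζ).fderiv_right (m := 2) (by norm_num)).clm_apply contDiffAt_const
  have hd1 : ∀ p (ζ : ℂ), ζ.re < 0 → DifferentiableAt ℝ (fun y => fderiv ℝ v y p) ζ :=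
    fun p ζ hζ => (hd p ζ hζ).differentiableAt (by norm_num)
  have hev : ∀ ζ : ℂ, ζ.re < 0 → ∀ᶠ y : ℂ in 𝓝 ζ, y.re < 0 := fun ζ hζ => isOpen_lhp.mem_nhds hζ
  obtain ⟨a, hac, ha⟩ := exists_continuous_extension hk (hd1 1) h3
  have h5 : ∀ ζ : ℂ, ζ.re < 0 → fderiv ℝ
      (fun y => fderiv ℝ (fun y => fderiv ℝ v y 1) y Complex.I) ζ 1 = k' ζ := fun ζ hζ => by
    rw [fderiv_apply_comm (hd 1 ζ hζ), ← h4 ζ hζ]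
    exact congrArg (fun L : ℂ →L[ℝ] ℝ => L Complex.I) (Filter.EventuallyEq.fderiv_eq
      ((hev ζ hζ).mono fun y hy => h3 y hy))
  obtain ⟨m, hmc, hm⟩ := exists_continuous_extension hk' (fun ζ hζ =>
    (((hd 1 ζ hζ).fderiv_right (m := 1) (by norm_num)).clm_apply
      (contDiffAt_const (c := Complex.I))).differentiableAt (by norm_num)) h5
  have ea : ∀ ζ : ℂ, ζ.re < 0 → a =ᶠ[𝓝 ζ] fun y => fderiv ℝ v y 1 := fun ζ hζ =>
    (hev ζ hζ).mono fun y hy => ha y hy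
  have eb : ∀ ζ : ℂ, ζ.re < 0 → b =ᶠ[𝓝 ζ] fun y => fderiv ℝ v y Complex.I := fun ζ hζ =>
    (hev ζ hζ).mono fun y hy => (h1 y hy).symm
  refine ⟨a, m, hac, hmc, hasFDerivWithinAt_lhp hv hac hb fun ζ hζ => ?_,
    hasFDerivWithinAt_lhp hac hk hmc fun ζ hζ => ?_,
    hasFDerivWithinAt_lhp hb hmc hl fun ζ hζ => ?_⟩
  · exact hasFDerivAt_reMul ((hv3 ζ hζ).differentiableAt (by norm_num)) (ha ζ hζ).symm (h1 ζ hζ)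
  · refine hasFDerivAt_reMul ((ea ζ hζ).differentiableAt_iff.2 (hd1 1 ζ hζ)) ?_ ?_
    · rw [(ea ζ hζ).fderiv_eq, h3 ζ hζ]
    · rw [(ea ζ hζ).fderiv_eq, hm ζ hζ]
  · refine hasFDerivAt_reMul ((eb ζ hζ).differentiableAt_iff.2 (hd1 Complex.I ζ hζ)) ?_ (h2 ζ hζ)
    rw [(eb ζ hζ).fderiv_eq, hm ζ hζ,
      fderiv_apply_comm ((hv3 ζ hζ).of_le (by norm_num))]

lemma hasFDerivAt_cgrad {v : ℂ → ℝ} {x : ℂ} (h : ContDiffAt ℝ 2 v x) :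
    HasFDerivAt (cgrad v) (Complex.ofRealCLM.comp (fderiv ℝ (fun y => fderiv ℝ v y 1) x) -
      Complex.I • Complex.ofRealCLM.comp (fderiv ℝ (fun y => fderiv ℝ v y Complex.I) x)) x := by
  have h1 : ∀ p, DifferentiableAt ℝ (fun y => fderiv ℝ v y p) x := fun p =>
    ((h.fderiv_right (m := 1) (by norm_num)).clm_apply contDiffAt_const).differentiableAt
      (by norm_num)
  have h2 : ∀ p, HasFDerivAt (fun y => ((fderiv ℝ v y p : ℝ) : ℂ))
      (Complex.ofRealCLM.comp (fderiv ℝ (fun y => fderiv ℝ v y p) x)) x := fun p =>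
    Complex.ofRealCLM.hasFDerivAt.comp x (h1 p).hasFDerivAt
  exact (h2 1).sub ((h2 Complex.I).const_mul Complex.I)

lemma re_dbar_cgrad {v : ℂ → ℝ} {x : ℂ} (h : ContDiffAt ℝ 2 v x) :
    (fderiv ℝ (cgrad v) x 1 + Complex.I * fderiv ℝ (cgrad v) x Complex.I).re =
      fderiv ℝ (fun y => fderiv ℝ v y 1) x 1 +
        fderiv ℝ (fun y => fderiv ℝ v y Complex.I) x Complex.I := by
  rw [(hasFDerivAt_cgrad h).fderiv]
  simp

lemma hasFDerivAt_comp_cexp {u : ℂ → ℝ} {ζ : ℂ} (h : DifferentiableAt ℝ u (Complex.exp ζ)) :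
    HasFDerivAt (fun ζ => u (Complex.exp ζ))
      (reMul (cgrad u (Complex.exp ζ) * Complex.exp ζ)) ζ := by
  have h1 : HasFDerivAt u (reMul (cgrad u (Complex.exp ζ))) (Complex.exp ζ) := by
    rw [reMul_cgrad]; exact h.hasFDerivAt
  have h2 : HasFDerivAt Complex.exp (Complex.exp ζ • (1 : ℂ →L[ℝ] ℂ)) ζ :=
    (Complex.hasDerivAt_exp ζ).complexToReal_fderiv
  have e : reMul (cgrad u (Complex.exp ζ) * Complex.exp ζ) =
      (reMul (cgrad u (Complex.exp ζ))).comp (Complex.exp ζ • (1 : ℂ →L[ℝ] ℂ)) :=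
    ContinuousLinearMap.ext fun y => by
      simp only [reMul_apply, ContinuousLinearMap.comp_apply, smul_apply, one_apply_eq_self,
        smul_eq_mul, mul_assoc]
  rw [e]
  exact h1.comp ζ h2

/-- The Laplacian in logarithmic coordinates. -/
lemma laplacian_comp_cexp {u : ℂ → ℝ} {ζ : ℂ}
    (h : ∀ᶠ x in 𝓝 (Complex.exp ζ), ContDiffAt ℝ 2 u x) :
    fderiv ℝ (fun y => fderiv ℝ (fun ζ => u (Complex.exp ζ)) y 1) ζ 1 +
      fderiv ℝ (fun y => fderiv ℝ (fun ζ => u (Complex.exp ζ)) y Complex.I) ζ Complex.I =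
    Real.exp (2 * ζ.re) * (fderiv ℝ (cgrad u) (Complex.exp ζ) 1 +
      Complex.I * fderiv ℝ (cgrad u) (Complex.exp ζ) Complex.I).re := by
  set w := Complex.exp ζ with hw
  have hu := h.self_of_nhds
  have hexp : ContDiffAt ℝ 2 Complex.exp ζ := Complex.contDiff_exp.contDiffAt
  rw [← re_dbar_cgrad (v := fun ζ => u (Complex.exp ζ)) (ContDiffAt.comp ζ hu hexp)]
  have eq : cgrad (fun ζ => u (Complex.exp ζ)) =ᶠ[𝓝 ζ]
      fun ζ => cgrad u (Complex.exp ζ) * Complex.exp ζ := by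
    filter_upwards [Complex.continuous_exp.continuousAt.eventually h] with y hy
    exact cgrad_of_hasFDerivAt (hasFDerivAt_comp_cexp (hy.differentiableAt (by norm_num)))
  have h2 : HasFDerivAt Complex.exp (w • (1 : ℂ →L[ℝ] ℂ)) ζ :=
    (Complex.hasDerivAt_exp ζ).complexToReal_fderiv
  have h1 : HasFDerivAt (cgrad u) (fderiv ℝ (cgrad u) w) w :=
    (hasFDerivAt_cgrad hu).differentiableAt.hasFDerivAt
  set L := fderiv ℝ (cgrad u) w
  have h3 : HasFDerivAt (fun ζ => cgrad u (Complex.exp ζ) * Complex.exp ζ)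
      (cgrad u w • (w • (1 : ℂ →L[ℝ] ℂ)) + w • L.comp (w • (1 : ℂ →L[ℝ] ℂ))) ζ :=
    (h1.comp ζ h2).mul h2
  rw [eq.fderiv_eq, h3.fderiv]
  have eL : ∀ y : ℂ, L y = y.re * L 1 + y.im * L Complex.I := fun y => by
    conv_lhs => rw [show y = y.re • (1 : ℂ) + y.im • Complex.I by simp, map_add, map_smul, map_smul]
    simp
  have hn : ((Real.exp (2 * ζ.re) : ℝ) : ℂ) = w * (w.re - w.im * Complex.I) := by
    have : w * (w.re - w.im * Complex.I) = (Complex.normSq w : ℂ) := by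
      refine Complex.ext ?_ ?_ <;> simp [Complex.normSq_apply]
      ring
    rw [this, Complex.normSq_eq_norm_sq, hw, Complex.norm_exp, ← Real.exp_nat_mul]
    norm_num
  rw [← Complex.re_ofReal_mul, hn]
  congr 1
  simp only [add_apply, smul_apply, ContinuousLinearMap.comp_apply, one_apply_eq_self, smul_eq_mul]
  rw [eL (w * 1), eL (w * Complex.I)]
  simp
  ring_nf
  rw [Complex.I_sq]
  ring

lemma RD.hasDerivAt {g g' : ℂ → ℝ} (h : RD g g') (ζ : ℂ) :
    HasDerivAt (fun τ : ℝ => g (Complex.exp (ζ + τ * Complex.I))) (g' (Complex.exp ζ)) 0 := by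
  rw [hasDerivAt_iff_tendsto_slope_zero]
  refine (h.lim.tendsto (Complex.exp ζ)).congr fun t => ?_
  simp only [dq, zero_add, Complex.ofReal_zero, zero_mul, add_zero, smul_eq_mul, bpt]
  rw [Complex.exp_add, mul_comm (Complex.exp _) (Complex.exp ζ), div_eq_inv_mul]

lemma fderiv_I_of_hasDerivAt {g : ℂ → ℝ} {ζ : ℂ} {d : ℝ} (hg : DifferentiableAt ℝ g ζ)
    (h : HasDerivAt (fun τ : ℝ => g (ζ + τ * Complex.I)) d 0) : fderiv ℝ g ζ Complex.I = d := by
  have h1 : HasDerivAt (fun τ : ℝ => (ζ + τ * Complex.I : ℂ)) Complex.I 0 := by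
    have := ((Complex.ofRealCLM.hasDerivAt (x := 0)).mul_const Complex.I).const_add ζ
    simpa using this
  have h2 : HasFDerivAt g (fderiv ℝ g ζ) (ζ + (0 : ℝ) * Complex.I) := by simpa using hg.hasFDerivAt
  exact (h2.comp_hasDerivAt 0 h1).unique h

lemma norm_cexp_lt {ζ : ℂ} (h : ζ.re < 0) : ‖Complex.exp ζ‖ < 1 := by
  rw [Complex.norm_exp]; exact Real.exp_zero ▸ Real.exp_lt_exp.2 h

/-- Second-order regularity of solutions up to the boundary, in logarithmic coordinates. -/
lemma Sol.exists_lhp_derivs {f j u : ℂ → ℝ} (hf : ContDiffOn ℝ (⊤ : ℕ∞) f cdisc)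
    (hj : ContDiffOn ℝ (⊤ : ℕ∞) j cdisc) (hu : Sol (glue f j) u) :
    ∃ a b k m l : ℂ → ℝ, Continuous a ∧ Continuous b ∧ Continuous k ∧ Continuous m ∧
      Continuous l ∧
      (∀ ζ, HasFDerivWithinAt (fun ζ => u (Complex.exp ζ)) (reMul (a ζ - Complex.I * b ζ))
        {ζ | ζ.re ≤ 0} ζ) ∧
      (∀ ζ, HasFDerivWithinAt a (reMul (k ζ - Complex.I * m ζ)) {ζ | ζ.re ≤ 0} ζ) ∧
      (∀ ζ, HasFDerivWithinAt b (reMul (m ζ - Complex.I * l ζ)) {ζ | ζ.re ≤ 0} ζ) := by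
  obtain ⟨u₁, u₂, u₃, c1, c2, c3, r1, r2, r3⟩ := hu.exists_rot_derivs hf hj
  set F : ℂ → ℝ := fun ζ => f (clamp (Complex.exp ζ))
  set F' : ℂ → ℝ := fun ζ => rder f (clamp (Complex.exp ζ))
  set E : ℂ → ℝ := fun ζ => Real.exp (2 * u (Complex.exp ζ))
  set k : ℂ → ℝ := fun ζ => -u₂ (Complex.exp ζ) - Real.exp (2 * ζ.re) * (F ζ * E ζ) with hk
  set k' : ℂ → ℝ := fun ζ => -u₃ (Complex.exp ζ) -
    Real.exp (2 * ζ.re) * (F' ζ * E ζ + F ζ * (E ζ * (2 * u₁ (Complex.exp ζ)))) with hk'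
  have hce : Continuous Complex.exp := Complex.continuous_exp
  have hFc : Continuous F := (continuous_comp_clamp hf.continuousOn).comp hce
  have hF'c : Continuous F' := (continuous_comp_clamp (rder_contDiffOn hf).continuousOn).comp hce
  have huc := hu.cont
  have hEc : Continuous E := by fun_prop
  have hkc : Continuous k := by fun_prop
  have hk'c : Continuous k' := by fun_prop
  have hv : ∀ n : ℕ, ∀ ζ : ℂ, ζ.re < 0 → ContDiffAt ℝ n (fun ζ => u (Complex.exp ζ)) ζ :=
    fun n ζ hζ => (hu.contDiffAt hf n _ (norm_cexp_lt hζ)).comp ζ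
      (Complex.contDiff_exp (𝕜 := ℝ)).contDiffAt
  have hd : ∀ p q (ζ : ℂ), ζ.re < 0 → DifferentiableAt ℝ
      (fun y => fderiv ℝ (fun y => fderiv ℝ (fun ζ => u (Complex.exp ζ)) y p) y q) ζ := by
    intro p q ζ hζ
    have h3 : ContDiffAt ℝ 2 (fderiv ℝ (fun ζ => u (Complex.exp ζ))) ζ :=
      (hv 3 ζ hζ).fderiv_right (by norm_num)
    have h2 := (h3.clm_apply (contDiffAt_const (c := p))).fderiv_right (m := 1) (by norm_num)
    exact (h2.clm_apply (contDiffAt_const (c := q))).differentiableAt (by norm_num)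
  have hd1 : ∀ p (ζ : ℂ), ζ.re < 0 → DifferentiableAt ℝ
      (fun y => fderiv ℝ (fun ζ => u (Complex.exp ζ)) y p) ζ := by
    intro p ζ hζ
    have h3 : ContDiffAt ℝ 1 (fderiv ℝ (fun ζ => u (Complex.exp ζ))) ζ :=
      (hv 2 ζ hζ).fderiv_right (by norm_num)
    exact (h3.clm_apply (contDiffAt_const (c := p))).differentiableAt (by norm_num)
  have hev : ∀ ζ : ℂ, ζ.re < 0 → ∀ᶠ y : ℂ in 𝓝 ζ, y.re < 0 := fun ζ hζ => isOpen_lhp.mem_nhds hζ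
  have e1 : ∀ ζ : ℂ, ζ.re < 0 →
      fderiv ℝ (fun ζ => u (Complex.exp ζ)) ζ Complex.I = u₁ (Complex.exp ζ) := fun ζ hζ =>
    fderiv_I_of_hasDerivAt ((hv 1 ζ hζ).differentiableAt (by norm_num)) (r1.hasDerivAt ζ)
  have e2 : ∀ ζ : ℂ, ζ.re < 0 →
      fderiv ℝ (fun ζ => u₁ (Complex.exp ζ)) ζ Complex.I = u₂ (Complex.exp ζ) := fun ζ hζ =>
    fderiv_I_of_hasDerivAt ((hd1 Complex.I ζ hζ).congr_of_eventuallyEq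
      ((hev ζ hζ).mono fun y hy => (e1 y hy).symm)) (r2.hasDerivAt ζ)
  have e3 : ∀ ζ : ℂ, ζ.re < 0 →
      fderiv ℝ (fun y => fderiv ℝ (fun ζ => u (Complex.exp ζ)) y 1) ζ 1 = k ζ := fun ζ hζ => by
    have hlt := norm_cexp_lt hζ
    have h1 := laplacian_comp_cexp (u := u) (ζ := ζ)
      (mem_of_superset ((isOpen_lt continuous_norm continuous_const).mem_nhds hlt) fun x hx =>
        hu.contDiffAt hf 2 x hx)
    have h2 : fderiv ℝ (fun y => fderiv ℝ (fun ζ => u (Complex.exp ζ)) y Complex.I) ζ Complex.I =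
        u₂ (Complex.exp ζ) := by
      rw [← e2 ζ hζ]
      exact congrArg (fun L : ℂ →L[ℝ] ℝ => L Complex.I) (Filter.EventuallyEq.fderiv_eq
        ((hev ζ hζ).mono fun y hy => e1 y hy))
    rw [h2, hu.dbar_cgrad hf hlt, Complex.neg_re, Complex.ofReal_re] at h1
    simp only [hk, F, E]
    rw [clamp_of_le hlt.le]
    linarith
  have e4 : ∀ ζ : ℂ, ζ.re < 0 → fderiv ℝ k ζ Complex.I = k' ζ := fun ζ hζ => by
    have hlt := norm_cexp_lt hζ
    refine fderiv_I_of_hasDerivAt ((hd 1 1 ζ hζ).congr_of_eventuallyEq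
      ((hev ζ hζ).mono fun y hy => (e3 y hy).symm)) ?_
    have dF : HasDerivAt (fun τ : ℝ => F (ζ + τ * Complex.I)) (F' ζ) 0 := by
      have h1 := hasDerivAt_rot (hf.differentiableOn (by simp)) hlt.le 0
      simp only [F, F']
      rw [clamp_of_le hlt.le]
      have b0 : bpt 0 = 1 := by simp [bpt]
      rw [b0, one_mul] at h1
      refine h1.congr_of_eventuallyEq (Eventually.of_forall fun τ => ?_)
      simp only
      rw [Complex.exp_add, mul_comm, ← bpt, clamp_of_le (by rw [norm_bpt_mul]; exact hlt.le)]
    have dE : HasDerivAt (fun τ : ℝ => E (ζ + τ * Complex.I)) (E ζ * (2 * u₁ (Complex.exp ζ))) 0 := by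
      have h := ((r1.hasDerivAt ζ).const_mul 2).exp
      simpa [E] using h
    have h5 := (r3.hasDerivAt ζ).neg.sub ((dF.mul dE).const_mul (Real.exp (2 * ζ.re)))
    have h6 : HasDerivAt (fun τ : ℝ => k (ζ + τ * Complex.I)) _ 0 :=
      h5.congr_of_eventuallyEq (Eventually.of_forall fun τ => by simp [hk])
    exact h6.congr_deriv (by simp [hk'])
  obtain ⟨a, m, ha, hm, d1, d2, d3⟩ := _root_.exists_lhp_derivs (huc.comp hce) (c1.comp hce)
    (c2.comp hce) hkc hk'c (hv 3) e1 e2 e3 e4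
  exact ⟨a, fun ζ => u₁ (Complex.exp ζ), k, m, fun ζ => u₂ (Complex.exp ζ), ha, c1.comp hce, hkc, hm,
    c2.comp hce, d1, d2, d3⟩

lemma uniqueDiffOn_lhp : UniqueDiffOn ℝ {ζ : ℂ | ζ.re ≤ 0} := by
  rw [← Complex.closure_setOfPred_re_lt]
  refine uniqueDiffOn_convex (convex_halfSpace_re_lt 0).closure ⟨-1, ?_⟩
  exact interior_mono subset_closure (isOpen_lhp.interior_eq.symm ▸ (by simp))

lemma contDiffOn_one_lhp {g c d : ℂ → ℝ} (hc : Continuous c) (hd : Continuous d)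
    (h : ∀ ζ, HasFDerivWithinAt g (reMul (c ζ - Complex.I * d ζ)) {ζ | ζ.re ≤ 0} ζ) :
    ContDiffOn ℝ 1 g {ζ | ζ.re ≤ 0} := by
  refine (contDiffOn_succ_iff_hasFDerivWithinAt_of_uniqueDiffOn (n := 0) uniqueDiffOn_lhp).2
    ⟨by simp, fun ζ => reMul (c ζ - Complex.I * d ζ), ?_, fun ζ _ => h ζ⟩
  have : Continuous fun ζ : ℂ => reMul (c ζ - Complex.I * d ζ) :=
    reMulL.continuous.comp (by fun_prop)
  exact contDiffOn_zero.2 this.continuousOn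

lemma contDiffOn_two_lhp {v a b k l m : ℂ → ℝ} (hk : Continuous k) (hm : Continuous m)
    (hl : Continuous l)
    (h1 : ∀ ζ, HasFDerivWithinAt v (reMul (a ζ - Complex.I * b ζ)) {ζ | ζ.re ≤ 0} ζ)
    (h2 : ∀ ζ, HasFDerivWithinAt a (reMul (k ζ - Complex.I * m ζ)) {ζ | ζ.re ≤ 0} ζ)
    (h3 : ∀ ζ, HasFDerivWithinAt b (reMul (m ζ - Complex.I * l ζ)) {ζ | ζ.re ≤ 0} ζ) :
    ContDiffOn ℝ 2 v {ζ | ζ.re ≤ 0} := by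
  refine (contDiffOn_succ_iff_hasFDerivWithinAt_of_uniqueDiffOn (n := 1) uniqueDiffOn_lhp).2
    ⟨by simp, fun ζ => reMul (a ζ - Complex.I * b ζ), ?_, fun ζ _ => h1 ζ⟩
  refine reMulL.contDiff.comp_contDiffOn ?_
  exact (Complex.ofRealCLM.contDiff.comp_contDiffOn (contDiffOn_one_lhp hk hm h2)).sub
    (contDiffOn_const.mul (Complex.ofRealCLM.contDiff.comp_contDiffOn (contDiffOn_one_lhp hm hl h3)))

/-- Solutions of the integral equation are of class `C²` up to the boundary. -/
lemma Sol.contDiffOn {f j u : ℂ → ℝ} (hf : ContDiffOn ℝ (⊤ : ℕ∞) f cdisc)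
    (hj : ContDiffOn ℝ (⊤ : ℕ∞) j cdisc) (hu : Sol (glue f j) u) : ContDiffOn ℝ 2 u cdisc := by
  obtain ⟨a, b, k, m, l, -, -, ck, cm, cl, d1, d2, d3⟩ := hu.exists_lhp_derivs hf hj
  have hv := contDiffOn_two_lhp ck cm cl d1 d2 d3
  intro z hz
  rcases (mem_cdisc.1 hz).lt_or_eq with h | h
  · exact (hu.contDiffAt hf 2 z h).contDiffWithinAt
  have hz0 : z ≠ 0 := norm_pos_iff.1 (by rw [h]; exact one_pos)
  obtain ⟨θ, rfl⟩ := exists_bpt h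
  set L : ℂ → ℂ := fun x => θ * Complex.I + Complex.log (x / bpt θ)
  have hL : ContDiffAt ℝ 2 L (bpt θ) := by
    refine contDiffAt_const.add ?_
    have h1 : ContDiffAt ℝ 2 Complex.log (bpt θ / bpt θ) := by
      rw [div_self hz0]
      exact (Complex.contDiffAt_log (by simp)).restrict_scalars ℝ
    exact ContDiffAt.comp (f := fun x => x / bpt θ) (bpt θ) h1 (contDiffAt_id.div_const (bpt θ))
  have hm : MapsTo L cdisc {ζ | ζ.re ≤ 0} := fun x hx => by
    simp only [L, mem_ofPred_eq, Complex.add_re, Complex.log_re, norm_div, h, div_one]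
    simpa using Real.log_nonpos (norm_nonneg x) (mem_cdisc.1 hx)
  have hcomp := ContDiffWithinAt.comp (bpt θ) (hv (L (bpt θ)) (hm hz)) hL.contDiffWithinAt hm
  refine hcomp.congr_of_eventuallyEq ?_ ?_
  · filter_upwards [mem_nhdsWithin_of_mem_nhds (isOpen_ne.mem_nhds hz0)] with x hx
    simp only [Function.comp_apply, L]
    rw [Complex.exp_add, Complex.exp_log (div_ne_zero hx hz0), ← bpt, mul_div_cancel₀ _ hz0]
  · simp only [Function.comp_apply, L]
    rw [Complex.exp_add, Complex.exp_log (div_ne_zero hz0 hz0), ← bpt, mul_div_cancel₀ _ hz0]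

lemma lapW_eq (w : ℂ → ℝ) {z : ℂ} (hz : ‖z‖ < 1) :
    lapW w z = fderiv ℝ (fun y => fderiv ℝ w y 1) z 1 +
      fderiv ℝ (fun y => fderiv ℝ w y Complex.I) z Complex.I := by
  have hev : ∀ z : ℂ, ‖z‖ < 1 → cdisc ∈ 𝓝 z := fun z hz =>
    mem_of_superset (isOpen_ball.mem_nhds (mem_ball_zero_iff.2 hz)) ball_subset_closedBall
  have e : ∀ p, fderivWithin ℝ (fun x => fderivWithin ℝ w cdisc x p) cdisc z =
      fderiv ℝ (fun y => fderiv ℝ w y p) z := fun p => by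
    rw [fderivWithin_of_mem_nhds (hev z hz)]
    refine Filter.EventuallyEq.fderiv_eq ?_
    filter_upwards [(isOpen_lt continuous_norm continuous_const).mem_nhds hz] with y hy
    rw [fderivWithin_of_mem_nhds (hev y hy)]
  rw [lapW, e, e]

lemma Sol.lapW {f j u : ℂ → ℝ} (hf : ContDiffOn ℝ (⊤ : ℕ∞) f cdisc) (hu : Sol (glue f j) u) {z : ℂ}
    (hz : ‖z‖ < 1) : -lapW u z = f z * Real.exp (2 * u z) := by
  rw [lapW_eq u hz, ← re_dbar_cgrad (hu.contDiffAt hf 2 z hz), hu.dbar_cgrad hf hz, Complex.neg_re,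
    Complex.ofReal_re, neg_neg]

lemma nder_eq_of_comp_cexp {u : ℂ → ℝ} {ζ p : ℂ} (hu : DifferentiableOn ℝ u cdisc) (hζ : ζ.re ≤ 0)
    (h : HasFDerivWithinAt (fun ζ => u (Complex.exp ζ)) (reMul p) {ζ | ζ.re ≤ 0} ζ) :
    nder u (Complex.exp ζ) = p.re := by
  have hm : MapsTo Complex.exp {ζ | ζ.re ≤ 0} cdisc := fun x hx => mem_cdisc.2 (by
    rw [Complex.norm_exp]; exact Real.exp_le_one_iff.2 hx)
  have h2 : HasFDerivAt Complex.exp (Complex.exp ζ • (1 : ℂ →L[ℝ] ℂ)) ζ :=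
    (Complex.hasDerivAt_exp ζ).complexToReal_fderiv
  have h1 := (hu _ (hm hζ)).hasFDerivWithinAt.comp ζ h2.hasFDerivWithinAt hm
  have := congrArg (fun L : ℂ →L[ℝ] ℝ => L 1) ((uniqueDiffOn_lhp ζ hζ).eq h1 h)
  simpa [nder] using this

/-- The radial difference quotient of the kernel at a boundary point. -/
def rker (z : ℂ) (r : ℝ) (y : ℂ) : ℝ := (nker z y - nker (r * z) y) / (1 - r)

lemma measurable_rker (z : ℂ) (r : ℝ) : Measurable (rker z r) :=
  ((measurable_nker_left z).sub (measurable_nker_left _)).div_const _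

lemma nker_smul_eq {z y : ℂ} (hz : ‖z‖ = 1) (r : ℝ) :
    nker (r * z) y = -Real.log ‖(r : ℂ) - (starRingEnd ℂ) z * y‖ -
      Real.log ‖1 - r * ((starRingEnd ℂ) z * y)‖ := by
  have hzz : z * (starRingEnd ℂ) z = 1 := by
    rw [Complex.mul_conj, Complex.normSq_eq_norm_sq, hz]; simp
  have e1 : ‖(r : ℂ) * z - y‖ = ‖(r : ℂ) - (starRingEnd ℂ) z * y‖ := by
    have : (r : ℂ) * z - y = z * ((r : ℂ) - (starRingEnd ℂ) z * y) := by
      linear_combination (-y) * (-hzz)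
    rw [this, norm_mul, hz, one_mul]
  have e2 : ‖1 - (r : ℂ) * z * (starRingEnd ℂ) y‖ = ‖1 - r * ((starRingEnd ℂ) z * y)‖ := by
    rw [← Complex.norm_conj]
    simp [mul_assoc]
  rw [nker, e1, e2]

lemma tendsto_rker {z y : ℂ} (hz : ‖z‖ = 1) (hy : ‖y‖ ≤ 1) (hne : y ≠ z) :
    Tendsto (fun r => rker z r y) (𝓝[<] 1) (𝓝 (-1)) := by
  set c := (starRingEnd ℂ) z * y with hc
  have hzz : z * (starRingEnd ℂ) z = 1 := by
    rw [Complex.mul_conj, Complex.normSq_eq_norm_sq, hz]; simp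
  have hcn : ‖c‖ ≤ 1 := by rw [hc, norm_mul, Complex.norm_conj, hz, one_mul]; exact hy
  have hc1 : c ≠ 1 := fun h => hne (by
    have : z * c = y := by rw [hc, ← mul_assoc, hzz, one_mul]
    rw [h, mul_one] at this; exact this.symm)
  have hre : 0 < (1 - c).re := by
    have h1 : c.re ≤ 1 := (Complex.re_le_norm c).trans hcn
    rcases h1.lt_or_eq with h | h
    · simpa using h
    · exfalso
      have h2 := Complex.sq_norm c
      rw [Complex.normSq_apply, h] at h2
      have h3 : c.im = 0 := by nlinarith [norm_nonneg c]
      exact hc1 (Complex.ext h h3)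
  have hsl : 1 - c ∈ Complex.slitPlane := Or.inl hre
  have hne1 : (1 - c) ≠ 0 := sub_ne_zero.2 hc1.symm
  have hd : HasDerivAt (fun r : ℝ => nker (r * z) y) (-1) 1 := by
    have g1 : HasDerivAt (fun r : ℂ => Complex.log (r - c)) ((1 : ℂ) / (1 - c)) ((1 : ℝ) : ℂ) := by
      have h := ((hasDerivAt_id ((1 : ℝ) : ℂ)).sub_const c).clog
        (by simpa using hsl)
      simpa using h
    have g2 : HasDerivAt (fun r : ℂ => Complex.log (1 - r * c)) (-c / (1 - c)) ((1 : ℝ) : ℂ) := by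
      have h := (((hasDerivAt_id ((1 : ℝ) : ℂ)).mul_const c).const_sub 1).clog
        (by simpa using hsl)
      simpa using h
    have g := (g1.neg.sub g2).real_of_complex
    have e : (-((1 : ℂ) / (1 - c)) - -c / (1 - c)).re = -1 := by
      have : (-((1 : ℂ) / (1 - c)) - -c / (1 - c)) = -1 := by field_simp; ring
      rw [this]; simp
    rw [e] at g
    refine g.congr_of_eventuallyEq (Eventually.of_forall fun r => ?_)
    simp only [nker_smul_eq hz]
    simp [Complex.log_re, hc]
  have h1 := (hasDerivWithinAt_iff_tendsto_slope' (by simp)).1 (hd.hasDerivWithinAt (s := Iio 1))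
  refine h1.congr' ?_
  filter_upwards [self_mem_nhdsWithin] with r hr
  have hr' : r - 1 ≠ 0 := sub_ne_zero.2 (ne_of_lt hr)
  have hr'' : 1 - r ≠ 0 := sub_ne_zero.2 (ne_of_gt hr)
  rw [slope_def_field, rker]
  simp only [Complex.ofReal_one, one_mul]
  field_simp
  ring

lemma abs_rker_le {z y : ℂ} {r : ℝ} (hz : ‖z‖ = 1) (hr0 : 0 ≤ r) (hr1 : r < 1) (hy : ‖y‖ ≤ 1)
    (h1 : y ≠ z) (h2 : y ≠ r * z) : |rker z r y| ≤ 2 * (‖z - y‖⁻¹ + ‖r * z - y‖⁻¹) := by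
  have hrz : ‖(r : ℂ) * z‖ ≤ 1 := by
    rw [norm_mul, hz, Complex.norm_real, Real.norm_of_nonneg hr0, mul_one]; exact hr1.le
  have p1 : 0 < ‖z - y‖ := norm_pos_iff.2 (sub_ne_zero.2 h1.symm)
  have p2 : 0 < ‖r * z - y‖ := norm_pos_iff.2 (sub_ne_zero.2 h2.symm)
  have q1 := norm_sub_le_norm_one_sub hz.le hy
  have q2 := norm_sub_le_norm_one_sub hrz hy
  have hd : ‖z - r * z‖ = 1 - r := by
    rw [show z - r * z = ((1 - r : ℝ) : ℂ) * z by push_cast; ring, norm_mul, hz, mul_one,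
      Complex.norm_real, Real.norm_of_nonneg (by linarith)]
  have b1 := abs_log_sub_log_le_mul_inv p1 p2 (h := 1 - r) (by
    refine (abs_norm_sub_norm_le _ _).trans ?_
    rw [show r * z - y - (z - y) = -(z - r * z) by ring, norm_neg, hd])
  have b2 := abs_log_sub_log_le_mul_inv (p1.trans_le q1) (p2.trans_le q2) (h := 1 - r) (by
    refine (abs_norm_sub_norm_le _ _).trans ?_
    rw [show 1 - r * z * (starRingEnd ℂ) y - (1 - z * (starRingEnd ℂ) y) =
      (z - r * z) * (starRingEnd ℂ) y by ring, norm_mul, hd, Complex.norm_conj]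
    exact mul_le_of_le_one_right (by linarith) hy)
  have i1 := inv_anti₀ p1 q1
  have i2 := inv_anti₀ p2 q2
  have hpos : 0 < 1 - r := by linarith
  rw [rker, abs_div, abs_of_pos hpos, div_le_iff₀ hpos]
  have hb : nker z y - nker (r * z) y = (Real.log ‖r * z - y‖ - Real.log ‖z - y‖) +
      (Real.log ‖1 - r * z * (starRingEnd ℂ) y‖ - Real.log ‖1 - z * (starRingEnd ℂ) y‖) := by
    rw [nker, nker]; ring
  rw [hb]
  refine (abs_add_le _ _).trans ?_
  nlinarith [mul_le_mul_of_nonneg_left i1 hpos.le, mul_le_mul_of_nonneg_left i2 hpos.le]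

lemma abs_rker_le_arc {z y : ℂ} {r : ℝ} (hz : ‖z‖ = 1) (hr0 : 0 ≤ r) (hr1 : r < 1) (hy : ‖y‖ = 1)
    (h1 : y ≠ z) : |rker z r y| ≤ 6 * ‖z - y‖⁻¹ := by
  have hrz : ‖(r : ℂ) * z‖ = r := by
    rw [norm_mul, hz, Complex.norm_real, Real.norm_of_nonneg hr0, mul_one]
  have h2 : y ≠ r * z := fun h => by rw [h, hrz] at hy; linarith
  have hd : ‖z - r * z‖ = 1 - r := by
    rw [show z - r * z = ((1 - r : ℝ) : ℂ) * z by push_cast; ring, norm_mul, hz, mul_one,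
      Complex.norm_real, Real.norm_of_nonneg (by linarith)]
  have p1 : 0 < ‖z - y‖ := norm_pos_iff.2 (sub_ne_zero.2 h1.symm)
  have h3 : ‖z - y‖ ≤ 2 * ‖r * z - y‖ := by
    have t1 := norm_sub_le_norm_sub_add_norm_sub z (r * z) y
    have t2 := norm_sub_norm_le y (r * z)
    rw [norm_sub_rev y] at t2
    linarith
  have i : ‖r * z - y‖⁻¹ ≤ 2 * ‖z - y‖⁻¹ := by
    have := inv_anti₀ p1 h3
    rw [mul_inv] at this
    linarith
  linarith [abs_rker_le hz hr0 hr1 hy.le h1 h2]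

lemma integral_nker_arcm {x : ℂ} (hx : ‖x‖ ≤ 1) : ∫ y, nker x y ∂arcm = 0 := by
  have e : ∫ y, nker x y ∂arcm = ∫ y, -2 * Real.log ‖y - x‖ ∂arcm := by
    refine integral_congr_ae (arcm_ae fun y hy => ?_)
    have : ‖1 - x * (starRingEnd ℂ) y‖ = ‖x - y‖ := by
      have h := norm_one_sub_conj_sq x y
      rw [hy] at h
      refine (sq_eq_sq₀ (norm_nonneg _) (norm_nonneg _)).1 ?_
      linarith
    simp only
    rw [nker, this, norm_sub_rev y]
    ring
  rw [e, integral_const_mul, integral_arcm (by fun_prop : Measurable _).aestronglyMeasurable]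
  have h := circleAverage_log_norm_sub_const_eq_posLog (a := x)
  rw [Real.circleAverage, (Real.posLog_eq_zero_iff _).2 (by rwa [abs_norm])] at h
  have h2 := (smul_eq_zero.1 h).resolve_left (by positivity)
  have e2 : ∀ θ, circleMap 0 1 θ = bpt θ := fun θ => by simp [circleMap, bpt]
  simp only [e2] at h2
  rw [h2, mul_zero]

lemma eventually_Ioo_left {δ : ℝ} (hδ : 0 < δ) : ∀ᶠ r : ℝ in 𝓝[<] 1, 0 ≤ r ∧ r < 1 ∧ 1 - r < δ := by
  have h := Ioo_mem_nhdsLT (show max (0 : ℝ) (1 - δ) < 1 from max_lt one_pos (by linarith))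
  filter_upwards [h] with r hr
  have h2 := lt_of_le_of_lt (le_max_right (0 : ℝ) (1 - δ)) hr.1
  exact ⟨(le_max_left _ _).trans hr.1.le, hr.2, by linarith⟩

lemma tendsto_integral_rker_arcm {s : ℂ → ℝ} {M C : ℝ} (hs : BM s M) {z : ℂ} (hz : ‖z‖ = 1)
    (hC : ∀ y, ‖y‖ = 1 → |s y - s z| ≤ C * √‖z - y‖) :
    Tendsto (fun r => ∫ y, rker z r y * s y ∂arcm) (𝓝[<] 1)
      (𝓝 (2 * π * s z - ∫ y, s y ∂arcm)) := by
  obtain ⟨R, -, hR⟩ := riesz_arc (α := 1 / 2) (by norm_num) (by norm_num)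
  have hne : ∀ᵐ y ∂arcm, y ≠ z := (Lam_ae_iff.1 (Lam_ae_ne z)).2
  have harc : Integrable s arcm := hs.integrable.mono_measure (by rw [Lam]; exact Measure.le_add_left le_rfl)
  have h1 : Tendsto (fun r => ∫ y, rker z r y * (s y - s z) ∂arcm) (𝓝[<] 1)
      (𝓝 (∫ y, -1 * (s y - s z) ∂arcm)) := by
    refine tendsto_integral_filter_of_dominated_convergence
      (fun y => 6 * C * ‖z - y‖ ^ (-(1 / 2) : ℝ)) ?_ ?_ (((hR z hz.le).1).const_mul _) ?_
    · exact Eventually.of_forall fun r =>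
        ((measurable_rker z r).mul (hs.meas.sub_const _)).aestronglyMeasurable
    · filter_upwards [eventually_Ioo_left one_pos] with r hr
      filter_upwards [arcm_ae (p := fun y => ‖y‖ = 1) fun _ h => h, hne] with y hy hyz
      have p1 : 0 < ‖z - y‖ := norm_pos_iff.2 (sub_ne_zero.2 hyz.symm)
      have h1 := mul_le_mul (abs_rker_le_arc hz hr.1 hr.2.1 hy hyz) (hC y hy) (abs_nonneg _)
        (by positivity)
      rw [Real.norm_eq_abs, abs_mul]
      refine h1.trans (le_of_eq ?_)
      rw [Real.rpow_neg p1.le, ← Real.sqrt_eq_rpow]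
      have hq := Real.sqrt_pos.2 p1
      have : ‖z - y‖ = √‖z - y‖ * √‖z - y‖ := (Real.mul_self_sqrt p1.le).symm
      rw [show ‖z - y‖⁻¹ = (√‖z - y‖)⁻¹ * (√‖z - y‖)⁻¹ by rw [← mul_inv, ← this]]
      field_simp
    · filter_upwards [arcm_ae (p := fun y => ‖y‖ = 1) fun _ h => h, hne] with y hy hyz
      exact (tendsto_rker hz hy.le hyz).mul_const _
  have e0 : ∫ y, -1 * (s y - s z) ∂arcm = 2 * π * s z - ∫ y, s y ∂arcm := by
    rw [integral_const_mul, integral_sub harc (integrable_const _), integral_const, arcm_univ, smul_eq_mul]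
    ring
  rw [e0] at h1
  refine h1.congr' ?_
  filter_upwards [eventually_Ioo_left one_pos] with r hr
  have hrz : ‖(r : ℂ) * z‖ ≤ 1 := by
    rw [norm_mul, hz, Complex.norm_real, Real.norm_of_nonneg hr.1, mul_one]; exact hr.2.1.le
  have hle : arcm ≤ Lam := by rw [Lam]; exact Measure.le_add_left le_rfl
  have i1 := (integrable_nker hz.le).mono_measure hle
  have i2 := (integrable_nker hrz).mono_measure hle
  have ik : Integrable (rker z r) arcm := (i1.sub i2).div_const _
  have e1 : ∫ y, rker z r y ∂arcm = 0 := by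
    simp only [rker]
    rw [integral_div, integral_sub i1 i2, integral_nker_arcm hz.le, integral_nker_arcm hrz]
    simp
  have i3 : Integrable (fun y => rker z r y * s y) arcm :=
    ik.mul_bdd hs.meas.aestronglyMeasurable (c := M) (Eventually.of_forall hs.bd)
  simp only [mul_sub]
  rw [integral_sub i3 (ik.mul_const _), integral_mul_const, e1, zero_mul, sub_zero]

lemma inv_le_of_norm_le {a d : ℝ} (ha : 0 < a) (had : a ≤ d) :
    a⁻¹ ≤ √d * a ^ (-(3 / 2) : ℝ) := by
  rw [rpow_neg_three_half ha]
  have hs := Real.sqrt_pos.2 ha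
  have h1 : √a ≤ √d := Real.sqrt_le_sqrt had
  have : a⁻¹ = √a * (√a)⁻¹ ^ 3 := by
    rw [← Real.mul_self_sqrt ha.le]; simp only [Real.sqrt_mul_self hs.le]; field_simp
  rw [this]
  gcongr

lemma tendsto_integral_rker_aream {s : ℂ → ℝ} {M : ℝ} (hs : BM s M) {z : ℂ} (hz : ‖z‖ = 1) :
    Tendsto (fun r => ∫ y, rker z r y * s y ∂aream) (𝓝[<] 1) (𝓝 (-∫ y, s y ∂aream)) := by
  obtain ⟨R, hR0, hR⟩ := riesz_area (α := 3 / 2) (by norm_num)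
  have hle : aream ≤ Lam := by rw [Lam]; exact Measure.le_add_right le_rfl
  have hM := hs.nonneg
  have hsi : Integrable s aream := hs.integrable.mono_measure hle
  have hrz : ∀ r : ℝ, 0 ≤ r → r < 1 → ‖(r : ℂ) * z‖ ≤ 1 := fun r h0 h1 => by
    rw [norm_mul, hz, Complex.norm_real, Real.norm_of_nonneg h0, mul_one]; exact h1.le
  have hd : ∀ r : ℝ, r < 1 → ‖z - r * z‖ = 1 - r := fun r hr1 => by
    rw [show z - r * z = ((1 - r : ℝ) : ℂ) * z by push_cast; ring, norm_mul, hz, mul_one,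
      Complex.norm_real, Real.norm_of_nonneg (by linarith)]
  have ik : ∀ r : ℝ, 0 ≤ r → r < 1 → Integrable (rker z r) aream := fun r h0 h1 =>
    (((integrable_nker hz.le).mono_measure hle).sub
      ((integrable_nker (hrz r h0 h1)).mono_measure hle)).div_const _
  have iks : ∀ r : ℝ, 0 ≤ r → r < 1 → Integrable (fun y => (rker z r y + 1) * s y) aream :=
    fun r h0 h1 => ((ik r h0 h1).add (integrable_const 1)).mul_bdd hs.meas.aestronglyMeasurable
      (c := M) (Eventually.of_forall hs.bd)
  suffices h : Tendsto (fun r => ∫ y, (rker z r y + 1) * s y ∂aream) (𝓝[<] 1) (𝓝 0) by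
    have h2 := h.sub_const (∫ y, s y ∂aream)
    rw [zero_sub] at h2
    refine h2.congr' ?_
    filter_upwards [eventually_Ioo_left one_pos] with r hr
    have e : ∀ y, (rker z r y + 1) * s y = rker z r y * s y + s y := fun y => by ring
    simp only [e]
    have i3 : Integrable (fun y => rker z r y * s y) aream :=
      (ik r hr.1 hr.2.1).mul_bdd hs.meas.aestronglyMeasurable (c := M) (Eventually.of_forall hs.bd)
    rw [integral_add i3 hsi, add_sub_cancel_right]
  rw [Metric.tendsto_nhds]
  intro ε hε
  obtain ⟨δ, hδ0, hδ1, hδ⟩ : ∃ δ : ℝ, 0 < δ ∧ δ ≤ 1 ∧ √(2 * δ) * (M * (6 * R)) < ε / 2 := by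
    have hc : Tendsto (fun δ : ℝ => √(2 * δ) * (M * (6 * R))) (𝓝[>] 0) (𝓝 0) := by
      have : Continuous fun δ : ℝ => √(2 * δ) * (M * (6 * R)) := by fun_prop
      simpa using (this.tendsto 0).mono_left (nhdsWithin_le_nhds (s := Ioi 0))
    obtain ⟨δ, h1, h2⟩ := ((hc.eventually (gt_mem_nhds (half_pos hε))).and
      (Ioc_mem_nhdsGT (zero_lt_one (α := ℝ)))).exists
    exact ⟨δ, h2.1, h2.2, h1⟩
  set N := ball z δ
  have hfar : Tendsto (fun r => ∫ y in Nᶜ, (rker z r y + 1) * s y ∂aream) (𝓝[<] 1) (𝓝 0) := by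
    have h0 : ∫ y in Nᶜ, (-1 + 1) * s y ∂aream = 0 := by simp
    rw [← h0]
    refine tendsto_integral_filter_of_dominated_convergence
      (fun _ => (2 * (δ⁻¹ + 2 * δ⁻¹) + 1) * M) ?_ ?_ (integrable_const _) ?_
    · exact Eventually.of_forall fun r =>
        (((measurable_rker z r).add_const 1).mul hs.meas).aestronglyMeasurable
    · filter_upwards [eventually_Ioo_left (half_pos hδ0)] with r hr
      filter_upwards [ae_restrict_mem measurableSet_ball.compl,
        ae_restrict_of_ae (aream_ae (p := fun y => ‖y‖ < 1) fun _ h => h),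
        ae_restrict_of_ae (aream_ae_ne z), ae_restrict_of_ae (aream_ae_ne (r * z))]
        with y hyN hy1 hyz hyrz
      have hyd : δ ≤ ‖z - y‖ := by
        rw [mem_compl_iff, mem_ball, not_lt, dist_eq_norm, norm_sub_rev] at hyN; exact hyN
      have hyd2 : δ / 2 ≤ ‖r * z - y‖ := by
        have := norm_sub_le_norm_sub_add_norm_sub z (r * z) y
        rw [hd r hr.2.1] at this
        linarith [hr.2.2]
      have b := abs_rker_le hz hr.1 hr.2.1 hy1.le hyz hyrz
      have b1 := inv_anti₀ hδ0 hyd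
      have b2 := inv_anti₀ (half_pos hδ0) hyd2
      rw [inv_div] at b2
      rw [Real.norm_eq_abs, abs_mul]
      refine mul_le_mul ?_ (hs.bd y) (abs_nonneg _) (by positivity)
      refine (abs_add_le _ _).trans ?_
      rw [abs_one]
      have : 2 / δ = 2 * δ⁻¹ := div_eq_mul_inv _ _
      linarith
    · filter_upwards [ae_restrict_of_ae (aream_ae (p := fun y => ‖y‖ < 1) fun _ h => h),
        ae_restrict_of_ae (aream_ae_ne z)] with y hy1 hyz
      exact ((tendsto_rker hz hy1.le hyz).add_const 1).mul_const _
  filter_upwards [eventually_Ioo_left hδ0,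
    (Metric.tendsto_nhds.1 hfar) (ε / 2) (half_pos hε)] with r hr hrfar
  rw [dist_zero_right, Real.norm_eq_abs] at hrfar ⊢
  have hI := iks r hr.1 hr.2.1
  rw [← integral_add_compl measurableSet_ball hI]
  have g1 := (hR z hz.le).1
  have g2 := (hR _ (hrz r hr.1 hr.2.1)).1
  have hnear : |∫ y in N, (rker z r y + 1) * s y ∂aream| ≤ √(2 * δ) * (M * (6 * R)) := by
    have gi : Integrable (fun y => 3 * √(2 * δ) * M *
        (‖z - y‖ ^ (-(3 / 2) : ℝ) + ‖r * z - y‖ ^ (-(3 / 2) : ℝ))) aream := (g1.add g2).const_mul _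
    calc |∫ y in N, (rker z r y + 1) * s y ∂aream|
        ≤ ∫ y in N, 3 * √(2 * δ) * M *
          (‖z - y‖ ^ (-(3 / 2) : ℝ) + ‖r * z - y‖ ^ (-(3 / 2) : ℝ)) ∂aream := by
          rw [← Real.norm_eq_abs]
          refine norm_integral_le_of_norm_le gi.integrableOn ?_
          filter_upwards [ae_restrict_mem measurableSet_ball,
            ae_restrict_of_ae (aream_ae (p := fun y => ‖y‖ < 1) fun _ h => h),
            ae_restrict_of_ae (aream_ae_ne z), ae_restrict_of_ae (aream_ae_ne (r * z))]
            with y hyN hy1 hyz hyrz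
          have hyd : ‖z - y‖ < δ := by
            rw [mem_ball, dist_eq_norm, norm_sub_rev] at hyN; exact hyN
          have p1 : 0 < ‖z - y‖ := norm_pos_iff.2 (sub_ne_zero.2 hyz.symm)
          have p2 : 0 < ‖r * z - y‖ := norm_pos_iff.2 (sub_ne_zero.2 hyrz.symm)
          have hyd2 : ‖r * z - y‖ ≤ 2 * δ := by
            have := norm_sub_le_norm_sub_add_norm_sub (r * z) z y
            rw [norm_sub_rev, norm_sub_rev (_ * _) z, hd r hr.2.1] at this
            rw [norm_sub_rev]
            linarith [hr.2.2]
          have b := abs_rker_le hz hr.1 hr.2.1 hy1.le hyz hyrz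
          have b1 := inv_le_of_norm_le p1 (d := 2 * δ) (by linarith)
          have b2 := inv_le_of_norm_le p2 hyd2
          have b3 : 1 ≤ ‖z - y‖⁻¹ := (one_le_inv₀ p1).2 (by linarith)
          have b4 : 0 < ‖r * z - y‖⁻¹ := inv_pos.2 p2
          rw [Real.norm_eq_abs, abs_mul]
          have b5 : |rker z r y + 1| ≤ 3 * √(2 * δ) *
              (‖z - y‖ ^ (-(3 / 2) : ℝ) + ‖r * z - y‖ ^ (-(3 / 2) : ℝ)) := by
            refine (abs_add_le _ _).trans ?_
            rw [abs_one]
            linarith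
          calc _ ≤ _ := mul_le_mul b5 (hs.bd y) (abs_nonneg _) (by positivity)
            _ = _ := by ring
      _ ≤ ∫ y, 3 * √(2 * δ) * M *
          (‖z - y‖ ^ (-(3 / 2) : ℝ) + ‖r * z - y‖ ^ (-(3 / 2) : ℝ)) ∂aream :=
          setIntegral_le_integral gi (Eventually.of_forall fun y => by
            simp only [Pi.zero_apply]; positivity)
      _ ≤ 3 * √(2 * δ) * M * (R + R) := by
          rw [integral_const_mul, integral_add g1 g2]
          exact mul_le_mul_of_nonneg_left (add_le_add (hR z hz.le).2
            (hR _ (hrz r hr.1 hr.2.1)).2) (by positivity)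
      _ = _ := by ring
  refine (abs_add_le _ _).trans_lt ?_
  linarith

lemma exists_lipschitz_cdisc {g : ℂ → ℝ} (hg : ContDiffOn ℝ 1 g cdisc) :
    ∃ K, 0 ≤ K ∧ ∀ x y, ‖x‖ ≤ 1 → ‖y‖ ≤ 1 → |g y - g x| ≤ K * ‖y - x‖ := by
  obtain ⟨K, hK⟩ := (isCompact_closedBall (0 : ℂ) 1).exists_bound_of_continuousOn
    (hg.continuousOn_fderivWithin uniqueDiffOn_cdisc (by simp))
  refine ⟨K, (norm_nonneg _).trans (hK 0 (by simp)), fun x y hx hy => ?_⟩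
  have hc : Convex ℝ cdisc := convex_closedBall 0 1
  exact hc.norm_image_sub_le_of_norm_fderivWithin_le (hg.differentiableOn (by simp)) hK
    (mem_cdisc.2 hx) (mem_cdisc.2 hy)

/-- The normal derivative is the limit of radial difference quotients. -/
lemma tendsto_radial_nder {g : ℂ → ℝ} {z : ℂ} (hz : ‖z‖ = 1) (hg : DifferentiableWithinAt ℝ g cdisc z) :
    Tendsto (fun r : ℝ => (g z - g (r * z)) / (1 - r)) (𝓝[<] 1) (𝓝 (nder g z)) := by
  have hm : MapsTo (fun r : ℝ => (r : ℂ) * z) (Ioo 0 1) cdisc := fun r hr => mem_cdisc.2 (by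
    rw [norm_mul, hz, Complex.norm_real, Real.norm_of_nonneg hr.1.le, mul_one]; exact hr.2.le)
  have h2 : HasDerivWithinAt (fun r : ℝ => (r : ℂ) * z) z (Ioo 0 1) 1 := by
    simpa using ((hasDerivAt_id (1 : ℝ)).ofReal_comp.mul_const z).hasDerivWithinAt
  have h3 : HasFDerivWithinAt g (fderivWithin ℝ g cdisc z) cdisc ((fun r : ℝ => (r : ℂ) * z) 1) := by
    simpa using hg.hasFDerivWithinAt
  have h := (h3.comp_hasDerivWithinAt 1 h2 hm)
  rw [hasDerivWithinAt_iff_tendsto_slope' (by simp), nhdsWithin_Ioo_eq_nhdsLT one_pos] at h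
  refine h.congr' ?_
  filter_upwards [self_mem_nhdsWithin] with r hr
  rw [slope_def_field, Function.comp_apply, Function.comp_apply, Complex.ofReal_one, one_mul,
    ← neg_div_neg_eq, neg_sub, neg_sub]

lemma wexp_of_eq {F v : ℂ → ℝ} {x : ℂ} (hx : ‖x‖ = 1) : wexp F v x = F x * Real.exp (v x) := by
  rw [wexp, kap_of_eq hx, one_mul]

/-- Solutions of the integral equation satisfy the geodesic curvature boundary condition. -/
lemma Sol.nder_eq {f j u : ℂ → ℝ} (hf : ContDiffOn ℝ (⊤ : ℕ∞) f cdisc)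
    (hj : ContDiffOn ℝ (⊤ : ℕ∞) j cdisc) (hu : Sol (glue f j) u) {z : ℂ} (hz : ‖z‖ = 1) :
    nder u z + 1 = j z * Real.exp (u z) := by
  have hu2 := hu.contDiffOn hf hj
  have hg : ContDiffOn ℝ 1 (fun y => j y * Real.exp (u y)) cdisc :=
    (hj.of_le (by simp)).mul (hu2.of_le (by norm_num)).exp
  obtain ⟨K, hK0, hK⟩ := exists_lipschitz_cdisc hg
  set s := wexp (glue f j) u with hs
  have hsz : ∀ y, ‖y‖ = 1 → s y = j y * Real.exp (u y) := fun y hy => by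
    rw [hs, wexp_of_eq hy, glue_of_eq hy]
  obtain ⟨M, hM⟩ := hu.dens.toPB.bm
  have hH : ∀ y, ‖y‖ = 1 → |s y - s z| ≤ (2 * K) * √‖z - y‖ := fun y hy => by
    rw [hsz y hy, hsz z hz]
    refine (hK z y hz.le hy.le).trans ?_
    rw [norm_sub_rev]
    have h1 : ‖z - y‖ ≤ 2 := (norm_sub_le _ _).trans (by rw [hz, hy]; norm_num)
    have h2 : √‖z - y‖ ≤ 2 := Real.sqrt_le_iff.2 ⟨by norm_num, by linarith⟩
    have h3 := Real.mul_self_sqrt (norm_nonneg (z - y))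
    have h4 := Real.sqrt_nonneg ‖z - y‖
    have : ‖z - y‖ ≤ 2 * √‖z - y‖ := by nlinarith
    nlinarith
  have hlim := ((tendsto_integral_rker_aream hM hz).add
    (tendsto_integral_rker_arcm hM hz hH)).const_mul (2 * π)⁻¹
  have hmass : ∫ y, s y ∂aream + ∫ y, s y ∂arcm = 2 * π := by
    rw [← integral_Lam hM.integrable]; exact hu.dens.mass
  have e0 : (2 * π)⁻¹ * (-∫ y, s y ∂aream + (2 * π * s z - ∫ y, s y ∂arcm)) = s z - 1 := by
    rw [show -∫ y, s y ∂aream + (2 * π * s z - ∫ y, s y ∂arcm) = 2 * π * (s z - 1) by linarith]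
    field_simp
  rw [e0] at hlim
  have hrad := tendsto_radial_nder hz (hu2.differentiableOn (by simp) z (mem_cdisc.2 hz.le))
  obtain ⟨c, hc⟩ := hu.eq
  have hev : (fun r : ℝ => (u z - u (r * z)) / (1 - r)) =ᶠ[𝓝[<] 1] fun r =>
      (2 * π)⁻¹ * (∫ y, rker z r y * s y ∂aream + ∫ y, rker z r y * s y ∂arcm) := by
    filter_upwards [eventually_Ioo_left one_pos] with r hr
    have hrz : ‖(r : ℂ) * z‖ ≤ 1 := by
      rw [norm_mul, hz, Complex.norm_real, Real.norm_of_nonneg hr.1, mul_one]; exact hr.2.1.le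
    have i1 := integrable_nker hz.le
    have i2 := integrable_nker hrz
    have j1 : Integrable (fun y => nker z y * s y) Lam :=
      i1.mul_bdd hM.meas.aestronglyMeasurable (c := M) (Eventually.of_forall hM.bd)
    have j2 : Integrable (fun y => nker (r * z) y * s y) Lam :=
      i2.mul_bdd hM.meas.aestronglyMeasurable (c := M) (Eventually.of_forall hM.bd)
    have e : ∀ y, rker z r y * s y = (nker z y * s y - nker (r * z) y * s y) / (1 - r) := fun y => by
      rw [rker]; ring
    have j3 : Integrable (fun y => rker z r y * s y) Lam := by
      simp only [e]; exact (j1.sub j2).div_const _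
    rw [← integral_Lam j3, hc z, hc (r * z), _root_.pot, _root_.pot, clamp_of_le hz.le,
      clamp_of_le hrz]
    simp only [e]
    rw [integral_div, integral_sub j1 j2]
    ring
  have := tendsto_nhds_unique (hrad.congr' hev) hlim
  rw [this, hsz z hz]; ring

/-- A solution of the integral equation solves the prescribed curvature problem. -/
lemma Sol.prescribed {f j u : ℂ → ℝ} (hf : ContDiffOn ℝ (⊤ : ℕ∞) f cdisc)
    (hj : ContDiffOn ℝ (⊤ : ℕ∞) j cdisc) (hu : Sol (glue f j) u) :
    ContDiffOn ℝ 2 u cdisc ∧ (∀ z ∈ odisc, -_root_.lapW u z = f z * Real.exp (2 * u z)) ∧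
      ∀ z ∈ bdry, nder u z + 1 = j z * Real.exp (u z) :=
  ⟨hu.contDiffOn hf hj, fun _ hz => Sol.lapW hf hu (mem_odisc.1 hz),
    fun _ hz => hu.nder_eq hf hj (mem_bdry.1 hz)⟩

/-- The Schwarzian-type quantity `2 ∂_z p - p²` of the complex gradient `p` of `u`. -/
def schw (u : ℂ → ℝ) (x : ℂ) : ℂ :=
  fderiv ℝ (cgrad u) x 1 - Complex.I * fderiv ℝ (cgrad u) x Complex.I - cgrad u x ^ 2

lemma cgrad_eq (u : ℂ → ℝ) (x : ℂ) :
    cgrad u x = fderiv ℝ u x 1 - Complex.I * fderiv ℝ u x Complex.I := rfl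

lemma schw_differentiableAt {u : ℂ → ℝ} {f₀ : ℝ} {x : ℂ} (hu : ContDiffAt ℝ 3 u x)
    (h : ∀ᶠ y in 𝓝 x, fderiv ℝ (cgrad u) y 1 + Complex.I * fderiv ℝ (cgrad u) y Complex.I =
      -((f₀ * Real.exp (2 * u y) : ℝ) : ℂ)) : DifferentiableAt ℂ (schw u) x := by
  have hp : ContDiffAt ℝ 2 (cgrad u) x := contDiffAt_cgrad (n := 2) (by exact_mod_cast hu)
  have hp1 : HasFDerivAt (cgrad u) (fderiv ℝ (cgrad u) x) x :=
    (hp.differentiableAt (by norm_num)).hasFDerivAt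
  have hD : DifferentiableAt ℝ (fderiv ℝ (cgrad u)) x :=
    (hp.fderiv_right (m := 1) (by norm_num)).differentiableAt (by norm_num)
  set D := fderiv ℝ (fderiv ℝ (cgrad u)) x with hDdef
  have hA : ∀ q, HasFDerivAt (fun y => fderiv ℝ (cgrad u) y q) (D.flip q) x := fun q => by
    have := hD.hasFDerivAt.clm_apply (hasFDerivAt_const q x)
    refine this.congr_fderiv (ContinuousLinearMap.ext fun h => by simp [hDdef])
  have hsymm : D Complex.I 1 = D 1 Complex.I :=
    (hp.isSymmSndFDerivAt (by simp)).eq Complex.I 1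
  have hu1 : HasFDerivAt u (fderiv ℝ u x) x := (hu.differentiableAt (by norm_num)).hasFDerivAt
  have hρ : HasFDerivAt (fun y => -((f₀ * Real.exp (2 * u y) : ℝ) : ℂ))
      (-Complex.ofRealCLM.comp ((2 * (f₀ * Real.exp (2 * u x))) • fderiv ℝ u x)) x := by
    have h1 := (hu1.const_mul 2).exp.const_mul f₀
    have h2 := (Complex.ofRealCLM.hasFDerivAt.comp x h1).neg
    refine h2.congr_fderiv (ContinuousLinearMap.ext fun h => ?_)
    simp; ring
  have hlhs := (hA 1).add ((hA Complex.I).const_mul Complex.I)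
  have huniq := (hρ.congr_of_eventuallyEq h).unique hlhs
  have e1 := congrArg (fun L : ℂ →L[ℝ] ℂ => L 1) huniq
  have e2 := congrArg (fun L : ℂ →L[ℝ] ℂ => L Complex.I) huniq
  simp at e1 e2
  have hS : HasFDerivAt (schw u) (D.flip 1 - Complex.I • D.flip Complex.I -
      (2 * cgrad u x) • fderiv ℝ (cgrad u) x) x := by
    have := ((hA 1).sub ((hA Complex.I).const_mul Complex.I)).sub (hp1.pow 2)
    refine this.congr_fderiv (ContinuousLinearMap.ext fun h => ?_)
    simp
  rw [differentiableAt_complex_iff_differentiableAt_real]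
  refine ⟨hS.differentiableAt, ?_⟩
  rw [hS.fderiv]
  have e3 := h.self_of_nhds
  have e4 := cgrad_eq u x
  simp at e3 ⊢
  have hI := Complex.I_sq
  set ρ : ℂ := f₀ * Complex.exp (2 * u x)
  linear_combination Complex.I * e1 + e2 + 2 * hsymm + 2 * Complex.I * cgrad u x * e3 -
    2 * Complex.I * ρ * e4 + (2 * D 1 Complex.I - 2 * cgrad u x * fderiv ℝ (cgrad u) x Complex.I +
      2 * ρ * fderiv ℝ u x Complex.I) * hI

/-- A holomorphic function on the unit disc with real values is constant. -/
lemma eq_of_im_eq_zero {g : ℂ → ℂ} (hg : DifferentiableOn ℂ g (ball 0 1))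
    (him : ∀ x ∈ ball (0 : ℂ) 1, (g x).im = 0) {x : ℂ} (hx : x ∈ ball (0 : ℂ) 1) : g x = g 0 := by
  refine (convex_ball (0 : ℂ) 1).is_const_of_fderivWithin_eq_zero (𝕜 := ℂ) hg (fun y hy => ?_) hx
    (mem_ball_self one_pos)
  rw [fderivWithin_of_isOpen isOpen_ball hy]
  have hd := (hg y hy).differentiableAt (isOpen_ball.mem_nhds hy)
  have hr : HasFDerivAt g ((fderiv ℂ g y).restrictScalars ℝ) y := hd.hasFDerivAt.restrictScalars ℝ
  have h1 : HasFDerivAt (fun x => (g x).im)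
      (Complex.imCLM.comp ((fderiv ℂ g y).restrictScalars ℝ)) y :=
    Complex.imCLM.hasFDerivAt.comp y hr
  have h2 : HasFDerivAt (fun x => (g x).im) (0 : ℂ →L[ℝ] ℝ) y :=
    (hasFDerivAt_const (0 : ℝ) y).congr_of_eventuallyEq (by
      filter_upwards [isOpen_ball.mem_nhds hy] with x hx using him x hx)
  have h3 := h1.unique h2
  have e1 := congrArg (fun L : ℂ →L[ℝ] ℝ => L 1) h3
  have e2 := congrArg (fun L : ℂ →L[ℝ] ℝ => L Complex.I) h3
  have e3 : fderiv ℂ g y Complex.I = Complex.I * fderiv ℂ g y 1 := by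
    rw [← smul_eq_mul, ← map_smul, smul_eq_mul, mul_one]
  simp [e3] at e1 e2
  refine ContinuousLinearMap.ext_ring (Complex.ext ?_ ?_)
  · simpa using e2
  · simpa using e1

/-- A holomorphic function on the disc whose imaginary part becomes small at the boundary is
constant. -/
lemma eq_of_im_small {g : ℂ → ℂ} (hg : DifferentiableOn ℂ g (ball 0 1))
    (h : ∀ ε > 0, ∃ r₀ < 1, ∀ x, r₀ < ‖x‖ → ‖x‖ < 1 → |(g x).im| ≤ ε) {x : ℂ}
    (hx : x ∈ ball (0 : ℂ) 1) : g x = g 0 := by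
  refine eq_of_im_eq_zero hg (fun y hy => ?_) hx
  rw [← abs_nonpos_iff]
  refine le_of_forall_pos_le_add fun ε hε => ?_
  obtain ⟨r₀, hr₀, hb⟩ := h ε hε
  rw [mem_ball_zero_iff] at hy
  obtain ⟨r, hr1, hr2⟩ := exists_between (max_lt hr₀ hy)
  have hsub : closedBall (0 : ℂ) r ⊆ ball 0 1 := closedBall_subset_ball hr2
  have hr0 : r ≠ 0 := ((norm_nonneg y).trans_lt ((le_max_right _ _).trans_lt hr1)).ne'
  have key : ∀ c : ℂ, (∀ w : ℂ, |(c * w).re| = |w.im|) → (c * g y).re ≤ ε := by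
    intro c hc2
    have hd : DiffContOnCl ℂ (fun x => Complex.exp (c * g x)) (ball 0 r) := by
      refine DifferentiableOn.diffContOnCl ?_
      rw [closure_ball _ hr0]
      exact ((hg.mono hsub).const_mul c).cexp
    have hle := Complex.norm_le_of_forall_mem_frontier_norm_le isBounded_ball hd (C := Real.exp ε)
      (fun z hz => ?_) (z := y) (subset_closure (mem_ball_zero_iff.2 ((le_max_right _ _).trans_lt hr1)))
    · rw [Complex.norm_exp] at hle
      exact Real.exp_le_exp.1 hle
    · rw [frontier_ball _ hr0, mem_sphere_zero_iff_norm] at hz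
      rw [Complex.norm_exp]
      refine Real.exp_le_exp.2 ((le_abs_self _).trans ?_)
      rw [hc2]
      exact hb z (by rw [hz]; exact (le_max_left _ _).trans_lt hr1) (by rw [hz]; exact hr2)
  have k1 := key Complex.I (fun w => by simp)
  have k2 := key (-Complex.I) (fun w => by simp)
  simp at k1 k2
  rw [zero_add]
  exact abs_le.2 ⟨by linarith, by linarith⟩

lemma holo_part_mul (T : ℂ →L[ℝ] ℂ) (c : ℂ) :
    T c - Complex.I * T (c * Complex.I) = c * (T 1 - Complex.I * T Complex.I) := by
  have e1 : T c = c.re * T 1 + c.im * T Complex.I := by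
    conv_lhs => rw [show c = c.re • (1 : ℂ) + c.im • Complex.I by simp]
    rw [map_add, map_smul, map_smul, Complex.real_smul, Complex.real_smul]
  have e2 : T (c * Complex.I) = c.re * T Complex.I - c.im * T 1 := by
    have : c * Complex.I = c.re • Complex.I - c.im • (1 : ℂ) := by
      apply Complex.ext <;> simp
    rw [this, map_sub, map_smul, map_smul, Complex.real_smul, Complex.real_smul]
  rw [e1, e2]
  conv_rhs => rw [← Complex.re_add_im c]
  linear_combination (c.im * T Complex.I) * Complex.I_sq

/-- The Schwarzian-type quantity in logarithmic coordinates. -/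
lemma schw_comp_cexp {u a b k m l : ℂ → ℝ} (hu : ∀ x, ‖x‖ < 1 → ContDiffAt ℝ 2 u x)
    (d1 : ∀ ζ, HasFDerivWithinAt (fun ζ => u (Complex.exp ζ)) (reMul (a ζ - Complex.I * b ζ))
      {ζ | ζ.re ≤ 0} ζ)
    (d2 : ∀ ζ, HasFDerivWithinAt a (reMul (k ζ - Complex.I * m ζ)) {ζ | ζ.re ≤ 0} ζ)
    (d3 : ∀ ζ, HasFDerivWithinAt b (reMul (m ζ - Complex.I * l ζ)) {ζ | ζ.re ≤ 0} ζ)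
    {ζ : ℂ} (hζ : ζ.re < 0) :
    Complex.exp ζ ^ 2 * schw u (Complex.exp ζ) = (k ζ - l ζ - 2 * Complex.I * m ζ) -
      2 * (a ζ - Complex.I * b ζ) - (a ζ - Complex.I * b ζ) ^ 2 := by
  have hnh : ∀ η : ℂ, η.re < 0 → {ζ : ℂ | ζ.re ≤ 0} ∈ 𝓝 η := fun η hη =>
    mem_of_superset (isOpen_lhp.mem_nhds hη) fun x (hx : x.re < 0) => hx.le
  have hq : ∀ η : ℂ, η.re < 0 → cgrad u (Complex.exp η) * Complex.exp η = a η - Complex.I * b η :=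
    fun η hη => reMul_injective ((hasFDerivAt_comp_cexp
      ((hu _ (norm_cexp_lt hη)).differentiableAt (by norm_num))).unique ((d1 η).hasFDerivAt (hnh η hη)))
  have hp : HasFDerivAt (cgrad u) (fderiv ℝ (cgrad u) (Complex.exp ζ)) (Complex.exp ζ) :=
    ((contDiffAt_cgrad (n := 1) (by exact_mod_cast hu _ (norm_cexp_lt hζ))).differentiableAt
      (by norm_num)).hasFDerivAt
  have he : HasFDerivAt Complex.exp (Complex.exp ζ • (1 : ℂ →L[ℝ] ℂ)) ζ :=
    (Complex.hasDerivAt_exp ζ).complexToReal_fderiv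
  have hL := (hp.comp ζ he).mul he
  have ha := Complex.ofRealCLM.hasFDerivAt.comp ζ ((d2 ζ).hasFDerivAt (hnh ζ hζ))
  have hb := Complex.ofRealCLM.hasFDerivAt.comp ζ ((d3 ζ).hasFDerivAt (hnh ζ hζ))
  have hR := ha.sub (hb.const_mul Complex.I)
  have huniq := (hL.congr_of_eventuallyEq (by
    filter_upwards [isOpen_lhp.mem_nhds hζ] with η hη using (hq η hη).symm)).unique hR
  have e1 := congrArg (fun L : ℂ →L[ℝ] ℂ => L 1) huniq
  have e2 := congrArg (fun L : ℂ →L[ℝ] ℂ => L Complex.I) huniq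
  simp at e1 e2
  have e3 := holo_part_mul (fderiv ℝ (cgrad u) (Complex.exp ζ)) (Complex.exp ζ)
  have e4 := hq ζ hζ
  rw [schw]
  rw [← e4]
  have hI := Complex.I_sq
  linear_combination e1 - Complex.I * e2 - Complex.exp ζ * e3 +
    (cgrad u (Complex.exp ζ) * Complex.exp ζ + l ζ) * hI

lemma contDiffOn_const_cdisc (c : ℝ) : ContDiffOn ℝ (⊤ : ℕ∞) (fun _ : ℂ => c) cdisc :=
  contDiffOn_const

/-- For constant curvatures the Schwarzian-type quantity of a solution vanishes. -/
lemma Sol.schw_eq_zero {f₀ j₀ : ℝ} {u : ℂ → ℝ} (hu : Sol (cwt f₀ j₀) u) {x : ℂ} (hx : ‖x‖ < 1) :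
    schw u x = 0 := by
  have hf := contDiffOn_const_cdisc f₀
  have hj := contDiffOn_const_cdisc j₀
  have hu' : Sol (glue (fun _ => f₀) (fun _ => j₀)) u := hu
  obtain ⟨a, b, k, m, l, ca, cb, ck, cm, cl, d1, d2, d3⟩ := hu'.exists_lhp_derivs hf hj
  have hsm : ∀ n : ℕ, ∀ x, ‖x‖ < 1 → ContDiffAt ℝ n u x := fun n x h => hu'.contDiffAt hf n x h
  have hdiff : ∀ x, ‖x‖ < 1 → DifferentiableAt ℂ (schw u) x := fun x h => by
    refine schw_differentiableAt (f₀ := f₀) (by exact_mod_cast hsm 3 x h) ?_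
    filter_upwards [isOpen_ball.mem_nhds (mem_ball_zero_iff.2 h)] with y hy
    exact hu'.dbar_cgrad hf (mem_ball_zero_iff.1 hy)
  set G : ℂ → ℂ := fun ζ => (k ζ - l ζ - 2 * Complex.I * m ζ) -
      2 * (a ζ - Complex.I * b ζ) - (a ζ - Complex.I * b ζ) ^ 2 with hG
  have hGc : Continuous fun ζ => (G ζ).im := by
    simp only [hG]; fun_prop
  have hG0 : ∀ ζ : ℂ, ζ.re = 0 → (G ζ).im = 0 := fun ζ hζ => by
    have hbd : ∀ η : ℂ, η.re = 0 → 1 + a η = j₀ * Real.exp (u (Complex.exp η)) := fun η hη => by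
      have h1 := nder_eq_of_comp_cexp ((hu'.contDiffOn hf hj).differentiableOn (by simp)) hη.le (d1 η)
      have h2 := hu'.nder_eq hf hj (z := Complex.exp η) (by rw [Complex.norm_exp, hη, Real.exp_zero])
      simp at h1
      rw [← h2, h1, add_comm]
    have hline : HasDerivAt (fun t : ℝ => ζ + t * Complex.I) Complex.I 0 := by
      have := ((Complex.ofRealCLM.hasDerivAt (x := 0)).mul_const Complex.I).const_add ζ
      simpa using this
    have hmaps : MapsTo (fun t : ℝ => ζ + t * Complex.I) univ {ζ | ζ.re ≤ 0} := fun t _ => by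
      simp [hζ]
    have hz0 : ζ + ((0 : ℝ) : ℂ) * Complex.I = ζ := by simp
    have da : HasDerivAt (fun t : ℝ => a (ζ + t * Complex.I)) (m ζ) 0 := by
      have h := HasFDerivWithinAt.comp_hasDerivWithinAt (f := fun t : ℝ => ζ + t * Complex.I) 0
        (hz0.symm ▸ d2 ζ) hline.hasDerivWithinAt hmaps
      simpa [Function.comp_def] using h
    have dv : HasDerivAt (fun t : ℝ => u (Complex.exp (ζ + t * Complex.I))) (b ζ) 0 := by
      have h := HasFDerivWithinAt.comp_hasDerivWithinAt (f := fun t : ℝ => ζ + t * Complex.I) 0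
        (hz0.symm ▸ d1 ζ) hline.hasDerivWithinAt hmaps
      simpa [Function.comp_def] using h
    have e : (fun t : ℝ => 1 + a (ζ + t * Complex.I)) =
        fun t : ℝ => j₀ * Real.exp (u (Complex.exp (ζ + t * Complex.I))) :=
      funext fun t => hbd _ (by simp [hζ])
    have hm := (e ▸ da.const_add 1).unique (dv.exp.const_mul j₀)
    rw [hz0, ← mul_assoc, ← hbd ζ hζ] at hm
    simp [hG, pow_two]
    linarith
  have hW : DifferentiableOn ℂ (fun x => x ^ 2 * schw u x) (ball 0 1) := fun x hx =>
    ((differentiableAt_id.pow 2).mul (hdiff x (mem_ball_zero_iff.1 hx))).differentiableWithinAt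
  have hzero : ∀ x ∈ ball (0 : ℂ) 1, x ^ 2 * schw u x = 0 := fun x hx => by
    rw [eq_of_im_small hW ?_ hx]
    · simp
    intro ε hε
    have huc := (isCompact_Icc.prod isCompact_Icc : IsCompact (Icc (-1 : ℝ) 0 ×ˢ Icc (-π) π))
      |>.uniformContinuousOn_of_continuous (f := fun p : ℝ × ℝ => (G (p.1 + p.2 * Complex.I)).im)
        (hGc.comp (by fun_prop)).continuousOn
    obtain ⟨δ, hδ, hd⟩ := Metric.uniformContinuousOn_iff.1 huc ε hε
    refine ⟨Real.exp (-min δ 1),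
      (Real.exp_lt_exp.2 (by linarith [lt_min hδ one_pos])).trans_eq Real.exp_zero, fun x h1 h2 => ?_⟩
    have hx0 : x ≠ 0 := norm_pos_iff.1 ((Real.exp_pos _).trans h1)
    have hlog : -min δ 1 < Real.log ‖x‖ := (Real.lt_log_iff_exp_lt (norm_pos_iff.2 hx0)).2 h1
    have hlog2 : Real.log ‖x‖ < 0 := Real.log_neg (norm_pos_iff.2 hx0) h2
    have hre : (Complex.log x).re < 0 := by rwa [Complex.log_re]
    have h3 := schw_comp_cexp (fun x h => by exact_mod_cast hsm 2 x h) d1 d2 d3 hre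
    rw [Complex.exp_log hx0] at h3
    simp only [h3]
    have hmem : x.arg ∈ Icc (-π) π := ⟨(Complex.neg_pi_lt_arg x).le, Complex.arg_le_pi x⟩
    have h4 := hd (Real.log ‖x‖, x.arg) ⟨⟨by linarith [min_le_right δ 1], hlog2.le⟩, hmem⟩
      (0, x.arg) ⟨⟨by norm_num, le_rfl⟩, hmem⟩ (by
        rw [Prod.dist_eq, dist_self, max_eq_left dist_nonneg, Real.dist_eq, sub_zero,
          abs_of_neg hlog2]
        linarith [min_le_left δ 1])
    have h5 : (G ((0 : ℝ) + x.arg * Complex.I)).im = 0 := hG0 _ (by simp)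
    simp only [h5, Real.dist_eq, sub_zero] at h4
    exact h4.le
  have hne : ∀ x, ‖x‖ < 1 → x ≠ 0 → schw u x = 0 := fun x h h0 =>
    (mul_eq_zero.1 (hzero x (mem_ball_zero_iff.2 h))).resolve_left (pow_ne_zero 2 h0)
  by_cases h0 : x = 0
  · have hc : ContinuousAt (schw u) x := (hdiff x hx).continuousAt
    have h1 : Tendsto (schw u) (𝓝[≠] x) (𝓝 0) := by
      refine tendsto_const_nhds.congr' ?_
      filter_upwards [self_mem_nhdsWithin,
        mem_nhdsWithin_of_mem_nhds (isOpen_ball.mem_nhds (mem_ball_zero_iff.2 hx))] with y hy hy1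
      exact (hne y (mem_ball_zero_iff.1 hy1) (by rw [← h0]; exact hy)).symm
    exact tendsto_nhds_unique (hc.tendsto.mono_left nhdsWithin_le_nhds) h1
  · exact hne x hx h0

lemma clm_eq_of_one_I {T S : ℂ →L[ℝ] ℂ} (h1 : T 1 = S 1) (hI : T Complex.I = S Complex.I) : T = S := by
  refine ContinuousLinearMap.ext fun h => ?_
  rw [show h = h.re • (1 : ℂ) + h.im • Complex.I by simp, map_add, map_add, map_smul, map_smul,
    map_smul, map_smul, h1, hI]

/-- Where the Schwarzian-type quantity vanishes, the conjugate of the complex gradient of `e^{-u}`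
is holomorphic with real derivative. -/
lemma hasDerivAt_conj_grad {u : ℂ → ℝ} {ρ : ℝ} {x : ℂ} (hu : ContDiffAt ℝ 2 u x)
    (hs : schw u x = 0)
    (h : fderiv ℝ (cgrad u) x 1 + Complex.I * fderiv ℝ (cgrad u) x Complex.I = -(ρ : ℂ)) :
    HasDerivAt (fun y => (starRingEnd ℂ) (-cgrad u y * (Real.exp (-u y) : ℝ)))
      ((Real.exp (-u x) / 2 * (ρ + ‖cgrad u x‖ ^ 2) : ℝ) : ℂ) x := by
  have hp : HasFDerivAt (cgrad u) (fderiv ℝ (cgrad u) x) x :=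
    ((contDiffAt_cgrad (n := 1) (by exact_mod_cast hu)).differentiableAt (by norm_num)).hasFDerivAt
  have hu1 : HasFDerivAt u (fderiv ℝ u x) x := (hu.differentiableAt (by norm_num)).hasFDerivAt
  have hw : HasFDerivAt (fun y => ((Real.exp (-u y) : ℝ) : ℂ))
      (Complex.ofRealCLM.comp (Real.exp (-u x) • -fderiv ℝ u x)) x :=
    Complex.ofRealCLM.hasFDerivAt.comp x hu1.neg.exp
  have hP := Complex.conjCLE.toContinuousLinearMap.hasFDerivAt.comp x (hp.neg.mul hw)
  have hn : ‖cgrad u x‖ ^ 2 = fderiv ℝ u x 1 ^ 2 + fderiv ℝ u x Complex.I ^ 2 := by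
    rw [← Complex.normSq_eq_norm_sq, Complex.normSq_apply, cgrad_eq]
    simp; ring
  rw [hn]
  have hI := Complex.I_sq
  have e0 := cgrad_eq u x
  have e1 : fderiv ℝ (cgrad u) x 1 = (cgrad u x ^ 2 - ρ) / 2 := by
    rw [schw] at hs; linear_combination hs / 2 + h / 2
  have e2 : fderiv ℝ (cgrad u) x Complex.I = Complex.I * (cgrad u x ^ 2 + ρ) / 2 := by
    rw [schw] at hs
    linear_combination Complex.I / 2 * hs - Complex.I / 2 * h + fderiv ℝ (cgrad u) x Complex.I * hI
  have hE : (starRingEnd ℂ) (Complex.exp (-(u x : ℂ))) = Complex.exp (-(u x : ℂ)) := by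
    rw [← Complex.ofReal_neg, ← Complex.ofReal_exp, Complex.conj_ofReal]
  have h2 : (starRingEnd ℂ) (2 : ℂ) = 2 := map_ofNat _ 2
  rw [hasDerivAt_iff_hasFDerivAt]
  refine hasFDerivAt_of_restrictScalars ℝ hP (clm_eq_of_one_I ?_ ?_)
  · simp [e1, e0, hE, h2]
    linear_combination (Complex.exp (-(u x : ℂ)) / 2 * fderiv ℝ u x Complex.I ^ 2) * hI
  · simp [e2, e0, hE, h2]
    linear_combination (-Complex.exp (-(u x : ℂ)) * (Complex.I * fderiv ℝ u x Complex.I ^ 2 / 2 +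
      fderiv ℝ u x 1 * fderiv ℝ u x Complex.I)) * hI

/-- Solutions with constant curvatures are given by quadratic polynomials. -/
lemma Sol.exists_quadratic {f₀ j₀ : ℝ} {u : ℂ → ℝ} (hu : Sol (cwt f₀ j₀) u) :
    ∃ (α γ : ℝ) (h₀ : ℂ), 4 * α * γ = f₀ + ‖h₀‖ ^ 2 ∧
      ∀ x, ‖x‖ ≤ 1 → Real.exp (-u x) = α + ((starRingEnd ℂ) h₀ * x).re + γ * ‖x‖ ^ 2 := by
  have hf := contDiffOn_const_cdisc f₀
  have hu' : Sol (glue (fun _ => f₀) (fun _ => j₀)) u := hu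
  have hsm : ∀ x ∈ ball (0 : ℂ) 1, ContDiffAt ℝ 2 u x := fun x h =>
    hu'.contDiffAt hf 2 x (mem_ball_zero_iff.1 h)
  set g : ℂ → ℂ := fun y => (starRingEnd ℂ) (-cgrad u y * (Real.exp (-u y) : ℝ)) with hg
  set R : ℂ → ℝ := fun x => Real.exp (-u x) / 2 * (f₀ * Real.exp (2 * u x) + ‖cgrad u x‖ ^ 2) with hR
  have hgd : ∀ x ∈ ball (0 : ℂ) 1, HasDerivAt g (R x) x := fun x hx =>
    hasDerivAt_conj_grad (hsm x hx) (hu.schw_eq_zero (mem_ball_zero_iff.1 hx))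
      (hu'.dbar_cgrad hf (mem_ball_zero_iff.1 hx))
  have hgdiff : DifferentiableOn ℂ g (ball 0 1) := fun x hx =>
    (hgd x hx).differentiableAt.differentiableWithinAt
  have hRc : ∀ x ∈ ball (0 : ℂ) 1, (R x : ℂ) = R 0 := fun x hx => by
    have h0 : (0 : ℂ) ∈ ball (0 : ℂ) 1 := mem_ball_self one_pos
    rw [← (hgd x hx).deriv, ← (hgd 0 h0).deriv]
    exact eq_of_im_eq_zero (hgdiff.deriv isOpen_ball) (fun y hy => by simp [(hgd y hy).deriv]) hx
  have hgl : ∀ x ∈ ball (0 : ℂ) 1, g x = g 0 + R 0 * x := fun x hx => by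
    have h1 : ∀ y ∈ ball (0 : ℂ) 1, HasDerivAt (fun x => g x - R 0 * x) 0 y := fun y hy => by
      have := (hgd y hy).sub ((hasDerivAt_id y).const_mul (R 0 : ℂ))
      rw [hRc y hy, mul_one, sub_self] at this
      exact this
    have := (convex_ball (0 : ℂ) 1).is_const_of_fderivWithin_eq_zero (𝕜 := ℂ)
      (fun y hy => (h1 y hy).differentiableAt.differentiableWithinAt) (fun y hy => by
        rw [fderivWithin_of_isOpen isOpen_ball hy, (h1 y hy).hasFDerivAt.fderiv]; simp) hx
      (mem_ball_self one_pos)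
    simp only [mul_zero, sub_zero] at this
    linear_combination this
  refine ⟨Real.exp (-u 0), R 0 / 2, g 0, ?_, ?_⟩
  · have e1 : ‖g 0‖ = ‖cgrad u 0‖ * Real.exp (-u 0) := by
      simp only [hg]
      rw [Complex.norm_conj, norm_mul, norm_neg, Complex.norm_real,
        Real.norm_of_nonneg (Real.exp_pos _).le]
    have e2 : Real.exp (-u 0) ^ 2 * Real.exp (2 * u 0) = 1 := by
      rw [pow_two, ← Real.exp_add, ← Real.exp_add, ← Real.exp_zero]; congr 1; ring
    simp only [hR]
    rw [e1]
    linear_combination f₀ * e2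
  · have hball : ∀ x ∈ ball (0 : ℂ) 1, Real.exp (-u x) =
        Real.exp (-u 0) + ((starRingEnd ℂ) (g 0) * x).re + R 0 / 2 * ‖x‖ ^ 2 := fun x hx => by
      have h1 : ∀ y ∈ ball (0 : ℂ) 1, HasFDerivAt (fun x => Real.exp (-u x) -
          (((starRingEnd ℂ) (g 0) * x).re + R 0 / 2 * ‖x‖ ^ 2)) (0 : ℂ →L[ℝ] ℝ) y := fun y hy => by
        have d1 : HasFDerivAt (fun x => Real.exp (-u x)) (Real.exp (-u y) • -fderiv ℝ u y) y :=
          ((hsm y hy).differentiableAt (by norm_num)).hasFDerivAt.neg.exp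
        have d2 : HasFDerivAt (fun x => ((starRingEnd ℂ) (g 0) * x).re)
            (reMul ((starRingEnd ℂ) (g 0))) y := by
          have : HasDerivAt (fun x => (starRingEnd ℂ) (g 0) * x) ((starRingEnd ℂ) (g 0)) y := by
            simpa using (hasDerivAt_id y).const_mul ((starRingEnd ℂ) (g 0))
          exact this.hasFDerivAt_re
        have d3 : HasFDerivAt (fun x : ℂ => ‖x‖ ^ 2) (2 • innerSL ℝ y) y :=
          (hasStrictFDerivAt_norm_sq y).hasFDerivAt
        have e : -(Real.exp (-u y)) * cgrad u y = (starRingEnd ℂ) (g 0) + R 0 * (starRingEnd ℂ) y := by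
          have := congrArg (starRingEnd ℂ) (hgl y hy)
          rw [map_add, map_mul, Complex.conj_ofReal] at this
          rw [← this]
          simp only [hg, Complex.conj_conj]
          ring
        refine (d1.sub (d2.add (d3.const_mul (R 0 / 2)))).congr_fderiv ?_
        refine ContinuousLinearMap.ext fun h => ?_
        have e2 := congrArg (fun c => (c * h).re) e
        rw [← reMul_cgrad]
        simp [-Complex.ofReal_exp] at e2 ⊢
        linear_combination e2
      have := (convex_ball (0 : ℂ) 1).is_const_of_fderivWithin_eq_zero (𝕜 := ℝ)
        (fun y hy => (h1 y hy).differentiableAt.differentiableWithinAt) (fun y hy => by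
          rw [fderivWithin_of_isOpen isOpen_ball hy, (h1 y hy).fderiv]) hx
        (mem_ball_self one_pos)
      simp only [mul_zero, norm_zero, Complex.zero_re] at this
      linarith
    intro x hx
    have hcl : x ∈ closure (ball (0 : ℂ) 1) := by
      rw [closure_ball _ one_ne_zero]; simpa using hx
    have huc := hu.cont
    exact (EqOn.closure (s := ball (0 : ℂ) 1) hball (by fun_prop) (by fun_prop)) hcl

lemma eq_zero_of_balanced {f₀ j₀ α γ : ℝ} {h₀ : ℂ} {u : ℂ → ℝ} (hf : 0 < f₀) (hj : 0 < j₀)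
    (hu : Sol (cwt f₀ j₀) u)
    (hb : ∀ c : ℂ, ∫ x, ((starRingEnd ℂ) c * clamp x).re * wexp (cwt f₀ j₀) u x ∂Lam = 0)
    (hw : ∀ x, ‖x‖ ≤ 1 → Real.exp (-u x) = α + ((starRingEnd ℂ) h₀ * x).re + γ * ‖x‖ ^ 2) :
    h₀ = 0 := by
  by_contra hne
  set s := wexp (cwt f₀ j₀) u with hs
  set φ : ℂ → ℝ := fun x => ((starRingEnd ℂ) h₀ * clamp x).re with hφ
  have hφx : ∀ x, ‖x‖ ≤ 1 → φ x = ((starRingEnd ℂ) h₀ * x).re := fun x hx => by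
    simp only [hφ, clamp_of_le hx]
  have hφn : ∀ x, ‖x‖ ≤ 1 → φ (-x) = -φ x := fun x hx => by
    rw [hφx x hx, hφx (-x) (by rwa [norm_neg]), mul_neg, Complex.neg_re]
  have hlt : ∀ x, ‖x‖ ≤ 1 → 0 < φ x → s x < s (-x) := fun x hx h => by
    have h1 := hw x hx
    have h2 := hw (-x) (by rwa [norm_neg])
    rw [← hφx x hx] at h1
    rw [← hφx (-x) (by rwa [norm_neg]), hφn x hx, norm_neg] at h2
    have h3 : u x < u (-x) := by
      have : Real.exp (-u (-x)) < Real.exp (-u x) := by linarith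
      linarith [Real.exp_lt_exp.1 this]
    have h4 : kap (-x) = kap x := by simp [kap]
    have h5 : cwt f₀ j₀ (-x) = cwt f₀ j₀ x := by simp [cwt]
    simp only [hs, wexp]
    rw [h4, h5]
    exact mul_lt_mul_of_pos_left (Real.exp_lt_exp.2 (mul_lt_mul_of_pos_left h3 (kap_pos x)))
      ((cwt_pb hf hj).pos x)
  obtain ⟨M, hM⟩ := hu.dens.toPB.bm
  have hφb : BM φ ‖h₀‖ := ⟨by
    have := continuous_clamp.measurable
    simp only [hφ]
    exact Complex.measurable_re.comp (this.const_mul _), fun x => by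
    refine (Complex.abs_re_le_norm _).trans ?_
    rw [norm_mul, Complex.norm_conj]
    exact mul_le_of_le_one_right (norm_nonneg _) (norm_clamp_le x)⟩
  have hMn : BM (fun x => s (-x)) M := ⟨hM.meas.comp measurable_neg, fun x => hM.bd _⟩
  have i1 : ∫ x, φ x * s x ∂Lam = 0 := hb h₀
  have i2 : ∫ x, φ x * s (-x) ∂Lam = 0 := by
    have h1 := integral_Lam_mul (c := -1) (by simp) (fun x => φ x * s x)
    rw [i1] at h1
    rw [← neg_eq_zero, ← h1, ← integral_neg]
    refine integral_congr_ae (Lam_ae fun x hx => ?_)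
    simp only [neg_one_mul]
    rw [hφn x hx, neg_mul]
  have i3 : ∫ x, φ x * (s (-x) - s x) ∂Lam = 0 := by
    simp only [mul_sub]
    rw [integral_sub (hφb.mul hMn).integrable (hφb.mul hM).integrable, i1, i2, sub_zero]
  have hnn : 0 ≤ᵐ[Lam] fun x => φ x * (s (-x) - s x) := Lam_ae fun x hx => by
    rcases lt_trichotomy (φ x) 0 with h | h | h
    · have := hlt (-x) (by rwa [norm_neg]) (by rw [hφn x hx]; linarith)
      rw [neg_neg] at this
      exact mul_nonneg_of_nonpos_of_nonpos h.le (by linarith)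
    · simp [h]
    · exact mul_nonneg h.le (by linarith [hlt x hx h])
  have hae := (integral_eq_zero_iff_of_nonneg_ae hnn (hφb.mul (hMn.sub hM)).integrable).1 i3
  have hae2 := (Lam_ae_iff.1 hae).1
  rw [aream, ae_restrict_iff' measurableSet_ball] at hae2
  set O : Set ℂ := {x | 0 < ((starRingEnd ℂ) h₀ * x).re} ∩ ball 0 1
  have hO : IsOpen O := (isOpen_lt continuous_const (by fun_prop)).inter isOpen_ball
  have hn : 0 < ‖h₀‖ := norm_pos_iff.2 hne
  have hOne : O.Nonempty := by
    refine ⟨((2 * ‖h₀‖)⁻¹ : ℝ) * h₀, ?_, ?_⟩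
    · rw [mem_ofPred_eq, mul_left_comm, Complex.conj_mul', ← Complex.ofReal_pow, ← Complex.ofReal_mul,
        Complex.ofReal_re]
      positivity
    · rw [mem_ball_zero_iff, norm_mul, Complex.norm_real, Real.norm_of_nonneg (by positivity)]
      field_simp
      norm_num
  have hpos := hO.measure_pos (volume : Measure ℂ) hOne
  have hzero : volume O = 0 := by
    refine measure_mono_null (fun x hx => ?_) hae2
    intro hcon
    have hx1 := mem_ball_zero_iff.1 hx.2
    have h1 := hcon hx.2
    have h2 : 0 < φ x := by rw [hφx x hx1.le]; exact hx.1
    have h3 := mul_pos h2 (sub_pos.2 (hlt x hx1.le h2))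
    simp only [Pi.zero_apply] at h1
    linarith
  exact hpos.ne' hzero

/-- The standard radial solution with constant curvatures, a minimizer of the energy. -/
lemma exists_standard_sol {f₀ j₀ : ℝ} (hf : 0 < f₀) (hj : 0 < j₀) :
    ∃ (u : ℂ → ℝ) (α γ : ℝ), Sol (cwt f₀ j₀) u ∧
      (∀ t, Dens t → En (cwt f₀ j₀) (wexp (cwt f₀ j₀) u) ≤ En (cwt f₀ j₀) t) ∧
      0 < α ∧ 0 < γ ∧ 4 * α * γ = f₀ ∧ α - γ = j₀ ∧
      ∀ x, ‖x‖ ≤ 1 → Real.exp (-u x) = α + γ * ‖x‖ ^ 2 := by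
  obtain ⟨u, hu, hmin, hb⟩ := exists_balanced_sol hf hj
  obtain ⟨α, γ, h₀, hαγ, hw⟩ := hu.exists_quadratic
  obtain rfl := eq_zero_of_balanced hf hj hu hb hw
  simp only [map_zero, zero_mul, Complex.zero_re, add_zero, norm_zero, ne_eq, OfNat.ofNat_ne_zero,
    not_false_eq_true, zero_pow] at hw hαγ
  have hα : 0 < α := by
    have := hw 0 (by simp)
    simp at this
    rw [← this]; exact Real.exp_pos _
  have hγ : 0 < γ := by
    by_contra h
    push Not at h
    nlinarith
  refine ⟨u, α, γ, hu, hmin, hα, hγ, hαγ, ?_, hw⟩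
  have hu' : Sol (glue (fun _ => f₀) (fun _ => j₀)) u := hu
  have hfc := contDiffOn_const_cdisc f₀
  have hjc := contDiffOn_const_cdisc j₀
  have hlog : ∀ x, ‖x‖ ≤ 1 → u x = -Real.log (α + γ * ‖x‖ ^ 2) := fun x hx => by
    rw [← hw x hx, Real.log_exp, neg_neg]
  have h1 : ‖(1 : ℂ)‖ = 1 := norm_one
  have hrad := tendsto_radial_nder h1 ((hu'.contDiffOn hfc hjc).differentiableOn (by simp) 1
    (mem_cdisc.2 h1.le))
  have hd : HasDerivAt (fun r : ℝ => -Real.log (α + γ * r ^ 2)) (-((γ * 2) / (α + γ))) 1 := by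
    have hq : HasDerivAt (fun r : ℝ => α + γ * r ^ 2) (γ * 2) 1 := by
      simpa using ((hasDerivAt_pow 2 (1 : ℝ)).const_mul γ).const_add α
    have : HasDerivAt (fun r : ℝ => -Real.log (α + γ * r ^ 2)) _ 1 :=
      (hq.log (by positivity)).neg
    exact this.congr_deriv (by simp)
  have hsl := (hasDerivAt_iff_tendsto_slope.1 hd).mono_left
    (nhdsWithin_mono _ (fun x (hx : x < 1) => hx.ne) : 𝓝[<] (1 : ℝ) ≤ 𝓝[≠] 1)
  have hn : nder u 1 = -((γ * 2) / (α + γ)) := by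
    refine tendsto_nhds_unique hrad (hsl.congr' ?_)
    filter_upwards [eventually_Ioo_left one_pos] with r hr
    have hr' : ‖(r : ℂ) * 1‖ = r := by
      rw [mul_one, Complex.norm_real, Real.norm_of_nonneg hr.1]
    rw [hlog 1 h1.le, hlog (r * 1) (by rw [hr']; exact hr.2.1.le), hr', h1, slope_def_field,
      ← neg_div_neg_eq, neg_sub, neg_sub]
  have hbd := hu'.nder_eq hfc hjc h1
  have he : Real.exp (u 1) = (α + γ)⁻¹ := by
    have := hw 1 h1.le
    rw [Real.exp_neg, h1] at this
    rw [← inv_inv (Real.exp _), this]; simp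
  rw [hn, he] at hbd
  have : α + γ ≠ 0 := by positivity
  field_simp at hbd
  linarith

lemma exists_sol_of_frequently {F : ℂ → ℝ} (hF : PB F) {m : ℝ} {s : ℕ → ℂ → ℝ}
    (hm : ∀ t, Dens t → m ≤ En F t) (hs : ∀ n, Dens (s n))
    (hlim : Tendsto (fun n => En F (s n)) atTop (𝓝 m)) {R κ : ℝ} (hR : 0 < R) (hκ0 : 0 ≤ κ)
    (hκ1 : κ < 1)
    (hfr : ∃ᶠ n in atTop, ∀ z : ℂ, ‖z‖ = 1 → ∫ x in ball z R, s n x ∂Lam ≤ κ * (2 * π)) :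
    ∃ u, Sol F u := by
  obtain ⟨δ, C, hδ, hco⟩ := En_coercive hF hR hκ0 hκ1
  obtain ⟨φ, hφ, hnc⟩ := extraction_of_frequently_atTop hfr
  obtain ⟨D, hD⟩ := hlim.bddAbove_range
  obtain ⟨u, hu, -⟩ := exists_sol_of_minimizing hF hm (fun n => hs (φ n))
    (hlim.comp hφ.tendsto_atTop) (C := (D + C) / δ) (fun n => by
      have h1 := hco _ (hs (φ n)) (hnc n)
      have h2 : En F (s (φ n)) ≤ D := hD ⟨φ n, rfl⟩
      rw [le_div_iff₀ hδ]
      linarith)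
  exact ⟨u, hu⟩

/-- Either the integral equation is solvable or minimising sequences concentrate at a boundary
point. -/
theorem exists_sol_or_concentrating {F : ℂ → ℝ} (hF : PB F) :
    (∃ u, Sol F u) ∨ ∃ (m : ℝ) (s : ℕ → ℂ → ℝ) (z : ℂ), ‖z‖ = 1 ∧ (∀ t, Dens t → m ≤ En F t) ∧
      (∀ n, Dens (s n)) ∧ Tendsto (fun n => En F (s n)) atTop (𝓝 m) ∧
      ∀ ρ ε : ℝ, 0 < ρ → 0 < ε →
        ∀ᶠ n in atTop, (1 - ε) * (2 * π) ≤ ∫ x in ball z ρ, s n x ∂Lam := by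
  obtain ⟨m, s, hm, hs, hlim⟩ := exists_minimizing_seq hF
  by_cases hsol : ∃ u, Sol F u
  · exact Or.inl hsol
  right
  have key : ∀ k : ℕ, ∃ n ≥ k, ∃ z : ℂ, ‖z‖ = 1 ∧
      (1 - 1 / ((k : ℝ) + 1)) * (2 * π) ≤ ∫ x in ball z (1 / ((k : ℝ) + 1)), s n x ∂Lam := by
    intro k
    by_contra hcon
    push Not at hcon
    have hk : (1 : ℝ) / ((k : ℝ) + 1) ≤ 1 := by
      rw [div_le_one (by positivity)]; linarith [k.cast_nonneg (α := ℝ)]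
    have hk0 : (0 : ℝ) < 1 / ((k : ℝ) + 1) := by positivity
    refine hsol (exists_sol_of_frequently hF hm hs hlim (R := 1 / ((k : ℝ) + 1))
      (κ := 1 - 1 / ((k : ℝ) + 1)) hk0 (by linarith) (by linarith) ?_)
    refine Eventually.frequently ?_
    filter_upwards [eventually_ge_atTop k] with n hn z hz
    exact (hcon n hn z hz).le
  choose n hn z hz hconc using key
  obtain ⟨w, hw, φ, hφ, hφlim⟩ := (isCompact_sphere (0 : ℂ) 1).tendsto_subseq
    (fun k => (by simp [hz k] : z k ∈ sphere (0 : ℂ) 1))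
  have hn' : Tendsto (fun k => n (φ k)) atTop atTop :=
    (tendsto_atTop_mono hn tendsto_id).comp hφ.tendsto_atTop
  refine ⟨m, fun k => s (n (φ k)), w, by simpa using hw, hm, fun k => hs _, hlim.comp hn', ?_⟩
  intro ρ ε hρ hε
  have h0 : Tendsto (fun k : ℕ => 1 / ((φ k : ℝ) + 1)) atTop (𝓝 0) :=
    (tendsto_one_div_add_atTop_nhds_zero_nat (𝕜 := ℝ)).comp hφ.tendsto_atTop
  filter_upwards [h0.eventually_lt_const hε, h0.eventually_lt_const (half_pos hρ),
    hφlim.eventually (ball_mem_nhds w (half_pos hρ))] with k h1 h2 h3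
  have hsub : ball (z (φ k)) (1 / ((φ k : ℝ) + 1)) ⊆ ball w ρ := by
    refine ball_subset_ball' ?_
    have : dist (z (φ k)) w < ρ / 2 := h3
    linarith
  calc (1 - ε) * (2 * π) ≤ (1 - 1 / ((φ k : ℝ) + 1)) * (2 * π) := by
        refine mul_le_mul_of_nonneg_right ?_ (by positivity)
        linarith
    _ ≤ _ := hconc (φ k)
    _ ≤ _ := setIntegral_mono_set (hs _).integrable.integrableOn
        (ae_of_all _ fun x => ((hs _).pos x).le) hsub.eventuallyLE

lemma En_sub_En {F G s : ℂ → ℝ} (hF : PB F) (hG : PB G) (hs : PB s) :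
    En F s - En G s = ∫ x, s x / kap x * (Real.log (G x) - Real.log (F x)) ∂Lam := by
  obtain ⟨A, hA⟩ := ent_bm hF hs
  obtain ⟨B, hB⟩ := ent_bm hG hs
  have : En F s - En G s = ent F s - ent G s := by unfold En; ring
  rw [this, ent, ent, ← integral_sub hA.integrable hB.integrable]
  refine integral_congr_ae (ae_of_all _ fun x => ?_)
  simp only
  rw [Real.log_div (hs.pos x).ne' (hF.pos x).ne', Real.log_div (hs.pos x).ne' (hG.pos x).ne']
  ring

/-- If `log F` is close to `log G` near `z`, the energies of densities concentrated near `z`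
are close. -/
lemma En_ge_of_concentrated {F G s : ℂ → ℝ} (hF : PB F) (hG : PB G) (hs : Dens s) {z : ℂ}
    {ρ ε M : ℝ} (hε : 0 ≤ ε) (hM : 0 ≤ M)
    (hnear : ∀ x ∈ ball z ρ, ‖x‖ ≤ 1 → Real.log (F x) - Real.log (G x) ≤ ε)
    (hfar : ∀ x, Real.log (F x) - Real.log (G x) ≤ M)
    (hc : (1 - ε) * (2 * π) ≤ ∫ x in ball z ρ, s x ∂Lam) :
    En G s - ε * (1 + M) * (2 * π) ≤ En F s := by
  have hi := hs.integrable
  obtain ⟨A, hA⟩ := ent_bm hF hs.toPB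
  have hpt : ∀ᵐ x ∂Lam, s x * -(ε + M) + M * (ball z ρ).indicator s x
      ≤ s x / kap x * (Real.log (G x) - Real.log (F x)) := by
    refine Lam_ae fun x hx => ?_
    have h0 := hs.pos x
    have hsk : s x / kap x ≤ s x := div_le_self h0.le (one_le_kap x)
    have hsk0 : 0 ≤ s x / kap x := (div_pos h0 (kap_pos x)).le
    by_cases hxz : x ∈ ball z ρ
    · rw [indicator_of_mem hxz]
      have := hnear x hxz hx
      nlinarith
    · rw [indicator_of_notMem hxz]
      have := hfar x
      nlinarith
  obtain ⟨LF, hLF⟩ := hF.log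
  obtain ⟨LG, hLG⟩ := hG.log
  obtain ⟨S, hS⟩ := (hs.toPB.div PB.kap).bm
  have hint : Integrable (fun x => s x / kap x * (Real.log (G x) - Real.log (F x))) Lam :=
    (hS.mul (hLG.sub hLF)).integrable
  have hind : Integrable ((ball z ρ).indicator s) Lam := hi.indicator measurableSet_ball
  have h := integral_mono_ae ((hi.mul_const _).add (hind.const_mul M)) hint hpt
  rw [← En_sub_En hF hG hs.toPB] at h
  have e : ∫ x, (fun x => s x * -(ε + M)) x + (fun x => M * (ball z ρ).indicator s x) x ∂Lam =
      2 * π * -(ε + M) + M * ∫ x in ball z ρ, s x ∂Lam := by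
    rw [integral_add (hi.mul_const _) (hind.const_mul M), integral_mul_const, hs.mass,
      integral_const_mul, integral_indicator measurableSet_ball]
  have h' : 2 * π * -(ε + M) + M * ∫ x in ball z ρ, s x ∂Lam ≤ En F s - En G s := e ▸ h
  have := mul_le_mul_of_nonneg_left hc hM
  nlinarith

/-- If the equation is not solvable, the infimum of the energy is bounded below by that of the
frozen weight at some boundary point. -/
theorem exists_sol_or_frozen_le {f j : ℂ → ℝ} (hf : ContinuousOn f cdisc)
    (hj : ContinuousOn j cdisc) (hf0 : ∀ z ∈ cdisc, 0 < f z) (hj0 : ∀ z ∈ bdry, 0 < j z) :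
    (∃ u, Sol (glue f j) u) ∨ ∃ z, ‖z‖ = 1 ∧ ∀ b, (∀ t, Dens t → b ≤ En (cwt (f z) (j z)) t) →
      ∀ t, Dens t → b ≤ En (glue f j) t := by
  have hF := glue_pb hf hj hf0 hj0
  refine (exists_sol_or_concentrating hF).imp_right ?_
  rintro ⟨m, s, z, hz, hm, hs, hlim, hconc⟩
  refine ⟨z, hz, fun b hb t ht => le_trans ?_ (hm t ht)⟩
  have hzc : z ∈ cdisc := mem_cdisc.2 hz.le
  have hfz := hf0 z hzc
  have hjz := hj0 z (mem_bdry.2 hz)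
  have hG := cwt_pb hfz hjz
  obtain ⟨LF, hLF⟩ := hF.log
  obtain ⟨LG, hLG⟩ := hG.log
  have hM : 0 ≤ LF + LG := add_nonneg hLF.nonneg hLG.nonneg
  have hfar : ∀ x, Real.log (glue f j x) - Real.log (cwt (f z) (j z) x) ≤ LF + LG := fun x => by
    have h1 := (abs_le.1 (hLF.bd x)).2
    have h2 := (abs_le.1 (hLG.bd x)).1
    linarith
  have hε : ∀ ε : ℝ, 0 < ε → b - ε * (1 + (LF + LG)) * (2 * π) ≤ m := by
    intro ε hε
    have hlf : ContinuousWithinAt (fun x => Real.log (f x)) cdisc z :=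
      (hf z hzc).log hfz.ne'
    have hlj : ContinuousWithinAt (fun x => Real.log (j x)) cdisc z :=
      (hj z hzc).log hjz.ne'
    obtain ⟨ρ₁, hρ₁, h1⟩ := Metric.continuousWithinAt_iff.1 hlf ε hε
    obtain ⟨ρ₂, hρ₂, h2⟩ := Metric.continuousWithinAt_iff.1 hlj ε hε
    refine ge_of_tendsto hlim ?_
    filter_upwards [hconc (min ρ₁ ρ₂) ε (lt_min hρ₁ hρ₂) hε] with n hn
    refine le_trans ?_ (En_ge_of_concentrated hF hG (hs n) hε.le hM ?_ hfar hn)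
    · linarith [hb _ (hs n)]
    · intro x hx hx1
      have hxd : dist x z < min ρ₁ ρ₂ := hx
      rcases hx1.lt_or_eq with h | h
      · have := (abs_lt.1 (h1 (mem_cdisc.2 hx1) (hxd.trans_le (min_le_left _ _)))).2
        rw [glue_of_lt h, cwt, if_pos h]
        exact this.le
      · have := (abs_lt.1 (h2 (mem_cdisc.2 hx1) (hxd.trans_le (min_le_right _ _)))).2
        rw [glue_of_eq h, cwt, if_neg h.not_lt]
        exact this.le
  have hlim0 : Tendsto (fun ε : ℝ => b - ε * (1 + (LF + LG)) * (2 * π)) (𝓝[>] 0) (𝓝 b) := by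
    have : Tendsto (fun ε : ℝ => b - ε * (1 + (LF + LG)) * (2 * π)) (𝓝 0)
        (𝓝 (b - 0 * (1 + (LF + LG)) * (2 * π))) := Continuous.tendsto (by fun_prop) 0
    simpa using this.mono_left nhdsWithin_le_nhds
  exact le_of_tendsto hlim0 (eventually_mem_nhdsWithin.mono fun ε hε' => hε ε hε')

lemma harmonicContOnCl_of_lapW {j : ℂ → ℝ} (hj : ContDiffOn ℝ 2 j cdisc)
    (hjharm : ∀ z ∈ odisc, lapW j z = 0) :
    InnerProductSpace.HarmonicContOnCl j (ball (0 : ℂ) 1) := by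
  have hcd : ∀ z : ℂ, ‖z‖ < 1 → ContDiffAt ℝ 2 j z := fun z hz =>
    hj.contDiffAt (mem_of_superset (isOpen_ball.mem_nhds (mem_ball_zero_iff.2 hz))
      ball_subset_closedBall)
  have hlap : ∀ z : ℂ, ‖z‖ < 1 → Laplacian.laplacian j z = 0 := fun z hz => by
    have hd : DifferentiableAt ℝ (fderiv ℝ j) z :=
      ((hcd z hz).fderiv_right (m := 1) (by norm_num)).differentiableAt (by simp)
    have e : ∀ p, fderiv ℝ (fun y => fderiv ℝ j y p) z p = fderiv ℝ (fderiv ℝ j) z p p := fun p => by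
      have : HasFDerivAt (fun y => fderiv ℝ j y p) _ z :=
        hd.hasFDerivAt.clm_apply (hasFDerivAt_const p z)
      rw [this.fderiv]; simp
    rw [InnerProductSpace.laplacian_eq_iteratedFDeriv_complexPlane]
    simp only [iteratedFDeriv_two_apply]
    have := hjharm z (mem_odisc.2 hz)
    rw [lapW_eq j hz, e, e] at this
    simpa using this
  refine ⟨fun z hz => ⟨hcd z (mem_ball_zero_iff.1 hz), ?_⟩, ?_⟩
  · filter_upwards [isOpen_ball.mem_nhds hz] with y hy
    exact hlap y (mem_ball_zero_iff.1 hy)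
  · rw [closure_ball _ one_ne_zero]
    exact hj.continuousOn

/-- The mean value property for a harmonic function composed with a disc automorphism. -/
lemma integral_arcm_comp_mob {j : ℂ → ℝ} (hj : ContDiffOn ℝ 2 j cdisc)
    (hjharm : ∀ z ∈ odisc, lapW j z = 0) {a : ℂ} (ha : ‖a‖ < 1) :
    ∫ x, j (mob a x) ∂arcm = 2 * π * j a := by
  have ha' : ‖-a‖ < 1 := by simpa using ha
  have hjc := continuous_comp_clamp hj.continuousOn
  have hcm : Continuous fun x => j (clamp (mob a x)) := hjc.comp (continuous_mob ha)
  have e1 : ∫ x, j (mob a x) ∂arcm = ∫ x, j (clamp (mob a x)) ∂arcm :=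
    integral_congr_ae (ae_of_all _ fun x => by
      simp only [clamp_of_le (norm_mob_le ha x)])
  have e2 : ∫ x, mdr (-a) x * j (clamp (mob a (mob (-a) x))) ∂arcm =
      ∫ x, mdr (-a) x * j (clamp x) ∂arcm :=
    integral_congr_ae (arcm_ae fun x hx => by
      simp only [mob_mob_neg ha hx.le])
  have hcm' : Continuous fun x => mdr (-a) x * j (clamp x) := (continuous_mdr ha').mul hjc
  rw [e1, ← integral_arcm_mob ha' hcm, e2, integral_arcm hcm'.aestronglyMeasurable]
  have hP := (harmonicContOnCl_of_lapW hj hjharm).circleAverage_poissonKernel_smul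
    (mem_ball_zero_iff.2 ha)
  rw [Real.circleAverage_def, smul_eq_mul] at hP
  rw [← hP, ← mul_assoc, mul_inv_cancel₀ (by positivity), one_mul]
  refine intervalIntegral.integral_congr fun θ _ => ?_
  have hb : circleMap 0 1 θ = bpt θ := by simp [circleMap, bpt]
  have hn := norm_bpt θ
  have h1 : ‖1 + (starRingEnd ℂ) (-a) * bpt θ‖ ^ 2 = ‖bpt θ - a‖ ^ 2 := by
    have h3 : (1 : ℂ) + (starRingEnd ℂ) (-a) * bpt θ = bpt θ * (starRingEnd ℂ) (bpt θ - a) := by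
      have : bpt θ * (starRingEnd ℂ) (bpt θ) = 1 := by
        rw [Complex.mul_conj, Complex.normSq_eq_norm_sq, hn]; simp
      rw [map_sub, mul_sub, this, map_neg]; ring
    rw [h3, norm_mul, hn, one_mul, Complex.norm_conj]
  simp only [Pi.smul_apply', smul_eq_mul, hb, clamp_of_le hn.le, mdr, poissonKernel, sub_zero, hn,
    h1, norm_neg, one_pow]

/-- Mean value property with a radial weight. -/
lemma integral_radial_mul {h : ℂ → ℂ} (hh : ∀ x : ℂ, ‖x‖ ≤ 1 → DifferentiableAt ℂ h x)
    (L : ℂ →L[ℝ] ℝ) {g : ℂ → ℝ} (hg : Continuous g) (hgr : ∀ c x : ℂ, ‖c‖ = 1 → g (c * x) = g x) :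
    ∫ x, L (h x) * g x ∂aream = L (h 0) * ∫ x, g x ∂aream := by
  have hhc : ContinuousOn h (closedBall 0 1) := fun x hx =>
    (hh x (mem_closedBall_zero_iff.1 hx)).continuousAt.continuousWithinAt
  set K : ℝ → ℂ → ℝ := fun θ x => L (h (bpt θ * clamp x)) * g (clamp x) with hK
  have hnorm : ∀ θ x, ‖bpt θ * clamp x‖ ≤ 1 := fun θ x => by
    rw [norm_mul, norm_bpt, one_mul]; exact norm_clamp_le x
  have hKc : Continuous (Function.uncurry K) := by
    have h1 : Continuous fun p : ℝ × ℂ => h (bpt p.1 * clamp p.2) :=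
      hhc.comp_continuous ((continuous_bpt.comp continuous_fst).mul
        (continuous_clamp.comp continuous_snd)) fun p => mem_closedBall_zero_iff.2 (hnorm _ _)
    exact (L.continuous.comp h1).mul (hg.comp (continuous_clamp.comp continuous_snd))
  obtain ⟨M, hM⟩ := (isCompact_closedBall (0 : ℂ) 1).exists_bound_of_continuousOn
    (L.continuous.comp_continuousOn hhc)
  obtain ⟨N, hN⟩ := (isCompact_closedBall (0 : ℂ) 1).exists_bound_of_continuousOn hg.continuousOn
  have hM0 : 0 ≤ M := (norm_nonneg _).trans (hM 0 (by simp))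
  have hint : Integrable (Function.uncurry K)
      ((volume.restrict (Ioc 0 (2 * π))).prod aream) := by
    refine Integrable.of_bound hKc.aestronglyMeasurable (M * N) (ae_of_all _ fun p => ?_)
    simp only [Function.uncurry, hK, norm_mul]
    exact mul_le_mul (hM _ (mem_closedBall_zero_iff.2 (hnorm _ _)))
      (hN _ (mem_closedBall_zero_iff.2 (norm_clamp_le _))) (norm_nonneg _) hM0
  have hswap := integral_integral_swap hint
  have hl : ∀ θ, ∫ x, K θ x ∂aream = ∫ x, L (h x) * g x ∂aream := fun θ => by
    have e1 : ∫ x, K θ x ∂aream = ∫ x, K 0 (bpt θ * x) ∂aream := by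
      refine integral_congr_ae (aream_ae fun x hx => ?_)
      have : ‖bpt θ * x‖ ≤ 1 := by rw [norm_mul, norm_bpt, one_mul]; exact hx.le
      have h0 : bpt 0 = 1 := by simp [bpt]
      simp only [hK, clamp_of_le hx.le, clamp_of_le this, h0, one_mul, hgr _ _ (norm_bpt θ)]
    have hmp : Continuous fun x => K 0 x := hKc.comp (by fun_prop : Continuous fun x : ℂ => ((0 : ℝ), x))
    rw [e1, ← integral_map (μ := aream) (φ := fun x => bpt θ * x) (f := K 0)
      (by fun_prop) hmp.aestronglyMeasurable, aream_map_mul (norm_bpt θ)]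
    refine integral_congr_ae (aream_ae fun x hx => ?_)
    simp [hK, clamp_of_le hx.le, bpt]
  have hr : ∀ x, ∫ θ in Ioc 0 (2 * π), K θ x = 2 * π * (L (h 0) * g (clamp x)) := fun x => by
    have hd : DiffContOnCl ℂ (fun w => h (w * clamp x)) (ball 0 |1|) := by
      have hn : ∀ w : ℂ, ‖w‖ ≤ 1 → ‖w * clamp x‖ ≤ 1 := fun w hw => by
        rw [norm_mul]; exact mul_le_one₀ hw (norm_nonneg _) (norm_clamp_le x)
      have hdw : ∀ w : ℂ, ‖w‖ ≤ 1 → DifferentiableAt ℂ (fun w => h (w * clamp x)) w := fun w hw =>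
        DifferentiableAt.comp w (hh _ (hn w hw)) (by fun_prop)
      rw [abs_one]
      refine ⟨fun w hw => (hdw w (mem_ball_zero_iff.1 hw).le).differentiableWithinAt, ?_⟩
      rw [closure_ball _ one_ne_zero]
      exact fun w hw => (hdw w (mem_closedBall_zero_iff.1 hw)).continuousAt.continuousWithinAt
    have hav := hd.circleAverage
    rw [Real.circleAverage_def, zero_mul] at hav
    have hci : Continuous fun θ => h (bpt θ * clamp x) :=
      hhc.comp_continuous (by have := continuous_bpt; fun_prop)
        fun θ => mem_closedBall_zero_iff.2 (hnorm _ _)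
    have e : ∫ θ in (0 : ℝ)..(2 * π), h (bpt θ * clamp x) = (2 * π : ℝ) • h 0 := by
      rw [← hav, smul_smul, mul_inv_cancel₀ (by positivity), one_smul]
      refine intervalIntegral.integral_congr fun θ _ => ?_
      simp [circleMap, bpt]
    have e2 : ∫ θ in (0 : ℝ)..(2 * π), L (h (bpt θ * clamp x)) = 2 * π * L (h 0) := by
      rw [L.intervalIntegral_comp_comm (hci.intervalIntegrable _ _), e, map_smul, smul_eq_mul]
    rw [← intervalIntegral.integral_of_le (by positivity), intervalIntegral.integral_mul_const, e2]
    ring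
  simp only [hl, hr] at hswap
  have e3 : ∫ x, 2 * π * (L (h 0) * g (clamp x)) ∂aream = 2 * π * (L (h 0) * ∫ x, g x ∂aream) := by
    rw [integral_const_mul, integral_const_mul]
    congr 2
    exact integral_congr_ae (aream_ae fun x hx => by simp only [clamp_of_le hx.le])
  rw [e3, integral_const, smul_eq_mul] at hswap
  have e4 : (volume.restrict (Ioc 0 (2 * π))).real univ = 2 * π := by
    rw [measureReal_restrict_apply_univ, Real.volume_real_Ioc_of_le (by positivity), sub_zero]
  rw [e4] at hswap
  exact mul_left_cancel₀ (by positivity) hswap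

lemma continuous_comp_mob {f : ℂ → ℝ} (hf : ContinuousOn f cdisc) {a : ℂ} (ha : ‖a‖ < 1) :
    Continuous fun x => f (mob a x) :=
  hf.comp_continuous (continuous_mob ha) fun x => mem_cdisc.2 (norm_mob_le ha x)

lemma mob_sub_boundary {z x : ℂ} {r : ℝ} (hz : ‖z‖ = 1) (hr0 : 0 ≤ r) (hr1 : r < 1)
    (hx : ‖x‖ ≤ 1) :
    mob (r * z) x - z = ((1 - r : ℝ) : ℂ) * ((x - z) / (1 + (starRingEnd ℂ) (r * z) * x)) := by
  have ha : ‖(r : ℂ) * z‖ < 1 := by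
    rw [norm_mul, Complex.norm_real, Real.norm_of_nonneg hr0, hz, mul_one]; exact hr1
  have hne := one_add_ne_zero ha hx
  have hzz : (starRingEnd ℂ) z * z = 1 := by
    rw [mul_comm, Complex.mul_conj, Complex.normSq_eq_norm_sq, hz]; simp
  rw [mob, clamp_of_le hx, ← mul_div_assoc, eq_div_iff hne, sub_mul, div_mul_cancel₀ _ hne]
  rw [map_mul, Complex.conj_ofReal]
  push_cast
  linear_combination (-(r : ℂ) * x) * hzz

lemma norm_mob_quotient_le {z x : ℂ} {r : ℝ} (hz : ‖z‖ = 1) (hr0 : 0 ≤ r) (hr1 : r < 1)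
    (hx : ‖x‖ < 1) :
    ‖(x - z) / (1 + (starRingEnd ℂ) (r * z) * x)‖ ≤ 4 * ‖-z - x‖ ^ (-1 : ℝ) := by
  have hr : ‖(r : ℂ) * z‖ = r := by
    rw [norm_mul, Complex.norm_real, Real.norm_of_nonneg hr0, hz, mul_one]
  have h1 := one_sub_le_norm_one_add (a := (r : ℂ) * z) hx.le
  rw [hr] at h1
  have hpos : 0 < ‖1 + (starRingEnd ℂ) (r * z) * x‖ := by linarith
  have hzz : z * (starRingEnd ℂ) z = 1 := by
    rw [Complex.mul_conj, Complex.normSq_eq_norm_sq, hz]; simp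
  have h2 : ‖-z - x‖ = ‖1 + (starRingEnd ℂ) z * x‖ := by
    have : -z - x = -z * (1 + (starRingEnd ℂ) z * x) := by linear_combination x * hzz
    rw [this, norm_mul, norm_neg, hz, one_mul]
  have h3 : ‖1 + (starRingEnd ℂ) z * x‖ ≤ 2 * ‖1 + (starRingEnd ℂ) (r * z) * x‖ := by
    have e : 1 + (starRingEnd ℂ) z * x = (1 + (starRingEnd ℂ) (r * z) * x) +
        ((1 - r : ℝ) : ℂ) * ((starRingEnd ℂ) z * x) := by
      rw [map_mul, Complex.conj_ofReal]; push_cast; ring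
    have e2 : ‖((1 - r : ℝ) : ℂ) * ((starRingEnd ℂ) z * x)‖ ≤ 1 - r := by
      rw [norm_mul, norm_mul, Complex.norm_real, Real.norm_of_nonneg (by linarith),
        Complex.norm_conj, hz, one_mul]
      exact mul_le_of_le_one_right (by linarith) hx.le
    rw [e]
    exact (norm_add_le _ _).trans (by linarith)
  have h4 : 0 < ‖-z - x‖ := by
    rw [norm_pos_iff]
    intro h
    have : x = -z := by linear_combination -h
    rw [this, norm_neg, hz] at hx
    exact lt_irrefl _ hx
  have h5 : ‖x - z‖ ≤ 2 := (norm_sub_le _ _).trans (by linarith)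
  rw [norm_div, Real.rpow_neg_one, ← div_eq_mul_inv, div_le_div_iff₀ hpos h4, h2]
  nlinarith [norm_nonneg (x - z), norm_nonneg (1 + (starRingEnd ℂ) z * x)]

/-- First-order expansion of the area integral of `f ∘ mob (r z)` against a radial weight as
`r → 1`. -/
theorem tendsto_area_quotient {f g : ℂ → ℝ} (hf : ContDiffOn ℝ 1 f cdisc) {z : ℂ} (hz : ‖z‖ = 1)
    (hg : Continuous g) (hgr : ∀ c x : ℂ, ‖c‖ = 1 → g (c * x) = g x) :
    Tendsto (fun r : ℝ => (∫ x, f (mob (r * z) x) * g x ∂aream - f z * ∫ x, g x ∂aream) / (1 - r))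
      (𝓝[<] 1) (𝓝 (-nder f z * ∫ x, g x ∂aream)) := by
  have hzc : z ∈ cdisc := mem_cdisc.2 hz.le
  set L := fderivWithin ℝ f cdisc z with hL
  have hfd : HasFDerivWithinAt f L cdisc z :=
    (hf.differentiableOn (by simp) z hzc).hasFDerivWithinAt
  obtain ⟨K, hK0, hK⟩ := exists_lipschitz_cdisc hf
  obtain ⟨N, hN⟩ := (isCompact_closedBall (0 : ℂ) 1).exists_bound_of_continuousOn hg.continuousOn
  have hN0 : 0 ≤ N := (norm_nonneg _).trans (hN 0 (by simp))
  set h : ℝ → ℂ → ℂ := fun r x => (x - z) / (1 + (starRingEnd ℂ) (r * z) * x) with hh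
  set D : ℝ → ℂ → ℝ := fun r x => (f (mob (r * z) x) - f z) / (1 - r) - L (h r x) with hD
  have hrz : ∀ r : ℝ, 0 ≤ r → r < 1 → ‖(r : ℂ) * z‖ < 1 := fun r h0 h1 => by
    rw [norm_mul, Complex.norm_real, Real.norm_of_nonneg h0, hz, mul_one]; exact h1
  have hgi : Integrable g aream :=
    Integrable.of_bound hg.aestronglyMeasurable N
      (aream_ae fun x hx => hN x (mem_closedBall_zero_iff.2 hx.le))
  have hev := eventually_Ioo_left one_pos
  have hdom : ∀ r : ℝ, 0 ≤ r → r < 1 → ∀ x : ℂ, ‖x‖ < 1 →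
      ‖D r x‖ ≤ (K + ‖L‖) * (4 * ‖-z - x‖ ^ (-1 : ℝ)) := fun r h0 h1 x hx => by
    have hq := norm_mob_quotient_le hz h0 h1 hx
    have hr1 : 0 < 1 - r := by linarith
    have e1 : |(f (mob (r * z) x) - f z) / (1 - r)| ≤ K * ‖h r x‖ := by
      rw [abs_div, abs_of_pos hr1, div_le_iff₀ hr1]
      refine (hK z _ hz.le (norm_mob_le (hrz r h0 h1) x)).trans (le_of_eq ?_)
      rw [mob_sub_boundary hz h0 h1 hx.le, norm_mul, Complex.norm_real, Real.norm_of_nonneg hr1.le]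
      ring
    calc ‖D r x‖ ≤ ‖(f (mob (r * z) x) - f z) / (1 - r)‖ + ‖L (h r x)‖ := norm_sub_le _ _
      _ ≤ K * ‖h r x‖ + ‖L‖ * ‖h r x‖ := add_le_add e1 (L.le_opNorm _)
      _ = (K + ‖L‖) * ‖h r x‖ := by ring
      _ ≤ _ := mul_le_mul_of_nonneg_left hq (by positivity)
  have hmeas : ∀ r : ℝ, 0 ≤ r → r < 1 → Measurable (D r) := fun r h0 h1 => by
    have m1 := (continuous_comp_mob hf.continuousOn (hrz r h0 h1)).measurable
    have m2 : Measurable (h r) := by rw [hh]; fun_prop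
    have m3 : Measurable fun x => L (h r x) := L.continuous.measurable.comp m2
    rw [hD]
    exact ((m1.sub_const _).div_const _).sub m3
  have hlim : Tendsto (fun r : ℝ => ∫ x, D r x * g x ∂aream) (𝓝[<] 1) (𝓝 (∫ _, (0 : ℝ) ∂aream)) := by
    obtain ⟨_, _, hrz'⟩ := riesz_area (α := 1) (by norm_num)
    have hint := (hrz' (-z) (by rw [norm_neg, hz])).1
    refine tendsto_integral_filter_of_dominated_convergence
      (fun x => (K + ‖L‖) * (4 * ‖-z - x‖ ^ (-1 : ℝ)) * N) ?_ ?_ ?_ ?_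
    · filter_upwards [hev] with r hr
      exact ((hmeas r hr.1 hr.2.1).mul hg.measurable).aestronglyMeasurable
    · filter_upwards [hev] with r hr
      refine aream_ae fun x hx => ?_
      rw [norm_mul]
      exact mul_le_mul (hdom r hr.1 hr.2.1 x hx) (hN x (mem_closedBall_zero_iff.2 hx.le))
        (norm_nonneg _) (by positivity)
    · exact ((hint.const_mul 4).const_mul _).mul_const N
    · refine aream_ae fun x hx => ?_
      have hb : ∀ᶠ r : ℝ in 𝓝[<] 1, ‖mob (r * z) x - z‖ ≤ 4 * ‖-z - x‖ ^ (-1 : ℝ) * ‖1 - r‖ := by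
        filter_upwards [hev] with r hr
        rw [mob_sub_boundary hz hr.1 hr.2.1 hx.le, norm_mul, Complex.norm_real, mul_comm]
        exact mul_le_mul_of_nonneg_right (norm_mob_quotient_le hz hr.1 hr.2.1 hx) (norm_nonneg _)
      have hO : (fun r : ℝ => mob (r * z) x - z) =O[𝓝[<] 1] fun r => 1 - r :=
        Asymptotics.IsBigO.of_bound _ hb
      have h10 : Tendsto (fun r : ℝ => 1 - r) (𝓝[<] 1) (𝓝 0) := by
        have : Tendsto (fun r : ℝ => 1 - r) (𝓝 1) (𝓝 (1 - 1)) := Continuous.tendsto (by fun_prop) 1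
        simpa using this.mono_left nhdsWithin_le_nhds
      have hw0 := hO.trans_tendsto h10
      have hw : Tendsto (fun r : ℝ => mob (r * z) x) (𝓝[<] 1) (𝓝[cdisc] z) := by
        refine tendsto_nhdsWithin_iff.2 ⟨by simpa using hw0.add_const z, ?_⟩
        filter_upwards [hev] with r hr
        exact mem_cdisc.2 (norm_mob_le (hrz r hr.1 hr.2.1) x)
      have hlo := (hfd.isLittleO.comp_tendsto hw).trans_isBigO hO
      have hl0 := hlo.tendsto_div_nhds_zero
      have hD0 : Tendsto (fun r => D r x) (𝓝[<] 1) (𝓝 0) := by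
        refine hl0.congr' ?_
        filter_upwards [hev] with r hr
        have hr1 : (1 - r) ≠ 0 := by linarith [hr.2.1]
        simp only [Function.comp_def, hD, hh]
        have hsm : ∀ w : ℂ, L (((1 - r : ℝ) : ℂ) * w) = (1 - r) * L w := fun w => by
          rw [← Complex.real_smul, L.map_smul, smul_eq_mul]
        rw [mob_sub_boundary hz hr.1 hr.2.1 hx.le, hsm, sub_div, mul_div_cancel_left₀ _ hr1]
      simpa using hD0.mul_const (g x)
  rw [integral_zero] at hlim
  have hfin := hlim.add_const (-nder f z * ∫ x, g x ∂aream)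
  rw [zero_add] at hfin
  refine hfin.congr' ?_
  filter_upwards [hev] with r hr
  have ha := hrz r hr.1 hr.2.1
  have hr1 : (1 - r) ≠ 0 := by linarith [hr.2.1]
  have hmean := integral_radial_mul (h := h r) (fun x hx => by
    have := one_add_ne_zero ha hx
    rw [hh]; fun_prop (disch := assumption)) L hg hgr
  have hL0 : L (h r 0) = -nder f z := by
    simp [hh, nder, hL]
  rw [hL0] at hmean
  have hi1 : Integrable (fun x => f (mob (r * z) x) * g x) aream := by
    refine hgi.bdd_mul (c := |f z| + K * 2)
      (continuous_comp_mob hf.continuousOn ha).aestronglyMeasurable (ae_of_all _ fun x => ?_)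
    have h1 := hK z _ hz.le (norm_mob_le ha x)
    have h2 : ‖mob (r * z) x - z‖ ≤ 2 :=
      (norm_sub_le _ _).trans (by rw [hz]; linarith [norm_mob_le ha x])
    have h3 := abs_sub_abs_le_abs_sub (f (mob (r * z) x)) (f z)
    have h4 := mul_le_mul_of_nonneg_left h2 hK0
    rw [Real.norm_eq_abs]
    linarith
  have hi2 : Integrable (fun x => L (h r x) * g x) aream := by
    have hc : ContinuousOn (fun x => L (h r x)) (closedBall 0 1) := by
      refine L.continuous.comp_continuousOn fun x hx => ?_
      have := one_add_ne_zero ha (mem_closedBall_zero_iff.1 hx)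
      refine ContinuousAt.continuousWithinAt ?_
      rw [hh]; fun_prop (disch := assumption)
    obtain ⟨M, hM⟩ := (isCompact_closedBall (0 : ℂ) 1).exists_bound_of_continuousOn hc
    have m2 : Measurable (h r) := by rw [hh]; fun_prop
    have m3 : Measurable fun x => L (h r x) := L.continuous.measurable.comp m2
    exact hgi.bdd_mul (c := M) m3.aestronglyMeasurable
      (aream_ae fun x hx => hM x (mem_closedBall_zero_iff.2 hx.le))
  have hsum : ∫ x, D r x * g x ∂aream =
      (∫ x, f (mob (r * z) x) * g x ∂aream - f z * ∫ x, g x ∂aream) / (1 - r) -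
        ∫ x, L (h r x) * g x ∂aream := by
    have hi3 : Integrable (fun x => (f (mob (r * z) x) * g x - f z * g x) / (1 - r)) aream :=
      (hi1.sub (hgi.const_mul _)).div_const _
    rw [← integral_const_mul, ← integral_sub hi1 (hgi.const_mul _), ← integral_div,
      ← integral_sub hi3 hi2]
    refine integral_congr_ae (ae_of_all _ fun x => ?_)
    simp only [hD]
    ring
  rw [hsum, hmean]
  ring

lemma integral_div_kap {s : ℂ → ℝ} (hs : PB s) :
    ∫ x, s x / kap x ∂Lam = 1 / 2 * ∫ x, s x ∂aream + ∫ x, s x ∂arcm := by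
  rw [integral_Lam (hs.div PB.kap).integrable, ← integral_const_mul]
  congr 1
  · exact integral_congr_ae (aream_ae fun x hx => by simp only [kap_of_lt hx]; ring)
  · exact integral_congr_ae (arcm_ae fun x hx => by simp only [kap_of_eq hx, div_one])

lemma Sol.exists_bm {F u : ℂ → ℝ} (hu : Sol F u) : ∃ M, BM u M := by
  obtain ⟨c, hc⟩ := hu.eq
  obtain ⟨A, hA⟩ := hu.dens.bm
  obtain ⟨B, hB⟩ := hA.pot
  rw [funext hc]
  exact ⟨_, hB.add (BM.const c)⟩

/-- The energy of the density of a solution. -/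
lemma En_wexp_eq {F u : ℂ → ℝ} (hF : PB F) (hu : Sol F u) {c : ℝ}
    (hc : ∀ x, u x = pot (wexp F u) x + c) :
    En F (wexp F u) = 1 / 2 * inn (wexp F u) (wexp F u) + 2 * π * c -
      (1 / 2 * ∫ x, wexp F u x ∂aream + ∫ x, wexp F u x ∂arcm) := by
  obtain ⟨A, hA⟩ := hu.dens.bm
  obtain ⟨B, hB⟩ := hA.pot
  have hi1 : Integrable (fun x => wexp F u x * pot (wexp F u) x) Lam := (hA.mul hB).integrable
  have hi2 := (hu.dens.toPB.div PB.kap).integrable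
  have hi3 : Integrable (fun x => wexp F u x * pot (wexp F u) x + wexp F u x * c) Lam :=
    hi1.add (hu.dens.integrable.mul_const c)
  have e : ent F (wexp F u) = inn (wexp F u) (wexp F u) + 2 * π * c -
      ∫ x, wexp F u x / kap x ∂Lam := by
    rw [inn, ← hu.dens.mass, ← integral_mul_const, ← integral_add hi1
      (hu.dens.integrable.mul_const c), ← integral_sub hi3 hi2, ent]
    refine integral_congr_ae (ae_of_all _ fun x => ?_)
    simp only [log_wexp_div hF]
    have := (kap_pos x).ne'
    rw [← mul_add, ← hc x]
    field_simp
  rw [En, e, integral_div_kap hu.dens.toPB]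
  ring

/-- An upper bound for the infimum of the energy with weight `F` in terms of a solution for
another weight. -/
lemma exists_En_le {F G u : ℂ → ℝ} (hF : PB F) (hu : Sol G u) {c A B : ℝ}
    (hc : ∀ x, u x = pot (wexp G u) x + c) (hA : ∫ x, wexp F u x ∂aream = A)
    (hB : ∫ x, wexp F u x ∂arcm = B) (hA0 : 0 < A) :
    ∃ t, Dens t ∧ En F t ≤ 1 / 2 * inn (wexp G u) (wexp G u) + 2 * π * c +
      ((2 * π - B) ^ 2 / (2 * A) - 2 * π) := by
  obtain ⟨M, hM⟩ := hu.exists_bm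
  set s := wexp G u with hs
  set d := nrm F (pot s) - c with hd
  have hn : npot F s = fun x => u x + d := by
    funext x
    rw [npot, hd, hc x]; ring
  have hbm := hM.add (BM.const d)
  refine ⟨_, Dens.wexp_npot (s := s) hF hu.dens.toPB, (En_update_le_dual hF hu.dens).trans ?_⟩
  set X := Real.exp d with hX
  have hX0 : 0 < X := Real.exp_pos d
  have ea : ∫ x, wexp F (fun y => u y + d) x ∂aream = X ^ 2 * A := by
    rw [← hA, ← integral_const_mul]
    refine integral_congr_ae (aream_ae fun x hx => ?_)
    simp only [wexp, kap_of_lt hx, mul_add, Real.exp_add, hX, ← Real.exp_nat_mul]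
    push_cast; ring
  have eb : ∫ x, wexp F (fun y => u y + d) x ∂arcm = X * B := by
    rw [← hB, ← integral_const_mul]
    refine integral_congr_ae (arcm_ae fun x hx => ?_)
    simp only [wexp, kap_of_eq hx, mul_add, Real.exp_add, one_mul, hX]
    ring
  rw [hn, integral_div_kap (hF.wexp hbm), ea, eb]
  have hlog : d ≤ X - 1 := by
    have := Real.add_one_le_exp d
    linarith
  have hnrm : nrm F (pot s) = c + d := by rw [hd]; ring
  rw [hnrm]
  have hsq : (2 * π - B) * X - 1 / 2 * A * X ^ 2 ≤ (2 * π - B) ^ 2 / (2 * A) := by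
    rw [le_div_iff₀ (by positivity)]
    nlinarith [sq_nonneg (2 * π - B - A * X)]
  have hpi := mul_le_mul_of_nonneg_left hlog Real.two_pi_pos.le
  nlinarith

lemma exists_dens_of_comp_mob {F t : ℂ → ℝ} (hF : PB F) (ht : Dens t) {a : ℂ} (ha : ‖a‖ < 1) :
    ∃ t', Dens t' ∧ En F t' = En (fun x => F (mob a x)) t := by
  have ha' : ‖-a‖ < 1 := by simpa using ha
  refine ⟨push (-a) t, ht.push ha', ?_⟩
  rw [← En_push hF (ht.push ha') ha, En_congr (push_neg_push ha t)]

lemma nder_add_sqrt {f j : ℂ → ℝ} {z : ℂ} (hz : ‖z‖ = 1) (hf : DifferentiableWithinAt ℝ f cdisc z)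
    (hj : DifferentiableWithinAt ℝ j cdisc z) (hpos : 0 < j z ^ 2 + f z) :
    nder (fun w => j w + Real.sqrt (j w ^ 2 + f w)) z =
      nder j z + (2 * j z * nder j z + nder f z) / (2 * Real.sqrt (j z ^ 2 + f z)) := by
  have h1 : HasFDerivWithinAt (fun w => j w ^ 2 + f w) _ cdisc z :=
    (hj.hasFDerivWithinAt.pow 2).add hf.hasFDerivWithinAt
  have h2 : HasFDerivWithinAt (fun w => j w + Real.sqrt (j w ^ 2 + f w)) _ cdisc z :=
    hj.hasFDerivWithinAt.add (h1.sqrt hpos.ne')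
  rw [nder, h2.fderivWithin (uniqueDiffOn_cdisc z (mem_cdisc.2 hz.le))]
  simp [nder]
  ring

/-- When the boundary derivative of `j + √(j² + f)` is negative at `z`, the infimum of the energy
lies strictly below that of the weight frozen at `z`. -/
theorem exists_En_lt_frozen {f j : ℂ → ℝ} (hf : ContDiffOn ℝ (⊤ : ℕ∞) f cdisc)
    (hf0 : ∀ z ∈ cdisc, 0 < f z) (hj : ContDiffOn ℝ (⊤ : ℕ∞) j cdisc)
    (hj0 : ∀ z ∈ bdry, 0 < j z) (hjharm : ∀ z ∈ odisc, lapW j z = 0) {z : ℂ} (hz : ‖z‖ = 1)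
    (hJ : nder (fun w => j w + Real.sqrt ((j w) ^ 2 + f w)) z < 0) :
    ∃ b, (∀ t, Dens t → b ≤ En (cwt (f z) (j z)) t) ∧ ∃ t, Dens t ∧ En (glue f j) t < b := by
  have hzc : z ∈ cdisc := mem_cdisc.2 hz.le
  have hfz := hf0 z hzc
  have hjz := hj0 z (mem_bdry.2 hz)
  have hF := glue_pb hf.continuousOn hj.continuousOn hf0 hj0
  have hG := cwt_pb hfz hjz
  have hfd := hf.differentiableOn (by simp) z hzc
  have hjd := hj.differentiableOn (by simp) z hzc
  obtain ⟨u, α, γ, hu, hmin, hα, hγ, hαγ, hsub, hexp⟩ := exists_standard_sol hfz hjz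
  refine ⟨_, hmin, ?_⟩
  obtain ⟨c, hc⟩ := hu.eq
  set g : ℂ → ℝ := fun x => ((α + γ * ‖x‖ ^ 2) ^ 2)⁻¹ with hg
  have hgpos : ∀ x : ℂ, 0 < (α + γ * ‖x‖ ^ 2) ^ 2 := fun x => by positivity
  have hgc : Continuous g := by
    refine Continuous.inv₀ (by fun_prop) fun x => (hgpos x).ne'
  have hgr : ∀ c x : ℂ, ‖c‖ = 1 → g (c * x) = g x := fun c x hc1 => by
    simp only [hg, norm_mul, hc1, one_mul]
  set V := ∫ x, g x ∂aream with hV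
  set L := 2 * π / (α + γ) with hLdef
  have hL0 : 0 < L := by positivity
  have hu1 : ∀ x, ‖x‖ ≤ 1 → Real.exp (u x) = (α + γ * ‖x‖ ^ 2)⁻¹ := fun x hx => by
    rw [← hexp x hx, Real.exp_neg, inv_inv]
  have hA : ∀ H : ℂ → ℝ, ∫ x, wexp H u x ∂aream = ∫ x, H x * g x ∂aream := fun H =>
    integral_congr_ae (aream_ae fun x hx => by
      have : Real.exp (2 * u x) = g x := by
        rw [two_mul, Real.exp_add, hu1 x hx.le, hg]
        simp only [sq, mul_inv]
      simp only [wexp, kap_of_lt hx, this])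
  have hB : ∀ H : ℂ → ℝ, ∫ x, wexp H u x ∂arcm = (∫ x, H x ∂arcm) * (α + γ)⁻¹ := fun H => by
    rw [← integral_mul_const]
    refine integral_congr_ae (arcm_ae fun x hx => ?_)
    simp only [wexp, kap_of_eq hx, one_mul, hu1 x hx.le, hx, one_pow, mul_one]
  have hA0 : ∫ x, wexp (cwt (f z) (j z)) u x ∂aream = f z * V := by
    rw [hA, hV, ← integral_const_mul]
    exact integral_congr_ae (aream_ae fun x hx => by simp only [cwt, if_pos hx])
  have hB0 : ∫ x, wexp (cwt (f z) (j z)) u x ∂arcm = j z * L := by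
    rw [hB]
    have : ∫ x, cwt (f z) (j z) x ∂arcm = ∫ _, j z ∂arcm :=
      integral_congr_ae (arcm_ae fun x hx => by simp only [cwt, if_neg hx.not_lt])
    rw [this, integral_const, arcm_univ, smul_eq_mul, hLdef]
    ring
  have hmass : f z * V + j z * L = 2 * π := by
    rw [← hA0, ← hB0, ← integral_Lam hu.dens.integrable, hu.dens.mass]
  have hLV : L = 2 * α * V := by
    have h1 : L * (α + γ) = 2 * π := by rw [hLdef]; field_simp
    have h2 : 2 * γ * (2 * α * V - L) = 0 := by
      rw [← hαγ, ← hsub] at hmass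
      linear_combination hmass - h1
    have h3 : 2 * α * V - L = 0 := (mul_eq_zero.1 h2).resolve_left (by positivity)
    linarith
  have hV0 : 0 < V := by
    by_contra h
    push Not at h
    nlinarith
  have hA0pos : 0 < f z * V := mul_pos hfz hV0
  have hsqrt : Real.sqrt (j z ^ 2 + f z) = α + γ := by
    rw [← hαγ, ← hsub, show (α - γ) ^ 2 + 4 * α * γ = (α + γ) ^ 2 by ring,
      Real.sqrt_sq (by positivity)]
  have hneg : 4 * α * nder j z + nder f z < 0 := by
    rw [nder_add_sqrt hz hfd hjd (by positivity), hsqrt, ← hsub] at hJ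
    have e : nder j z + (2 * (α - γ) * nder j z + nder f z) / (2 * (α + γ)) =
        (4 * α * nder j z + nder f z) / (2 * (α + γ)) := by
      field_simp; ring
    rw [e] at hJ
    by_contra h
    push Not at h
    exact hJ.not_ge (div_nonneg h (by positivity))
  have hP := tendsto_area_quotient (contDiffOn_infty.1 hf 1) hz hgc hgr
  have hQ := (tendsto_radial_nder hz hjd).const_mul L
  have h10 : Tendsto (fun r : ℝ => 1 - r) (𝓝[<] 1) (𝓝 0) := by
    have : Tendsto (fun r : ℝ => 1 - r) (𝓝 1) (𝓝 (1 - 1)) := Continuous.tendsto (by fun_prop) 1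
    simpa using this.mono_left nhdsWithin_le_nhds
  have hlim := ((hQ.const_mul (2 * (f z * V))).add (h10.mul (hQ.pow 2))).sub
    (hP.const_mul (f z * V))
  have hlimneg : 2 * (f z * V) * (L * nder j z) + 0 * (L * nder j z) ^ 2 -
      f z * V * (-nder f z * V) < 0 := by
    have e : 2 * (f z * V) * (L * nder j z) + 0 * (L * nder j z) ^ 2 -
        f z * V * (-nder f z * V) = f z * V * V * (4 * α * nder j z + nder f z) := by
      rw [hLV]; ring
    rw [e]
    exact mul_neg_of_pos_of_neg (mul_pos hA0pos hV0) hneg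
  obtain ⟨r, hr, hr0, hr1, -⟩ := ((hlim.eventually_lt_const hlimneg).and
    (eventually_Ioo_left one_pos)).exists
  have ht : 0 < 1 - r := by linarith
  have ha : ‖(r : ℂ) * z‖ < 1 := by
    rw [norm_mul, Complex.norm_real, Real.norm_of_nonneg hr0, hz, mul_one]; exact hr1
  set A := ∫ x, f (mob (r * z) x) * g x ∂aream with hAdef
  set B := L * j (r * z) with hBdef
  have hA1 : ∫ x, wexp (fun x => glue f j (mob (r * z) x)) u x ∂aream = A := by
    rw [hA]
    exact integral_congr_ae (aream_ae fun x hx => by simp only [glue_of_lt (norm_mob_lt ha hx)])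
  have hB1 : ∫ x, wexp (fun x => glue f j (mob (r * z) x)) u x ∂arcm = B := by
    rw [hB]
    have : ∫ x, glue f j (mob (r * z) x) ∂arcm = ∫ x, j (mob (r * z) x) ∂arcm :=
      integral_congr_ae (arcm_ae fun x hx => by simp only [glue_of_eq (norm_mob_eq ha hx)])
    rw [this, integral_arcm_comp_mob (contDiffOn_infty.1 hj 2) hjharm ha, hBdef, hLdef]
    ring
  have hkey : (2 * π - B) ^ 2 < f z * V * A := by
    have h1 := mul_lt_mul_of_pos_left hr ht
    have e1 : (1 - r) * ((A - f z * V) / (1 - r)) = A - f z * V := by field_simp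
    have e2 : (1 - r) * (L * ((j z - j (r * z)) / (1 - r))) = L * j z - B := by
      rw [hBdef]; field_simp
    set P := (A - f z * V) / (1 - r)
    set Q := L * ((j z - j (r * z)) / (1 - r))
    have e3 : 2 * π - B = f z * V + (1 - r) * Q := by rw [e2]; linarith
    have e4 : A = f z * V + (1 - r) * P := by rw [e1]; ring
    rw [e3, e4]
    nlinarith
  have hApos : 0 < A := by
    by_contra h
    push Not at h
    nlinarith [sq_nonneg (2 * π - B), mul_nonneg hA0pos.le (neg_nonneg.2 h)]
  obtain ⟨t, htd, htE⟩ := exists_En_le (hF.comp_mob ha) hu hc hA1 hB1 hApos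
  obtain ⟨t', htd', htE'⟩ := exists_dens_of_comp_mob hF htd ha
  refine ⟨t', htd', ?_⟩
  rw [htE', En_wexp_eq hG hu hc, hA0, hB0]
  refine htE.trans_lt ?_
  have : (2 * π - B) ^ 2 / (2 * A) < 1 / 2 * (f z * V) := by
    rw [div_lt_iff₀ (by positivity)]
    linarith
  linarith

/-- If `∂J/∂ν₀ < 0` everywhere on `∂B`, where `J = j + √(j² + f)` and `j` is
extended harmonically, then the prescribed curvature problem is solvable. -/
theorem prescribed_curvature_exists_of_nder_neg (f j : ℂ → ℝ)
    (hf : ContDiffOn ℝ (⊤ : ℕ∞) f cdisc) (hfpos : ∀ z ∈ cdisc, 0 < f z)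
    (hj : ContDiffOn ℝ (⊤ : ℕ∞) j cdisc) (hjpos : ∀ z ∈ bdry, 0 < j z)
    (hjharm : ∀ z ∈ odisc, lapW j z = 0)
    (hJ : ∀ z ∈ bdry, nder (fun w => j w + Real.sqrt ((j w) ^ 2 + f w)) z < 0) :
    ∃ u : ℂ → ℝ, ContDiffOn ℝ 2 u cdisc ∧
      (∀ z ∈ odisc, - lapW u z = f z * Real.exp (2 * u z)) ∧
      (∀ z ∈ bdry, nder u z + 1 = j z * Real.exp (u z)) := by
  rcases exists_sol_or_frozen_le hf.continuousOn hj.continuousOn hfpos hjpos with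
    ⟨u, hu⟩ | ⟨z, hz, hle⟩
  · exact ⟨u, Sol.prescribed hf hj hu⟩
  · obtain ⟨b, hb, t, ht, hlt⟩ :=
      exists_En_lt_frozen hf hfpos hj hjpos hjharm hz (hJ z (mem_bdry.2 hz))
    exact absurd (hle b hb t ht) hlt.not_ge
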